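/- The pretentious large sieve: For every κ > 0 and every natural number J ≥ 1 there is a constant C = C(κ,J) > 0 such that for all f in the class C(κ), all real X ≥ C and all natural numbers q with 1 ≤ q ≤ X^{1/4}, setting Q = q·log X, there exists a set 𝒳 of Dirichlet characters mod q with at most J elements such that for all real x with √X ≤ x ≤ X², ∑ over Dirichlet characters χ mod q with χ ∉ 𝒳 of |S_f(x,χ)|² ≤ C · ( x·(log x)^{κ−1} )² · ( (log Q/log x)^{κ(1−1/√(J+1))} · log(log x/log Q) )². -/

import Mathlib

open Complex MeasureTheory
open scoped Classical

noncomputable section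

/-- Membership of `f` in the class `C(κ)`, witnessed by `Λf`. -/
structure IsHalaszClass (κ : ℝ) (f : ℕ → ℂ) (Λf : ℕ → ℂ) : Prop where
  map_one : f 1 = 1
  mult : ∀ m n : ℕ, Nat.Coprime m n → f (m * n) = f m * f n
  supp : ∀ n : ℕ, ¬ IsPrimePow n → Λf n = 0
  bound : ∀ n : ℕ, 1 ≤ n → ‖Λf n‖ ≤ κ * ArithmeticFunction.vonMangoldt n
  conv : ∀ n : ℕ, 1 ≤ n →
    f n * (Real.log n : ℂ) = ∑ d ∈ n.divisors, Λf d * f (n / d)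
  abs_conv : ∀ σ : ℝ, 1 < σ → Summable (fun n : ℕ => ‖f n‖ / (n : ℝ) ^ σ)

/-- The Dirichlet series `F(s) = ∑ f(n) n^{-s}`. -/
def Fser (f : ℕ → ℂ) (s : ℂ) : ℂ := ∑' n : ℕ, f n / (n : ℂ) ^ s

/-- `S_f(x,χ) = ∑_{n ≤ x} f(n) conj(χ(n))`. -/
def Sf {q : ℕ} (f : ℕ → ℂ) (χ : DirichletCharacter ℂ q) (x : ℝ) : ℂ :=
  ∑ n ∈ Finset.Icc 1 ⌊x⌋₊, f n * (starRingEnd ℂ) (χ (n : ZMod q))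

local notation "Λ" => ArithmeticFunction.vonMangoldt

/-- The Selberg main-term denominator, truncated at level `R`. -/
def selbergSum (s : BoundingSieve) (R : ℝ) : ℝ :=
  ∑ l ∈ s.prodPrimes.divisors.filter (fun l : ℕ => (l : ℝ) ≤ R), s.selbergTerms l

/-- Selberg's optimal weights at level `R`. -/
def selbergWeight (s : BoundingSieve) (R : ℝ) (d : ℕ) : ℝ :=
  (ArithmeticFunction.moebius d : ℝ) * (s.nu d)⁻¹ *
    (∑ l ∈ s.prodPrimes.divisors.filter (fun l : ℕ => d ∣ l ∧ (l : ℝ) ≤ R), s.selbergTerms l) / selbergSum s R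

lemma sum_moebius_between {P l m : ℕ} (hm : m ∣ P) (hP : Squarefree P) :
    ∑ d ∈ P.divisors, (if l ∣ d ∧ d ∣ m then (ArithmeticFunction.moebius d : ℝ) else 0) =
      if l = m then (ArithmeticFunction.moebius l : ℝ) else 0 := by
  have hm0 : m ≠ 0 := ne_zero_of_dvd_ne_zero hP.ne_zero hm
  have hmsq : Squarefree m := hP.squarefree_of_dvd hm
  by_cases hlm : l ∣ m
  · obtain ⟨k, rfl⟩ := hlm
    have hk0 : k ≠ 0 := right_ne_zero_of_mul hm0
    have hl0 : l ≠ 0 := left_ne_zero_of_mul hm0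
    have h1 : ∑ d ∈ P.divisors,
        (if l ∣ d ∧ d ∣ l * k then (ArithmeticFunction.moebius d : ℝ) else 0) =
        ∑ e ∈ k.divisors, (ArithmeticFunction.moebius (l * e) : ℝ) := by
      rw [← Finset.sum_filter]
      symm
      apply Finset.sum_nbij (fun e => l * e)
      · intro e he
        have he' := Nat.dvd_of_mem_divisors he
        simp only [Finset.mem_filter, Nat.mem_divisors]
        exact ⟨⟨(Nat.mul_dvd_mul_left l he').trans hm, hP.ne_zero⟩, Nat.dvd_mul_right _ _,
          Nat.mul_dvd_mul_left l he'⟩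
      · intro x _ y _ hxy
        exact Nat.eq_of_mul_eq_mul_left (Nat.pos_of_ne_zero hl0) hxy
      · intro d hd
        simp only [Finset.coe_filter, Nat.mem_divisors, Set.mem_ofPred_eq] at hd
        obtain ⟨_, ⟨e, rfl⟩, h⟩ := hd
        refine ⟨e, ?_, rfl⟩
        simp only [Finset.mem_coe, Nat.mem_divisors]
        exact ⟨Nat.dvd_of_mul_dvd_mul_left (Nat.pos_of_ne_zero hl0) h, hk0⟩
      · intros; rfl
    rw [h1]
    have h2 : ∀ e ∈ k.divisors, (ArithmeticFunction.moebius (l * e) : ℝ) =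
        (ArithmeticFunction.moebius l : ℝ) * (ArithmeticFunction.moebius e : ℝ) := by
      intro e he
      have : Nat.Coprime l e := Nat.Coprime.coprime_dvd_right (Nat.dvd_of_mem_divisors he)
        (Nat.coprime_of_squarefree_mul hmsq)
      rw [ArithmeticFunction.isMultiplicative_moebius.2 this]; push_cast; rfl
    rw [Finset.sum_congr rfl h2, ← Finset.mul_sum]
    have h3 : ∑ e ∈ k.divisors, (ArithmeticFunction.moebius e : ℝ) = if k = 1 then 1 else 0 := by
      have := congrArg (fun f => f k) ArithmeticFunction.moebius_mul_coe_zeta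
      simp only [ArithmeticFunction.coe_mul_zeta_apply, ArithmeticFunction.one_apply] at this
      exact_mod_cast this
    rw [h3]
    by_cases hk : k = 1
    · simp [hk]
    · have : l ≠ l * k := by
        intro h
        have h' : l * 1 = l * k := by rwa [mul_one]
        exact hk (Nat.eq_of_mul_eq_mul_left (Nat.pos_of_ne_zero hl0) h').symm
      rw [if_neg hk, if_neg this, mul_zero]
  · have : l ≠ m := fun h => hlm (h ▸ dvd_rfl)
    rw [if_neg this]
    apply Finset.sum_eq_zero
    intro d _
    rw [if_neg]
    exact fun h => hlm (h.1.trans h.2)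

lemma selbergSum_pos (s : BoundingSieve) {R : ℝ} (hR : 1 ≤ R) : 0 < selbergSum s R := by
  unfold selbergSum
  apply Finset.sum_pos
  · intro l hl
    exact BoundingSieve.selbergTerms_pos (Nat.dvd_of_mem_divisors (Finset.mem_filter.1 hl).1)
  · exact ⟨1, by simp [BoundingSieve.prodPrimes_ne_zero, hR]⟩

lemma selbergWeight_one (s : BoundingSieve) {R : ℝ} (hR : 1 ≤ R) : selbergWeight s R 1 = 1 := by
  have := (selbergSum_pos s hR).ne'
  unfold selbergWeight
  simp only [ArithmeticFunction.moebius_apply_one, Int.cast_one, s.nu_mult.1, inv_one, one_mul,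
    one_dvd, true_and]
  exact div_self this

lemma abs_selbergWeight_le (s : BoundingSieve) {R : ℝ} (hR : 1 ≤ R) {d : ℕ}
    (hd : d ∣ s.prodPrimes) : |selbergWeight s R d| ≤ if (d : ℝ) ≤ R then (s.nu d)⁻¹ else 0 := by
  have hG := selbergSum_pos s hR
  have hnu := BoundingSieve.nu_pos_of_dvd_prodPrimes hd
  have hnn : ∀ l ∈ s.prodPrimes.divisors, 0 ≤ s.selbergTerms l := fun l hl =>
    (BoundingSieve.selbergTerms_pos (Nat.dvd_of_mem_divisors hl)).le
  split_ifs with h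
  · unfold selbergWeight
    have hS : (∑ l ∈ s.prodPrimes.divisors.filter (fun l : ℕ => d ∣ l ∧ (l : ℝ) ≤ R), s.selbergTerms l) ≤
        selbergSum s R := by
      apply Finset.sum_le_sum_of_subset_of_nonneg
      · intro l hl
        simp only [Finset.mem_filter] at hl ⊢
        exact ⟨hl.1, hl.2.2⟩
      · intro l hl _
        exact hnn l (Finset.mem_filter.1 hl).1
    have hS0 : 0 ≤ (∑ l ∈ s.prodPrimes.divisors.filter (fun l : ℕ => d ∣ l ∧ (l : ℝ) ≤ R), s.selbergTerms l) :=
      Finset.sum_nonneg fun l hl => hnn l (Finset.mem_filter.1 hl).1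
    have hmu : |(ArithmeticFunction.moebius d : ℝ)| ≤ 1 := by
      exact_mod_cast ArithmeticFunction.abs_moebius_le_one
    rw [abs_div, abs_mul, abs_mul, abs_of_pos hG, abs_of_nonneg hS0, abs_of_pos (inv_pos.2 hnu),
      div_le_iff₀ hG]
    have := inv_pos.2 hnu
    gcongr
    calc _ ≤ 1 * (s.nu d)⁻¹ := by gcongr
      _ = _ := one_mul _
  · unfold selbergWeight
    rw [Finset.filter_false_of_mem]
    · simp
    · intro l hl hdl
      have hl0 : 0 < l := Nat.pos_of_mem_divisors hl
      have : (d : ℝ) ≤ l := by exact_mod_cast Nat.le_of_dvd hl0 hdl.1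
      exact h (this.trans hdl.2)

lemma mainSum_selbergWeight (s : BoundingSieve) {R : ℝ} (hR : 1 ≤ R) :
    s.mainSum (BoundingSieve.lambdaSquared (selbergWeight s R)) = (selbergSum s R)⁻¹ := by
  have hG := (selbergSum_pos s hR).ne'
  rw [BoundingSieve.mainSum_lambdaSquared_eq_sum_mul_sum_sq]
  have key : ∀ l ∈ s.prodPrimes.divisors,
      (∑ d ∈ s.prodPrimes.divisors, if l ∣ d then s.nu d * selbergWeight s R d else 0) =
      if (l : ℝ) ≤ R then (ArithmeticFunction.moebius l : ℝ) * s.selbergTerms l / selbergSum s R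
        else 0 := by
    intro l hl
    have h1 : ∀ d ∈ s.prodPrimes.divisors,
        (if l ∣ d then s.nu d * selbergWeight s R d else 0) =
        ∑ m ∈ s.prodPrimes.divisors, (if (m : ℝ) ≤ R then s.selbergTerms m / selbergSum s R else 0) *
          (if l ∣ d ∧ d ∣ m then (ArithmeticFunction.moebius d : ℝ) else 0) := by
      intro d hd
      have hnu := (BoundingSieve.nu_pos_of_dvd_prodPrimes (Nat.dvd_of_mem_divisors hd)).ne'
      by_cases hld : l ∣ d
      · simp only [hld, if_true, true_and]
        unfold selbergWeight
        rw [Finset.sum_filter, mul_div_assoc, Finset.sum_div, ← mul_assoc,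
          mul_left_comm, mul_inv_cancel₀ hnu, mul_one, Finset.mul_sum]
        apply Finset.sum_congr rfl
        intro m _
        by_cases h1 : d ∣ m <;> by_cases h2 : (m : ℝ) ≤ R <;> simp [h1, h2, mul_comm]
      · simp [hld]
    rw [Finset.sum_congr rfl h1, Finset.sum_comm]
    have h2 : ∀ m ∈ s.prodPrimes.divisors, ∑ d ∈ s.prodPrimes.divisors,
        (if (m : ℝ) ≤ R then s.selbergTerms m / selbergSum s R else 0) *
          (if l ∣ d ∧ d ∣ m then (ArithmeticFunction.moebius d : ℝ) else 0) =
        if l = m then (if (m : ℝ) ≤ R then s.selbergTerms m / selbergSum s R else 0) *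
          (ArithmeticFunction.moebius l : ℝ) else 0 := by
      intro m hm
      rw [← Finset.mul_sum, sum_moebius_between (Nat.dvd_of_mem_divisors hm)
        s.prodPrimes_squarefree, mul_ite, mul_zero]
    rw [Finset.sum_congr rfl h2, Finset.sum_ite_eq, if_pos hl]
    split_ifs
    · ring
    · ring
  have h3 : ∀ l ∈ s.prodPrimes.divisors, (s.selbergTerms l)⁻¹ *
      (∑ d ∈ s.prodPrimes.divisors, if l ∣ d then s.nu d * selbergWeight s R d else 0) ^ 2 =
      (if (l : ℝ) ≤ R then s.selbergTerms l else 0) / selbergSum s R ^ 2 := by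
    intro l hl
    rw [key l hl]
    have hg := (BoundingSieve.selbergTerms_pos (Nat.dvd_of_mem_divisors hl)).ne'
    have hmu : (ArithmeticFunction.moebius l : ℝ) ^ 2 = 1 := by
      have := ArithmeticFunction.moebius_sq_eq_one_of_squarefree
        (s.prodPrimes_squarefree.squarefree_of_dvd (Nat.dvd_of_mem_divisors hl))
      exact_mod_cast this
    split_ifs
    · rw [div_pow, mul_pow, hmu]; field_simp
    · simp
  rw [Finset.sum_congr rfl h3, ← Finset.sum_div, ← Finset.sum_filter]
  change selbergSum s R / selbergSum s R ^ 2 = _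
  field_simp

lemma siftedSum_le_selberg (s : BoundingSieve) {R B : ℝ} (hR : 1 ≤ R)
    (hrem : ∀ d, d ∣ s.prodPrimes → |s.rem d| ≤ B) (hB : 0 ≤ B)
    (hnu : ∀ d, d ∣ s.prodPrimes → (s.nu d)⁻¹ ≤ d) :
    s.siftedSum ≤ s.totalMass / selbergSum s R + B * R ^ 4 := by
  have h := BoundingSieve.siftedSum_le_mainSum_errSum_of_upperMoebius (s := s) _
    (BoundingSieve.upperMoebius_lambdaSquared (selbergWeight s R) (selbergWeight_one s hR))
  rw [mainSum_selbergWeight s hR, ← div_eq_mul_inv] at h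
  refine h.trans ?_
  gcongr
  have hw : ∀ d ∈ s.prodPrimes.divisors, |selbergWeight s R d| ≤ if (d : ℝ) ≤ R then R else 0 := by
    intro d hd
    refine (abs_selbergWeight_le s hR (Nat.dvd_of_mem_divisors hd)).trans ?_
    split_ifs with h
    · exact (hnu d (Nat.dvd_of_mem_divisors hd)).trans h
    · rfl
  have hsumw : ∑ d ∈ s.prodPrimes.divisors, |selbergWeight s R d| ≤ R ^ 2 := by
    calc _ ≤ ∑ d ∈ s.prodPrimes.divisors, (if (d : ℝ) ≤ R then R else 0) := Finset.sum_le_sum hw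
      _ = (({d ∈ s.prodPrimes.divisors | (d : ℝ) ≤ R} : Finset ℕ).card : ℝ) * R := by
        rw [← Finset.sum_filter, Finset.sum_const, nsmul_eq_mul]
      _ ≤ R * R := by
        gcongr
        calc (({d ∈ s.prodPrimes.divisors | (d : ℝ) ≤ R} : Finset ℕ).card : ℝ) ≤ ((Finset.Icc 1 ⌊R⌋₊).card : ℝ) := by
              gcongr
              intro d hd
              simp only [Finset.mem_filter] at hd
              simp only [Finset.mem_Icc]
              exact ⟨Nat.pos_of_mem_divisors hd.1, Nat.le_floor hd.2⟩
          _ ≤ R := by simpa using Nat.floor_le (by linarith)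
      _ = R ^ 2 := by ring
  unfold BoundingSieve.errSum
  calc ∑ d ∈ s.prodPrimes.divisors, |BoundingSieve.lambdaSquared (selbergWeight s R) d| * |s.rem d|
      ≤ ∑ d ∈ s.prodPrimes.divisors, (∑ d1 ∈ s.prodPrimes.divisors, ∑ d2 ∈ s.prodPrimes.divisors,
        if d = Nat.lcm d1 d2 then |selbergWeight s R d1| * |selbergWeight s R d2| else 0) * B := by
        apply Finset.sum_le_sum
        intro d hd
        have hdP := Nat.dvd_of_mem_divisors hd
        gcongr
        · unfold BoundingSieve.lambdaSquared
          refine (Finset.abs_sum_le_sum_abs _ _).trans ?_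
          refine (Finset.sum_le_sum fun d1 _ => Finset.abs_sum_le_sum_abs _ _).trans ?_
          have hsub : d.divisors ⊆ s.prodPrimes.divisors :=
            Nat.divisors_subset_of_dvd BoundingSieve.prodPrimes_ne_zero hdP
          have hterm : ∀ d1 d2 : ℕ, |if d = Nat.lcm d1 d2 then
              selbergWeight s R d1 * selbergWeight s R d2 else 0| =
              if d = Nat.lcm d1 d2 then |selbergWeight s R d1| * |selbergWeight s R d2| else 0 := by
            intro d1 d2
            split_ifs
            · exact abs_mul _ _
            · simp
          simp only [hterm]
          have hnn : ∀ d1 d2 : ℕ, 0 ≤ if d = Nat.lcm d1 d2 then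
              |selbergWeight s R d1| * |selbergWeight s R d2| else 0 := by
            intro d1 d2; split_ifs <;> positivity
          refine (Finset.sum_le_sum fun d1 _ =>
            Finset.sum_le_sum_of_subset_of_nonneg hsub fun i _ _ => hnn d1 i).trans ?_
          exact Finset.sum_le_sum_of_subset_of_nonneg hsub
            fun i _ _ => Finset.sum_nonneg fun j _ => hnn i j
        · exact hrem d hdP
    _ = (∑ d1 ∈ s.prodPrimes.divisors, ∑ d2 ∈ s.prodPrimes.divisors, ∑ d ∈ s.prodPrimes.divisors,
        if d = Nat.lcm d1 d2 then |selbergWeight s R d1| * |selbergWeight s R d2| else 0) * B := by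
        rw [← Finset.sum_mul, Finset.sum_comm]
        congr 1
        apply Finset.sum_congr rfl
        intro d1 _
        rw [Finset.sum_comm]
    _ ≤ (∑ d1 ∈ s.prodPrimes.divisors, ∑ d2 ∈ s.prodPrimes.divisors,
        |selbergWeight s R d1| * |selbergWeight s R d2|) * B := by
        gcongr with d1 _ d2 _
        rw [Finset.sum_ite_eq']
        split_ifs
        · rfl
        · positivity
    _ = (∑ d1 ∈ s.prodPrimes.divisors, |selbergWeight s R d1|) ^ 2 * B := by
        rw [sq, Finset.sum_mul_sum]
    _ ≤ (R ^ 2) ^ 2 * B := by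
        gcongr
    _ = B * R ^ 4 := by ring

lemma sum_inv_factored_le (s T : Finset ℕ) (hs : ∀ p ∈ s, p.Prime)
    (hT : ∀ m ∈ T, m ∈ Nat.factoredNumbers s) :
    ∑ m ∈ T, ((m : ℝ))⁻¹ ≤ ∏ p ∈ s, (1 - (p : ℝ)⁻¹)⁻¹ := by
  let f : ℕ →* ℝ :=
    { toFun := fun n => (n : ℝ)⁻¹
      map_one' := by simp
      map_mul' := by intro x y; simp [mul_comm] }
  have h := EulerProduct.summable_and_hasSum_factoredNumbers_prod_filter_prime_geometric (f := f)
    (by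
      intro p hp
      change ‖((p : ℝ))⁻¹‖ < 1
      rw [norm_inv, RCLike.norm_natCast]
      exact inv_lt_one_of_one_lt₀ (by exact_mod_cast hp.one_lt)) s
  have h2 := h.2
  rw [Finset.filter_true_of_mem hs] at h2
  have h3 : ∑ m ∈ T, ((m : ℝ))⁻¹ = ∑ m ∈ T.subtype (fun m => m ∈ Nat.factoredNumbers s), f m := by
    rw [Finset.sum_subtype_of_mem (fun m => f m) hT]
    rfl
  rw [h3]
  refine sum_le_hasSum _ (fun i _ => ?_) h2
  change (0 : ℝ) ≤ ((i : ℕ) : ℝ)⁻¹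
  positivity

lemma prod_one_sub_inv (q : ℕ) (hq : 1 ≤ q) :
    ∏ p ∈ q.primeFactors, (1 - (p : ℝ)⁻¹) = (q.totient : ℝ) / q := by
  have h := Nat.totient_eq_mul_prod_factors q
  have h' : (q.totient : ℝ) = q * ∏ p ∈ q.primeFactors, (1 - (p : ℝ)⁻¹) := by
    have := congrArg (fun x : ℚ => (x : ℝ)) h
    push_cast at this
    exact this
  have : (q : ℝ) ≠ 0 := by positivity
  rw [h']; field_simp

/-- The product of the primes up to `R` that do not divide `q`. -/
def coprimePrimorial (q : ℕ) (R : ℝ) : ℕ :=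
  ∏ p ∈ (Finset.Icc 1 ⌊R⌋₊).filter (fun p => p.Prime ∧ ¬ p ∣ q), p

lemma squarefree_prod_primes (s : Finset ℕ) (hs : ∀ p ∈ s, p.Prime) : Squarefree (∏ p ∈ s, p) := by
  refine Finset.squarefree_prod_of_pairwise_isCoprime (fun p hp r hr hpr ↦ ?_)
    fun p hp => (hs p hp).squarefree
  exact (Nat.coprime_iff_isRelPrime.1 ((Nat.coprime_primes (hs p hp) (hs r hr)).2 hpr))

lemma prime_dvd_coprimePrimorial {q : ℕ} {R : ℝ} (hR : 0 ≤ R) {p : ℕ} (hp : p.Prime) :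
    p ∣ coprimePrimorial q R ↔ (p : ℝ) ≤ R ∧ ¬ p ∣ q := by
  unfold coprimePrimorial
  rw [hp.prime.dvd_finsetProd_iff]
  constructor
  · rintro ⟨r, hr, hpr⟩
    simp only [Finset.mem_filter, Finset.mem_Icc] at hr
    have := (Nat.prime_dvd_prime_iff_eq hp hr.2.1).1 hpr
    subst this
    exact ⟨(Nat.le_floor_iff hR).1 hr.1.2, hr.2.2⟩
  · rintro ⟨h1, h2⟩
    refine ⟨p, ?_, dvd_rfl⟩
    simp only [Finset.mem_filter, Finset.mem_Icc]
    exact ⟨⟨hp.one_lt.le, Nat.le_floor h1⟩, hp, h2⟩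

/-- The Selberg sieve data for an arithmetic progression. -/
def apSieve (q a A B : ℕ) (R : ℝ) : BoundingSieve where
  support := (Finset.Ioc A B).filter (fun n => n ≡ a [MOD q])
  prodPrimes := coprimePrimorial q R
  prodPrimes_squarefree := squarefree_prod_primes _ fun p hp => (Finset.mem_filter.1 hp).2.1
  weights := fun _ => 1
  weights_nonneg := fun _ => zero_le_one
  totalMass := ((B : ℝ) - A) / q
  nu := ⟨fun n => (n : ℝ)⁻¹, by simp⟩
  nu_mult := ⟨by simp, by intro m n _; simp [mul_comm]⟩
  nu_pos_of_prime := by intro p hp _; simpa using hp.pos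
  nu_lt_one_of_prime := by
    intro p hp _
    exact inv_lt_one_of_one_lt₀ (by exact_mod_cast hp.one_lt)

lemma card_ap_bound (q a A B : ℕ) (hq : 1 ≤ q) (hAB : A ≤ B) :
    |((((Finset.Ioc A B).filter (fun n => n ≡ a [MOD q])).card : ℕ) : ℝ) - ((B : ℝ) - A) / q| ≤ 1 := by
  have h := Nat.Ioc_filter_modEq_card A B (r := q) hq a
  have hq0 : (0 : ℚ) < q := by exact_mod_cast hq
  set u : ℚ := (B - a) / (q : ℚ) with hu
  set v : ℚ := (A - a) / (q : ℚ) with hv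
  have huv : v ≤ u := by
    rw [hu, hv]; gcongr
  rw [max_eq_left (by have := Int.floor_mono huv; omega)] at h
  have hd : u - v = ((B : ℚ) - A) / q := by rw [hu, hv]; ring
  have h1 := Int.floor_le u
  have h2 := Int.lt_floor_add_one u
  have h3 := Int.floor_le v
  have h4 := Int.lt_floor_add_one v
  have key : |((((Finset.Ioc A B).filter (fun n => n ≡ a [MOD q])).card : ℕ) : ℚ) - ((B : ℚ) - A) / q| ≤ 1 := by
    have hc : ((((Finset.Ioc A B).filter (fun n => n ≡ a [MOD q])).card : ℕ) : ℚ) = ⌊u⌋ - ⌊v⌋ := by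
      exact_mod_cast congrArg (fun z : ℤ => (z : ℚ)) h
    rw [hc, ← hd, abs_le]
    constructor <;> linarith
  have := (Rat.cast_le (K := ℝ)).2 key
  push_cast at this
  exact this

lemma coprimePrimorial_coprime {q d : ℕ} {R : ℝ} (hR : 0 ≤ R) (hd : d ∣ coprimePrimorial q R) :
    Nat.Coprime d q := by
  apply Nat.Coprime.coprime_dvd_left hd
  apply Nat.Coprime.symm
  rw [Nat.coprime_comm]
  apply Nat.coprime_of_dvd
  intro p hp h1 h2
  exact ((prime_dvd_coprimePrimorial hR hp).1 h1).2 h2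

lemma apSieve_rem (q a A B : ℕ) (R : ℝ) (hR : 0 ≤ R) (hq : 1 ≤ q) (hAB : A ≤ B) {d : ℕ}
    (hd : d ∣ coprimePrimorial q R) : |(apSieve q a A B R).rem d| ≤ 1 := by
  have hco := coprimePrimorial_coprime hR hd
  have hd0 : d ≠ 0 := ne_zero_of_dvd_ne_zero
    (squarefree_prod_primes _ fun p hp => (Finset.mem_filter.1 hp).2.1).ne_zero hd
  obtain ⟨c, hc1, hc2⟩ := Nat.chineseRemainder hco 0 a
  have h := card_ap_bound (d * q) c A B (Nat.mul_pos (Nat.pos_of_ne_zero hd0) hq) hAB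
  have heq : (apSieve q a A B R).multSum d =
      ((((Finset.Ioc A B).filter (fun n => n ≡ c [MOD d * q])).card : ℕ) : ℝ) := by
    simp only [BoundingSieve.multSum, apSieve]
    rw [← Finset.sum_filter, Finset.filter_filter, Finset.sum_const, nsmul_eq_mul, mul_one]
    congr 2
    apply Finset.filter_congr
    intro n _
    rw [← Nat.modEq_and_modEq_iff_modEq_mul hco, ← Nat.modEq_zero_iff_dvd]
    constructor
    · rintro ⟨h1, h2⟩; exact ⟨h2.trans hc1.symm, h1.trans hc2.symm⟩
    · rintro ⟨h1, h2⟩; exact ⟨h2.trans hc2, h1.trans hc1⟩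
  unfold BoundingSieve.rem
  rw [heq]
  have : (apSieve q a A B R).nu d * (apSieve q a A B R).totalMass = ((B : ℝ) - A) / ((d * q : ℕ) : ℝ) := by
    simp only [apSieve, ArithmeticFunction.coe_mk]
    push_cast
    field_simp
  rw [this]; exact h

lemma selbergSum_apSieve (q a A B : ℕ) (R : ℝ) (hR : 1 ≤ R) (hq : 1 ≤ q) :
    (q.totient : ℝ) / q * Real.log R ≤ selbergSum (apSieve q a A B R) R := by
  have hφ : (0 : ℝ) < q.totient := by exact_mod_cast Nat.totient_pos.2 hq
  have hq' : (0 : ℝ) < q := by exact_mod_cast hq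
  set N := ⌊R⌋₊ with hN
  have hlog : Real.log R ≤ ∑ n ∈ Finset.Icc 1 N, ((n : ℝ))⁻¹ := by
    have h1 := log_add_one_le_harmonic N
    rw [harmonic_eq_sum_Icc] at h1
    push_cast at h1
    refine le_trans ?_ h1
    apply Real.log_le_log (by linarith)
    exact (Nat.lt_floor_add_one R).le
  let r : ℕ → ℕ := fun n => ∏ p ∈ n.primeFactors.filter (fun p => ¬ p ∣ q), p
  have hr : ∀ n ∈ Finset.Icc 1 N, r n ∈ (coprimePrimorial q R).divisors.filter
      (fun l : ℕ => (l : ℝ) ≤ R) := by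
    intro n hn
    rw [Finset.mem_Icc] at hn
    have hdvd : r n ∣ n := (Finset.prod_dvd_prod_of_subset _ _ _ (Finset.filter_subset _ _)).trans
      (Nat.prod_primeFactors_dvd n)
    have hle : r n ≤ N := (Nat.le_of_dvd hn.1 hdvd).trans hn.2
    simp only [Finset.mem_filter, Nat.mem_divisors]
    refine ⟨⟨Finset.prod_dvd_prod_of_subset _ _ _ ?_, ?_⟩, ?_⟩
    · intro p hp
      simp only [Finset.mem_filter, Nat.mem_primeFactors] at hp
      simp only [Finset.mem_filter, Finset.mem_Icc]
      exact ⟨⟨hp.1.1.pos, (Nat.le_of_dvd hn.1 hp.1.2.1).trans hn.2⟩, hp.1.1, hp.2⟩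
    · exact (squarefree_prod_primes _ fun p hp => (Finset.mem_filter.1 hp).2.1).ne_zero
    · exact (Nat.cast_le.2 hle).trans (Nat.floor_le (by linarith))
  rw [div_mul_eq_mul_div, div_le_iff₀ hq']
  calc (q.totient : ℝ) * Real.log R ≤ q.totient * ∑ n ∈ Finset.Icc 1 N, ((n : ℝ))⁻¹ := by gcongr
    _ = q.totient * ∑ l ∈ (coprimePrimorial q R).divisors.filter (fun l : ℕ => (l : ℝ) ≤ R),
        ∑ n ∈ (Finset.Icc 1 N).filter (fun n => r n = l), ((n : ℝ))⁻¹ := by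
        rw [Finset.sum_fiberwise_of_maps_to hr]
    _ ≤ q.totient * ∑ l ∈ (coprimePrimorial q R).divisors.filter (fun l : ℕ => (l : ℝ) ≤ R),
        (apSieve q a A B R).selbergTerms l * (q / q.totient) := by
        gcongr with l hl
        simp only [Finset.mem_filter] at hl
        have hlP := Nat.dvd_of_mem_divisors hl.1
        have hl0 : 0 < l := Nat.pos_of_mem_divisors hl.1
        have hco := coprimePrimorial_coprime (by linarith) hlP
        rw [BoundingSieve.selbergTerms_apply]
        have hnu : ∀ p : ℕ, (apSieve q a A B R).nu p = (p : ℝ)⁻¹ := fun p => rfl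
        simp only [hnu]
        have hprod : (∏ p ∈ l.primeFactors, (1 - (p : ℝ)⁻¹)⁻¹) * (q / q.totient) =
            ∏ p ∈ (l.primeFactors ∪ q.primeFactors), (1 - (p : ℝ)⁻¹)⁻¹ := by
          rw [Finset.prod_union hco.disjoint_primeFactors]
          congr 1
          rw [Finset.prod_inv_distrib, prod_one_sub_inv q hq, inv_div]
        rw [mul_assoc, hprod]
        have h5 : ∑ n ∈ (Finset.Icc 1 N).filter (fun n => r n = l), ((n : ℝ))⁻¹ =
            (l : ℝ)⁻¹ * ∑ m ∈ ((Finset.Icc 1 N).filter (fun n => r n = l)).image (fun n => n / l),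
              ((m : ℝ))⁻¹ := by
          have hdv : ∀ n ∈ (Finset.Icc 1 N).filter (fun n => r n = l), l ∣ n := by
            intro n hn
            simp only [Finset.mem_filter] at hn
            rw [← hn.2]
            exact (Finset.prod_dvd_prod_of_subset _ _ _ (Finset.filter_subset _ _)).trans
              (Nat.prod_primeFactors_dvd n)
          rw [Finset.sum_image, Finset.mul_sum]
          · apply Finset.sum_congr rfl
            intro n hn
            have := hdv n hn
            obtain ⟨k, rfl⟩ := this
            rw [Nat.mul_div_cancel_left _ hl0]
            push_cast
            rw [mul_inv]
          · intro x hx y hy hxy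
            exact (Nat.div_left_inj (hdv x hx) (hdv y hy)).1 hxy
        rw [h5]
        gcongr
        apply sum_inv_factored_le
        · intro p hp
          rcases Finset.mem_union.1 hp with h | h <;> exact Nat.prime_of_mem_primeFactors h
        · intro m hm
          rw [Finset.mem_image] at hm
          obtain ⟨n, hn, rfl⟩ := hm
          simp only [Finset.mem_filter, Finset.mem_Icc] at hn
          have hdv : l ∣ n := by
            rw [← hn.2]
            exact (Finset.prod_dvd_prod_of_subset _ _ _ (Finset.filter_subset _ _)).trans
              (Nat.prod_primeFactors_dvd n)
          have hn0 : n / l ≠ 0 := (Nat.div_pos (Nat.le_of_dvd hn.1.1 hdv) hl0).ne'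
          apply Nat.mem_factoredNumbers_of_primeFactors_subset hn0
          intro p hp
          have hpp := Nat.prime_of_mem_primeFactors hp
          have hpn : p ∣ n := (Nat.dvd_of_mem_primeFactors hp).trans (Nat.div_dvd_of_dvd hdv)
          rw [Finset.mem_union, Nat.mem_primeFactors, Nat.mem_primeFactors]
          by_cases hpq : p ∣ q
          · right; exact ⟨hpp, hpq, by omega⟩
          · left
            refine ⟨hpp, ?_, hl0.ne'⟩
            rw [← hn.2]
            apply Finset.dvd_prod_of_mem (fun p => p)
            simp only [Finset.mem_filter, Nat.mem_primeFactors]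
            exact ⟨⟨hpp, hpn, by omega⟩, hpq⟩
    _ = selbergSum (apSieve q a A B R) R * q := by
        rw [← Finset.sum_mul, mul_left_comm, mul_div_cancel₀ _ hφ.ne']
        rfl

/-- Integers in a reduced residue class without prime factors up to `R`. -/
lemma card_rough_ap_le (q a A B : ℕ) (hq : 1 ≤ q) (hAB : A ≤ B) (R : ℝ) (hR : 1 < R) :
    ((((Finset.Ioc A B).filter (fun n => n ≡ a [MOD q] ∧
      ∀ p : ℕ, p.Prime → (p : ℝ) ≤ R → ¬ p ∣ n)).card : ℕ) : ℝ) ≤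
      ((B : ℝ) - A) / (q.totient * Real.log R) + R ^ 4 := by
  have hφ : (0 : ℝ) < q.totient := by exact_mod_cast Nat.totient_pos.2 hq
  have hq' : (0 : ℝ) < q := by exact_mod_cast hq
  have hlog := Real.log_pos hR
  have h := siftedSum_le_selberg (apSieve q a A B R) (R := R) (B := 1) hR.le
    (fun d hd => apSieve_rem q a A B R (by linarith) hq hAB hd) zero_le_one
    (fun d _ => by
      change (((d : ℝ))⁻¹)⁻¹ ≤ d
      rw [inv_inv])
  have hG := selbergSum_apSieve q a A B R hR.le hq
  have hAB' : (A : ℝ) ≤ B := by exact_mod_cast hAB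
  have h1 : (apSieve q a A B R).totalMass / selbergSum (apSieve q a A B R) R ≤
      ((B : ℝ) - A) / (q.totient * Real.log R) := by
    change ((B : ℝ) - A) / q / _ ≤ _
    calc ((B : ℝ) - A) / q / selbergSum (apSieve q a A B R) R ≤
        ((B : ℝ) - A) / q / ((q.totient : ℝ) / q * Real.log R) := by
          gcongr
      _ = _ := by field_simp
  have h2 : ((((Finset.Ioc A B).filter (fun n => n ≡ a [MOD q] ∧
      ∀ p : ℕ, p.Prime → (p : ℝ) ≤ R → ¬ p ∣ n)).card : ℕ) : ℝ) ≤
      (apSieve q a A B R).siftedSum := by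
    rw [← Finset.filter_filter, Finset.card_filter]
    push_cast
    unfold BoundingSieve.siftedSum
    apply Finset.sum_le_sum
    intro n _
    split_ifs with hnp hc hc
    · rfl
    · exfalso
      apply hc
      apply Nat.coprime_of_dvd
      intro p hp h1 h2
      exact hnp p hp ((prime_dvd_coprimePrimorial (by linarith) hp).1 h1).1 h2
    · exact zero_le_one
    · rfl
  linarith

lemma sum_vonMangoldt_mul_div (N : ℕ) :
    ∑ n ∈ Finset.Icc 1 N, Λ n * ((N / n : ℕ) : ℝ) = Real.log (N.factorial) := by
  have h1 : Real.log (N.factorial) = ∑ m ∈ Finset.Icc 1 N, Real.log m := by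
    rw [← Finset.prod_Ico_id_eq_factorial N, show Finset.Icc 1 N = Finset.Ico 1 (N + 1) by
      ext; simp only [Finset.mem_Icc, Finset.mem_Ico]; omega]
    push_cast
    rw [Real.log_prod]
    intro i hi
    have := (Finset.mem_Icc.1 hi).1
    positivity
  rw [h1]
  simp_rw [← ArithmeticFunction.vonMangoldt_sum]
  rw [Finset.sum_comm' (t' := Finset.Icc 1 N) (s' := fun n => (Finset.Icc 1 N).filter (fun m => n ∣ m))]
  · apply Finset.sum_congr rfl
    intro n _
    rw [Finset.sum_const, nsmul_eq_mul, mul_comm]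
    congr 2
    exact (Nat.Ioc_filter_dvd_card_eq_div N n).symm
  · intro m n
    simp only [Finset.mem_Icc, Nat.mem_divisors, Finset.mem_filter]
    constructor
    · rintro ⟨⟨h1, h2⟩, h3, h4⟩
      exact ⟨⟨⟨h1, h2⟩, h3⟩, Nat.pos_of_dvd_of_pos h3 h1, (Nat.le_of_dvd h1 h3).trans h2⟩
    · rintro ⟨⟨⟨h1, h2⟩, h3⟩, h4, h5⟩
      exact ⟨⟨h1, h2⟩, h3, by omega⟩

lemma psi_le_six {x : ℝ} (hx : 0 ≤ x) : Chebyshev.psi x ≤ 6 * x := by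
  refine (Chebyshev.psi_le_const_mul_self hx).trans ?_
  gcongr
  have : Real.log 4 = 2 * Real.log 2 := by
    rw [show (4 : ℝ) = 2 ^ 2 by norm_num, Real.log_pow]; norm_num
  have := Real.log_two_lt_d9
  linarith

lemma abs_mertens_nat (N : ℕ) (hN : 1 ≤ N) :
    |∑ n ∈ Finset.Icc 1 N, Λ n / n - Real.log N| ≤ 6 := by
  have hN' : (0 : ℝ) < N := by exact_mod_cast hN
  have hS := sum_vonMangoldt_mul_div N
  have hpsi := psi_le_six hN'.le
  have hpsi' : Chebyshev.psi N = ∑ n ∈ Finset.Icc 1 N, Λ n := by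
    unfold Chebyshev.psi
    rw [Nat.floor_natCast]
    rfl
  have hup : Real.log N.factorial ≤ N * Real.log N := by
    rw [← Real.log_pow]
    apply Real.log_le_log (by exact_mod_cast N.factorial_pos)
    exact_mod_cast N.factorial_le_pow
  have hlow : N * Real.log N - N ≤ Real.log N.factorial := by
    have h := Real.pow_div_factorial_le_exp (N : ℝ) hN'.le N
    have hf : (0 : ℝ) < N.factorial := by exact_mod_cast N.factorial_pos
    have h2 := Real.log_le_log (by positivity) h
    rw [Real.log_exp, Real.log_div (by positivity) hf.ne', Real.log_pow] at h2
    linarith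
  have hA : Real.log N.factorial ≤ N * ∑ n ∈ Finset.Icc 1 N, Λ n / n := by
    rw [← hS, Finset.mul_sum]
    apply Finset.sum_le_sum
    intro n hn
    have := Nat.cast_div_le (m := N) (n := n) (α := ℝ)
    calc Λ n * ((N / n : ℕ) : ℝ) ≤ Λ n * (N / n) := by
          gcongr
      _ = _ := by ring
  have hB : N * ∑ n ∈ Finset.Icc 1 N, Λ n / n ≤ Real.log N.factorial + Chebyshev.psi N := by
    rw [← hS, hpsi', Finset.mul_sum, ← Finset.sum_add_distrib]
    apply Finset.sum_le_sum
    intro n hn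
    have hn1 : 0 < n := (Finset.mem_Icc.1 hn).1
    have h : (N : ℝ) / n ≤ (N / n : ℕ) + 1 := by
      have := Nat.lt_div_mul_add hn1 (a := N)
      rw [div_le_iff₀ (by exact_mod_cast hn1)]
      have h2 : N ≤ (N / n + 1) * n := by linarith
      exact_mod_cast h2
    calc (N : ℝ) * (Λ n / n) = Λ n * (N / n) := by ring
      _ ≤ Λ n * ((N / n : ℕ) + 1) := by
        gcongr
      _ = _ := by ring
  rw [abs_le]
  constructor
  · have : N * (Real.log N - 1) ≤ N * ∑ n ∈ Finset.Icc 1 N, Λ n / n := by linarith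
    have := le_of_mul_le_mul_left this hN'
    linarith
  · have : N * ∑ n ∈ Finset.Icc 1 N, Λ n / n ≤ N * (Real.log N + 6) := by linarith
    have := le_of_mul_le_mul_left this hN'
    linarith

lemma abs_mertens {x : ℝ} (hx : 1 ≤ x) :
    |∑ n ∈ Finset.Icc 1 ⌊x⌋₊, Λ n / n - Real.log x| ≤ 7 := by
  have hN : 1 ≤ ⌊x⌋₊ := (Nat.one_le_floor_iff x).2 hx
  have h := abs_mertens_nat _ hN
  have hN' : (1 : ℝ) ≤ (⌊x⌋₊ : ℝ) := by exact_mod_cast hN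
  have h1 : Real.log ⌊x⌋₊ ≤ Real.log x :=
    Real.log_le_log (by linarith) (Nat.floor_le (by linarith))
  have h2 : Real.log x ≤ Real.log ⌊x⌋₊ + 1 := by
    have : x ≤ 2 * ⌊x⌋₊ := by have := Nat.lt_floor_add_one x; linarith
    have h3 := Real.log_le_log (by linarith) this
    rw [Real.log_mul (by norm_num) (by linarith)] at h3
    have := Real.log_two_lt_d9
    linarith
  rw [abs_le] at h ⊢
  constructor <;> linarith [h.1, h.2]

lemma continuousOn_deriv_inv_log {a b : ℝ} (ha : 1 < a) :
    ContinuousOn (fun t : ℝ => -(t⁻¹ / Real.log t ^ 2)) (Set.Icc a b) := by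
  intro t ht
  have h1 : 0 < Real.log t := Real.log_pos (lt_of_lt_of_le ha ht.1)
  have h2 : t ≠ 0 := by have := ht.1; intro h; linarith
  apply ContinuousAt.continuousWithinAt
  have := Real.continuousAt_log h2
  exact ((continuousAt_inv₀ h2).div (this.pow 2) (pow_ne_zero 2 h1.ne')).neg

/-- Mertens' second theorem on an interval (upper bound). -/
lemma mertens_interval {a b : ℝ} (ha : 1 < a) (hab : a ≤ b) :
    ∑ n ∈ Finset.Ioc ⌊a⌋₊ ⌊b⌋₊, Λ n / (n * Real.log n) ≤
      Real.log (Real.log b / Real.log a) + 21 / Real.log a := by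
  have hla : 0 < Real.log a := Real.log_pos ha
  have hlab : Real.log a ≤ Real.log b := Real.log_le_log (by linarith) hab
  have hlb : 0 < Real.log b := by linarith
  have hder : ∀ t ∈ Set.Icc a b, HasDerivAt (fun t => (Real.log t)⁻¹) (-(t⁻¹ / Real.log t ^ 2)) t := by
    intro t ht
    have h1 : 0 < Real.log t := Real.log_pos (lt_of_lt_of_le ha ht.1)
    have h2 : t ≠ 0 := by have := ht.1; intro h; linarith
    have := (Real.hasDerivAt_log h2).inv h1.ne'
    convert! this using 1
    ring
  have hcont := continuousOn_deriv_inv_log (a := a) (b := b) ha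
  have hderiv : Set.EqOn (deriv (fun t => (Real.log t)⁻¹)) (fun t => -(t⁻¹ / Real.log t ^ 2))
      (Set.Icc a b) := fun t ht => (hder t ht).deriv
  have habel := sum_mul_eq_sub_sub_integral_mul (f := fun t => (Real.log t)⁻¹)
    (fun n : ℕ => Λ n / n) (by linarith) hab
    (fun t ht => (hder t ht).differentiableAt)
    ((hcont.integrableOn_Icc).congr_fun hderiv.symm measurableSet_Icc)
  have hS : ∀ t : ℝ, ∑ k ∈ Finset.Icc 0 ⌊t⌋₊, Λ k / k = ∑ k ∈ Finset.Icc 1 ⌊t⌋₊, Λ k / k := by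
    intro t
    symm
    apply Finset.sum_subset (Finset.Icc_subset_Icc_left zero_le_one)
    intro x _ hx
    have : x = 0 := by
      by_contra h
      simp only [Finset.mem_Icc] at *
      omega
    simp [this]
  have hL : ∑ n ∈ Finset.Ioc ⌊a⌋₊ ⌊b⌋₊, Λ n / (n * Real.log n) =
      ∑ k ∈ Finset.Ioc ⌊a⌋₊ ⌊b⌋₊, (fun t => (Real.log t)⁻¹) (k : ℝ) * (Λ k / k) := by
    apply Finset.sum_congr rfl
    intro n _
    simp only []
    rw [← div_div, div_eq_mul_inv _ (Real.log n), mul_comm]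
  rw [hL, habel, hS, hS]
  have hint : -∫ t in Set.Ioc a b, deriv (fun t => (Real.log t)⁻¹) t *
      ∑ k ∈ Finset.Icc 0 ⌊t⌋₊, Λ k / k ≤
      ∫ t in Set.Ioc a b, (t⁻¹ / Real.log t + 7 * (t⁻¹ / Real.log t ^ 2)) := by
    rw [← integral_neg]
    have hi1 : IntegrableOn (fun t : ℝ => t⁻¹ / Real.log t + 7 * (t⁻¹ / Real.log t ^ 2))
        (Set.Icc a b) := by
      apply ContinuousOn.integrableOn_Icc
      intro t ht
      have h1 : 0 < Real.log t := Real.log_pos (lt_of_lt_of_le ha ht.1)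
      have h2 : t ≠ 0 := by have := ht.1; intro h; linarith
      apply ContinuousAt.continuousWithinAt
      have := Real.continuousAt_log h2
      exact ((continuousAt_inv₀ h2).div this h1.ne').add
        (((continuousAt_inv₀ h2).div (this.pow 2) (pow_ne_zero 2 h1.ne')).const_mul 7)
    apply setIntegral_mono_on
    · apply Integrable.neg
      exact (integrableOn_mul_sum_Icc (fun n : ℕ => Λ n / n) (by linarith : (0:ℝ) ≤ a)
        ((hcont.integrableOn_Icc).congr_fun hderiv.symm measurableSet_Icc)).mono_set
        Set.Ioc_subset_Icc_self
    · exact hi1.mono_set Set.Ioc_subset_Icc_self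
    · exact measurableSet_Ioc
    · intro t ht
      have ht' := Set.Ioc_subset_Icc_self ht
      rw [hS, hderiv ht']
      have h1 : 0 < Real.log t := Real.log_pos (lt_of_lt_of_le ha ht'.1)
      have h2 : 0 < t := by linarith [ht'.1]
      have hm := (abs_le.1 (abs_mertens (x := t) (by linarith [ht'.1]))).2
      simp only []
      calc -(-(t⁻¹ / Real.log t ^ 2) * ∑ k ∈ Finset.Icc 1 ⌊t⌋₊, Λ k / k)
          = t⁻¹ / Real.log t ^ 2 * ∑ k ∈ Finset.Icc 1 ⌊t⌋₊, Λ k / k := by ring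
        _ ≤ t⁻¹ / Real.log t ^ 2 * (Real.log t + 7) := by gcongr; linarith
        _ = _ := by field_simp
  have hint2 : ∫ t in Set.Ioc a b, (t⁻¹ / Real.log t + 7 * (t⁻¹ / Real.log t ^ 2)) =
      (Real.log (Real.log b) - 7 * (Real.log b)⁻¹) - (Real.log (Real.log a) - 7 * (Real.log a)⁻¹) := by
    rw [← intervalIntegral.integral_of_le hab]
    apply intervalIntegral.integral_eq_sub_of_hasDerivAt (f := fun t => Real.log (Real.log t) - 7 * (Real.log t)⁻¹)
    · intro t ht
      rw [Set.uIcc_of_le hab] at ht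
      have h1 : 0 < Real.log t := Real.log_pos (lt_of_lt_of_le ha ht.1)
      have h2 : t ≠ 0 := by have := ht.1; intro h; linarith
      have := ((Real.hasDerivAt_log h2).log h1.ne').sub ((hder t ht).const_mul 7)
      convert! this using 1
      ring
    · apply ContinuousOn.intervalIntegrable
      rw [Set.uIcc_of_le hab]
      intro t ht
      have h1 : 0 < Real.log t := Real.log_pos (lt_of_lt_of_le ha ht.1)
      have h2 : t ≠ 0 := by have := ht.1; intro h; linarith
      apply ContinuousAt.continuousWithinAt
      have := Real.continuousAt_log h2
      exact ((continuousAt_inv₀ h2).div this h1.ne').add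
        (((continuousAt_inv₀ h2).div (this.pow 2) (pow_ne_zero 2 h1.ne')).const_mul 7)
  have hb2 := (abs_le.1 (abs_mertens (x := b) (by linarith))).2
  have ha2 := (abs_le.1 (abs_mertens (x := a) (by linarith))).1
  rw [Real.log_div hlb.ne' hla.ne']
  have e1 : (Real.log b)⁻¹ * ∑ k ∈ Finset.Icc 1 ⌊b⌋₊, Λ k / k ≤ 1 + 7 * (Real.log b)⁻¹ := by
    calc _ ≤ (Real.log b)⁻¹ * (Real.log b + 7) := by gcongr; linarith
      _ = _ := by field_simp
  have e2 : 1 - 7 * (Real.log a)⁻¹ ≤ (Real.log a)⁻¹ * ∑ k ∈ Finset.Icc 1 ⌊a⌋₊, Λ k / k := by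
    calc _ = (Real.log a)⁻¹ * (Real.log a - 7) := by field_simp
      _ ≤ _ := by gcongr; linarith
  have e3 : 0 < (Real.log b)⁻¹ := by positivity
  have e4 : 0 < (Real.log a)⁻¹ := by positivity
  rw [div_eq_mul_inv 21]
  linarith

/-- The coefficients of `(1 - t)^(-κ)`. -/
def divCoeff (κ : ℝ) : ℕ → ℝ
  | 0 => 1
  | k + 1 => divCoeff κ k * ((κ + k) / (k + 1))

/-- The generalised divisor function `d_κ`, the extremal element of the class `C(κ)`. -/
def divMaj (κ : ℝ) (n : ℕ) : ℝ := ∏ p ∈ n.primeFactors, divCoeff κ (n.factorization p)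

lemma divCoeff_succ (κ : ℝ) (k : ℕ) :
    divCoeff κ (k + 1) = divCoeff κ k * ((κ + k) / (k + 1)) := rfl

lemma divCoeff_pos {κ : ℝ} (hκ : 0 < κ) (k : ℕ) : 0 < divCoeff κ k := by
  induction k with
  | zero => exact zero_lt_one
  | succ k ih => rw [divCoeff_succ]; positivity

lemma divCoeff_sum {κ : ℝ} (k : ℕ) :
    k * divCoeff κ k = κ * ∑ i ∈ Finset.range k, divCoeff κ i := by
  induction k with
  | zero => simp
  | succ k ih =>
    rw [Finset.sum_range_succ, mul_add, ← ih]
    rw [divCoeff_succ]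
    push_cast
    field_simp
    ring

lemma divCoeff_succ_le {κ : ℝ} (hκ : 0 < κ) (k : ℕ) :
    divCoeff κ (k + 1) ≤ divCoeff κ k * max κ 1 := by
  have := divCoeff_pos hκ k
  rw [divCoeff]
  gcongr
  rw [div_le_iff₀ (by positivity)]
  have h1 := le_max_left κ 1
  have h2 := le_max_right κ 1
  have : (k : ℝ) * 1 ≤ k * max κ 1 := by gcongr
  linarith

lemma divCoeff_le_pow {κ : ℝ} (hκ : 0 < κ) (k : ℕ) : divCoeff κ k ≤ (max κ 1) ^ k := by
  induction k with
  | zero => simp [divCoeff]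
  | succ k ih =>
    calc _ ≤ divCoeff κ k * max κ 1 := divCoeff_succ_le hκ k
      _ ≤ _ := by rw [pow_succ]; gcongr

lemma divCoeff_le_poly {κ : ℝ} (hκ : 0 < κ) (k : ℕ) : divCoeff κ k ≤ ((k : ℝ) + 1) ^ ⌈κ⌉₊ := by
  induction k with
  | zero => simp [divCoeff]
  | succ k ih =>
    have hm := Nat.le_ceil κ
    have hb := one_add_mul_le_pow (a := 1 / ((k : ℝ) + 1)) (by
      have : 0 ≤ 1 / ((k : ℝ) + 1) := by positivity
      linarith) ⌈κ⌉₊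
    calc _ ≤ ((k : ℝ) + 1) ^ ⌈κ⌉₊ * (1 + 1 / ((k : ℝ) + 1)) ^ ⌈κ⌉₊ := by
          rw [divCoeff_succ]
          gcongr
          refine le_trans ?_ hb
          rw [div_le_iff₀ (by positivity)]
          field_simp
          linarith
      _ = _ := by
          rw [← mul_pow]; push_cast; congr 1; field_simp

lemma divMaj_pos {κ : ℝ} (hκ : 0 < κ) (n : ℕ) : 0 < divMaj κ n :=
  Finset.prod_pos fun _ _ => divCoeff_pos hκ _

lemma divMaj_one (κ : ℝ) : divMaj κ 1 = 1 := by simp [divMaj]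

lemma divMaj_mul_coprime (κ : ℝ) {m n : ℕ} (h : Nat.Coprime m n) :
    divMaj κ (m * n) = divMaj κ m * divMaj κ n := by
  unfold divMaj
  rw [h.primeFactors_mul, Finset.prod_union h.disjoint_primeFactors]
  congr 1
  · apply Finset.prod_congr rfl
    intro p hp
    rw [Nat.factorization_eq_of_coprime_left h (Nat.mem_primeFactors_iff_mem_primeFactorsList.1 hp)]
  · apply Finset.prod_congr rfl
    intro p hp
    rw [Nat.factorization_eq_of_coprime_right h (Nat.mem_primeFactors_iff_mem_primeFactorsList.1 hp)]

lemma divMaj_prime_pow (κ : ℝ) {p : ℕ} (hp : p.Prime) (k : ℕ) :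
    divMaj κ (p ^ k) = divCoeff κ k := by
  rcases Nat.eq_zero_or_pos k with rfl | hk
  · simp [divMaj, divCoeff]
  · unfold divMaj
    rw [Nat.primeFactors_prime_pow hk.ne' hp, Finset.prod_singleton, hp.factorization_pow]
    simp

lemma divMaj_mul_prime_le {κ : ℝ} (hκ : 0 < κ) {n p : ℕ} (hn : n ≠ 0) (hp : p.Prime) :
    divMaj κ (n * p) ≤ divMaj κ n * max κ 1 := by
  obtain ⟨k, m, hpm, rfl⟩ := Nat.exists_eq_pow_mul_and_not_dvd hn p hp.ne_one
  have hco : ∀ j, Nat.Coprime (p ^ j) m := fun j =>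
    Nat.Coprime.pow_left j ((Nat.Prime.coprime_iff_not_dvd hp).2 hpm)
  rw [show p ^ k * m * p = p ^ (k + 1) * m by ring, divMaj_mul_coprime κ (hco _),
    divMaj_mul_coprime κ (hco _), divMaj_prime_pow κ hp, divMaj_prime_pow κ hp]
  have := divMaj_pos hκ m
  calc divCoeff κ (k + 1) * divMaj κ m ≤ (divCoeff κ k * max κ 1) * divMaj κ m := by
        gcongr
        exact divCoeff_succ_le hκ k
    _ = _ := by ring

lemma divMaj_mul_le {κ : ℝ} (hκ : 0 < κ) {m : ℕ} (hm : m ≠ 0) (n : ℕ) (hn : n ≠ 0) :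
    divMaj κ (m * n) ≤ divMaj κ m * (max κ 1) ^ (ArithmeticFunction.cardFactors n) := by
  induction n using induction_on_primes with
  | zero => exact absurd rfl hn
  | one => simp
  | prime_mul p a hp ih =>
    have ha : a ≠ 0 := right_ne_zero_of_mul hn
    have h1 : (0 : ℝ) < max κ 1 := lt_max_of_lt_right zero_lt_one
    calc divMaj κ (m * (p * a)) = divMaj κ (m * a * p) := by congr 1; ring
      _ ≤ divMaj κ (m * a) * max κ 1 := divMaj_mul_prime_le hκ (mul_ne_zero hm ha) hp
      _ ≤ divMaj κ m * (max κ 1) ^ (ArithmeticFunction.cardFactors a) * max κ 1 := by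
          gcongr; exact ih ha
      _ = _ := by
          rw [ArithmeticFunction.cardFactors_mul hp.ne_zero ha,
            ArithmeticFunction.cardFactors_apply_prime hp, pow_add]
          ring

lemma IsHalaszClass.norm_prime_pow_le {κ : ℝ} (hκ : 0 < κ) {f Λf : ℕ → ℂ}
    (hf : IsHalaszClass κ f Λf) {p : ℕ} (hp : p.Prime) (k : ℕ) :
    ‖f (p ^ k)‖ ≤ divCoeff κ k := by
  induction k using Nat.strong_induction_on with
  | _ k ih =>
  rcases Nat.eq_zero_or_pos k with rfl | hk
  · simp [hf.map_one, divCoeff]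
  have hlp : 0 < Real.log p := Real.log_pos (by exact_mod_cast hp.one_lt)
  have hc := hf.conv (p ^ k) (Nat.one_le_pow _ _ hp.pos)
  rw [Nat.sum_divisors_prime_pow hp, Finset.sum_range_succ', pow_zero] at hc
  have hΛ1 : Λf 1 = 0 := hf.supp 1 not_isPrimePow_one
  rw [hΛ1, zero_mul, add_zero] at hc
  have hn : ‖f (p ^ k)‖ * (k * Real.log p) ≤ ∑ i ∈ Finset.range k, κ * Real.log p * divCoeff κ (k - 1 - i) := by
    have h1 : ‖f (p ^ k) * (Real.log ((p ^ k : ℕ)) : ℂ)‖ = ‖f (p ^ k)‖ * (k * Real.log p) := by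
      rw [norm_mul, Complex.norm_real]
      push_cast
      rw [Real.log_pow, Real.norm_of_nonneg (by positivity)]
    rw [← h1, hc]
    refine (norm_sum_le _ _).trans ?_
    apply Finset.sum_le_sum
    intro i hi
    have hi' := Finset.mem_range.1 hi
    rw [norm_mul, Nat.pow_div (by omega) hp.pos]
    have hb := hf.bound (p ^ (i + 1)) (Nat.one_le_pow _ _ hp.pos)
    rw [ArithmeticFunction.vonMangoldt_apply_pow (by omega),
      ArithmeticFunction.vonMangoldt_apply_prime hp] at hb
    have h2 := ih (k - (i + 1)) (by omega)
    rw [show k - 1 - i = k - (i + 1) by omega]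
    gcongr
  have h3 : ∑ i ∈ Finset.range k, κ * Real.log p * divCoeff κ (k - 1 - i) =
      Real.log p * (k * divCoeff κ k) := by
    rw [Finset.sum_range_reflect (fun i => κ * Real.log p * divCoeff κ i), divCoeff_sum,
      ← Finset.mul_sum]
    ring
  rw [h3] at hn
  have hk' : (0 : ℝ) < k := by exact_mod_cast hk
  have : ‖f (p ^ k)‖ * (k * Real.log p) ≤ divCoeff κ k * (k * Real.log p) := by linarith
  exact le_of_mul_le_mul_right this (by positivity)

lemma IsHalaszClass.norm_le_divMaj {κ : ℝ} (hκ : 0 < κ) {f Λf : ℕ → ℂ}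
    (hf : IsHalaszClass κ f Λf) {n : ℕ} (hn : n ≠ 0) : ‖f n‖ ≤ divMaj κ n := by
  induction n using Nat.recOnPosPrimePosCoprime with
  | prime_pow p k hp hk => rw [divMaj_prime_pow κ hp]; exact hf.norm_prime_pow_le hκ hp k
  | zero => exact absurd rfl hn
  | one => simp [hf.map_one, divMaj_one]
  | coprime a b ha hb hab iha ihb =>
    rw [hf.mult a b hab, divMaj_mul_coprime κ hab, norm_mul]
    exact mul_le_mul (iha (by omega)) (ihb (by omega)) (norm_nonneg _) (divMaj_pos hκ a).le

lemma exists_poly_le_rpow (m : ℕ) {ε : ℝ} (hε : 0 < ε) :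
    ∃ A : ℝ, 1 ≤ A ∧ ∀ k : ℕ, ((k : ℝ) + 1) ^ m ≤ A * (2 : ℝ) ^ (ε * k) := by
  have h : Filter.Tendsto (fun k : ℕ => ((k : ℝ) + 1) ^ m / (2 : ℝ) ^ (ε * k)) Filter.atTop (nhds 0) := by
    have h1 := (isLittleO_pow_exp_pos_mul_atTop (k := m) (b := ε * Real.log 2)
      (by have := Real.log_pos (by norm_num : (1:ℝ) < 2); positivity)).tendsto_div_nhds_zero
    have h2 := h1.comp (Filter.tendsto_atTop_add_const_right _ (1 : ℝ) (tendsto_natCast_atTop_atTop (R := ℝ)))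
    have h3 := h2.const_mul (Real.exp (ε * Real.log 2))
    rw [mul_zero] at h3
    refine h3.congr fun k => ?_
    simp only [Function.comp]
    rw [Real.rpow_def_of_pos (by norm_num), mul_add, mul_one, Real.exp_add]
    have := Real.exp_pos (ε * Real.log 2)
    rw [show Real.log 2 * (ε * k) = ε * Real.log 2 * k by ring]
    field_simp
  obtain ⟨A, hA⟩ := h.bddAbove_range
  refine ⟨max A 1, le_max_right _ _, fun k => ?_⟩
  have h1 := hA ⟨k, rfl⟩
  simp only [] at h1
  rw [div_le_iff₀ (by positivity)] at h1
  exact h1.trans (by gcongr; exact le_max_left _ _)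

/-- Divisor-type bound for the majorant. -/
lemma exists_divMaj_le_rpow {κ : ℝ} (hκ : 0 < κ) {ε : ℝ} (hε : 0 < ε) :
    ∃ A : ℝ, 1 ≤ A ∧ ∀ n : ℕ, n ≠ 0 → divMaj κ n ≤ A * (n : ℝ) ^ ε := by
  obtain ⟨A, hA1, hA⟩ := exists_poly_le_rpow ⌈κ⌉₊ hε
  obtain ⟨P, hP⟩ := ((tendsto_rpow_atTop hε).comp
    (tendsto_natCast_atTop_atTop (R := ℝ))).eventually_ge_atTop (max κ 1) |>.exists_forall_of_atTop
  refine ⟨A ^ P, one_le_pow₀ hA1, fun n hn => ?_⟩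
  have h1 : divMaj κ n ≤ ∏ p ∈ n.primeFactors,
      ((if p < P then A else 1) * ((p : ℝ) ^ (n.factorization p)) ^ ε) := by
    unfold divMaj
    apply Finset.prod_le_prod
    · intro p _; exact (divCoeff_pos hκ _).le
    · intro p hp
      have hpp := Nat.prime_of_mem_primeFactors hp
      have hp0 : (0 : ℝ) < p := by exact_mod_cast hpp.pos
      have hp2 : (2 : ℝ) ≤ p := by exact_mod_cast hpp.two_le
      have e : ((p : ℝ) ^ (n.factorization p)) ^ ε = (p : ℝ) ^ (ε * (n.factorization p)) := by
        rw [← Real.rpow_natCast, ← Real.rpow_mul hp0.le, mul_comm]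
      rw [e]
      split_ifs with h
      · calc _ ≤ _ := divCoeff_le_poly hκ _
          _ ≤ A * (2 : ℝ) ^ (ε * (n.factorization p)) := hA _
          _ ≤ _ := by gcongr
      · rw [one_mul]
        calc _ ≤ _ := divCoeff_le_pow hκ _
          _ ≤ ((p : ℝ) ^ ε) ^ (n.factorization p) := by
            gcongr
            exact hP p (not_lt.1 h)
          _ = _ := by rw [← Real.rpow_natCast, ← Real.rpow_mul hp0.le]
  refine h1.trans ?_
  rw [Finset.prod_mul_distrib]
  have h2 : ∏ p ∈ n.primeFactors, ((p : ℝ) ^ (n.factorization p)) ^ ε = (n : ℝ) ^ ε := by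
    rw [Real.finsetProd_rpow _ _ (fun p _ => by positivity)]
    congr 1
    have := Nat.prod_factorization_pow_eq_self hn
    rw [Finsupp.prod, Nat.support_factorization] at this
    exact_mod_cast this
  rw [h2]
  gcongr
  rw [← Finset.prod_filter, Finset.prod_const]
  apply pow_le_pow_right₀ hA1
  calc _ ≤ (Finset.range P).card := by
        apply Finset.card_le_card
        intro p hp
        simp only [Finset.mem_filter] at hp
        exact Finset.mem_range.2 hp.2
    _ = P := Finset.card_range P

lemma sum_vonMangoldt_div_log_le {w : ℝ} (hw : 2 ≤ w) :
    ∑ n ∈ Finset.Ioc 1 ⌊w⌋₊, Λ n / (n * Real.log n) ≤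
      Real.log (Real.log w) + (Real.log (1 / Real.log (3 / 2)) + 21 / Real.log (3 / 2)) := by
  have h := mertens_interval (a := 3 / 2) (b := w) (by norm_num) (by linarith)
  have h1 : ⌊(3 / 2 : ℝ)⌋₊ = 1 := by
    rw [Nat.floor_eq_iff (by norm_num)]; norm_num
  have hl : 0 < Real.log (3 / 2) := Real.log_pos (by norm_num)
  have hlw : 0 < Real.log w := Real.log_pos (by linarith)
  rw [h1, div_eq_mul_one_div (Real.log w), Real.log_mul hlw.ne' (by positivity)] at h
  linarith

lemma sum_primes_inv_le {w : ℝ} :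
    ∑ p ∈ Nat.primesBelow (⌊w⌋₊ + 1), ((p : ℝ))⁻¹ ≤ ∑ n ∈ Finset.Ioc 1 ⌊w⌋₊, Λ n / (n * Real.log n) := by
  calc _ = ∑ p ∈ Nat.primesBelow (⌊w⌋₊ + 1), Λ p / (p * Real.log p) := by
        apply Finset.sum_congr rfl
        intro p hp
        have hpp := (Nat.mem_primesBelow.1 hp).2
        have hlp : 0 < Real.log p := Real.log_pos (by exact_mod_cast hpp.one_lt)
        rw [ArithmeticFunction.vonMangoldt_apply_prime hpp]
        field_simp
    _ ≤ _ := by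
        apply Finset.sum_le_sum_of_subset_of_nonneg
        · intro p hp
          have hpp := Nat.mem_primesBelow.1 hp
          rw [Finset.mem_Ioc]
          exact ⟨hpp.2.one_lt, by omega⟩
        · intro n _ _
          have := Real.log_natCast_nonneg n
          have := ArithmeticFunction.vonMangoldt_nonneg (n := n)
          positivity

lemma sum_primes_log_div_le {w : ℝ} (hw : 1 ≤ w) :
    ∑ p ∈ Nat.primesBelow (⌊w⌋₊ + 1), Real.log p / p ≤ Real.log w + 7 := by
  have h := (abs_le.1 (abs_mertens hw)).2
  refine le_trans ?_ (by linarith : ∑ n ∈ Finset.Icc 1 ⌊w⌋₊, Λ n / n ≤ _)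
  calc _ = ∑ p ∈ Nat.primesBelow (⌊w⌋₊ + 1), Λ p / p := by
        apply Finset.sum_congr rfl
        intro p hp
        rw [ArithmeticFunction.vonMangoldt_apply_prime (Nat.mem_primesBelow.1 hp).2]
    _ ≤ _ := by
        apply Finset.sum_le_sum_of_subset_of_nonneg
        · intro p hp
          have hpp := Nat.mem_primesBelow.1 hp
          rw [Finset.mem_Icc]
          exact ⟨hpp.2.one_lt.le, by omega⟩
        · intro n _ _
          have := ArithmeticFunction.vonMangoldt_nonneg (n := n)
          positivity

lemma exists_local_factor_bound {κ : ℝ} (hκ : 0 < κ) :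
    ∃ C : ℝ, 0 ≤ C ∧ ∀ t : ℝ, 0 ≤ t → t ≤ (2 : ℝ) ^ (-(3 / 4) : ℝ) →
      Summable (fun k : ℕ => divCoeff κ k * t ^ k) ∧
      ∑' k : ℕ, divCoeff κ k * t ^ k ≤ Real.exp (κ * t + C * t ^ 2) := by
  set τ : ℝ := (2 : ℝ) ^ (-(3 / 4) : ℝ) with hτ
  have hτ0 : 0 < τ := by positivity
  have hτ1 : τ < 1 := Real.rpow_lt_one_of_one_lt_of_neg (by norm_num) (by norm_num)
  have hs0 : Summable (fun k : ℕ => ((k : ℝ) + 1) ^ ⌈κ⌉₊ * τ ^ k) := by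
    have h := (summable_nat_add_iff 1).2 (summable_pow_mul_geometric_of_norm_lt_one ⌈κ⌉₊
      (r := τ) (by rwa [Real.norm_of_nonneg hτ0.le]))
    have h2 := h.mul_right τ⁻¹
    refine h2.congr fun k => ?_
    push_cast
    rw [pow_succ]
    field_simp
  have hsum : ∀ t : ℝ, 0 ≤ t → t ≤ τ → Summable (fun k : ℕ => divCoeff κ k * t ^ k) := by
    intro t ht0 ht
    refine hs0.of_nonneg_of_le (fun k => ?_) (fun k => ?_)
    · have := divCoeff_pos hκ k; positivity
    · have := divCoeff_pos hκ k
      gcongr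
      exact divCoeff_le_poly hκ k
  refine ⟨∑' k : ℕ, divCoeff κ (k + 2) * τ ^ k, ?_, fun t ht0 ht => ⟨hsum t ht0 ht, ?_⟩⟩
  · exact tsum_nonneg fun k => by have := divCoeff_pos hκ (k + 2); positivity
  have hs2 : ∀ t : ℝ, 0 ≤ t → t ≤ τ → Summable (fun k : ℕ => divCoeff κ (k + 2) * t ^ k) := by
    intro t ht0 ht
    rcases eq_or_lt_of_le ht0 with h | h
    · rw [← h]
      apply summable_of_ne_finset_zero (s := {0})
      intro b hb
      simp only [Finset.mem_singleton] at hb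
      simp [hb]
    · have h1 := ((summable_nat_add_iff 2).2 (hsum t ht0 ht)).mul_right (t ^ 2)⁻¹
      refine h1.congr fun k => ?_
      rw [pow_add]; field_simp
  have h1 : ∑' k : ℕ, divCoeff κ k * t ^ k = 1 + κ * t + (∑' k : ℕ, divCoeff κ (k + 2) * t ^ k) * t ^ 2 := by
    rw [← (hsum t ht0 ht).sum_add_tsum_nat_add 2, Finset.sum_range_succ, Finset.sum_range_one,
      ← tsum_mul_right]
    have e0 : divCoeff κ 0 = 1 := rfl
    have e1 : divCoeff κ 1 = κ := by rw [divCoeff_succ, e0]; simp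
    rw [e0, e1]
    simp only [pow_zero, pow_one, mul_one]
    congr 1
    apply tsum_congr
    intro k; ring
  rw [h1]
  have h2 : ∑' k : ℕ, divCoeff κ (k + 2) * t ^ k ≤ ∑' k : ℕ, divCoeff κ (k + 2) * τ ^ k := by
    apply (hs2 t ht0 ht).tsum_le_tsum _ (hs2 τ hτ0.le le_rfl)
    intro k
    have := divCoeff_pos hκ (k + 2)
    gcongr
  calc _ ≤ (κ * t + (∑' k : ℕ, divCoeff κ (k + 2) * τ ^ k) * t ^ 2) + 1 := by
        have : (∑' k : ℕ, divCoeff κ (k + 2) * t ^ k) * t ^ 2 ≤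
          (∑' k : ℕ, divCoeff κ (k + 2) * τ ^ k) * t ^ 2 := by gcongr
        linarith
    _ ≤ _ := Real.add_one_le_exp _

/-- `n` has no prime factor exceeding `w`. -/
def Smooth (w : ℝ) (n : ℕ) : Prop := n ≠ 0 ∧ ∀ p : ℕ, p.Prime → p ∣ n → (p : ℝ) ≤ w

lemma rankin_bound {κ : ℝ} (hκ : 0 < κ) {c₀ : ℝ} :
    ∃ C : ℝ, 1 ≤ C ∧ ∀ w : ℝ, 2 ≤ w → ∀ β : ℝ, 0 ≤ β → β ≤ 1 / 4 → β * Real.log w ≤ c₀ →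
      ∀ T : Finset ℕ, (∀ b ∈ T, Smooth w b) →
        ∑ b ∈ T, divMaj κ b * (b : ℝ) ^ (β - 1) ≤ C * Real.log w ^ κ := by
  obtain ⟨C2, hC2, hloc⟩ := exists_local_factor_bound hκ
  have hs3 : Summable (fun n : ℕ => (n : ℝ) ^ (-(3 / 2) : ℝ)) :=
    Real.summable_nat_rpow.2 (by norm_num)
  set C3 := ∑' n : ℕ, (n : ℝ) ^ (-(3 / 2) : ℝ) with hC3
  have hC30 : 0 ≤ C3 := tsum_nonneg fun n => by positivity
  set L := Real.log (1 / Real.log (3 / 2)) + 21 / Real.log (3 / 2) with hL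
  set E := κ * (L + Real.exp c₀ * (c₀ + 7)) + C2 * C3 with hE
  refine ⟨max 1 (Real.exp E), le_max_left _ _, fun w hw β hβ0 hβ1 hβw T hT => ?_⟩
  have hlw : 0 < Real.log w := Real.log_pos (by linarith)
  set N := ⌊w⌋₊ + 1 with hN
  set F : ℕ → ℝ := fun b => divMaj κ b * (b : ℝ) ^ (β - 1) with hF
  have hFpow : ∀ p : ℕ, p.Prime → ∀ k : ℕ, F (p ^ k) = divCoeff κ k * ((p : ℝ) ^ (β - 1)) ^ k := by
    intro p hp k
    simp only [hF]
    rw [divMaj_prime_pow κ hp]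
    push_cast
    rw [← Real.rpow_natCast, ← Real.rpow_natCast, ← Real.rpow_mul (by positivity),
      ← Real.rpow_mul (by positivity), mul_comm (k : ℝ)]
  have ht : ∀ p : ℕ, p.Prime → (p : ℝ) ^ (β - 1) ≤ (2 : ℝ) ^ (-(3 / 4) : ℝ) := by
    intro p hp
    have h2 : (2 : ℝ) ≤ p := by exact_mod_cast hp.two_le
    calc (p : ℝ) ^ (β - 1) ≤ (p : ℝ) ^ (-(3 / 4) : ℝ) :=
          Real.rpow_le_rpow_of_exponent_le (by linarith) (by linarith)
      _ ≤ _ := Real.rpow_le_rpow_of_nonpos (by norm_num) h2 (by norm_num)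
  have hF0 : ∀ b, 0 ≤ F b := fun b => by
    have := divMaj_pos hκ b
    simp only [hF]; positivity
  have hEP := EulerProduct.summable_and_hasSum_smoothNumbers_prod_primesBelow_tsum (f := F)
    (by simp [hF, divMaj_one])
    (by
      intro m n hmn
      simp only [hF]
      rw [divMaj_mul_coprime κ hmn]
      push_cast
      rw [Real.mul_rpow (by positivity) (by positivity)]
      ring)
    (by
      intro p hp
      simp only [hFpow p hp]
      have := (hloc _ (by positivity) (ht p hp)).1
      refine this.congr fun k => ?_
      rw [Real.norm_of_nonneg]
      have := divCoeff_pos hκ k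
      positivity) N
  have h1 : ∑ b ∈ T, F b ≤ ∏ p ∈ N.primesBelow, ∑' k : ℕ, F (p ^ k) := by
    have h3 : ∑ b ∈ T, F b = ∑ m ∈ T.subtype (fun m => m ∈ Nat.smoothNumbers N), F m := by
      rw [Finset.sum_subtype_of_mem (fun m => F m)]
      intro b hb
      rw [Nat.mem_smoothNumbers']
      intro p hp hpb
      have := (hT b hb).2 p hp hpb
      rw [hN, Nat.lt_succ_iff]
      exact Nat.le_floor this
    rw [h3]
    exact sum_le_hasSum _ (fun i _ => hF0 i) hEP.2
  refine h1.trans ?_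
  have h2 : ∏ p ∈ N.primesBelow, ∑' k : ℕ, F (p ^ k) ≤
      ∏ p ∈ N.primesBelow, Real.exp (κ * (p : ℝ) ^ (β - 1) + C2 * ((p : ℝ) ^ (β - 1)) ^ 2) := by
    apply Finset.prod_le_prod
    · intro p _; exact tsum_nonneg fun k => hF0 _
    · intro p hp
      have hpp := (Nat.mem_primesBelow.1 hp).2
      simp only [hFpow p hpp]
      exact (hloc _ (by positivity) (ht p hpp)).2
  refine h2.trans ?_
  rw [← Real.exp_sum, Finset.sum_add_distrib, ← Finset.mul_sum, ← Finset.mul_sum]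
  have h3 : ∑ p ∈ N.primesBelow, ((p : ℝ) ^ (β - 1)) ^ 2 ≤ C3 := by
    calc _ ≤ ∑ p ∈ N.primesBelow, (p : ℝ) ^ (-(3 / 2) : ℝ) := by
          apply Finset.sum_le_sum
          intro p hp
          have hpp := (Nat.mem_primesBelow.1 hp).2
          have h1 : (1 : ℝ) ≤ p := by exact_mod_cast hpp.one_lt.le
          rw [← Real.rpow_natCast, ← Real.rpow_mul (by positivity)]
          apply Real.rpow_le_rpow_of_exponent_le h1
          push_cast; linarith
      _ ≤ C3 := hs3.sum_le_tsum _ (fun n _ => by positivity)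
  have h4 : ∑ p ∈ N.primesBelow, (p : ℝ) ^ (β - 1) ≤
      Real.log (Real.log w) + (L + Real.exp c₀ * (c₀ + 7)) := by
    have h5 := (sum_primes_inv_le (w := w)).trans (sum_vonMangoldt_div_log_le hw)
    have h6 := sum_primes_log_div_le (w := w) (by linarith)
    calc _ ≤ ∑ p ∈ N.primesBelow, ((p : ℝ)⁻¹ + β * Real.exp c₀ * (Real.log p / p)) := by
          apply Finset.sum_le_sum
          intro p hp
          have hpp := (Nat.mem_primesBelow.1 hp)
          have hp0 : (0 : ℝ) < p := by exact_mod_cast hpp.2.pos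
          have hlp : 0 ≤ Real.log p := Real.log_natCast_nonneg p
          have hpw : (p : ℝ) ≤ w := by
            have : p ≤ ⌊w⌋₊ := by omega
            exact (Nat.le_floor_iff (by linarith)).1 this
          have hx : β * Real.log p ≤ c₀ := by
            refine le_trans ?_ hβw
            gcongr
          have he : (p : ℝ) ^ β ≤ 1 + β * Real.log p * Real.exp c₀ := by
            rw [Real.rpow_def_of_pos hp0, mul_comm (Real.log p)]
            have h7 := Real.add_one_le_exp (-(β * Real.log p))
            have h8 : Real.exp (β * Real.log p) ≤ Real.exp c₀ := Real.exp_le_exp.2 hx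
            have h9 : Real.exp (β * Real.log p) * Real.exp (-(β * Real.log p)) = 1 := by
              rw [← Real.exp_add]; simp
            have h10 : 0 < Real.exp (β * Real.log p) := Real.exp_pos _
            have h11 : 0 ≤ β * Real.log p := by positivity
            have h12 : Real.exp (β * Real.log p) * (-(β * Real.log p) + 1) ≤ 1 := by
              calc Real.exp (β * Real.log p) * (-(β * Real.log p) + 1)
                  ≤ Real.exp (β * Real.log p) * Real.exp (-(β * Real.log p)) := by gcongr
                _ = 1 := h9
            have h13 : β * Real.log p * Real.exp (β * Real.log p) ≤ β * Real.log p * Real.exp c₀ := by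
              gcongr
            linarith
          rw [Real.rpow_sub hp0, Real.rpow_one]
          calc (p : ℝ) ^ β / p ≤ (1 + β * Real.log p * Real.exp c₀) / p := by gcongr
            _ = _ := by field_simp
      _ = ∑ p ∈ N.primesBelow, (p : ℝ)⁻¹ + β * Real.exp c₀ * ∑ p ∈ N.primesBelow, Real.log p / p := by
          rw [Finset.sum_add_distrib, Finset.mul_sum]
      _ ≤ (Real.log (Real.log w) + L) + β * Real.exp c₀ * (Real.log w + 7) := by
          gcongr
      _ ≤ _ := by
          have : β * Real.exp c₀ * (Real.log w + 7) ≤ Real.exp c₀ * (c₀ + 7) := by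
            have he := Real.exp_pos c₀
            have : β * (Real.log w + 7) ≤ c₀ + 7 := by linarith
            calc _ = Real.exp c₀ * (β * (Real.log w + 7)) := by ring
              _ ≤ _ := by gcongr
          linarith
  calc Real.exp _ ≤ Real.exp (κ * (Real.log (Real.log w) + (L + Real.exp c₀ * (c₀ + 7))) + C2 * C3) := by
        gcongr
    _ = Real.exp E * Real.log w ^ κ := by
        rw [Real.rpow_def_of_pos hlw, ← Real.exp_add]
        congr 1
        rw [hE]; ring
    _ ≤ _ := by
        gcongr
        exact le_max_right _ _

/-- `n` has no prime factor `≤ R`. -/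
def Rough (R : ℝ) (n : ℕ) : Prop := ∀ p : ℕ, p.Prime → (p : ℝ) ≤ R → ¬ p ∣ n

lemma Rough.pow_cardFactors_le {R : ℝ} (hR : 1 ≤ R) {n : ℕ} (hn : n ≠ 0) (h : Rough R n) :
    R ^ (ArithmeticFunction.cardFactors n) ≤ n := by
  induction n using induction_on_primes with
  | zero => exact absurd rfl hn
  | one => simp
  | prime_mul p a hp ih =>
    have ha : a ≠ 0 := right_ne_zero_of_mul hn
    rw [ArithmeticFunction.cardFactors_mul hp.ne_zero ha,
      ArithmeticFunction.cardFactors_apply_prime hp, pow_add, pow_one]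
    have h1 : R ≤ p := by
      by_contra hlt
      exact h p hp (not_le.1 hlt).le (dvd_mul_right p a)
    have h2 := ih ha (fun r hr hrR hra => h r hr hrR (hra.mul_left p))
    push_cast
    gcongr

lemma Rough.cardFactors_le {R : ℝ} (hR : 1 < R) {n : ℕ} (hn : n ≠ 0) (h : Rough R n) {Y : ℝ}
    (hY : (n : ℝ) ≤ Y) :
    (ArithmeticFunction.cardFactors n : ℝ) ≤ Real.log Y / Real.log R := by
  have h1 := (h.pow_cardFactors_le hR.le hn).trans hY
  have h2 := Real.log_le_log (by positivity) h1
  rw [Real.log_pow] at h2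
  rwa [le_div_iff₀ (Real.log_pos hR)]

lemma Rough.divMaj_mul_le {κ : ℝ} (hκ : 0 < κ) {R : ℝ} (hR : 1 < R) {b c : ℕ} (hb : b ≠ 0)
    (hc : c ≠ 0) (h : Rough R c) {Y : ℝ} (hY : (c : ℝ) ≤ Y) :
    divMaj κ (b * c) ≤ divMaj κ b * (max κ 1) ^ (Real.log Y / Real.log R) := by
  refine (_root_.divMaj_mul_le hκ hb c hc).trans ?_
  have := divMaj_pos hκ b
  gcongr
  rw [← Real.rpow_natCast]
  exact Real.rpow_le_rpow_of_exponent_le (le_max_right _ _) (h.cardFactors_le hR hc hY)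

/-- Sieve bound for the multiples `n = b c` of `b` with rough cofactor. -/
lemma card_mul_rough_le {q a A B b : ℕ} (hq : 1 ≤ q) (ha : Nat.Coprime a q) (hAB : A ≤ B)
    (hb : b ≠ 0) {R : ℝ} (hR : 1 < R)
    (hH : (b : ℝ) * R ^ 4 * R * q ≤ (B : ℝ) - A) :
    (((Finset.Ioc A B).filter
      (fun n : ℕ => n ≡ a [MOD q] ∧ b ∣ n ∧ Rough R (n / b))).card : ℝ)
      ≤ 3 * ((B : ℝ) - A) / (q.totient * Real.log R) * (b : ℝ)⁻¹ := by
  have hlR := Real.log_pos hR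
  have hφ : (0 : ℝ) < q.totient := by exact_mod_cast Nat.totient_pos.2 hq
  have hφq : (q.totient : ℝ) ≤ q := by exact_mod_cast Nat.totient_le q
  have hb0 : (0 : ℝ) < b := by positivity
  have hAB' : (0 : ℝ) ≤ (B : ℝ) - A := by
    have : (A : ℝ) ≤ B := by exact_mod_cast hAB
    linarith
  set S := (Finset.Ioc A B).filter
      (fun n : ℕ => n ≡ a [MOD q] ∧ b ∣ n ∧ Rough R (n / b)) with hS
  rcases S.eq_empty_or_nonempty with h0 | ⟨n₀, hn₀⟩
  · rw [h0]; simp only [Finset.card_empty, Nat.cast_zero]; positivity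
  have hbq : Nat.Coprime b q := by
    rw [hS, Finset.mem_filter] at hn₀
    have h1 : Nat.gcd n₀ q = Nat.gcd a q := hn₀.2.1.gcd_eq
    have h2 : Nat.Coprime n₀ q := by
      unfold Nat.Coprime at *; rw [h1, ha]
    exact Nat.Coprime.coprime_dvd_left hn₀.2.2.1 h2
  have hcard : S.card ≤ ((Finset.Ioc (A / b) (B / b)).filter (fun n => n ≡ n₀ / b [MOD q] ∧
      ∀ p : ℕ, p.Prime → (p : ℝ) ≤ R → ¬ p ∣ n)).card := by
    refine Finset.card_le_card_of_injOn (fun n => n / b) ?_ ?_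
    · intro n hn
      rw [hS] at hn hn₀
      simp only [Finset.coe_filter, Set.mem_ofPred_eq, Finset.mem_filter, Finset.mem_Ioc] at hn hn₀ ⊢
      obtain ⟨⟨h1, h2⟩, h3, h4, h5⟩ := hn
      refine ⟨⟨?_, Nat.div_le_div_right h2⟩, ?_, h5⟩
      · rw [Nat.div_lt_iff_lt_mul (Nat.pos_of_ne_zero hb), Nat.div_mul_cancel h4]; exact h1
      · apply Nat.ModEq.cancel_left_of_coprime (c := b) (by simpa [Nat.coprime_comm] using hbq)
        rw [Nat.mul_div_cancel' h4, Nat.mul_div_cancel' hn₀.2.2.1]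
        exact h3.trans hn₀.2.1.symm
    · intro n hn m hm h
      rw [hS] at hn hm
      simp only [Finset.coe_filter, Set.mem_ofPred_eq] at hn hm
      have := congrArg (fun t => t * b) h
      simpa [Nat.div_mul_cancel hn.2.2.1, Nat.div_mul_cancel hm.2.2.1] using this
  have h1 := card_rough_ap_le q (n₀ / b) (A / b) (B / b) hq (Nat.div_le_div_right hAB) R hR
  have h2 : (S.card : ℝ) ≤ _ := (Nat.cast_le.2 hcard).trans h1
  refine h2.trans ?_
  have h3 : ((B / b : ℕ) : ℝ) - ((A / b : ℕ) : ℝ) ≤ ((B : ℝ) - A) / b + 1 := by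
    have e1 : ((B / b : ℕ) : ℝ) ≤ (B : ℝ) / b := Nat.cast_div_le
    have e2 : (A : ℝ) / b < ((A / b : ℕ) : ℝ) + 1 := by
      rw [div_lt_iff₀ hb0]
      have := Nat.lt_div_mul_add (a := A) (Nat.pos_of_ne_zero hb)
      have h' : A < (A / b + 1) * b := by linarith [this, (by ring : (A / b + 1) * b = A / b * b + b)]
      exact_mod_cast h'
    rw [sub_div]; linarith
  have hq1 : (1 : ℝ) ≤ q := by exact_mod_cast hq
  have hR4 : 1 ≤ R ^ 4 := one_le_pow₀ hR.le
  have h4 : 1 ≤ ((B : ℝ) - A) / b := by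
    rw [le_div_iff₀ hb0, one_mul]
    refine le_trans ?_ hH
    calc (b : ℝ) = b * 1 * 1 * 1 := by ring
      _ ≤ _ := by gcongr
  have hlogR : Real.log R ≤ R := (Real.log_le_sub_one_of_pos (by linarith)).trans (by linarith)
  have h5 : R ^ 4 ≤ ((B : ℝ) - A) / b / (q.totient * Real.log R) := by
    rw [le_div_iff₀ (by positivity), le_div_iff₀ hb0]
    calc R ^ 4 * (q.totient * Real.log R) * b = b * R ^ 4 * Real.log R * q.totient := by ring
      _ ≤ b * R ^ 4 * R * q := by gcongr
      _ ≤ _ := hH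
  have h6 : (((B / b : ℕ) : ℝ) - ((A / b : ℕ) : ℝ)) / (q.totient * Real.log R)
      ≤ (2 * (((B : ℝ) - A) / b)) / (q.totient * Real.log R) := by
    gcongr; linarith
  calc _ ≤ (2 * (((B : ℝ) - A) / b)) / (q.totient * Real.log R)
        + ((B : ℝ) - A) / b / (q.totient * Real.log R) := add_le_add h6 h5
    _ = _ := by field_simp; ring

/-- Brun–Titchmarsh for `Λ`. -/
lemma sum_vonMangoldt_ap_le {q a A B : ℕ} (hq : 1 ≤ q) (hAB : A ≤ B) {z : ℝ} (hz : 2 ≤ z)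
    (hB : (B : ℝ) ≤ z ^ 28) (hH : (q : ℝ) * z ^ 7 ≤ (B : ℝ) - A) :
    ∑ n ∈ (Finset.Ioc A B).filter (fun n : ℕ => n ≡ a [MOD q]), Λ n
      ≤ 200 * (((B : ℝ) - A) / q.totient) := by
  have hlz := Real.log_pos (by linarith : 1 < z)
  have hφ : (0 : ℝ) < q.totient := by exact_mod_cast Nat.totient_pos.2 hq
  have hφq : (q.totient : ℝ) ≤ q := by exact_mod_cast Nat.totient_le q
  have hAB' : (A : ℝ) ≤ B := by exact_mod_cast hAB
  set S := (Finset.Ioc A B).filter (fun n : ℕ => n ≡ a [MOD q]) with hS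
  set S₁ := (Finset.Ioc A B).filter (fun n : ℕ => n ≡ a [MOD q] ∧
    ∀ p : ℕ, p.Prime → (p : ℝ) ≤ z → ¬ p ∣ n) with hS₁
  set S₂ := (Finset.Ioc A B).filter (fun n : ℕ => IsPrimePow n ∧ (n.minFac : ℝ) ≤ z) with hS₂
  have hlogB : ∀ n ∈ Finset.Ioc A B, Real.log n ≤ 28 * Real.log z := by
    intro n hn
    rw [Finset.mem_Ioc] at hn
    rw [show (28 : ℝ) * Real.log z = Real.log (z ^ 28) by rw [Real.log_pow]; norm_num]
    apply Real.log_le_log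
    · exact_mod_cast (by omega : 0 < n)
    · exact le_trans (by exact_mod_cast hn.2) hB
  have hsplit : ∑ n ∈ S, Λ n ≤ ∑ n ∈ S₁, Λ n + ∑ n ∈ S₂, Λ n := by
    have h0 : ∑ n ∈ S, Λ n = ∑ n ∈ S.filter (fun n => IsPrimePow n), Λ n := by
      symm
      apply Finset.sum_filter_of_ne
      intro n _ h
      by_contra h'
      exact h (ArithmeticFunction.vonMangoldt_eq_zero_iff.2 h')
    rw [h0, ← Finset.sum_union_inter]
    refine le_trans (Finset.sum_le_sum_of_subset_of_nonneg (t := S₁ ∪ S₂) ?_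
      (fun _ _ _ => ArithmeticFunction.vonMangoldt_nonneg)) ?_
    · intro n hn
      simp only [hS, hS₁, hS₂, Finset.mem_filter, Finset.mem_union] at hn ⊢
      by_cases hm : (n.minFac : ℝ) ≤ z
      · exact Or.inr ⟨hn.1.1, hn.2, hm⟩
      · refine Or.inl ⟨hn.1.1, hn.1.2, fun p hp hpz hpn => hm (le_trans ?_ hpz)⟩
        exact_mod_cast Nat.minFac_le_of_dvd hp.two_le hpn
    · exact le_add_of_nonneg_right
        (Finset.sum_nonneg fun _ _ => ArithmeticFunction.vonMangoldt_nonneg)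
  have h1 : ∑ n ∈ S₁, Λ n ≤ S₁.card * (28 * Real.log z) := by
    rw [← nsmul_eq_mul]
    apply Finset.sum_le_card_nsmul
    intro n hn
    rw [hS₁, Finset.mem_filter] at hn
    exact ArithmeticFunction.vonMangoldt_le_log.trans (hlogB n hn.1)
  have h1' := card_rough_ap_le q a A B hq hAB z (by linarith)
  have h2 : ∑ n ∈ S₂, Λ n ≤ S₂.card * Real.log z := by
    rw [← nsmul_eq_mul]
    apply Finset.sum_le_card_nsmul
    intro n hn
    rw [hS₂, Finset.mem_filter] at hn
    rw [ArithmeticFunction.vonMangoldt_apply, if_pos hn.2.1]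
    apply Real.log_le_log _ hn.2.2
    exact_mod_cast n.minFac_pos
  have h2' : (S₂.card : ℝ) ≤ (z + 1) * (28 * (2 * z) + 1) := by
    have hc : S₂.card ≤ ((Finset.range (⌊z⌋₊ + 1)) ×ˢ
        (Finset.range (⌊28 * (2 * Real.log z)⌋₊ + 1))).card := by
      refine Finset.card_le_card_of_injOn (fun n => (n.minFac, n.factorization n.minFac)) ?_ ?_
      · intro n hn
        rw [Finset.mem_coe, hS₂, Finset.mem_filter] at hn
        simp only [Finset.coe_product, Finset.coe_range, Set.mem_prod, Set.mem_Iio]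
        refine ⟨Nat.lt_succ_of_le (Nat.le_floor hn.2.2), Nat.lt_succ_of_le (Nat.le_floor ?_)⟩
        have e1 := hlogB n hn.1
        have e2 : (n.minFac) ^ (n.factorization n.minFac) = n := hn.2.1.minFac_pow_factorization_eq
        have e3 : Real.log n = (n.factorization n.minFac) * Real.log n.minFac := by
          conv_lhs => rw [← e2]
          push_cast
          rw [Real.log_pow]
        have e4 : Real.log 2 ≤ Real.log n.minFac := by
          apply Real.log_le_log (by norm_num)
          exact_mod_cast (Nat.minFac_prime hn.2.1.ne_one).two_le
        have e5 : (n.factorization n.minFac : ℝ) * Real.log 2 ≤ 28 * Real.log z := by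
          rw [e3] at e1
          refine le_trans ?_ e1
          gcongr
        have := Real.log_two_gt_d9
        nlinarith [(Nat.cast_nonneg (n.factorization n.minFac) : (0 : ℝ) ≤ _)]
      · intro n hn m hm h
        rw [Finset.mem_coe, hS₂, Finset.mem_filter] at hn hm
        simp only [Prod.mk.injEq] at h
        rw [← hn.2.1.minFac_pow_factorization_eq, ← hm.2.1.minFac_pow_factorization_eq, h.2, h.1]
    rw [Finset.card_product, Finset.card_range, Finset.card_range] at hc
    calc (S₂.card : ℝ) ≤ ((⌊z⌋₊ + 1) * (⌊28 * (2 * Real.log z)⌋₊ + 1) : ℕ) := by exact_mod_cast hc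
      _ ≤ (z + 1) * (28 * (2 * z) + 1) := by
        push_cast
        gcongr
        · exact Nat.floor_le (by linarith)
        · refine (Nat.floor_le (by positivity)).trans ?_
          have := Real.log_le_sub_one_of_pos (by linarith : 0 < z)
          linarith
  have hlz' : Real.log z ≤ z := by
    have := Real.log_le_sub_one_of_pos (by linarith : 0 < z)
    linarith
  have hH' : z ^ 7 ≤ ((B : ℝ) - A) / q.totient := by
    rw [le_div_iff₀ hφ]
    calc z ^ 7 * q.totient ≤ z ^ 7 * q := by gcongr
      _ ≤ _ := by linarith
  have k1 : S₁.card * (28 * Real.log z) ≤ 28 * (((B : ℝ) - A) / q.totient) + 28 * z ^ 5 := by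
    have : (S₁.card : ℝ) * (28 * Real.log z) ≤
      (((B : ℝ) - A) / (q.totient * Real.log z) + z ^ 4) * (28 * Real.log z) := by gcongr
    refine this.trans ?_
    have e : (((B : ℝ) - A) / (q.totient * Real.log z) + z ^ 4) * (28 * Real.log z)
      = 28 * (((B : ℝ) - A) / q.totient) + 28 * (z ^ 4 * Real.log z) := by field_simp
    rw [e]
    have : z ^ 4 * Real.log z ≤ z ^ 4 * z := by gcongr
    nlinarith
  have k2 : S₂.card * Real.log z ≤ (2 * z) * (57 * z) * z := by
    have : (0:ℝ) ≤ 28 * (2 * z) + 1 := by linarith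
    calc (S₂.card : ℝ) * Real.log z ≤ ((z + 1) * (28 * (2 * z) + 1)) * z := by gcongr
      _ ≤ _ := by gcongr <;> linarith
  have k3 : z ^ 5 * 4 ≤ z ^ 7 := by
    have : z ^ 7 = z ^ 5 * z ^ 2 := by ring
    rw [this]; gcongr; nlinarith
  have k4 : z ^ 3 * 16 ≤ z ^ 7 := by
    have : z ^ 7 = z ^ 3 * (z ^ 2 * z ^ 2) := by ring
    have h4 : 4 ≤ z ^ 2 := by nlinarith
    rw [this]; gcongr; nlinarith
  nlinarith

/-- The largest `w`-smooth divisor of `n`. -/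
def smoothPart (w : ℝ) (n : ℕ) : ℕ :=
  ∏ p ∈ n.primeFactors.filter (fun p : ℕ => (p : ℝ) ≤ w), p ^ n.factorization p

lemma smoothPart_dvd (w : ℝ) {n : ℕ} (hn : n ≠ 0) : smoothPart w n ∣ n := by
  conv_rhs => rw [← Nat.prod_factorization_pow_eq_self hn]
  exact Finset.prod_dvd_prod_of_subset _ _ _ (Finset.filter_subset _ _)

lemma smoothPart_dvd_smoothPart {w w' : ℝ} (h : w ≤ w') (n : ℕ) :
    smoothPart w n ∣ smoothPart w' n := by
  apply Finset.prod_dvd_prod_of_subset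
  intro p hp
  simp only [Finset.mem_filter] at hp ⊢
  exact ⟨hp.1, hp.2.trans h⟩

lemma smoothPart_ne_zero (w : ℝ) (n : ℕ) : smoothPart w n ≠ 0 := by
  apply Finset.prod_ne_zero_iff.2
  intro p hp
  simp only [Finset.mem_filter] at hp
  exact pow_ne_zero _ (Nat.prime_of_mem_primeFactors hp.1).ne_zero

lemma smooth_smoothPart (w : ℝ) (n : ℕ) : Smooth w (smoothPart w n) := by
  refine ⟨smoothPart_ne_zero w n, fun p hp hd => ?_⟩
  obtain ⟨r, hr, hpr⟩ := (Prime.dvd_finsetProd_iff hp.prime _).1 hd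
  simp only [Finset.mem_filter] at hr
  have := (Nat.prime_dvd_prime_iff_eq hp (Nat.prime_of_mem_primeFactors hr.1)).1
    (hp.dvd_of_dvd_pow hpr)
  rw [this]; exact hr.2

lemma Smooth.of_dvd {w : ℝ} {m n : ℕ} (h : Smooth w n) (hd : m ∣ n) : Smooth w m :=
  ⟨fun h0 => h.1 (by rw [h0] at hd; exact zero_dvd_iff.1 hd), fun p hp hpm => h.2 p hp (hpm.trans hd)⟩

lemma Smooth.mono {w w' : ℝ} {n : ℕ} (h : Smooth w n) (hw : w ≤ w') : Smooth w' n :=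
  ⟨h.1, fun p hp hd => (h.2 p hp hd).trans hw⟩

lemma rough_div_of_smoothPart_dvd {w : ℝ} {n b : ℕ} (hn : n ≠ 0) (h : smoothPart w n ∣ b)
    (hb : b ∣ n) : Rough w (n / b) := by
  intro p hp hpw hd
  have h1 : p * smoothPart w n ∣ n := by
    calc p * smoothPart w n ∣ (n / b) * b := mul_dvd_mul hd h
      _ = n := Nat.div_mul_cancel hb
  have hpn : p ∣ n := (dvd_mul_right _ _).trans h1
  have h2 : p ^ n.factorization p ∣ smoothPart w n := by
    apply Finset.dvd_prod_of_mem (fun p => p ^ n.factorization p)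
    simp only [Finset.mem_filter]
    exact ⟨Nat.mem_primeFactors.2 ⟨hp, hpn, hn⟩, hpw⟩
  have h3 : p ^ (n.factorization p + 1) ∣ n := by
    rw [pow_succ, mul_comm]
    exact (mul_dvd_mul_left p h2).trans h1
  exact Nat.pow_succ_factorization_not_dvd hn hp h3

lemma exists_intermediate_divisor {m M : ℕ} {z w : ℝ} (hM : Smooth w M) (hmM : m ∣ M)
    (hm : (m : ℝ) ≤ z) (hz : z < M) :
    ∃ b, m ∣ b ∧ b ∣ M ∧ z < b ∧ (b : ℝ) ≤ z * w := by
  have hex : ∃ b, m ∣ b ∧ b ∣ M ∧ z < b := ⟨M, hmM, dvd_rfl, hz⟩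
  obtain ⟨h1, h2, h3⟩ := Nat.find_spec hex
  set b := Nat.find hex
  refine ⟨b, h1, h2, h3, ?_⟩
  have hb0 : b ≠ 0 := (hM.of_dvd h2).1
  obtain ⟨c, hc⟩ := h1
  have hc1 : c ≠ 1 := by
    rintro rfl
    rw [mul_one] at hc
    rw [hc] at h3
    linarith
  obtain ⟨p, hp, hpc⟩ := Nat.exists_prime_and_dvd hc1
  obtain ⟨e, rfl⟩ := hpc
  have hpw : (p : ℝ) ≤ w := hM.2 p hp (((dvd_mul_right p e).trans ⟨m, by rw [hc]; ring⟩).trans h2)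
  have hlt : m * e < b := by
    rw [hc]
    have : m * e ≠ 0 := by
      intro h0
      apply hb0; rw [hc, show m * (p * e) = p * (m * e) by ring, h0, mul_zero]
    calc m * e < p * (m * e) := by
          have := hp.two_le
          nlinarith [Nat.pos_of_ne_zero ‹m * e ≠ 0›]
      _ = _ := by ring
  have h4 := Nat.find_min hex hlt
  have h5 : ((m * e : ℕ) : ℝ) ≤ z := by
    by_contra hcon
    exact h4 ⟨dvd_mul_right _ _, (Dvd.intro p (by rw [hc]; ring) : m * e ∣ b).trans h2, not_le.1 hcon⟩
  have hz0 : 0 ≤ z := le_trans (Nat.cast_nonneg _) h5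
  calc (b : ℝ) = ((m * e : ℕ) : ℝ) * p := by rw [hc]; push_cast; ring
    _ ≤ z * w := by gcongr

lemma divMaj_one_left (n : ℕ) : divMaj 1 n = 1 := by
  have : ∀ k, divCoeff 1 k = 1 := by
    intro k
    induction k with
    | zero => rfl
    | succ k ih =>
      rw [divCoeff_succ, ih, one_mul, add_comm]
      exact div_self (by positivity)
  simp [divMaj, this]

lemma sum_divMaj_piece_le {κ : ℝ} {q a A B : ℕ} (hq : 1 ≤ q) (ha : Nat.Coprime a q)
    (hAB : A ≤ B) {R : ℝ} (hR : 1 < R) {T 𝔅 : Finset ℕ} {G : ℕ → ℝ}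
    (hTS : T ⊆ (Finset.Ioc A B).filter (fun n : ℕ => n ≡ a [MOD q]))
    (hG : ∀ b ∈ 𝔅, 0 ≤ G b)
    (hT : ∀ n ∈ T, ∃ b ∈ 𝔅, b ∣ n ∧ Rough R (n / b) ∧ divMaj κ n ≤ G b)
    (h𝔅 : ∀ b ∈ 𝔅, b ≠ 0 ∧ (b : ℝ) * R ^ 4 * R * q ≤ (B : ℝ) - A) :
    ∑ n ∈ T, divMaj κ n ≤
      3 * ((B : ℝ) - A) / (q.totient * Real.log R) * ∑ b ∈ 𝔅, G b * (b : ℝ)⁻¹ := by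
  set P : ℕ → ℕ → Prop := fun b n => b ∣ n ∧ Rough R (n / b)
  calc ∑ n ∈ T, divMaj κ n ≤ ∑ n ∈ T, ∑ b ∈ 𝔅, if P b n then G b else 0 := by
        apply Finset.sum_le_sum
        intro n hn
        obtain ⟨b, hb, h1, h2, h3⟩ := hT n hn
        refine h3.trans ?_
        refine le_trans ?_ (Finset.single_le_sum (f := fun b => if P b n then G b else 0) ?_ hb)
        · simp only [P]; rw [if_pos ⟨h1, h2⟩]
        · intro b' hb'
          split_ifs
          · exact hG b' hb'
          · exact le_rfl
    _ = ∑ b ∈ 𝔅, ((T.filter (P b)).card : ℝ) * G b := by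
        rw [Finset.sum_comm]
        apply Finset.sum_congr rfl
        intro b _
        rw [← Finset.sum_filter, Finset.sum_const, nsmul_eq_mul]
    _ ≤ ∑ b ∈ 𝔅, (3 * ((B : ℝ) - A) / (q.totient * Real.log R) * (b : ℝ)⁻¹) * G b := by
        apply Finset.sum_le_sum
        intro b hb
        apply mul_le_mul_of_nonneg_right _ (hG b hb)
        refine le_trans ?_ (card_mul_rough_le hq ha hAB (h𝔅 b hb).1 hR (h𝔅 b hb).2)
        norm_cast
        apply Finset.card_le_card
        intro n hn
        rw [Finset.mem_filter] at hn
        have := hTS hn.1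
        rw [Finset.mem_filter] at this ⊢
        exact ⟨this.1, this.2, hn.2.1, hn.2.2⟩
    _ = _ := by
        rw [Finset.mul_sum]
        apply Finset.sum_congr rfl
        intro b _
        ring

lemma sum_inv_smooth_tail_le {κ : ℝ} (hκ : 0 < κ) {C w β z : ℝ} (hz : 0 < z) (hβ : 0 ≤ β)
    {𝔅 : Finset ℕ} (h𝔅 : ∀ b ∈ 𝔅, z < b)
    (hC : ∑ b ∈ 𝔅, divMaj κ b * (b : ℝ) ^ (β - 1) ≤ C * Real.log w ^ κ) :
    ∑ b ∈ 𝔅, divMaj κ b * (b : ℝ)⁻¹ ≤ z ^ (-β) * (C * Real.log w ^ κ) := by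
  calc ∑ b ∈ 𝔅, divMaj κ b * (b : ℝ)⁻¹
      ≤ ∑ b ∈ 𝔅, z ^ (-β) * (divMaj κ b * (b : ℝ) ^ (β - 1)) := by
        apply Finset.sum_le_sum
        intro b hb
        have hzb := h𝔅 b hb
        have hb0 : (0 : ℝ) < b := hz.trans hzb
        have h1 : z ^ β ≤ (b : ℝ) ^ β := Real.rpow_le_rpow hz.le hzb.le hβ
        have h2 : 1 ≤ z ^ (-β) * (b : ℝ) ^ β := by
          rw [Real.rpow_neg hz.le, ← div_eq_inv_mul, le_div_iff₀ (by positivity), one_mul]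
          exact h1
        have h3 := divMaj_pos hκ b
        rw [Real.rpow_sub hb0, Real.rpow_one]
        calc divMaj κ b * (b : ℝ)⁻¹ = 1 * (divMaj κ b * (b : ℝ)⁻¹) := by ring
          _ ≤ (z ^ (-β) * (b : ℝ) ^ β) * (divMaj κ b * (b : ℝ)⁻¹) := by gcongr
          _ = _ := by field_simp
    _ = z ^ (-β) * ∑ b ∈ 𝔅, divMaj κ b * (b : ℝ) ^ (β - 1) := by rw [Finset.mul_sum]
    _ ≤ _ := by gcongr

lemma two_pow_mul_exp_neg_le (x : ℝ) (hx : 0 < x) : x * Real.exp (-x) ≤ 2 / x := by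
  have h := Real.quadratic_le_exp_of_nonneg hx.le
  rw [Real.exp_neg, ← div_eq_mul_inv, div_le_div_iff₀ (Real.exp_pos x) hx]
  nlinarith

set_option maxHeartbeats 2000000 in
/-- Shiu's Brun–Titchmarsh theorem for `d_κ` in short intervals and progressions. -/
theorem shiu {κ : ℝ} (hκ : 0 < κ) : ∃ C z₀ : ℝ, 0 < C ∧ 3 ≤ z₀ ∧ ∀ z, z₀ ≤ z →
    ∀ q a A B : ℕ, 1 ≤ q → Nat.Coprime a q → A ≤ B → (B : ℝ) ≤ z ^ 28 →
    (q : ℝ) * z ^ 7 ≤ (B : ℝ) - A →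
    ∑ n ∈ (Finset.Ioc A B).filter (fun n : ℕ => n ≡ a [MOD q]), divMaj κ n
      ≤ C * (((B : ℝ) - A) / q.totient) * Real.log z ^ (κ - 1) := by
  set κ' := max κ 1 with hκ'
  have hκ'1 : 1 ≤ κ' := le_max_right _ _
  have hlκ' : 0 ≤ Real.log κ' := Real.log_nonneg hκ'1
  set K := 28 * Real.log κ' + 1 with hK
  have hK1 : 1 ≤ K := by linarith
  obtain ⟨C₁, hC₁1, hC₁⟩ := rankin_bound hκ (c₀ := 2 * K)
  obtain ⟨C₂, hC₂1, hC₂⟩ := rankin_bound one_pos (c₀ := 2 * K)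
  obtain ⟨C₃, hC₃1, hC₃⟩ := exists_divMaj_le_rpow hκ (ε := 1 / 448) (by norm_num)
  refine ⟨3 * (C₁ * κ' ^ (28 : ℝ)) + 12 * C₁ + 3 / Real.log (3 / 2) * (C₃ * (C₂ * (8 * K) * (16 / 3))),
    max 3 (Real.exp (4 * K)), ?_, le_max_left _ _, ?_⟩
  · have : 0 < Real.log (3 / 2 : ℝ) := Real.log_pos (by norm_num)
    positivity
  intro z hz q a A B hq ha hAB hB hH
  have hz3 : 3 ≤ z := (le_max_left _ _).trans hz
  have hz0 : 0 < z := by linarith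
  have hzK : Real.exp (4 * K) ≤ z := (le_max_right _ _).trans hz
  set L := Real.log z with hL
  have hLK : 4 * K ≤ L := by
    rw [hL, Real.le_log_iff_exp_le hz0]; exact hzK
  have hL0 : 0 < L := by linarith
  have hφ : (0 : ℝ) < q.totient := by exact_mod_cast Nat.totient_pos.2 hq
  have hq1 : (1 : ℝ) ≤ q := by exact_mod_cast hq
  set H := (B : ℝ) - A with hHdef
  have hH0 : 0 < H := lt_of_lt_of_le (by positivity) hH
  have hzL : z = Real.exp L := (Real.exp_log hz0).symm
  obtain ⟨J₀, hJ1, hJ2⟩ := exists_nat_pow_near (x := L / (4 * K)) (y := 2)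
    (by rw [le_div_iff₀ (by linarith)]; linarith) (by norm_num)
  rw [le_div_iff₀ (by linarith)] at hJ1
  rw [div_lt_iff₀ (by linarith)] at hJ2
  set R : ℕ → ℝ := fun j => Real.exp (L / 2 ^ j) with hR
  have hlogR : ∀ j, Real.log (R j) = L / 2 ^ j := fun j => Real.log_exp _
  have hR1 : ∀ j, 1 < R j := fun j => Real.one_lt_exp_iff.2 (by positivity)
  have hRz : ∀ j, R j ≤ z := by
    intro j
    rw [hzL]; apply Real.exp_le_exp.2
    apply div_le_self hL0.le
    exact one_le_pow₀ (by norm_num)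
  have hRmono : ∀ j, R (j + 1) ≤ R j := by
    intro j
    apply Real.exp_le_exp.2
    apply div_le_div_of_nonneg_left hL0.le (by positivity)
    rw [pow_succ]; nlinarith [pow_pos (two_pos (α := ℝ)) j]
  set S := (Finset.Ioc A B).filter (fun n : ℕ => n ≡ a [MOD q]) with hS
  have hS0 : ∀ n ∈ S, n ≠ 0 ∧ (n : ℝ) ≤ z ^ 28 := by
    intro n hn
    rw [hS, Finset.mem_filter, Finset.mem_Ioc] at hn
    exact ⟨by omega, le_trans (by exact_mod_cast hn.1.2) hB⟩
  -- the sifting condition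
  have hsift : ∀ b : ℕ, ∀ R : ℝ, 1 < R → R ≤ z → (b : ℝ) ≤ z ^ 2 → (b : ℝ) * R ^ 4 * R * q ≤ H := by
    intro b R h1 h2 h3
    refine le_trans ?_ hH
    calc (b : ℝ) * R ^ 4 * R * q ≤ z ^ 2 * z ^ 4 * z * q := by gcongr
      _ = _ := by ring
  have hbound : ∀ n ∈ S, ∀ b j, b ≠ 0 → b ∣ n → Rough (R j) (n / b) →
      divMaj κ n ≤ divMaj κ b * κ' ^ ((28 : ℝ) * 2 ^ j) := by
    intro n hn b j hb hbn hr
    obtain ⟨hn0, hnz⟩ := hS0 n hn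
    have h1 := hr.divMaj_mul_le hκ (hR1 j) hb (Nat.div_pos (Nat.le_of_dvd (Nat.pos_of_ne_zero hn0) hbn)
      (Nat.pos_of_ne_zero hb)).ne' (Y := z ^ 28) (le_trans (by exact_mod_cast Nat.div_le_self n b) hnz)
    rw [Nat.mul_div_cancel' hbn, Real.log_pow, hlogR] at h1
    convert! h1 using 3
    push_cast
    rw [← hL]
    field_simp
  have hG0 : ∀ (b j : ℕ), 0 ≤ divMaj κ b * κ' ^ ((28 : ℝ) * 2 ^ j) := fun b j => by
    have := divMaj_pos hκ b
    positivity
  set P : ℝ := H / q.totient * L ^ (κ - 1) with hP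
  have hP0 : 0 < P := by positivity
  have hLκ : L ^ κ = L ^ (κ - 1) * L := by
    rw [Real.rpow_sub hL0, Real.rpow_one]; field_simp
  -- smooth part small
  have piece0 : ∑ n ∈ S.filter (fun n => (smoothPart (R 0) n : ℝ) ≤ z), divMaj κ n
      ≤ 3 * (C₁ * κ' ^ (28 : ℝ)) * P := by
    set 𝔅 := (Finset.Icc 1 ⌊z⌋₊).filter (Smooth z)
    have h1 := sum_divMaj_piece_le (κ := κ) hq ha hAB (hR1 0)
      (T := S.filter (fun n => (smoothPart (R 0) n : ℝ) ≤ z)) (𝔅 := 𝔅)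
      (G := fun b => divMaj κ b * κ' ^ ((28 : ℝ) * 2 ^ 0)) (Finset.filter_subset _ _)
      (fun b _ => hG0 b 0) ?_ ?_
    · refine h1.trans ?_
      have h2 := hC₁ z (by linarith) 0 le_rfl (by norm_num) (by linarith) 𝔅
        (fun b hb => (Finset.mem_filter.1 hb).2)
      have h3 : ∑ b ∈ 𝔅, divMaj κ b * κ' ^ ((28 : ℝ) * 2 ^ 0) * (b : ℝ)⁻¹
          ≤ κ' ^ (28 : ℝ) * (C₁ * L ^ κ) := by
        refine le_trans (le_of_eq ?_) (mul_le_mul_of_nonneg_left h2 (by positivity))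
        rw [Finset.mul_sum]
        apply Finset.sum_congr rfl
        intro b _
        rw [pow_zero, mul_one, zero_sub, Real.rpow_neg_one]; ring
      rw [hlogR]
      calc _ ≤ 3 * H / (q.totient * (L / 2 ^ 0)) * (κ' ^ (28 : ℝ) * (C₁ * L ^ κ)) := by gcongr
        _ = _ := by rw [hLκ, hP]; field_simp
    · intro n hn
      rw [Finset.mem_filter] at hn
      obtain ⟨hn0, hnz⟩ := hS0 n hn.1
      refine ⟨smoothPart (R 0) n, ?_, smoothPart_dvd _ hn0,
        rough_div_of_smoothPart_dvd hn0 dvd_rfl (smoothPart_dvd _ hn0),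
        hbound n hn.1 _ 0 (smoothPart_ne_zero _ _) (smoothPart_dvd _ hn0)
          (rough_div_of_smoothPart_dvd hn0 dvd_rfl (smoothPart_dvd _ hn0))⟩
      rw [Finset.mem_filter, Finset.mem_Icc]
      exact ⟨⟨Nat.pos_of_ne_zero (smoothPart_ne_zero _ _), Nat.le_floor hn.2⟩,
        (smooth_smoothPart _ _).mono (hRz 0)⟩
    · intro b hb
      rw [Finset.mem_filter, Finset.mem_Icc] at hb
      refine ⟨by omega, hsift b _ (hR1 0) (hRz 0) ?_⟩
      have : (b : ℝ) ≤ z := (Nat.le_floor_iff hz0.le).1 hb.1.2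
      nlinarith
  have piece : ∀ j < J₀, ∑ n ∈ S.filter (fun n => (smoothPart (R (j + 1)) n : ℝ) ≤ z ∧
      z < smoothPart (R j) n), divMaj κ n ≤ 6 * C₁ * P * (1 / 2) ^ j := by
    intro j hj
    set 𝔅 := (Finset.Icc 1 ⌊z ^ 2⌋₊).filter (fun b : ℕ => Smooth (R j) b ∧ z < b) with h𝔅
    have h2j : (0 : ℝ) < 2 ^ j := by positivity
    have hjJ : (2 : ℝ) ^ (j + 1) * (4 * K) ≤ L := by
      refine le_trans ?_ hJ1
      gcongr
      · norm_num
      · exact hj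
    have h1 := sum_divMaj_piece_le (κ := κ) hq ha hAB (hR1 (j + 1))
      (T := S.filter (fun n => (smoothPart (R (j + 1)) n : ℝ) ≤ z ∧
      z < smoothPart (R j) n)) (𝔅 := 𝔅)
      (G := fun b => divMaj κ b * κ' ^ ((28 : ℝ) * 2 ^ (j + 1))) (Finset.filter_subset _ _)
      (fun b _ => hG0 b _) ?_ ?_
    · refine h1.trans ?_
      set β := K * 2 ^ (j + 1) / L with hβ
      have hβL : β * L = K * 2 ^ (j + 1) := by rw [hβ]; field_simp
      have h2 := hC₁ (R j) ?_ β (by positivity) ?_ ?_ 𝔅 (fun b hb => (Finset.mem_filter.1 hb).2.1)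
      · have h3 := sum_inv_smooth_tail_le hκ hz0 (by positivity : 0 ≤ β)
          (fun b hb => (Finset.mem_filter.1 hb).2.2) h2
        have h4 : z ^ (-β) = Real.exp (-(K * 2 ^ (j + 1))) := by
          rw [Real.rpow_def_of_pos hz0, ← hL, ← hβL]; ring_nf
        have h5 : κ' ^ ((28 : ℝ) * 2 ^ (j + 1)) * Real.exp (-(K * 2 ^ (j + 1)))
            = Real.exp (-2 ^ (j + 1)) := by
          rw [Real.rpow_def_of_pos (by linarith), ← Real.exp_add, hK]; ring_nf
        have h6 : (Real.log (R j)) ^ κ ≤ L ^ κ := by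
          rw [hlogR]
          apply Real.rpow_le_rpow (by positivity) _ hκ.le
          exact div_le_self hL0.le (one_le_pow₀ (by norm_num))
        have h7 : ∑ b ∈ 𝔅, divMaj κ b * κ' ^ ((28 : ℝ) * 2 ^ (j + 1)) * (b : ℝ)⁻¹
          ≤ Real.exp (-2 ^ (j + 1)) * (C₁ * L ^ κ) := by
          calc _ = κ' ^ ((28 : ℝ) * 2 ^ (j + 1)) * ∑ b ∈ 𝔅, divMaj κ b * (b : ℝ)⁻¹ := by
                rw [Finset.mul_sum]
                apply Finset.sum_congr rfl
                intro b _; ring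
            _ ≤ κ' ^ ((28 : ℝ) * 2 ^ (j + 1)) * (Real.exp (-(K * 2 ^ (j + 1))) * (C₁ * L ^ κ)) := by
                rw [h4] at h3
                refine mul_le_mul_of_nonneg_left (h3.trans ?_) (by positivity)
                gcongr
            _ = _ := by rw [← mul_assoc, h5]
        rw [hlogR]
        have h8 := two_pow_mul_exp_neg_le (2 ^ (j + 1)) (by positivity)
        calc _ ≤ 3 * H / (q.totient * (L / 2 ^ (j + 1))) * (Real.exp (-2 ^ (j + 1)) * (C₁ * L ^ κ)) := by
              gcongr
          _ = 3 * C₁ * P * (2 ^ (j + 1) * Real.exp (-2 ^ (j + 1))) := by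
              rw [hLκ, hP]; field_simp
          _ ≤ 3 * C₁ * P * (2 / 2 ^ (j + 1)) := by gcongr
          _ ≤ 6 * C₁ * P * (1 / 2) ^ j := by
              have e : (2 : ℝ) / 2 ^ (j + 1) = (1 / 2) ^ j := by
                rw [pow_succ, one_div, inv_pow]; field_simp
              rw [e]
              have : 0 < C₁ * P * (1 / 2) ^ j := by positivity
              nlinarith
      · have : Real.exp 1 ≤ R j := by
          apply Real.exp_le_exp.2
          rw [le_div_iff₀ h2j]
          rw [pow_succ] at hjJ
          nlinarith
        linarith [Real.add_one_le_exp 1]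
      · rw [hβ, div_le_iff₀ hL0]; linarith
      · rw [hlogR, ← mul_div_assoc, hβL, pow_succ]
        apply le_of_eq; field_simp
    · intro n hn
      rw [Finset.mem_filter] at hn
      obtain ⟨hn0, hnz⟩ := hS0 n hn.1
      obtain ⟨b, hb1, hb2, hb3, hb4⟩ := exists_intermediate_divisor (smooth_smoothPart (R j) n)
        (smoothPart_dvd_smoothPart (hRmono j) n) hn.2.1 hn.2.2
      have hbn : b ∣ n := hb2.trans (smoothPart_dvd _ hn0)
      have hb0 : b ≠ 0 := fun h => hn0 (by rw [h] at hbn; exact zero_dvd_iff.1 hbn)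
      have hr := rough_div_of_smoothPart_dvd hn0 hb1 hbn
      refine ⟨b, ?_, hbn, hr, hbound n hn.1 _ _ hb0 hbn hr⟩
      rw [h𝔅, Finset.mem_filter, Finset.mem_Icc]
      refine ⟨⟨Nat.pos_of_ne_zero hb0, Nat.le_floor ?_⟩, (smooth_smoothPart _ _).of_dvd hb2, hb3⟩
      refine hb4.trans ?_
      rw [pow_two]
      have := hRz j
      gcongr
    · intro b hb
      rw [h𝔅, Finset.mem_filter, Finset.mem_Icc] at hb
      refine ⟨by omega, hsift b _ (hR1 _) (hRz _) ?_⟩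
      exact (Nat.le_floor_iff (by positivity)).1 hb.1.2
  have pieceLast : ∑ n ∈ S.filter (fun n => z < smoothPart (R J₀) n), divMaj κ n
      ≤ 3 / Real.log (3 / 2) * (C₃ * (C₂ * (8 * K) * (16 / 3))) * P := by
    set 𝔅 := (Finset.Icc 1 ⌊z ^ 2⌋₊).filter (fun b : ℕ => Smooth (R J₀) b ∧ z < b) with h𝔅
    have h1 := sum_divMaj_piece_le (κ := κ) hq ha hAB (R := 3 / 2) (by norm_num)
      (T := S.filter (fun n => z < smoothPart (R J₀) n)) (𝔅 := 𝔅)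
      (G := fun _ => C₃ * z ^ (1 / 16 : ℝ)) (Finset.filter_subset _ _)
      (fun b _ => by positivity) ?_ ?_
    · refine h1.trans ?_
      have hlR : Real.log (R J₀) ≤ 8 * K := by
        rw [hlogR, div_le_iff₀ (by positivity)]
        rw [pow_succ] at hJ2
        linarith
      have hlR' : 4 * K ≤ Real.log (R J₀) := by
        rw [hlogR, le_div_iff₀ (by positivity)]
        linarith
      have hl0 : 0 ≤ Real.log (R J₀) := by linarith
      have h2 := hC₂ (R J₀) ?_ (1 / 4) (by norm_num) le_rfl (by linarith) 𝔅
        (fun b hb => (Finset.mem_filter.1 hb).2.1)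
      · have h3 := sum_inv_smooth_tail_le one_pos hz0 (by norm_num : (0 : ℝ) ≤ 1 / 4)
          (fun b hb => (Finset.mem_filter.1 hb).2.2) h2
        simp only [divMaj_one_left, one_mul, Real.rpow_one] at h3
        have h32 : 0 < Real.log (3 / 2 : ℝ) := Real.log_pos (by norm_num)
        have h5 : L ≤ 16 / 3 * z ^ (3 / 16 : ℝ) := by
          have := Real.log_le_rpow_div hz0.le (ε := 3 / 16) (by norm_num)
          rw [← hL] at this
          linarith
        have h6 : z ^ (1 / 16 : ℝ) * z ^ (-(1 / 4) : ℝ) ≤ 16 / 3 * L ^ (κ - 1) := by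
          rw [← Real.rpow_add hz0, show (1 / 16 : ℝ) + -(1 / 4) = -(3 / 16) by norm_num,
            Real.rpow_neg hz0.le]
          have h7 : L ^ (-1 : ℝ) ≤ L ^ (κ - 1) :=
            Real.rpow_le_rpow_of_exponent_le (by linarith) (by linarith)
          rw [Real.rpow_neg_one] at h7
          refine le_trans ?_ (mul_le_mul_of_nonneg_left h7 (by norm_num))
          rw [← div_eq_mul_inv, le_div_iff₀ hL0, inv_mul_le_iff₀ (by positivity)]
          linarith
        rw [← Finset.mul_sum]
        calc _ ≤ 3 * H / (q.totient * Real.log (3 / 2)) *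
            (C₃ * z ^ (1 / 16 : ℝ) * (z ^ (-(1 / 4) : ℝ) * (C₂ * (8 * K)))) := by
              gcongr
              refine h3.trans ?_
              gcongr
          _ = 3 * H / (q.totient * Real.log (3 / 2)) * (C₃ * (C₂ * (8 * K))) *
            (z ^ (1 / 16 : ℝ) * z ^ (-(1 / 4) : ℝ)) := by ring
          _ ≤ 3 * H / (q.totient * Real.log (3 / 2)) * (C₃ * (C₂ * (8 * K))) *
            (16 / 3 * L ^ (κ - 1)) := by gcongr
          _ = _ := by rw [hP]; field_simp
      · have : Real.exp 1 ≤ R J₀ := by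
          apply Real.exp_le_exp.2
          rw [← hlogR]
          linarith
        linarith [Real.add_one_le_exp 1]
    · intro n hn
      rw [Finset.mem_filter] at hn
      obtain ⟨hn0, hnz⟩ := hS0 n hn.1
      obtain ⟨b, -, hb2, hb3, hb4⟩ := exists_intermediate_divisor (smooth_smoothPart (R J₀) n)
        (one_dvd _) (by push_cast; linarith) hn.2
      have hbn : b ∣ n := hb2.trans (smoothPart_dvd _ hn0)
      have hb0 : b ≠ 0 := fun h => hn0 (by rw [h] at hbn; exact zero_dvd_iff.1 hbn)
      refine ⟨b, ?_, hbn, ?_, ?_⟩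
      · rw [h𝔅, Finset.mem_filter, Finset.mem_Icc]
        refine ⟨⟨Nat.pos_of_ne_zero hb0, Nat.le_floor ?_⟩, (smooth_smoothPart _ _).of_dvd hb2, hb3⟩
        refine hb4.trans ?_
        rw [pow_two]
        have := hRz J₀
        gcongr
      · intro p hp hp3
        have : (2 : ℝ) ≤ p := by exact_mod_cast hp.two_le
        linarith
      · refine (hC₃ n hn0).trans ?_
        have : (n : ℝ) ^ (1 / 448 : ℝ) ≤ (z ^ 28) ^ (1 / 448 : ℝ) := by gcongr
        rw [← Real.rpow_natCast, ← Real.rpow_mul hz0.le] at this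
        norm_num at this ⊢
        gcongr
    · intro b hb
      rw [h𝔅, Finset.mem_filter, Finset.mem_Icc] at hb
      refine ⟨by omega, hsift b _ (by norm_num) (by linarith) ?_⟩
      exact (Nat.le_floor_iff (by positivity)).1 hb.1.2
  have hg0 : ∀ n, 0 ≤ divMaj κ n := fun n => (divMaj_pos hκ n).le
  have cover : ∀ n ∈ S, divMaj κ n ≤
      (if (smoothPart (R 0) n : ℝ) ≤ z then divMaj κ n else 0) +
      ∑ j ∈ Finset.range J₀, (if (smoothPart (R (j + 1)) n : ℝ) ≤ z ∧ z < smoothPart (R j) n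
        then divMaj κ n else 0) + (if z < smoothPart (R J₀) n then divMaj κ n else 0) := by
    intro n hn
    have key : ∀ i, divMaj κ n ≤
      (if (smoothPart (R 0) n : ℝ) ≤ z then divMaj κ n else 0) +
      ∑ j ∈ Finset.range i, (if (smoothPart (R (j + 1)) n : ℝ) ≤ z ∧ z < smoothPart (R j) n
        then divMaj κ n else 0) + (if z < smoothPart (R i) n then divMaj κ n else 0) := by
      intro i
      induction i with
      | zero =>
        rcases le_or_gt (smoothPart (R 0) n : ℝ) z with h | h
        · simp [h, h.not_gt]
        · simp [h, h.not_ge]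
      | succ i ih =>
        refine ih.trans ?_
        rw [Finset.sum_range_succ]
        have : (if z < smoothPart (R i) n then divMaj κ n else 0) ≤
          (if (smoothPart (R (i + 1)) n : ℝ) ≤ z ∧ z < smoothPart (R i) n
            then divMaj κ n else 0) + (if z < smoothPart (R (i + 1)) n then divMaj κ n else 0) := by
          have := hg0 n
          by_cases h1 : z < (smoothPart (R i) n : ℝ) <;>
            by_cases h2 : z < (smoothPart (R (i + 1)) n : ℝ)
          · simp [h1, h2, h2.not_ge]
          · simp [h1, not_lt.1 h2, h2]
          · simp [h1, h2, this]
          · simp [h1, h2]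
        linarith
    exact key J₀
  calc ∑ n ∈ S, divMaj κ n ≤ _ := Finset.sum_le_sum cover
    _ = ∑ n ∈ S.filter (fun n => (smoothPart (R 0) n : ℝ) ≤ z), divMaj κ n +
        ∑ j ∈ Finset.range J₀, ∑ n ∈ S.filter (fun n => (smoothPart (R (j + 1)) n : ℝ) ≤ z ∧
          z < smoothPart (R j) n), divMaj κ n +
        ∑ n ∈ S.filter (fun n => z < smoothPart (R J₀) n), divMaj κ n := by
      rw [Finset.sum_add_distrib, Finset.sum_add_distrib, Finset.sum_comm]
      simp only [Finset.sum_filter]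
    _ ≤ 3 * (C₁ * κ' ^ (28 : ℝ)) * P + ∑ j ∈ Finset.range J₀, 6 * C₁ * P * (1 / 2) ^ j +
        3 / Real.log (3 / 2) * (C₃ * (C₂ * (8 * K) * (16 / 3))) * P := by
      refine add_le_add (add_le_add piece0 (Finset.sum_le_sum fun j hj => piece j ?_)) pieceLast
      exact Finset.mem_range.1 hj
    _ ≤ 3 * (C₁ * κ' ^ (28 : ℝ)) * P + 12 * C₁ * P +
        3 / Real.log (3 / 2) * (C₃ * (C₂ * (8 * K) * (16 / 3))) * P := by
      gcongr
      rw [← Finset.mul_sum]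
      have := sum_geometric_two_le J₀
      calc _ ≤ 6 * C₁ * P * 2 := by gcongr
        _ = _ := by ring
    _ = _ := by rw [hP]; ring

lemma sum_vonMangoldt_div_interval {a b : ℝ} (ha : 1 ≤ a) (hab : a ≤ b) :
    ∑ n ∈ Finset.Ioc ⌊a⌋₊ ⌊b⌋₊, Λ n / n ≤ Real.log (b / a) + 14 := by
  have h1 := abs_le.1 (abs_mertens ha)
  have h2 := abs_le.1 (abs_mertens (ha.trans hab))
  have h3 : ∑ n ∈ Finset.Icc 1 ⌊b⌋₊, Λ n / (n : ℝ) = ∑ n ∈ Finset.Icc 1 ⌊a⌋₊, Λ n / (n : ℝ)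
      + ∑ n ∈ Finset.Ioc ⌊a⌋₊ ⌊b⌋₊, Λ n / n := by
    have hfl : ⌊a⌋₊ ≤ ⌊b⌋₊ := Nat.floor_mono hab
    rw [← Finset.sum_union]
    · congr 1
      ext n
      simp only [Finset.mem_union, Finset.mem_Icc, Finset.mem_Ioc]
      omega
    · rw [Finset.disjoint_left]
      intro n hn hn'
      simp only [Finset.mem_Icc, Finset.mem_Ioc] at hn hn'
      omega
  rw [Real.log_div (by linarith) (by linarith)]
  linarith

lemma sum_tail_rpow_le {y σ : ℝ} (hy : 1 ≤ y) (hσ : 0 < σ) (T : Finset ℕ)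
    (hT : ∀ n ∈ T, y < n) :
    ∑ n ∈ T, Λ n / n * (n : ℝ) ^ (-σ) ≤ 2 * (1 / σ + 14) * y ^ (-σ) := by
  have hy0 : 0 < y := by linarith
  set k : ℕ → ℕ := fun n => ⌈σ * Real.log (n / y)⌉₊ - 1 with hk
  obtain ⟨K, hK⟩ : ∃ K, ∀ n ∈ T, k n < K := by
    refine ⟨(T.image k).sup id + 1, fun n hn => Nat.lt_succ_of_le ?_⟩
    exact Finset.le_sup (f := id) (Finset.mem_image_of_mem k hn)
  have hblock : ∀ j ∈ Finset.range K, ∑ n ∈ T.filter (fun n => k n = j),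
      Λ n / n * (n : ℝ) ^ (-σ) ≤ (1 / σ + 14) * y ^ (-σ) * Real.exp (-1) ^ j := by
    intro j _
    set a := y * Real.exp (j / σ) with ha
    set b := y * Real.exp ((j + 1) / σ) with hb
    have ha1 : 1 ≤ a := by
      have : 1 ≤ Real.exp (j / σ) := Real.one_le_exp (by positivity)
      nlinarith
    have hab : a ≤ b := by
      rw [ha, hb]; gcongr; linarith
    have hn : ∀ n ∈ T.filter (fun n => k n = j), a < n ∧ (n : ℝ) ≤ b := by
      intro n hn
      rw [Finset.mem_filter] at hn
      have hyn := hT n hn.1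
      have hn0 : (0 : ℝ) < n := hy0.trans hyn
      have h0 : 0 < σ * Real.log (n / y) := by
        have : 0 < Real.log (n / y) := Real.log_pos (by rw [lt_div_iff₀ hy0]; linarith)
        positivity
      have h0' : 0 < ⌈σ * Real.log (n / y)⌉₊ := Nat.ceil_pos.2 h0
      have hce : ⌈σ * Real.log (n / y)⌉₊ = j + 1 := by
        have := hn.2
        simp only [hk] at this
        omega
      have h1 := (Nat.ceil_eq_iff (by omega)).1 hce
      rw [Nat.add_sub_cancel] at h1
      push_cast at h1
      have e : (n : ℝ) = y * Real.exp (Real.log (n / y)) := by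
        rw [Real.exp_log (by positivity)]; field_simp
      constructor
      · rw [e, ha]
        gcongr
        rw [div_lt_iff₀ hσ]; linarith
      · rw [e, hb]
        gcongr
        rw [le_div_iff₀ hσ]; linarith
    have hpow : ∀ n ∈ T.filter (fun n => k n = j),
        (n : ℝ) ^ (-σ) ≤ y ^ (-σ) * Real.exp (-1) ^ j := by
      intro n hn'
      have h1 := (hn n hn').1.le
      calc (n : ℝ) ^ (-σ) ≤ a ^ (-σ) :=
            Real.rpow_le_rpow_of_nonpos (by linarith) h1 (by linarith)
        _ = _ := by
            rw [ha, Real.mul_rpow hy0.le (Real.exp_pos _).le, ← Real.exp_mul, ← Real.exp_nat_mul]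
            congr 2; field_simp
    calc ∑ n ∈ T.filter (fun n => k n = j), Λ n / n * (n : ℝ) ^ (-σ)
        ≤ ∑ n ∈ T.filter (fun n => k n = j), Λ n / n * (y ^ (-σ) * Real.exp (-1) ^ j) := by
          apply Finset.sum_le_sum
          intro n hn'
          have := ArithmeticFunction.vonMangoldt_nonneg (n := n)
          have := hpow n hn'
          gcongr
      _ = (∑ n ∈ T.filter (fun n => k n = j), Λ n / n) * (y ^ (-σ) * Real.exp (-1) ^ j) := by
          rw [Finset.sum_mul]
      _ ≤ (1 / σ + 14) * (y ^ (-σ) * Real.exp (-1) ^ j) := by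
          apply mul_le_mul_of_nonneg_right _ (by positivity)
          have h1 := sum_vonMangoldt_div_interval ha1 hab
          have h2 : Real.log (b / a) = 1 / σ := by
            rw [hb, ha, mul_div_mul_left _ _ hy0.ne', ← Real.exp_sub, Real.log_exp]
            field_simp; ring
          rw [h2] at h1
          refine le_trans (Finset.sum_le_sum_of_subset_of_nonneg ?_ ?_) h1
          · intro n hn'
            have := hn n hn'
            rw [Finset.mem_Ioc]
            exact ⟨(Nat.floor_lt (by linarith)).2 this.1, Nat.le_floor this.2⟩
          · intro n _ _
            have := ArithmeticFunction.vonMangoldt_nonneg (n := n)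
            positivity
      _ = _ := by ring
  have hsplit : ∑ n ∈ T, Λ n / n * (n : ℝ) ^ (-σ) = ∑ j ∈ Finset.range K,
      ∑ n ∈ T.filter (fun n => k n = j), Λ n / n * (n : ℝ) ^ (-σ) := by
    rw [Finset.sum_fiberwise_of_maps_to]
    intro n hn
    exact Finset.mem_range.2 (hK n hn)
  rw [hsplit]
  refine (Finset.sum_le_sum hblock).trans ?_
  rw [← Finset.mul_sum]
  have he : Real.exp (-1) ≤ 1 / 2 := by
    rw [Real.exp_neg, one_div]
    apply inv_anti₀ (by norm_num)
    linarith [Real.add_one_le_exp 1]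
  have hgeo : ∑ j ∈ Finset.range K, Real.exp (-1) ^ j ≤ 2 := by
    refine le_trans (Finset.sum_le_sum fun j _ => ?_) (sum_geometric_two_le K)
    gcongr
  calc (1 / σ + 14) * y ^ (-σ) * ∑ j ∈ Finset.range K, Real.exp (-1) ^ j
      ≤ (1 / σ + 14) * y ^ (-σ) * 2 := by gcongr
    _ = _ := by ring

/-- `Λ(n) / log n`, the coefficients of `log ζ`. -/
def logZetaCoeff (n : ℕ) : ℝ := Λ n / Real.log n

lemma logZetaCoeff_nonneg (n : ℕ) : 0 ≤ logZetaCoeff n :=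
  div_nonneg ArithmeticFunction.vonMangoldt_nonneg (Real.log_natCast_nonneg n)

lemma logZetaCoeff_mul_log (n : ℕ) : logZetaCoeff n * Real.log n = Λ n := by
  unfold logZetaCoeff
  rcases eq_or_ne (Real.log n) 0 with h | h
  · rw [h, mul_zero]
    have := ArithmeticFunction.vonMangoldt_le_log (n := n)
    exact le_antisymm ArithmeticFunction.vonMangoldt_nonneg (by rw [← h]; exact this)
  · field_simp

lemma sum_tail_log_of_ge {y σ : ℝ} (hy : Real.exp 1 ≤ y) (hσ : 1 / Real.log y ≤ σ) (T : Finset ℕ)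
    (hT : ∀ n ∈ T, y < n) :
    ∑ n ∈ T, logZetaCoeff n / n * (n : ℝ) ^ (-σ) ≤ 30 := by
  have he := Real.add_one_le_exp 1
  have hy1 : 1 < y := by linarith
  have hly : 1 ≤ Real.log y := (Real.le_log_iff_exp_le (by linarith)).2 hy
  have hσ0 : 0 < σ := lt_of_lt_of_le (by positivity) hσ
  have h1 := sum_tail_rpow_le hy1.le hσ0 T hT
  calc ∑ n ∈ T, logZetaCoeff n / n * (n : ℝ) ^ (-σ)
      ≤ ∑ n ∈ T, 1 / Real.log y * (Λ n / n * (n : ℝ) ^ (-σ)) := by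
        apply Finset.sum_le_sum
        intro n hn
        have hln : Real.log y ≤ Real.log n := Real.log_le_log (by linarith) (hT n hn).le
        have hln0 : 0 < Real.log n := by linarith
        have h0 := ArithmeticFunction.vonMangoldt_nonneg (n := n)
        unfold logZetaCoeff
        rw [show Λ n / Real.log n / n * (n : ℝ) ^ (-σ)
          = 1 / Real.log n * (Λ n / n * (n : ℝ) ^ (-σ)) by field_simp]
        gcongr
    _ = 1 / Real.log y * ∑ n ∈ T, (Λ n / n * (n : ℝ) ^ (-σ)) := by rw [Finset.mul_sum]
    _ ≤ 1 / Real.log y * (2 * (1 / σ + 14) * y ^ (-σ)) := by gcongr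
    _ ≤ 1 / Real.log y * (2 * (1 / σ + 14) * 1) := by
        gcongr
        exact Real.rpow_le_one_of_one_le_of_nonpos hy1.le (by linarith)
    _ ≤ 1 / Real.log y * (2 * (Real.log y + 14 * Real.log y) * 1) := by
        gcongr
        · rw [div_le_iff₀ hσ0]; rw [div_le_iff₀ (by linarith)] at hσ; linarith
        · linarith
    _ = 30 := by field_simp; norm_num

lemma sum_tail_log_of_le {y σ : ℝ} (hy : Real.exp 1 ≤ y) (hσ0 : 0 < σ) (hσ : σ ≤ 1 / Real.log y)
    (T : Finset ℕ) (hT : ∀ n ∈ T, y < n) :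
    ∑ n ∈ T, logZetaCoeff n / n * (n : ℝ) ^ (-σ) ≤ Real.log (1 / (σ * Real.log y)) + 51 := by
  have he := Real.add_one_le_exp 1
  have hy1 : 1 < y := by linarith
  have hly : 1 ≤ Real.log y := (Real.le_log_iff_exp_le (by linarith)).2 hy
  have hσly : σ * Real.log y ≤ 1 := by rwa [le_div_iff₀ (by linarith)] at hσ
  set w := Real.exp (1 / σ) with hw
  have hlw : Real.log w = 1 / σ := Real.log_exp _
  have hyw : y ≤ w := by
    rw [hw, ← Real.log_le_iff_le_exp (by linarith), le_div_iff₀ hσ0]; linarith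
  have h1 := mertens_interval hy1 hyw
  have h2 := sum_tail_log_of_ge (y := w) (hy.trans hyw) (σ := σ) (by rw [hlw]; simp)
    (T.filter (fun n : ℕ => w < n)) (fun n hn => (Finset.mem_filter.1 hn).2)
  rw [← Finset.sum_filter_add_sum_filter_not T (fun n : ℕ => w < n)]
  have h3 : ∑ n ∈ T.filter (fun n : ℕ => ¬ w < n), logZetaCoeff n / n * (n : ℝ) ^ (-σ)
      ≤ ∑ n ∈ Finset.Ioc ⌊y⌋₊ ⌊w⌋₊, Λ n / (n * Real.log n) := by
    refine le_trans (Finset.sum_le_sum (g := fun n : ℕ => Λ n / (n * Real.log n)) ?_)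
      (Finset.sum_le_sum_of_subset_of_nonneg ?_ ?_)
    · intro n hn
      rw [Finset.mem_filter] at hn
      have h0 : (1 : ℝ) ≤ n := by linarith [hT n hn.1]
      have := Real.rpow_le_one_of_one_le_of_nonpos h0 (show -σ ≤ 0 by linarith)
      have hc := logZetaCoeff_nonneg n
      calc logZetaCoeff n / n * (n : ℝ) ^ (-σ) ≤ logZetaCoeff n / n * 1 := by gcongr
        _ = _ := by unfold logZetaCoeff; rw [mul_one, div_div, mul_comm]
    · intro n hn
      rw [Finset.mem_filter] at hn
      rw [Finset.mem_Ioc]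
      exact ⟨(Nat.floor_lt (by linarith)).2 (hT n hn.1), Nat.le_floor (not_lt.1 hn.2)⟩
    · intro n _ _
      have := ArithmeticFunction.vonMangoldt_nonneg (n := n)
      have := Real.log_natCast_nonneg n
      positivity
  rw [hlw] at h1
  have h4 : (1 / σ) / Real.log y = 1 / (σ * Real.log y) := by field_simp
  rw [h4] at h1
  have h5 : 21 / Real.log y ≤ 21 := div_le_self (by norm_num) hly
  linarith

/-- Coefficients `Λ_f(n) / log n` of `log F`. -/
def logCoeff (Λf : ℕ → ℂ) (n : ℕ) : ℂ := Λf n / (Real.log n : ℂ)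

lemma LSeries.convolution_apply_eq (f g : ℕ → ℂ) (n : ℕ) :
    LSeries.convolution f g n = ∑ d ∈ n.divisors, f d * g (n / d) := by
  rw [LSeries.convolution_def]
  exact Nat.sum_divisorsAntidiagonal (fun a b => f a * g b)

lemma IsHalaszClass.twist {κ : ℝ} {f Λf : ℕ → ℂ} (hf : IsHalaszClass κ f Λf) {q : ℕ}
    (ψ : DirichletCharacter ℂ q) :
    IsHalaszClass κ (fun n => f n * ψ (n : ZMod q)) (fun n => Λf n * ψ (n : ZMod q)) where
  map_one := by simp [hf.map_one]
  mult m n h := by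
    simp only [hf.mult m n h, Nat.cast_mul, map_mul]; ring
  supp n hn := by simp [hf.supp n hn]
  bound n hn := by
    rw [norm_mul]
    calc ‖Λf n‖ * ‖ψ (n : ZMod q)‖ ≤ ‖Λf n‖ * 1 := by gcongr; exact ψ.norm_le_one _
      _ ≤ _ := by rw [mul_one]; exact hf.bound n hn
  conv n hn := by
    rw [mul_right_comm, hf.conv n hn, Finset.sum_mul]
    apply Finset.sum_congr rfl
    intro d hd
    have hdn := Nat.dvd_of_mem_divisors hd
    have : (n : ZMod q) = (d : ZMod q) * ((n / d : ℕ) : ZMod q) := by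
      rw [← Nat.cast_mul, Nat.mul_div_cancel' hdn]
    rw [this, map_mul]; ring
  abs_conv σ hσ := by
    refine Summable.of_nonneg_of_le (fun n => by positivity) (fun n => ?_) (hf.abs_conv σ hσ)
    gcongr
    rw [norm_mul]
    exact mul_le_of_le_one_right (norm_nonneg _) (ψ.norm_le_one _)

lemma isHalaszClass_one : IsHalaszClass 1 (fun _ => 1) (fun n => (Λ n : ℂ)) where
  map_one := rfl
  mult := by simp
  supp n hn := by
    simp [ArithmeticFunction.vonMangoldt_eq_zero_iff.2 hn]
  bound n _ := by
    simp [abs_of_nonneg (ArithmeticFunction.vonMangoldt_nonneg (n := n))]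
  conv n _ := by
    rw [← ArithmeticFunction.vonMangoldt_sum]
    push_cast
    simp
  abs_conv σ hσ := by
    simpa using Real.summable_one_div_nat_rpow.2 hσ

lemma IsHalaszClass.abscissa_le {κ : ℝ} {f Λf : ℕ → ℂ} (hf : IsHalaszClass κ f Λf) :
    LSeries.abscissaOfAbsConv f ≤ 1 := by
  apply LSeries.abscissaOfAbsConv_le_of_forall_lt_LSeriesSummable (x := 1)
  intro σ hσ
  unfold LSeriesSummable
  rw [← summable_norm_iff]
  refine Summable.of_nonneg_of_le (fun n => norm_nonneg _) (fun n => ?_) (hf.abs_conv σ hσ)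
  rw [LSeries.norm_term_eq]
  split_ifs with h
  · positivity
  · simp

lemma IsHalaszClass.map_zero' {κ : ℝ} {f Λf : ℕ → ℂ} (hf : IsHalaszClass κ f Λf) : Λf 0 = 0 :=
  hf.supp 0 not_isPrimePow_zero

lemma IsHalaszClass.bound' {κ : ℝ} {f Λf : ℕ → ℂ} (hf : IsHalaszClass κ f Λf) (n : ℕ) :
    ‖Λf n‖ ≤ κ * Λ n := by
  rcases Nat.eq_zero_or_pos n with rfl | h
  · simp [hf.map_zero']
  · exact hf.bound n h

lemma IsHalaszClass.norm_logCoeff_le {κ : ℝ} {f Λf : ℕ → ℂ} (hf : IsHalaszClass κ f Λf)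
    (n : ℕ) : ‖logCoeff Λf n‖ ≤ κ * logZetaCoeff n := by
  unfold logCoeff logZetaCoeff
  rw [norm_div, Complex.norm_real, Real.norm_of_nonneg (Real.log_natCast_nonneg n), ← mul_div_assoc]
  have := Real.log_natCast_nonneg n
  gcongr
  exact hf.bound' n

lemma logZetaCoeff_le_one (n : ℕ) : logZetaCoeff n ≤ 1 :=
  div_le_one_of_le₀ ArithmeticFunction.vonMangoldt_le_log (Real.log_natCast_nonneg n)

lemma IsHalaszClass.logMul_logCoeff {κ : ℝ} {f Λf : ℕ → ℂ} (hf : IsHalaszClass κ f Λf) :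
    LSeries.logMul (logCoeff Λf) = Λf := by
  ext n
  unfold LSeries.logMul logCoeff
  rw [← Complex.ofReal_natCast, ← Complex.ofReal_log (Nat.cast_nonneg n)]
  rcases eq_or_ne (Real.log n) 0 with h | h
  · have h1 := hf.bound' n
    have h2 := ArithmeticFunction.vonMangoldt_le_log (n := n)
    have h3 : Λ n = 0 := le_antisymm (by rw [← h]; exact h2) ArithmeticFunction.vonMangoldt_nonneg
    rw [h3, mul_zero] at h1
    rw [norm_le_zero_iff.1 h1]; simp
  · have : (Real.log n : ℂ) ≠ 0 := by exact_mod_cast h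
    field_simp

lemma IsHalaszClass.logCoeff_abscissa_le {κ : ℝ} (hκ : 0 ≤ κ) {f Λf : ℕ → ℂ} (hf : IsHalaszClass κ f Λf) :
    LSeries.abscissaOfAbsConv (logCoeff Λf) ≤ 1 := by
  apply LSeries.abscissaOfAbsConv_le_of_le_const
  refine ⟨κ, fun n _ => (hf.norm_logCoeff_le n).trans ?_⟩
  exact mul_le_of_le_one_right hκ (logZetaCoeff_le_one n)

lemma IsHalaszClass.LSeriesSummable_logCoeff {κ : ℝ} (hκ : 0 ≤ κ) {f Λf : ℕ → ℂ}
    (hf : IsHalaszClass κ f Λf) {s : ℂ} (hs : 1 < s.re) : LSeriesSummable (logCoeff Λf) s :=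
  LSeriesSummable_of_abscissaOfAbsConv_lt_re
    ((hf.logCoeff_abscissa_le hκ).trans_lt (by exact_mod_cast hs))

lemma IsHalaszClass.LSeriesSummable {κ : ℝ} {f Λf : ℕ → ℂ}
    (hf : IsHalaszClass κ f Λf) {s : ℂ} (hs : 1 < s.re) : LSeriesSummable f s :=
  LSeriesSummable_of_abscissaOfAbsConv_lt_re (hf.abscissa_le.trans_lt (by exact_mod_cast hs))

theorem IsHalaszClass.LSeries_eq_exp {κ : ℝ} (hκ : 0 ≤ κ) {f Λf : ℕ → ℂ}
    (hf : IsHalaszClass κ f Λf) {s : ℂ} (hs : 1 < s.re) :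
    LSeries f s = Complex.exp (LSeries (logCoeff Λf) s) := by
  have habs1 : ∀ z : ℂ, 1 < z.re → LSeries.abscissaOfAbsConv f < z.re := fun z hz =>
    hf.abscissa_le.trans_lt (by exact_mod_cast hz)
  have habs2 : ∀ z : ℂ, 1 < z.re → LSeries.abscissaOfAbsConv (logCoeff Λf) < z.re := fun z hz =>
    (hf.logCoeff_abscissa_le hκ).trans_lt (by exact_mod_cast hz)
  have hd : ∀ z : ℂ, 1 < z.re → HasDerivAt
      (fun z => LSeries f z * Complex.exp (-LSeries (logCoeff Λf) z)) 0 z := by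
    intro z hz
    have h1 := LSeries_hasDerivAt (habs1 z hz)
    have h2 := LSeries_hasDerivAt (habs2 z hz)
    have h3 := h1.mul (h2.neg.cexp)
    rw [hf.logMul_logCoeff] at h3
    have h4 : LSeries (LSeries.logMul f) z = LSeries Λf z * LSeries f z := by
      rw [← LSeries_convolution']
      · apply LSeries_congr
        intro n hn
        rw [LSeries.convolution_apply_eq, ← hf.conv n (Nat.pos_of_ne_zero hn)]
        unfold LSeries.logMul
        rw [← Complex.ofReal_natCast, ← Complex.ofReal_log (Nat.cast_nonneg n), mul_comm]
      · have := LSeriesSummable_logMul_of_lt_re (habs2 z hz)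
        rwa [hf.logMul_logCoeff] at this
      · exact hf.LSeriesSummable hz
    convert! h3 using 1
    rw [h4]; ring
  have hopen : IsOpen {z : ℂ | 1 < z.re} := isOpen_lt continuous_const Complex.continuous_re
  have hconv : Convex ℝ {z : ℂ | 1 < z.re} := convex_halfSpace_re_gt 1
  have hconst : ∀ x y : ℂ, 1 < x.re → 1 < y.re →
      LSeries f x * Complex.exp (-LSeries (logCoeff Λf) x)
        = LSeries f y * Complex.exp (-LSeries (logCoeff Λf) y) := by
    intro x y hx hy
    apply hconv.is_const_of_fderivWithin_eq_zero (𝕜 := ℂ)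
      (f := fun z => LSeries f z * Complex.exp (-LSeries (logCoeff Λf) z)) (s := {z : ℂ | 1 < z.re})
    · exact fun z hz => (hd z hz).differentiableAt.differentiableWithinAt
    · intro z hz
      rw [fderivWithin_of_isOpen hopen hz]
      have := (hd z hz).hasFDerivAt.fderiv
      rw [this]; simp
    · exact hx
    · exact hy
  have hlim1 := LSeries.tendsto_atTop (f := f) (hf.abscissa_le.trans_lt (by decide))
  have hlim2 := LSeries.tendsto_atTop (f := logCoeff Λf)
    ((hf.logCoeff_abscissa_le hκ).trans_lt (by decide))
  have hlim := hlim1.mul ((Complex.continuous_exp.tendsto _).comp hlim2.neg)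
  have h1 : logCoeff Λf 1 = 0 := by simp [logCoeff]
  rw [h1, hf.map_one] at hlim
  simp only [neg_zero, Complex.exp_zero, mul_one] at hlim
  have hev : ∀ᶠ x : ℝ in Filter.atTop, LSeries f s * Complex.exp (-LSeries (logCoeff Λf) s)
      = LSeries f x * Complex.exp (-LSeries (logCoeff Λf) x) := by
    filter_upwards [Filter.eventually_gt_atTop 1] with x hx
    exact hconst s x hs (by simpa using hx)
  have hfin : LSeries f s * Complex.exp (-LSeries (logCoeff Λf) s) = 1 :=
    tendsto_nhds_unique (tendsto_const_nhds.congr' hev) hlim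
  rw [Complex.exp_neg] at hfin
  rw [mul_inv_eq_one₀ (Complex.exp_ne_zero _)] at hfin
  exact hfin

/-- The part of a Dirichlet series coming from `n > y`. -/
def tailCoeff (y : ℝ) (a : ℕ → ℂ) (n : ℕ) : ℂ := if y < n then a n else 0

lemma norm_term_le_of_norm_le {a : ℕ → ℂ} {κ : ℝ}
    (ha : ∀ n, ‖a n‖ ≤ κ * logZetaCoeff n) (σ : ℝ) {s : ℂ} (hs : s.re = 1 + σ) (n : ℕ) :
    ‖LSeries.term a s n‖ ≤ κ * (logZetaCoeff n / n * (n : ℝ) ^ (-σ)) := by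
  rw [LSeries.norm_term_eq]
  split_ifs with h
  · subst h; simp
  · have hn : (0 : ℝ) < n := by exact_mod_cast Nat.pos_of_ne_zero h
    rw [hs, Real.rpow_add hn, Real.rpow_one, Real.rpow_neg hn.le, ← div_div, ← mul_assoc,
      ← mul_div_assoc, ← div_eq_mul_inv]
    gcongr
    exact ha n

lemma summable_logZetaCoeff {σ : ℝ} (hσ : 0 < σ) :
    Summable (fun n : ℕ => logZetaCoeff n / n * (n : ℝ) ^ (-σ)) := by
  refine Summable.of_nonneg_of_le (fun n => ?_) (fun n => ?_)
    (Real.summable_one_div_nat_rpow.2 (show 1 < 1 + σ by linarith))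
  · have := logZetaCoeff_nonneg n
    positivity
  · rcases Nat.eq_zero_or_pos n with rfl | h
    · simp only [Nat.cast_zero, div_zero, zero_mul]; positivity
    · have hn : (0 : ℝ) < n := by exact_mod_cast h
      rw [Real.rpow_add hn, Real.rpow_one, Real.rpow_neg hn.le, ← div_div, ← div_eq_mul_inv]
      gcongr
      exact logZetaCoeff_le_one n

lemma tsum_tail_le {σ y B : ℝ} (hσ : 0 < σ) (hB : ∀ T : Finset ℕ, (∀ n ∈ T, y < n) →
    ∑ n ∈ T, logZetaCoeff n / n * (n : ℝ) ^ (-σ) ≤ B) :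
    ∑' n : ℕ, (if y < n then logZetaCoeff n / n * (n : ℝ) ^ (-σ) else 0) ≤ B := by
  apply Summable.tsum_le_of_sum_le
  · refine Summable.of_nonneg_of_le (fun n => ?_) (fun n => ?_) (summable_logZetaCoeff hσ)
    all_goals
      have := logZetaCoeff_nonneg n
      split_ifs
      all_goals first | positivity | exact le_rfl
  · intro T
    rw [← Finset.sum_filter]
    exact hB _ (fun n hn => (Finset.mem_filter.1 hn).2)

lemma norm_LSeries_tail_le {a : ℕ → ℂ} {κ σ y B : ℝ} (hκ : 0 ≤ κ)
    (ha : ∀ n, ‖a n‖ ≤ κ * logZetaCoeff n) (hσ : 0 < σ) (hB : ∀ T : Finset ℕ, (∀ n ∈ T, y < n) →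
    ∑ n ∈ T, logZetaCoeff n / n * (n : ℝ) ^ (-σ) ≤ B) {s : ℂ} (hs : s.re = 1 + σ) :
    ‖LSeries (tailCoeff y a) s‖ ≤ κ * B := by
  have hsum : Summable (fun n : ℕ => κ * (if y < n then logZetaCoeff n / n * (n : ℝ) ^ (-σ) else 0)) := by
    apply Summable.mul_left
    refine Summable.of_nonneg_of_le (fun n => ?_) (fun n => ?_) (summable_logZetaCoeff hσ)
    all_goals
      have := logZetaCoeff_nonneg n
      split_ifs
      all_goals first | positivity | exact le_rfl
  unfold LSeries
  refine (tsum_of_norm_bounded hsum.hasSum (fun n => ?_)).trans ?_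
  · have h1 := norm_term_le_of_norm_le ha σ hs n
    split_ifs with h
    · have : LSeries.term (tailCoeff y a) s n = LSeries.term a s n := by
        simp [LSeries.term, tailCoeff, h]
      rwa [this]
    · have : LSeries.term (tailCoeff y a) s n = 0 := by
        simp [LSeries.term, tailCoeff, h]
      simp [this]
  · rw [tsum_mul_left]
    gcongr
    exact tsum_tail_le hσ hB

/-- Splitting a Dirichlet series at `y`. -/
lemma LSeries_eq_sum_add_tail {a : ℕ → ℂ} {s : ℂ} (ha : LSeriesSummable a s) {y : ℝ} (hy : 0 ≤ y) :
    LSeries a s = ∑ n ∈ Finset.Icc 1 ⌊y⌋₊, a n / (n : ℂ) ^ s + LSeries (tailCoeff y a) s := by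
  have h1 : LSeries.term a s = fun n => LSeries.term (fun n => if y < n then 0 else a n) s n
      + LSeries.term (tailCoeff y a) s n := by
    ext n
    by_cases h : y < n <;> simp [LSeries.term, tailCoeff, h]
  have h0 : ∀ n ∉ Finset.Icc 1 ⌊y⌋₊, LSeries.term (fun n : ℕ => if y < n then 0 else a n) s n = 0 := by
    intro n hn
    rcases Nat.eq_zero_or_pos n with rfl | h
    · simp
    · have : y < n := by
        by_contra hc
        exact hn (Finset.mem_Icc.2 ⟨h, Nat.le_floor (not_lt.1 hc)⟩)
      simp [LSeries.term, this]
  have hs1 : Summable (LSeries.term (fun n : ℕ => if y < n then 0 else a n) s) :=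
    summable_of_ne_finset_zero h0
  have hs2 : Summable (LSeries.term (tailCoeff y a) s) := by
    have := (show Summable (LSeries.term a s) from ha).sub hs1
    refine this.congr (fun n => ?_)
    rw [h1]; ring
  unfold LSeries
  rw [h1, hs1.tsum_add hs2, tsum_eq_sum h0]
  congr 1
  apply Finset.sum_congr rfl
  intro n hn
  rw [Finset.mem_Icc] at hn
  have : ¬ y < n := not_lt.2 ((Nat.le_floor_iff hy).1 hn.2)
  rw [LSeries.term_of_ne_zero (by omega)]
  simp [this]

lemma logZetaCoeff_tail_two_le {σ : ℝ} (hσ0 : 0 < σ) (hσ : σ ≤ 1) :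
    ∑' n : ℕ, logZetaCoeff n / n * (n : ℝ) ^ (-σ) ≤ Real.log (1 / σ) + 52 := by
  apply Summable.tsum_le_of_sum_le (summable_logZetaCoeff hσ0)
  intro T
  have h1 := sum_tail_log_of_le (y := Real.exp 1) le_rfl hσ0 (by simpa using hσ)
    (T.filter (fun n : ℕ => Real.exp 1 < n)) (fun n hn => (Finset.mem_filter.1 hn).2)
  rw [Real.log_exp, mul_one] at h1
  rw [← Finset.sum_filter_add_sum_filter_not T (fun n : ℕ => Real.exp 1 < n)]
  have h2 : ∑ n ∈ T.filter (fun n : ℕ => ¬ Real.exp 1 < n), logZetaCoeff n / n * (n : ℝ) ^ (-σ) ≤ 1 := by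
    refine le_trans (Finset.sum_le_sum_of_subset_of_nonneg (t := Finset.range 3) ?_ ?_) ?_
    · intro n hn
      have h3 := (Finset.mem_filter.1 hn).2
      have h4 : (n : ℝ) < 3 := (not_lt.1 h3).trans_lt Real.exp_one_lt_three
      rw [Finset.mem_range]; exact_mod_cast h4
    · intro n _ _
      have := logZetaCoeff_nonneg n
      positivity
    · rw [Finset.sum_range_succ, Finset.sum_range_succ, Finset.sum_range_one]
      have h3 := logZetaCoeff_le_one 2
      have h4 := logZetaCoeff_nonneg 2
      have h5 : ((2 : ℕ) : ℝ) ^ (-σ) ≤ 1 :=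
        Real.rpow_le_one_of_one_le_of_nonpos (by norm_num) (by linarith)
      have h6 : logZetaCoeff 1 = 0 := by simp [logZetaCoeff]
      rw [h6]
      have : logZetaCoeff 2 / (2 : ℕ) * ((2 : ℕ) : ℝ) ^ (-σ) ≤ 1 / (2 : ℕ) * 1 := by gcongr
      norm_num at this ⊢
      linarith
  linarith

lemma norm_character_sum_le {q : ℕ} (hq : 1 ≤ q) {ψ : DirichletCharacter ℂ q} (hψ : ψ ≠ 1) (N : ℕ) :
    ‖∑ n ∈ Finset.Icc 1 N, ψ (n : ZMod q)‖ ≤ q := by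
  have : NeZero q := ⟨by omega⟩
  have hper : ∑ n ∈ Finset.range q, ψ (n : ZMod q) = 0 := by
    rw [← MulChar.sum_eq_zero_of_ne_one hψ]
    refine Finset.sum_nbij' (fun n : ℕ => (n : ZMod q)) (fun a : ZMod q => a.val) ?_ ?_ ?_ ?_ ?_
    · intro a _; exact Finset.mem_univ _
    · intro a _; exact Finset.mem_range.2 (ZMod.val_lt a)
    · intro a ha; exact ZMod.val_cast_of_lt (Finset.mem_range.1 ha)
    · intro a _; exact ZMod.natCast_zmod_val a
    · intro a _; rfl
  have hmod : ∀ N : ℕ, ∑ n ∈ Finset.range N, ψ (n : ZMod q) =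
      ∑ n ∈ Finset.range (N % q), ψ (n : ZMod q) := by
    intro N
    induction N using Nat.strong_induction_on with
    | _ N ih =>
      rcases lt_or_ge N q with h | h
      · rw [Nat.mod_eq_of_lt h]
      · obtain ⟨M, rfl⟩ := Nat.exists_eq_add_of_le h
        rw [Finset.sum_range_add, hper, zero_add, Nat.add_mod_left, ← ih M (by omega)]
        apply Finset.sum_congr rfl
        intro i _
        simp
  have h0 : ψ ((0 : ℕ) : ZMod q) = 0 := by
    rcases eq_or_ne q 1 with rfl | h1
    · exact absurd (DirichletCharacter.level_one ψ) hψ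
    · have : Nontrivial (ZMod q) := ZMod.nontrivial_iff.2 h1
      rw [Nat.cast_zero]
      exact MulChar.map_nonunit _ not_isUnit_zero
  have h1 : ∑ n ∈ Finset.Icc 1 N, ψ (n : ZMod q) = ∑ n ∈ Finset.range (N + 1), ψ (n : ZMod q) := by
    rw [Finset.range_eq_Ico, Finset.sum_eq_sum_Ico_succ_bot (by omega), h0, zero_add]
    rfl
  rw [h1, hmod]
  calc ‖∑ n ∈ Finset.range ((N + 1) % q), ψ (n : ZMod q)‖
      ≤ ∑ n ∈ Finset.range ((N + 1) % q), (1 : ℝ) :=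
        norm_sum_le_of_le _ (fun n _ => ψ.norm_le_one _)
    _ = ((N + 1) % q : ℕ) := by simp
    _ ≤ q := by exact_mod_cast (Nat.mod_lt _ (by omega)).le

/-- Summatory function of a character. -/
def charSum {q : ℕ} (ψ : DirichletCharacter ℂ q) (v : ℝ) : ℂ :=
  ∑ n ∈ Finset.Icc 1 ⌊v⌋₊, ψ (n : ZMod q)

/-- The continuation of `L(s, ψ)` to `Re s > 0`. -/
def LCont {q : ℕ} (ψ : DirichletCharacter ℂ q) (s : ℂ) : ℂ := s * mellin (charSum ψ) (-s)

lemma charSum_eq_zero {q : ℕ} (ψ : DirichletCharacter ℂ q) {v : ℝ} (hv : v < 1) : charSum ψ v = 0 := by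
  unfold charSum
  rw [Nat.floor_eq_zero.2 hv]; simp

lemma norm_charSum_le {q : ℕ} (hq : 1 ≤ q) {ψ : DirichletCharacter ℂ q} (hψ : ψ ≠ 1) (v : ℝ) :
    ‖charSum ψ v‖ ≤ q := norm_character_sum_le hq hψ _

lemma measurable_charSum {q : ℕ} (ψ : DirichletCharacter ℂ q) : Measurable (charSum ψ) :=
  (measurable_from_top (f := fun N : ℕ => ∑ n ∈ Finset.Icc 1 N, ψ (n : ZMod q))).comp Nat.measurable_floor

lemma mellin_charSum {q : ℕ} (ψ : DirichletCharacter ℂ q) (s : ℂ) :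
    mellin (charSum ψ) (-s) = ∫ t in Set.Ioi (1 : ℝ), charSum ψ t * t ^ (-(s + 1)) := by
  unfold mellin
  have h1 : ∫ t in Set.Ioi (0 : ℝ), (t : ℂ) ^ (-s - 1) • charSum ψ t
      = ∫ t in Set.Ici (1 : ℝ), (t : ℂ) ^ (-s - 1) • charSum ψ t := by
    apply setIntegral_eq_of_subset_of_forall_sdiff_eq_zero measurableSet_Ioi
    · intro t ht; exact lt_of_lt_of_le one_pos (Set.mem_Ici.1 ht)
    · intro t ht
      rw [charSum_eq_zero ψ (not_le.1 ht.2), smul_zero]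
  rw [h1, integral_Ici_eq_integral_Ioi]
  apply integral_congr_ae
  filter_upwards with t
  rw [smul_eq_mul, mul_comm]
  congr 2; ring

lemma norm_LCont_le {q : ℕ} (hq : 1 ≤ q) {ψ : DirichletCharacter ℂ q} (hψ : ψ ≠ 1) {s : ℂ}
    (hs : 1 / 2 ≤ s.re) : ‖LCont ψ s‖ ≤ 2 * q * ‖s‖ := by
  unfold LCont
  rw [norm_mul, mellin_charSum]
  have hre : -s.re - 1 < -1 := by linarith
  have h1 : ‖∫ t in Set.Ioi (1 : ℝ), charSum ψ t * t ^ (-(s + 1))‖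
      ≤ ∫ t in Set.Ioi (1 : ℝ), (q : ℝ) * t ^ (-s.re - 1) := by
    apply norm_integral_le_of_norm_le
    · exact (integrableOn_Ioi_rpow_of_lt hre one_pos).const_mul _
    · filter_upwards [ae_restrict_mem measurableSet_Ioi] with t ht
      have ht0 : (0 : ℝ) < t := lt_trans one_pos ht
      rw [norm_mul, Complex.norm_cpow_eq_rpow_re_of_pos ht0]
      have : (-(s + 1)).re = -s.re - 1 := by simp; ring
      rw [this]
      gcongr
      exact norm_charSum_le hq hψ t
  rw [integral_const_mul, integral_Ioi_rpow_of_lt hre one_pos, Real.one_rpow] at h1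
  have h2 : (-1 : ℝ) / (-s.re - 1 + 1) ≤ 2 := by
    rw [show -s.re - 1 + 1 = -s.re by ring, neg_div_neg_eq, div_le_iff₀ (by linarith)]
    linarith
  calc ‖s‖ * ‖∫ t in Set.Ioi (1 : ℝ), charSum ψ t * t ^ (-(s + 1))‖ ≤ ‖s‖ * (q * 2) := by
        gcongr
        exact h1.trans (by gcongr)
    _ = _ := by ring

lemma differentiableAt_LCont {q : ℕ} (hq : 1 ≤ q) {ψ : DirichletCharacter ℂ q} (hψ : ψ ≠ 1) {s : ℂ}
    (hs : 0 < s.re) : DifferentiableAt ℂ (LCont ψ) s := by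
  unfold LCont
  apply differentiableAt_id.mul
  have h : DifferentiableAt ℂ (mellin (charSum ψ)) (-s) := by
    apply mellin_differentiableAt_of_isBigO_rpow (a := 0) (b := (-s).re - 1)
    · refine LocallyIntegrable.locallyIntegrableOn ?_ _
      refine (locallyIntegrable_const (q : ℝ)).mono (measurable_charSum ψ).aestronglyMeasurable ?_
      filter_upwards with v
      simpa using norm_charSum_le hq hψ v
    · apply Asymptotics.IsBigO.of_bound (q : ℝ)
      filter_upwards with v
      simpa using norm_charSum_le hq hψ v
    · simpa using hs
    · apply Asymptotics.IsBigO.of_bound 0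
      filter_upwards [mem_nhdsWithin_of_mem_nhds (Iio_mem_nhds one_pos)] with v hv
      rw [charSum_eq_zero ψ hv]; simp
    · linarith
  exact h.comp s differentiableAt_id.neg

lemma LCont_eq {q : ℕ} (hq : 1 ≤ q) {ψ : DirichletCharacter ℂ q} (hψ : ψ ≠ 1) {s : ℂ}
    (hs : 1 < s.re) : LCont ψ s = LSeries (fun n => ψ (n : ZMod q)) s := by
  rw [LSeries_eq_mul_integral (r := 0) _ le_rfl (by linarith)]
  · unfold LCont
    rw [mellin_charSum]; rfl
  · have := (isHalaszClass_one.twist ψ).LSeriesSummable hs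
    simpa using this
  · apply Asymptotics.IsBigO.of_bound (q : ℝ)
    filter_upwards with N
    simpa using norm_character_sum_le hq hψ N

lemma norm_natCast_cpow_I_sub_one_le {n : ℕ} (hn : n ≠ 0) (v : ℝ) :
    ‖(n : ℂ) ^ (-(v * I)) - 1‖ ≤ |v| * Real.log n ∧ ‖(n : ℂ) ^ (-(v * I)) - 1‖ ≤ 2 := by
  have hn0 : (n : ℂ) ≠ 0 := by exact_mod_cast hn
  have h1 : (n : ℂ) ^ (-(v * I)) = Complex.exp (I * ((-(v * Real.log n) : ℝ) : ℂ)) := by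
    rw [Complex.cpow_def_of_ne_zero hn0]
    congr 1
    rw [← Complex.ofReal_natCast, ← Complex.ofReal_log (Nat.cast_nonneg n)]
    push_cast; ring
  constructor
  · rw [h1]
    refine (Real.norm_exp_I_mul_ofReal_sub_one_le).trans ?_
    rw [norm_neg, norm_mul, Real.norm_eq_abs, Real.norm_of_nonneg (Real.log_natCast_nonneg n)]
  · refine (norm_sub_le _ _).trans ?_
    rw [Complex.norm_natCast_cpow_of_pos (Nat.pos_of_ne_zero hn)]
    simp; norm_num

lemma norm_LSeries_sub_le {a : ℕ → ℂ} {s₁ s₂ : ℂ} {B : ℝ} (h₁ : LSeriesSummable a s₁)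
    (h₂ : LSeriesSummable a s₂)
    (hB : ∀ T : Finset ℕ, ∑ n ∈ T, ‖LSeries.term a s₁ n - LSeries.term a s₂ n‖ ≤ B) :
    ‖LSeries a s₁ - LSeries a s₂‖ ≤ B := by
  unfold LSeries
  rw [← h₁.tsum_sub h₂]
  have hs : Summable (fun n => ‖LSeries.term a s₁ n - LSeries.term a s₂ n‖) :=
    (Summable.sub (f := LSeries.term a s₁) (g := LSeries.term a s₂) h₁ h₂).norm
  exact (norm_tsum_le_tsum_norm hs).trans (hs.tsum_le_of_sum_le hB)

lemma term_vertical_shift {a : ℕ → ℂ} {n : ℕ} (hn : n ≠ 0) (c t v : ℝ) :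
    LSeries.term a ⟨c, t + v⟩ n - LSeries.term a ⟨c, t⟩ n
      = LSeries.term a ⟨c, t⟩ n * ((n : ℂ) ^ (-(v * I)) - 1) := by
  have hn0 : (n : ℂ) ≠ 0 := by exact_mod_cast hn
  have h : (⟨c, t + v⟩ : ℂ) = ⟨c, t⟩ + v * I := by
    apply Complex.ext <;> simp
  rw [LSeries.term_of_ne_zero hn, LSeries.term_of_ne_zero hn, h, Complex.cpow_add _ _ hn0,
    Complex.cpow_neg]
  have h1 : (n : ℂ) ^ (⟨c, t⟩ : ℂ) ≠ 0 := by simp [Complex.cpow_eq_zero_iff, hn0]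
  have h2 : (n : ℂ) ^ (v * I) ≠ 0 := by simp [Complex.cpow_eq_zero_iff, hn0]
  field_simp

lemma LSeries_vertical_shift_le {a : ℕ → ℂ} (ha : ∀ n, ‖a n‖ ≤ 1 * logZetaCoeff n) {η : ℝ}
    (hη0 : 0 < η) (hη : η ≤ 1) (t v : ℝ) (hs : ∀ s : ℂ, 1 < s.re → LSeriesSummable a s) :
    ‖LSeries a ⟨1 + η, t + v⟩ - LSeries a ⟨1 + η, t⟩‖ ≤
      2 * Real.log (min (max |v| η) 1 / η) + 112 := by
  set m := min (max |v| η) 1 with hm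
  have hmη : η ≤ m := le_min (le_max_right _ _) hη
  have hm1 : m ≤ 1 := min_le_right _ _
  have hm0 : 0 < m := hη0.trans_le hmη
  set Y := Real.exp (1 / m) with hY
  have hlY : Real.log Y = 1 / m := Real.log_exp _
  have hYe : Real.exp 1 ≤ Y := by
    rw [hY]; gcongr; rw [le_div_iff₀ hm0]; linarith
  have hY1 : 1 ≤ Y := by linarith [Real.add_one_le_exp 1]
  apply norm_LSeries_sub_le (hs _ (by simp; linarith)) (hs _ (by simp; linarith))
  intro T
  rw [← Finset.sum_filter_add_sum_filter_not T (fun n : ℕ => Y < n)]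
  have hterm : ∀ n : ℕ, ‖LSeries.term a ⟨1 + η, t⟩ n‖ ≤ logZetaCoeff n / n * (n : ℝ) ^ (-η) := by
    intro n
    simpa using norm_term_le_of_norm_le ha η (s := ⟨1 + η, t⟩) rfl n
  have hb1 : ∑ n ∈ T.filter (fun n : ℕ => Y < n),
      ‖LSeries.term a ⟨1 + η, t + v⟩ n - LSeries.term a ⟨1 + η, t⟩ n‖
      ≤ 2 * (Real.log (m / η) + 51) := by
    have h1 := sum_tail_log_of_le hYe hη0 (by rw [hlY]; simpa using hmη)
      (T.filter (fun n : ℕ => Y < n)) (fun n hn => (Finset.mem_filter.1 hn).2)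
    have h2 : 1 / (η * Real.log Y) = m / η := by rw [hlY]; field_simp
    rw [h2] at h1
    refine le_trans ?_ (mul_le_mul_of_nonneg_left h1 (by norm_num))
    rw [Finset.mul_sum]
    apply Finset.sum_le_sum
    intro n hn
    have hn0 : n ≠ 0 := by
      rintro rfl
      have := (Finset.mem_filter.1 hn).2
      simp only [Nat.cast_zero] at this
      linarith
    rw [term_vertical_shift hn0, norm_mul, mul_comm]
    gcongr
    · exact (norm_natCast_cpow_I_sub_one_le hn0 v).2
    · exact hterm n
  have hb2 : ∑ n ∈ T.filter (fun n : ℕ => ¬ Y < n),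
      ‖LSeries.term a ⟨1 + η, t + v⟩ n - LSeries.term a ⟨1 + η, t⟩ n‖ ≤ 8 := by
    rcases le_or_gt |v| m with hv | hv
    · have h1 := (abs_le.1 (abs_mertens hY1)).2
      have h2 : m * ∑ n ∈ Finset.Icc 1 ⌊Y⌋₊, Λ n / n ≤ 8 := by
        calc m * ∑ n ∈ Finset.Icc 1 ⌊Y⌋₊, Λ n / n ≤ m * (1 / m + 7) := by
              gcongr; linarith
          _ = 1 + 7 * m := by field_simp
          _ ≤ 8 := by linarith
      refine le_trans ?_ h2
      have h3 : ∑ n ∈ T.filter (fun n : ℕ => ¬ Y < n),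
          ‖LSeries.term a ⟨1 + η, t + v⟩ n - LSeries.term a ⟨1 + η, t⟩ n‖
          ≤ ∑ n ∈ T.filter (fun n : ℕ => ¬ Y < n), m * (Λ n / n) := by
        apply Finset.sum_le_sum
        intro n hn
        rcases eq_or_ne n 0 with rfl | hn0
        · simp
        · rw [term_vertical_shift hn0, norm_mul]
          have hn1 : (1 : ℝ) ≤ n := by exact_mod_cast Nat.pos_of_ne_zero hn0
          have hc := logZetaCoeff_nonneg n
          calc ‖LSeries.term a ⟨1 + η, t⟩ n‖ * ‖(n : ℂ) ^ (-(v * I)) - 1‖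
              ≤ (logZetaCoeff n / n * 1) * (|v| * Real.log n) := by
                gcongr
                · refine (hterm n).trans ?_
                  gcongr
                  exact Real.rpow_le_one_of_one_le_of_nonpos hn1 (by linarith)
                · exact (norm_natCast_cpow_I_sub_one_le hn0 v).1
            _ = |v| * (Λ n / n) := by
                rw [← logZetaCoeff_mul_log]; ring
            _ ≤ m * (Λ n / n) := by
                have := ArithmeticFunction.vonMangoldt_nonneg (n := n)
                gcongr
      refine h3.trans ?_
      rw [← Finset.mul_sum]
      apply mul_le_mul_of_nonneg_left _ hm0.le
      calc ∑ n ∈ T.filter (fun n : ℕ => ¬ Y < n), Λ n / (n : ℝ)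
          = ∑ n ∈ (T.filter (fun n : ℕ => ¬ Y < n)).filter (fun n => n ≠ 0), Λ n / (n : ℝ) := by
            refine (Finset.sum_filter_of_ne ?_).symm
            rintro n _ h rfl
            simp at h
        _ ≤ _ := by
            apply Finset.sum_le_sum_of_subset_of_nonneg
            · intro n hn
              rw [Finset.mem_filter, Finset.mem_filter] at hn
              rw [Finset.mem_Icc]
              exact ⟨Nat.pos_of_ne_zero hn.2, Nat.le_floor (not_lt.1 hn.1.2)⟩
            · intro n _ _
              have := ArithmeticFunction.vonMangoldt_nonneg (n := n)
              positivity
    · have hm1' : m = 1 := by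
        rw [hm]
        apply min_eq_right
        by_contra hc
        rw [not_le] at hc
        have : m = max |v| η := min_eq_left hc.le
        have := le_max_left |v| η
        linarith
      have hY' : Y < 3 := by rw [hY, hm1', div_one]; exact Real.exp_one_lt_three
      refine le_trans (Finset.sum_le_sum_of_subset_of_nonneg (t := Finset.range 3) ?_ ?_) ?_
      · intro n hn
        have h4 : (n : ℝ) < 3 := (not_lt.1 (Finset.mem_filter.1 hn).2).trans_lt hY'
        rw [Finset.mem_range]; exact_mod_cast h4
      · intro n _ _; exact norm_nonneg _
      · have hn : ∀ n ∈ Finset.range 3,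
            ‖LSeries.term a ⟨1 + η, t + v⟩ n - LSeries.term a ⟨1 + η, t⟩ n‖ ≤ 2 := by
          intro n _
          rcases eq_or_ne n 0 with rfl | hn0
          · simp
          · rw [term_vertical_shift hn0, norm_mul]
            have hn1 : (1 : ℝ) ≤ n := by exact_mod_cast Nat.pos_of_ne_zero hn0
            have hc := logZetaCoeff_nonneg n
            calc ‖LSeries.term a ⟨1 + η, t⟩ n‖ * ‖(n : ℂ) ^ (-(v * I)) - 1‖
                ≤ (1 / 1 * 1) * 2 := by
                  gcongr
                  · refine (hterm n).trans ?_
                    gcongr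
                    · exact logZetaCoeff_le_one n
                    · exact Real.rpow_le_one_of_one_le_of_nonpos hn1 (by linarith)
                  · exact (norm_natCast_cpow_I_sub_one_le hn0 v).2
              _ = 2 := by norm_num
        refine (Finset.sum_le_sum hn).trans ?_
        simp; norm_num
  linarith

lemma sum_horizontal_shift_le {a : ℕ → ℂ} (ha : ∀ n, ‖a n‖ ≤ 1 * logZetaCoeff n) {σ η y : ℝ}
    (hσ0 : 0 < σ) (hση : σ ≤ η) (hy : 1 ≤ y) (t : ℝ) :
    ‖∑ n ∈ Finset.Icc 1 ⌊y⌋₊, a n / (n : ℂ) ^ (⟨1 + σ, t⟩ : ℂ)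
      - ∑ n ∈ Finset.Icc 1 ⌊y⌋₊, a n / (n : ℂ) ^ (⟨1 + η, t⟩ : ℂ)‖ ≤ η * (Real.log y + 7) := by
  have h1 := (abs_le.1 (abs_mertens hy)).2
  rw [← Finset.sum_sub_distrib]
  calc _ ≤ ∑ n ∈ Finset.Icc 1 ⌊y⌋₊, η * (Λ n / n) := by
        apply norm_sum_le_of_le
        intro n hn
        have hn0 : n ≠ 0 := by rw [Finset.mem_Icc] at hn; omega
        have hnc : (n : ℂ) ≠ 0 := by exact_mod_cast hn0
        have hn1 : (1 : ℝ) ≤ n := by exact_mod_cast Nat.pos_of_ne_zero hn0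
        have hc := logZetaCoeff_nonneg n
        have hl := Real.log_natCast_nonneg n
        have e : (⟨1 + η, t⟩ : ℂ) = ⟨1 + σ, t⟩ + ((η - σ : ℝ) : ℂ) := by
          apply Complex.ext <;> simp
        have h2 : (n : ℂ) ^ (⟨1 + σ, t⟩ : ℂ) ≠ 0 := by simp [Complex.cpow_eq_zero_iff, hnc]
        have h3 : (n : ℂ) ^ ((η - σ : ℝ) : ℂ) ≠ 0 := by simp [Complex.cpow_eq_zero_iff, hnc]
        have h4 : a n / (n : ℂ) ^ (⟨1 + σ, t⟩ : ℂ) - a n / (n : ℂ) ^ (⟨1 + η, t⟩ : ℂ)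
            = LSeries.term a ⟨1 + σ, t⟩ n * ((1 - (n : ℝ) ^ (-(η - σ)) : ℝ) : ℂ) := by
          rw [LSeries.term_of_ne_zero hn0, e, Complex.cpow_add _ _ hnc]
          push_cast
          rw [Complex.ofReal_cpow (by positivity)]
          push_cast
          rw [Complex.cpow_neg]
          push_cast at h3
          field_simp
        rw [h4, norm_mul, Complex.norm_real]
        have h5 := norm_term_le_of_norm_le ha σ (s := ⟨1 + σ, t⟩) rfl n
        have h6 : ‖1 - (n : ℝ) ^ (-(η - σ))‖ ≤ η * Real.log n := by
          have h7 : (n : ℝ) ^ (-(η - σ)) ≤ 1 :=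
            Real.rpow_le_one_of_one_le_of_nonpos hn1 (by linarith)
          rw [Real.norm_of_nonneg (by linarith), Real.rpow_def_of_pos (by linarith)]
          have h8 := Real.add_one_le_exp (Real.log n * -(η - σ))
          nlinarith
        calc _ ≤ (1 * (logZetaCoeff n / n * 1)) * (η * Real.log n) := by
              gcongr
              refine h5.trans ?_
              gcongr
              exact Real.rpow_le_one_of_one_le_of_nonpos hn1 (by linarith)
          _ = η * (Λ n / n) := by rw [← logZetaCoeff_mul_log]; ring
    _ = η * ∑ n ∈ Finset.Icc 1 ⌊y⌋₊, (Λ n / n) := by rw [Finset.mul_sum]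
    _ ≤ _ := by
        have : 0 < η := by linarith
        gcongr; linarith

/-- Coefficients of `log L(s, ψ)`. -/
def charLogCoeff {q : ℕ} (ψ : DirichletCharacter ℂ q) : ℕ → ℂ :=
  logCoeff (fun n => (Λ n : ℂ) * ψ (n : ZMod q))

lemma norm_charLogCoeff_le {q : ℕ} (ψ : DirichletCharacter ℂ q) (n : ℕ) :
    ‖charLogCoeff ψ n‖ ≤ 1 * logZetaCoeff n :=
  (isHalaszClass_one.twist ψ).norm_logCoeff_le n

lemma summable_charLogCoeff {q : ℕ} (ψ : DirichletCharacter ℂ q) (s : ℂ) (hs : 1 < s.re) :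
    LSeriesSummable (charLogCoeff ψ) s :=
  (isHalaszClass_one.twist ψ).LSeriesSummable_logCoeff zero_le_one hs

lemma LCont_eq_exp {q : ℕ} (hq : 1 ≤ q) {ψ : DirichletCharacter ℂ q} (hψ : ψ ≠ 1) {s : ℂ}
    (hs : 1 < s.re) : LCont ψ s = Complex.exp (LSeries (charLogCoeff ψ) s) := by
  rw [LCont_eq hq hψ hs]
  have := (isHalaszClass_one.twist ψ).LSeries_eq_exp zero_le_one hs
  simpa [charLogCoeff] using this

lemma norm_LCont {q : ℕ} (hq : 1 ≤ q) {ψ : DirichletCharacter ℂ q} (hψ : ψ ≠ 1) {s : ℂ}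
    (hs : 1 < s.re) : ‖LCont ψ s‖ = Real.exp (LSeries (charLogCoeff ψ) s).re := by
  rw [LCont_eq_exp hq hψ hs, Complex.norm_exp]

lemma norm_LSeries_le_of_log {a : ℕ → ℂ} (ha : ∀ n, ‖a n‖ ≤ 1 * logZetaCoeff n) {η : ℝ}
    (hη0 : 0 < η) (hη : η ≤ 1) (t : ℝ) : ‖LSeries a ⟨1 + η, t⟩‖ ≤ Real.log (1 / η) + 52 := by
  unfold LSeries
  refine (tsum_of_norm_bounded (summable_logZetaCoeff hη0).hasSum (fun n => ?_)).trans
    (logZetaCoeff_tail_two_le hη0 hη)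
  simpa using norm_term_le_of_norm_le ha η (s := ⟨1 + η, t⟩) rfl n

lemma norm_LCont_ge {q : ℕ} (hq : 1 ≤ q) {ψ : DirichletCharacter ℂ q} (hψ : ψ ≠ 1) {η : ℝ}
    (hη0 : 0 < η) (hη : η ≤ 1) (t : ℝ) : Real.exp (-52) * η ≤ ‖LCont ψ ⟨1 + η, t⟩‖ := by
  rw [norm_LCont hq hψ (by simp; linarith)]
  have h1 := norm_LSeries_le_of_log (norm_charLogCoeff_le ψ) hη0 hη t
  have h2 := (abs_le.1 ((Complex.abs_re_le_norm _).trans h1)).1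
  rw [one_div, Real.log_inv] at h2
  calc Real.exp (-52) * η = Real.exp (-52 + Real.log η) := by rw [Real.exp_add, Real.exp_log hη0]
    _ ≤ _ := by gcongr; linarith

lemma norm_LCont_vertical_le {q : ℕ} (hq : 1 ≤ q) {ψ : DirichletCharacter ℂ q} (hψ : ψ ≠ 1) {η : ℝ}
    (hη0 : 0 < η) (hη : η ≤ 1) (t v : ℝ) :
    ‖LCont ψ ⟨1 + η, t + v⟩‖ ≤
      Real.exp 112 * (1 + v ^ 2 / η ^ 2) * ‖LCont ψ ⟨1 + η, t⟩‖ := by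
  rw [norm_LCont hq hψ (by simp; linarith), norm_LCont hq hψ (by simp; linarith)]
  have h1 := LSeries_vertical_shift_le (norm_charLogCoeff_le ψ) hη0 hη t v (summable_charLogCoeff ψ)
  have h2 := (abs_le.1 ((Complex.abs_re_le_norm _).trans h1)).2
  rw [Complex.sub_re] at h2
  set m := min (max |v| η) 1 with hm
  have hmη : η ≤ m := le_min (le_max_right _ _) hη
  have hm0 : 0 < m / η := by have := hη0.trans_le hmη; positivity
  have h3 : (m / η) ^ 2 ≤ 1 + v ^ 2 / η ^ 2 := by
    rw [div_pow, div_le_iff₀ (by positivity), add_mul, div_mul_cancel₀ _ (by positivity), one_mul]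
    have h4 : m ≤ max |v| η := min_le_left _ _
    have h5 : 0 < m := hη0.trans_le hmη
    rcases le_total |v| η with h | h
    · rw [max_eq_right h] at h4; nlinarith [sq_nonneg v]
    · rw [max_eq_left h] at h4
      have : m ^ 2 ≤ |v| ^ 2 := by gcongr
      rw [sq_abs] at this; nlinarith
  calc Real.exp (LSeries (charLogCoeff ψ) ⟨1 + η, t + v⟩).re
      ≤ Real.exp (112 + 2 * Real.log (m / η) + (LSeries (charLogCoeff ψ) ⟨1 + η, t⟩).re) := by
        gcongr; linarith
    _ = Real.exp 112 * (m / η) ^ 2 * Real.exp (LSeries (charLogCoeff ψ) ⟨1 + η, t⟩).re := by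
        rw [Real.exp_add, Real.exp_add]
        congr 2
        rw [mul_comm, Real.exp_mul, Real.exp_log hm0]
        norm_cast
    _ ≤ _ := by gcongr

set_option maxHeartbeats 1000000 in
lemma norm_LCont_le_of_le {q : ℕ} (hq : 1 ≤ q) {ψ : DirichletCharacter ℂ q} (hψ : ψ ≠ 1)
    {y t σ : ℝ} (hy : Real.exp 1 ≤ y) (hyq : q * (2 + |t|) ≤ y) (hσ0 : 0 < σ)
    (hσ : σ ≤ 1 / Real.log y) :
    ‖LCont ψ ⟨1 + σ, t⟩‖ ≤ 4 * Real.exp 114 * ‖LCont ψ ⟨1 + 1 / Real.log y, t⟩‖ := by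
  have he := Real.add_one_le_exp 1
  have hy0 : 0 < y := by linarith
  have hly : 1 ≤ Real.log y := (Real.le_log_iff_exp_le hy0).2 hy
  set η := 1 / Real.log y with hη
  have hη0 : 0 < η := by positivity
  have hη1 : η ≤ 1 := by rw [hη, div_le_one (by linarith)]; exact hly
  have hηl : η * Real.log y = 1 := by rw [hη]; field_simp
  set L0 := ‖LCont ψ ⟨1 + η, t⟩‖ with hL0
  have hL0ge : Real.exp (-52) * η ≤ L0 := norm_LCont_ge hq hψ hη0 hη1 t
  set w : ℂ → ℂ := fun s => (1 + 2 * η - (s - t * I)) / η with hw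
  set h : ℂ → ℂ := fun s => LCont ψ s * (w s)⁻¹ ^ 2 * Complex.exp (2 * (s - 1 - t * I) * Real.log y)
    with hh
  have hηc : (η : ℂ) ≠ 0 := by exact_mod_cast hη0.ne'
  have hwre : ∀ s, (w s).re = (1 + 2 * η - s.re) / η := by
    intro s
    simp only [hw, Complex.div_ofReal_re]
    simp
  have hwim : ∀ s, (w s).im = -(s.im - t) / η := by
    intro s
    simp only [hw, Complex.div_ofReal_im]
    simp
  have hwsq : ∀ s, ‖w s‖ ^ 2 = ((1 + 2 * η - s.re) ^ 2 + (s.im - t) ^ 2) / η ^ 2 := by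
    intro s
    rw [Complex.sq_norm, Complex.normSq_apply, hwre, hwim]
    field_simp
  have hnorm : ∀ s, ‖h s‖ = ‖LCont ψ s‖ * (‖w s‖ ^ 2)⁻¹ * Real.exp (2 * (s.re - 1) * Real.log y) := by
    intro s
    simp only [hh]
    rw [norm_mul, norm_mul, norm_pow, norm_inv, inv_pow, Complex.norm_exp]
    congr 2
    rw [Complex.re_mul_ofReal]
    simp
  have hwne : ∀ s : ℂ, s.re ≤ 1 + η → w s ≠ 0 := by
    intro s hs h0
    have := hwre s
    rw [h0, Complex.zero_re] at this
    have h2 : 0 < (1 + 2 * η - s.re) / η := by apply div_pos _ hη0; linarith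
    linarith
  have hdiff : ∀ s : ℂ, 1 / 2 ≤ s.re → s.re ≤ 1 + η → DifferentiableAt ℂ h s := by
    intro s hs1 hs2
    have h1 := differentiableAt_LCont hq hψ (show 0 < s.re by linarith)
    have h2 : DifferentiableAt ℂ w s := by simp only [hw]; fun_prop
    have h3 := (h2.inv (hwne s hs2)).pow 2
    have h4 : DifferentiableAt ℂ (fun s : ℂ => Complex.exp (2 * (s - 1 - t * I) * Real.log y)) s := by
      fun_prop
    exact (h1.mul h3).mul h4
  have hq0 : (1 : ℝ) ≤ q := by exact_mod_cast hq
  have key : ‖h ⟨1 + σ, t⟩‖ ≤ Real.exp 114 * L0 := by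
    apply PhragmenLindelof.vertical_strip (a := 1 / 2) (b := 1 + η)
    · apply DifferentiableOn.diffContOnCl
      intro s hs
      have hcl : closure (Complex.re ⁻¹' Set.Ioo (1 / 2) (1 + η)) ⊆ Complex.re ⁻¹' Set.Icc (1 / 2) (1 + η) :=
        closure_minimal (Set.preimage_mono Set.Ioo_subset_Icc_self)
          (isClosed_Icc.preimage Complex.continuous_re)
      have := hcl hs
      exact (hdiff s this.1 this.2).differentiableWithinAt
    · refine ⟨1, ?_, 1, ?_⟩
      · rw [lt_div_iff₀ (by linarith)]; linarith [Real.pi_gt_three]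
      · apply Asymptotics.IsBigO.of_bound (4 * q * Real.exp 2)
        rw [Filter.eventually_inf_principal]
        filter_upwards with s hs
        have hs1 : 1 / 2 < s.re := hs.1
        have hs2 : s.re < 1 + η := hs.2
        rw [hnorm, Real.norm_of_nonneg (Real.exp_pos _).le, one_mul, one_mul]
        have h1 := norm_LCont_le hq hψ hs1.le
        have h2 : (‖w s‖ ^ 2)⁻¹ ≤ 1 := by
          apply inv_le_one_of_one_le₀
          rw [hwsq, le_div_iff₀ (by positivity)]
          nlinarith [sq_nonneg (s.im - t)]
        have h3 : Real.exp (2 * (s.re - 1) * Real.log y) ≤ Real.exp 2 := by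
          gcongr; nlinarith
        have h4 : ‖s‖ ≤ 2 * Real.exp (Real.exp |s.im|) := by
          have h5 := Complex.norm_le_abs_re_add_abs_im s
          rw [abs_of_pos (by linarith : 0 < s.re)] at h5
          have h6 := Real.add_one_le_exp |s.im|
          have h7 := Real.add_one_le_exp (Real.exp |s.im|)
          have := abs_nonneg s.im
          linarith
        calc ‖LCont ψ s‖ * (‖w s‖ ^ 2)⁻¹ * Real.exp (2 * (s.re - 1) * Real.log y)
            ≤ (2 * q * (2 * Real.exp (Real.exp |s.im|))) * 1 * Real.exp 2 := by
              gcongr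
              exact h1.trans (by gcongr)
          _ = _ := by ring
    · intro s hs
      rw [hnorm, hwsq, hs]
      have h1 := norm_LCont_le hq hψ hs.ge
      have h2 : ‖s‖ ≤ 1 / 2 + |t| + |s.im - t| := by
        have h5 := Complex.norm_le_abs_re_add_abs_im s
        rw [hs, abs_of_pos (by norm_num : (0 : ℝ) < 1 / 2)] at h5
        have h6 : |s.im| ≤ |t| + |s.im - t| := by
          calc |s.im| = |t + (s.im - t)| := by ring_nf
            _ ≤ _ := abs_add_le _ _
        linarith
      set v := s.im - t with hv
      have hv2 : |v| ^ 2 = v ^ 2 := sq_abs v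
      have h3 : 1 / 2 + |t| + |v| ≤ 4 * (2 + |t|) * ((1 + 2 * η - 1 / 2) ^ 2 + v ^ 2) := by
        have ht := abs_nonneg t
        have h6 : 1 / 4 + v ^ 2 ≤ (1 + 2 * η - 1 / 2) ^ 2 + v ^ 2 := by nlinarith
        have h7 : 1 / 2 + |t| + |v| ≤ 4 * (2 + |t|) * (1 / 4 + v ^ 2) := by
          rw [← hv2]; nlinarith [sq_nonneg (|v| - 1 / 2), mul_nonneg ht (sq_nonneg |v|)]
        exact h7.trans (by gcongr)
      have h4 : Real.exp (2 * (1 / 2 - 1) * Real.log y) = y⁻¹ := by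
        rw [show (2 * (1 / 2 - 1) * Real.log y : ℝ) = -Real.log y by ring, Real.exp_neg, Real.exp_log hy0]
      rw [h4, inv_div]
      set D := (1 + 2 * η - 1 / 2) ^ 2 + v ^ 2 with hD
      have hD0 : 0 < D := by nlinarith [sq_nonneg v]
      calc ‖LCont ψ s‖ * (η ^ 2 / D) * y⁻¹
          ≤ (2 * q * (4 * (2 + |t|) * D)) * (η ^ 2 / D) * y⁻¹ := by
            gcongr
            refine h1.trans ?_
            gcongr
            exact h2.trans h3
        _ = 8 * η ^ 2 * ((q * (2 + |t|)) / y) := by field_simp; ring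
        _ ≤ 8 * η ^ 2 * 1 := by gcongr; exact div_le_one_of_le₀ hyq hy0.le
        _ ≤ Real.exp 62 * η := by
            have : (63 : ℝ) ≤ Real.exp 62 := by linarith [Real.add_one_le_exp 62]
            have : 8 * η ^ 2 * 1 ≤ 8 * η := by nlinarith
            nlinarith
        _ ≤ Real.exp 114 * (Real.exp (-52) * η) := by
            rw [← mul_assoc, ← Real.exp_add]
            norm_num
        _ ≤ Real.exp 114 * L0 := by gcongr
    · intro s hs
      rw [hnorm, hwsq, hs]
      have h1 := norm_LCont_vertical_le hq hψ hη0 hη1 t (s.im - t)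
      have hsc : (⟨1 + η, t + (s.im - t)⟩ : ℂ) = s := by
        apply Complex.ext <;> simp [hs]
      rw [hsc] at h1
      set v := s.im - t with hv
      have h4 : Real.exp (2 * (1 + η - 1) * Real.log y) = Real.exp 2 := by
        congr 1; linear_combination 2 * hηl
      rw [h4]
      have hD : ((1 + 2 * η - (1 + η)) ^ 2 + v ^ 2) / η ^ 2 = 1 + v ^ 2 / η ^ 2 := by
        field_simp; ring
      rw [hD]
      have hD0 : 0 < 1 + v ^ 2 / η ^ 2 := by positivity
      calc ‖LCont ψ s‖ * (1 + v ^ 2 / η ^ 2)⁻¹ * Real.exp 2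
          ≤ (Real.exp 112 * (1 + v ^ 2 / η ^ 2) * L0) * (1 + v ^ 2 / η ^ 2)⁻¹ * Real.exp 2 := by
            gcongr
        _ = Real.exp 112 * Real.exp 2 * L0 := by field_simp
        _ = _ := by rw [← Real.exp_add]; norm_num
    · simp; linarith
    · simp; linarith
  rw [hnorm, hwsq] at key
  simp only [sub_self] at key
  have h1 : 1 ≤ Real.exp (2 * (1 + σ - 1) * Real.log y) := by
    apply Real.one_le_exp
    have : 0 ≤ σ * Real.log y := by positivity
    linarith
  have h2 : (1 : ℝ) / 4 ≤ (((1 + 2 * η - (1 + σ)) ^ 2 + 0 ^ 2) / η ^ 2)⁻¹ := by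
    rw [inv_div, div_le_div_iff₀ (by norm_num) (by nlinarith)]
    nlinarith
  have h3 : ‖LCont ψ ⟨1 + σ, t⟩‖ * (1 / 4) * 1 ≤ Real.exp 114 * L0 := by
    refine le_trans ?_ key
    gcongr
  linarith

/-- Tails of `log L(s, ψ)` are bounded above for nonprincipal `ψ`. -/
theorem re_charLog_tail_le {q : ℕ} (hq : 1 ≤ q) {ψ : DirichletCharacter ℂ q} (hψ : ψ ≠ 1)
    {y t σ : ℝ} (hy : Real.exp 1 ≤ y) (hyq : q * (2 + |t|) ≤ y) (hσ0 : 0 < σ) :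
    (LSeries (tailCoeff y (charLogCoeff ψ)) ⟨1 + σ, t⟩).re ≤ 160 := by
  have he := Real.add_one_le_exp 1
  have hy0 : 0 < y := by linarith
  have hly : 1 ≤ Real.log y := (Real.le_log_iff_exp_le hy0).2 hy
  have htail : ∀ σ', 1 / Real.log y ≤ σ' →
      |(LSeries (tailCoeff y (charLogCoeff ψ)) ⟨1 + σ', t⟩).re| ≤ 30 := by
    intro σ' h
    have h0 : 0 < σ' := lt_of_lt_of_le (by positivity) h
    have := norm_LSeries_tail_le zero_le_one (norm_charLogCoeff_le ψ) h0
      (fun T hT => sum_tail_log_of_ge hy h T hT) (s := ⟨1 + σ', t⟩) rfl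
    rw [one_mul] at this
    exact (Complex.abs_re_le_norm _).trans this
  rcases le_total (1 / Real.log y) σ with h | h
  · have := (abs_le.1 (htail σ h)).2
    linarith
  · set η := 1 / Real.log y with hη
    have hη0 : 0 < η := by positivity
    have h1 := norm_LCont_le_of_le hq hψ hy hyq hσ0 h
    rw [norm_LCont hq hψ (by simp; linarith), norm_LCont hq hψ (by simp; positivity),
      LSeries_eq_sum_add_tail (summable_charLogCoeff ψ _ (by simp; linarith)) hy0.le,
      LSeries_eq_sum_add_tail (summable_charLogCoeff ψ _ (by simp; positivity)) hy0.le,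
      Complex.add_re, Complex.add_re] at h1
    have h2 : (4 : ℝ) ≤ Real.exp 3 := by linarith [Real.add_one_le_exp 3]
    have h3 := (abs_le.1 (htail η le_rfl)).2
    have h4 := (abs_le.1 ((Complex.abs_re_le_norm _).trans
      (sum_horizontal_shift_le (norm_charLogCoeff_le ψ) hσ0 h (by linarith : (1 : ℝ) ≤ y) t))).1
    have h5 : η * (Real.log y + 7) ≤ 8 := by
      rw [hη, div_mul_eq_mul_div, div_le_iff₀ (by linarith)]; linarith
    rw [Complex.sub_re] at h4
    set S1 := (∑ n ∈ Finset.Icc 1 ⌊y⌋₊, charLogCoeff ψ n / (n : ℂ) ^ (⟨1 + σ, t⟩ : ℂ)).re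
    set S2 := (∑ n ∈ Finset.Icc 1 ⌊y⌋₊, charLogCoeff ψ n / (n : ℂ) ^ (⟨1 + η, t⟩ : ℂ)).re
    set R1 := (LSeries (tailCoeff y (charLogCoeff ψ)) ⟨1 + σ, t⟩).re
    set R2 := (LSeries (tailCoeff y (charLogCoeff ψ)) ⟨1 + η, t⟩).re
    have h6 : Real.exp (S1 + R1) ≤ Real.exp (3 + 114 + (S2 + R2)) := by
      refine h1.trans ?_
      rw [Real.exp_add (3 + 114), Real.exp_add 3]
      gcongr
    have h7 := Real.exp_le_exp.1 h6
    linarith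

/-- The twist `f · χ⁻¹`. -/
def charTwist {q : ℕ} (f : ℕ → ℂ) (χ : DirichletCharacter ℂ q) (n : ℕ) : ℂ := f n * χ⁻¹ (n : ZMod q)

lemma IsHalaszClass.twist_inv {κ : ℝ} {f Λf : ℕ → ℂ} (hf : IsHalaszClass κ f Λf) {q : ℕ}
    (χ : DirichletCharacter ℂ q) : IsHalaszClass κ (charTwist f χ) (charTwist Λf χ) := hf.twist χ⁻¹

lemma sum_logCoeff_le {κ : ℝ} (hκ : 0 < κ) {f Λf : ℕ → ℂ} (hf : IsHalaszClass κ f Λf)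
    {y σ : ℝ} (hy : 2 ≤ y) (hσ : 0 < σ) (t : ℝ) :
    ‖∑ n ∈ Finset.Icc 1 ⌊y⌋₊, logCoeff Λf n / (n : ℂ) ^ (⟨1 + σ, t⟩ : ℂ)‖ ≤
      κ * (Real.log (Real.log y) + (Real.log (1 / Real.log (3 / 2)) + 21 / Real.log (3 / 2))) := by
  have h1 := sum_vonMangoldt_div_log_le hy
  have hfl : 1 ≤ ⌊y⌋₊ := Nat.le_floor (by norm_num; linarith)
  calc _ ≤ ∑ n ∈ Finset.Icc 1 ⌊y⌋₊, κ * (Λ n / (n * Real.log n)) := by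
        apply norm_sum_le_of_le
        intro n hn
        have hn0 : n ≠ 0 := by rw [Finset.mem_Icc] at hn; omega
        have hn1 : (1 : ℝ) ≤ n := by exact_mod_cast Nat.pos_of_ne_zero hn0
        have hc := logZetaCoeff_nonneg n
        have h2 := norm_term_le_of_norm_le (hf.norm_logCoeff_le) σ (s := ⟨1 + σ, t⟩) rfl n
        rw [LSeries.term_of_ne_zero hn0] at h2
        refine h2.trans ?_
        gcongr
        calc logZetaCoeff n / n * (n : ℝ) ^ (-σ) ≤ logZetaCoeff n / n * 1 := by
              gcongr
              exact Real.rpow_le_one_of_one_le_of_nonpos hn1 (by linarith)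
          _ = _ := by unfold logZetaCoeff; rw [mul_one, div_div, mul_comm]
    _ = κ * ∑ n ∈ Finset.Ioc 1 ⌊y⌋₊, Λ n / (n * Real.log n) := by
        rw [← Finset.mul_sum]
        congr 1
        rw [← Finset.add_sum_Ioc_eq_sum_Icc hfl]
        simp
    _ ≤ _ := by gcongr

/-- The constant in the bound of `F` by its tail. -/
def eulerConst : ℝ := Real.log (1 / Real.log (3 / 2)) + 21 / Real.log (3 / 2)

lemma norm_LSeries_le_tail {κ : ℝ} (hκ : 0 < κ) {f Λf : ℕ → ℂ} (hf : IsHalaszClass κ f Λf)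
    {y σ : ℝ} (hy : 2 ≤ y) (hσ : 0 < σ) (t : ℝ) :
    ‖LSeries f ⟨1 + σ, t⟩‖ ≤ Real.exp (κ * eulerConst) * Real.log y ^ κ *
      Real.exp (LSeries (tailCoeff y (logCoeff Λf)) ⟨1 + σ, t⟩).re := by
  have hs : 1 < (⟨1 + σ, t⟩ : ℂ).re := by simp; linarith
  have hly : 0 < Real.log y := Real.log_pos (by linarith)
  rw [hf.LSeries_eq_exp hκ.le hs, Complex.norm_exp,
    LSeries_eq_sum_add_tail (hf.LSeriesSummable_logCoeff hκ.le hs) (by linarith : 0 ≤ y), Complex.add_re]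
  have h1 := (abs_le.1 ((Complex.abs_re_le_norm _).trans (sum_logCoeff_le hκ hf hy hσ t))).2
  rw [Real.rpow_def_of_pos hly, ← Real.exp_add, ← Real.exp_add]
  gcongr
  unfold eulerConst
  linarith

lemma tail_mono_bound {y σ₀ σ : ℝ} (hy : Real.exp 1 ≤ y) (hσ₀ : 0 < σ₀) (h₀ : σ₀ ≤ 1 / Real.log y)
    (hσ : σ₀ ≤ σ) (T : Finset ℕ) (hT : ∀ n ∈ T, y < n) :
    ∑ n ∈ T, logZetaCoeff n / n * (n : ℝ) ^ (-σ) ≤ Real.log (1 / (σ₀ * Real.log y)) + 51 := by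
  refine le_trans (Finset.sum_le_sum fun n hn => ?_) (sum_tail_log_of_le hy hσ₀ h₀ T hT)
  have hn1 : (1 : ℝ) ≤ n := by linarith [hT n hn, Real.add_one_le_exp 1]
  have := logZetaCoeff_nonneg n
  gcongr

/-- The value `χ⁻¹(n) n^{-σ-it}`. -/
def twistValue {q : ℕ} (χ : DirichletCharacter ℂ q) (s : ℂ) (n : ℕ) : ℂ :=
  χ⁻¹ (n : ZMod q) * (n : ℂ) ^ (-s)

lemma twistValue_mul_conj {q : ℕ} [NeZero q] (χ χ' : DirichletCharacter ℂ q) (s s' : ℂ) {n : ℕ} (hn : n ≠ 0) :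
    twistValue χ s n * (starRingEnd ℂ) (twistValue χ' s' n) =
      (χ⁻¹ * χ') (n : ZMod q) * (n : ℂ) ^ (-(s + (starRingEnd ℂ) s')) := by
  have hn0 : (n : ℂ) ≠ 0 := by exact_mod_cast hn
  unfold twistValue
  have hc : (starRingEnd ℂ) ((n : ℂ) ^ (-s')) = (n : ℂ) ^ (-(starRingEnd ℂ) s') := by
    have := Complex.cpow_conj (n : ℂ) (-s') (by simp [Complex.natCast_arg, Real.pi_ne_zero.symm])
    rw [map_neg, Complex.conj_natCast] at this
    exact this.symm
  rw [map_mul, hc, MulChar.mul_apply]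
  rw [show (starRingEnd ℂ) (χ'⁻¹ (n : ZMod q)) = χ' (n : ZMod q) by
    rw [starRingEnd_apply, MulChar.star_apply', inv_inv]]
  rw [neg_add, Complex.cpow_add _ _ hn0]
  ring

lemma re_sum_term_le {κ : ℝ} (hκ : 0 < κ) {f Λf : ℕ → ℂ} (hf : IsHalaszClass κ f Λf) {q : ℕ} [NeZero q]
    (S : Finset (DirichletCharacter ℂ q)) (σ t : DirichletCharacter ℂ q → ℝ) (y σ₀ : ℝ)
    {r : ℝ} (hr : 0 < r) (n : ℕ) :
    (∑ χ ∈ S, LSeries.term (tailCoeff y (logCoeff (charTwist Λf χ))) ⟨1 + σ χ, t χ⟩ n).re ≤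
      κ / 2 * (r * (if y < n then logZetaCoeff n / n * (n : ℝ) ^ (-σ₀) else 0) +
        1 / r * (∑ χ ∈ S, ∑ χ' ∈ S, LSeries.term (tailCoeff y (charLogCoeff (χ⁻¹ * χ')))
          ⟨1 + (σ χ + σ χ' - σ₀), t χ - t χ'⟩ n).re) := by
  rcases eq_or_ne n 0 with rfl | hn0
  · simp
  by_cases hyn : y < n
  swap
  · simp [LSeries.term, tailCoeff, hyn]
  have hn : (0 : ℝ) < n := by exact_mod_cast Nat.pos_of_ne_zero hn0
  have hnc : (n : ℂ) ≠ 0 := by exact_mod_cast hn0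
  rw [if_pos hyn]
  set Z : ℂ := ∑ χ ∈ S, twistValue χ ⟨σ χ, t χ⟩ n with hZ
  have hW := logZetaCoeff_nonneg n
  have e1 : ∑ χ ∈ S, LSeries.term (tailCoeff y (logCoeff (charTwist Λf χ))) ⟨1 + σ χ, t χ⟩ n
      = logCoeff Λf n / n * Z := by
    rw [hZ, Finset.mul_sum]
    apply Finset.sum_congr rfl
    intro χ _
    have h1 : (⟨1 + σ χ, t χ⟩ : ℂ) = 1 + ⟨σ χ, t χ⟩ := by apply Complex.ext <;> simp
    rw [LSeries.term_of_ne_zero hn0, h1, Complex.cpow_add _ _ hnc, Complex.cpow_one]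
    unfold tailCoeff logCoeff charTwist twistValue
    rw [if_pos hyn, Complex.cpow_neg]
    ring
  have e2 : ∑ χ ∈ S, ∑ χ' ∈ S, LSeries.term (tailCoeff y (charLogCoeff (χ⁻¹ * χ')))
      ⟨1 + (σ χ + σ χ' - σ₀), t χ - t χ'⟩ n
      = ((logZetaCoeff n / n * (n : ℝ) ^ σ₀ * ‖Z‖ ^ 2 : ℝ) : ℂ) := by
    have h2 : ((‖Z‖ ^ 2 : ℝ) : ℂ) = Z * (starRingEnd ℂ) Z := by
      rw [Complex.mul_conj, Complex.normSq_eq_norm_sq]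
    rw [Complex.ofReal_mul, h2, hZ, map_sum, Finset.sum_mul_sum, Finset.mul_sum]
    apply Finset.sum_congr rfl
    intro χ _
    rw [Finset.mul_sum]
    apply Finset.sum_congr rfl
    intro χ' _
    rw [twistValue_mul_conj _ _ _ _ hn0, LSeries.term_of_ne_zero hn0]
    have h1 : (⟨1 + (σ χ + σ χ' - σ₀), t χ - t χ'⟩ : ℂ)
        = 1 + (⟨σ χ, t χ⟩ + (starRingEnd ℂ) ⟨σ χ', t χ'⟩) + -(σ₀ : ℂ) := by
      apply Complex.ext <;> simp <;> ring
    rw [h1, Complex.cpow_add _ _ hnc, Complex.cpow_add _ _ hnc, Complex.cpow_one]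
    unfold tailCoeff charLogCoeff logCoeff logZetaCoeff
    rw [if_pos hyn]
    push_cast
    rw [Complex.ofReal_cpow hn.le, Complex.cpow_neg, Complex.cpow_neg]
    push_cast
    have h4 : (n : ℂ) ^ (σ₀ : ℂ) ≠ 0 := by simp [Complex.cpow_eq_zero_iff, hnc]
    generalize (χ⁻¹ * χ') (n : ZMod q) = u
    generalize (n : ℂ) ^ ((⟨σ χ, t χ⟩ : ℂ) + (starRingEnd ℂ) ⟨σ χ', t χ'⟩) = u'
    field_simp
  rw [e1, e2, Complex.ofReal_re]
  calc (logCoeff Λf n / n * Z).re ≤ ‖logCoeff Λf n / n * Z‖ := Complex.re_le_norm _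
    _ = ‖logCoeff Λf n‖ / n * ‖Z‖ := by rw [norm_mul, norm_div, Complex.norm_natCast]
    _ ≤ (κ * logZetaCoeff n) / n * ‖Z‖ := by gcongr; exact hf.norm_logCoeff_le n
    _ = κ * (logZetaCoeff n / n) * ‖Z‖ := by ring
    _ ≤ κ * (logZetaCoeff n / n) * ((r * (n : ℝ) ^ (-σ₀) + 1 / r * ((n : ℝ) ^ σ₀ * ‖Z‖ ^ 2)) / 2) := by
        gcongr
        rw [Real.rpow_neg hn.le]
        have hp : 0 < (n : ℝ) ^ σ₀ := by positivity
        generalize (n : ℝ) ^ σ₀ = p at hp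
        have h5 : r * p⁻¹ + 1 / r * (p * ‖Z‖ ^ 2) - 2 * ‖Z‖ = (r - p * ‖Z‖) ^ 2 / (r * p) := by
          field_simp; ring
        have h6 : 0 ≤ (r - p * ‖Z‖) ^ 2 / (r * p) := by positivity
        linarith
    _ = _ := by ring

theorem exists_exceptional {κ : ℝ} (hκ : 0 < κ) (J : ℕ) :
    ∃ C : ℝ, 1 ≤ C ∧ ∀ f Λf : ℕ → ℂ, IsHalaszClass κ f Λf → ∀ q : ℕ, 1 ≤ q → ∀ y σ₀ T : ℝ,
      Real.exp 1 ≤ y → 0 < σ₀ → σ₀ ≤ 1 / Real.log y → q * (2 + 2 * T) ≤ y →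
      ∃ 𝒳 : Finset (DirichletCharacter ℂ q), 𝒳.card ≤ J ∧ ∀ χ ∉ 𝒳, ∀ σ t : ℝ, σ₀ ≤ σ → |t| ≤ T →
        ‖LSeries (charTwist f χ) ⟨1 + σ, t⟩‖ ≤
          C * Real.log y ^ κ * (1 / (σ₀ * Real.log y)) ^ (κ / Real.sqrt (J + 1)) := by
  set r := Real.sqrt ((J : ℝ) + 1) with hr
  have hr0 : 0 < r := by positivity
  have hr2 : r * r = J + 1 := Real.mul_self_sqrt (by positivity)
  set C1 : ℝ := 51 + 80 * (J + 1) with hC1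
  refine ⟨Real.exp (κ * |eulerConst| + κ / r * C1), Real.one_le_exp (by positivity), ?_⟩
  intro f Λf hf q hq y σ₀ T hy hσ₀ hσ₀' hyT
  have : NeZero q := ⟨by omega⟩
  have he := Real.add_one_le_exp 1
  have hly : 1 ≤ Real.log y := (Real.le_log_iff_exp_le (by linarith)).2 hy
  set M := Real.exp (κ * |eulerConst| + κ / r * C1) * Real.log y ^ κ *
    (1 / (σ₀ * Real.log y)) ^ (κ / r) with hM
  set 𝒳 : Finset (DirichletCharacter ℂ q) := Finset.univ.filter (fun χ =>
    ∃ σ t : ℝ, σ₀ ≤ σ ∧ |t| ≤ T ∧ M < ‖LSeries (charTwist f χ) ⟨1 + σ, t⟩‖) with h𝒳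
  refine ⟨𝒳, ?_, ?_⟩
  swap
  · intro χ hχ σ t hσ ht
    by_contra hc
    exact hχ (Finset.mem_filter.2 ⟨Finset.mem_univ _, σ, t, hσ, ht, not_le.1 hc⟩)
  by_contra hcard
  obtain ⟨S, hS𝒳, hScard⟩ := Finset.exists_subset_card_eq (show J + 1 ≤ 𝒳.card by omega)
  have hprop : ∀ χ ∈ S, ∃ σ t : ℝ, σ₀ ≤ σ ∧ |t| ≤ T ∧ M < ‖LSeries (charTwist f χ) ⟨1 + σ, t⟩‖ :=
    fun χ hχ => (Finset.mem_filter.1 (hS𝒳 hχ)).2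
  choose! σ t hσ ht hbig using hprop
  set ℓ := Real.log (1 / (σ₀ * Real.log y)) with hℓ
  have hprod : σ₀ * Real.log y ≤ 1 := by rwa [le_div_iff₀ (by linarith)] at hσ₀'
  have hℓ0 : 0 ≤ ℓ := Real.log_nonneg (by rw [le_div_iff₀ (by positivity)]; linarith)
  set R : DirichletCharacter ℂ q → ℝ := fun χ =>
    (LSeries (tailCoeff y (logCoeff (charTwist Λf χ))) ⟨1 + σ χ, t χ⟩).re with hR
  have hsumtail : ∀ {a : ℕ → ℂ} {c σ' : ℝ} (t' : ℝ), (∀ n, ‖a n‖ ≤ c * logZetaCoeff n) → 0 < σ' →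
      Summable (LSeries.term (tailCoeff y a) ⟨1 + σ', t'⟩) := by
    intro a c σ' t' ha hσ'
    refine Summable.of_norm_bounded ((summable_logZetaCoeff hσ').mul_left c) (fun n => ?_)
    refine norm_term_le_of_norm_le (fun m => ?_) σ' rfl n
    unfold tailCoeff
    split_ifs
    · exact ha m
    · rw [norm_zero]; exact (norm_nonneg _).trans (ha m)
  have hs1 : ∀ χ ∈ S, Summable (LSeries.term (tailCoeff y (logCoeff (charTwist Λf χ))) ⟨1 + σ χ, t χ⟩) :=
    fun χ hχ => hsumtail _ (hf.twist_inv χ).norm_logCoeff_le (hσ₀.trans_le (hσ χ hχ))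
  have hs2 : ∀ χ ∈ S, ∀ χ' ∈ S, Summable (LSeries.term (tailCoeff y (charLogCoeff (χ⁻¹ * χ')))
          ⟨1 + (σ χ + σ χ' - σ₀), t χ - t χ'⟩) :=
    fun χ hχ χ' hχ' => hsumtail _ (norm_charLogCoeff_le _) (by linarith [hσ χ hχ, hσ χ' hχ'])
  have hsA : Summable (fun n : ℕ => if y < n then logZetaCoeff n / n * (n : ℝ) ^ (-σ₀) else 0) := by
    refine Summable.of_nonneg_of_le (fun n => ?_) (fun n => ?_) (summable_logZetaCoeff hσ₀)
    all_goals
      have := logZetaCoeff_nonneg n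
      split_ifs
      all_goals first | positivity | exact le_rfl
  have hs1' := summable_sum hs1
  have hs2' := summable_sum (fun χ hχ => summable_sum (hs2 χ hχ))
  have htotal : ∑ χ ∈ S, R χ ≤ κ / 2 * (r * (ℓ + 51) +
      1 / r * ((J + 1) * (ℓ + 51) + (J + 1) * (J + 1) * 160)) := by
    have h1 : ∑ χ ∈ S, R χ = ∑' n, (∑ χ ∈ S,
        LSeries.term (tailCoeff y (logCoeff (charTwist Λf χ))) ⟨1 + σ χ, t χ⟩ n).re := by
      rw [← Complex.re_tsum (by simpa using hs1'), Summable.tsum_finsetSum hs1, Complex.re_sum]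
      rfl
    have h2 : (∑' n, ∑ χ ∈ S, ∑ χ' ∈ S, LSeries.term (tailCoeff y (charLogCoeff (χ⁻¹ * χ')))
          ⟨1 + (σ χ + σ χ' - σ₀), t χ - t χ'⟩ n).re ≤ (J + 1) * (ℓ + 51) + (J + 1) * (J + 1) * 160 := by
      rw [Summable.tsum_finsetSum (fun χ hχ => by simpa using summable_sum (hs2 χ hχ)), Complex.re_sum]
      have h3 : ∀ χ ∈ S, (∑' n, ∑ χ' ∈ S, LSeries.term (tailCoeff y (charLogCoeff (χ⁻¹ * χ')))
          ⟨1 + (σ χ + σ χ' - σ₀), t χ - t χ'⟩ n).re ≤ (ℓ + 51) + (J + 1) * 160 := by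
        intro χ hχ
        rw [Summable.tsum_finsetSum (hs2 χ hχ), Complex.re_sum]
        calc ∑ χ' ∈ S, (∑' n, LSeries.term (tailCoeff y (charLogCoeff (χ⁻¹ * χ')))
              ⟨1 + (σ χ + σ χ' - σ₀), t χ - t χ'⟩ n).re
            ≤ ∑ χ' ∈ S, ((if χ' = χ then ℓ + 51 else 0) + 160) := by
              apply Finset.sum_le_sum
              intro χ' hχ'
              have hp : σ₀ ≤ σ χ + σ χ' - σ₀ := by linarith [hσ χ hχ, hσ χ' hχ']
              split_ifs with h
              · have := norm_LSeries_tail_le zero_le_one (norm_charLogCoeff_le (χ⁻¹ * χ'))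
                  (hσ₀.trans_le hp) (fun T hT => tail_mono_bound hy hσ₀ hσ₀' hp T hT)
                  (s := ⟨1 + (σ χ + σ χ' - σ₀), t χ - t χ'⟩) rfl
                rw [one_mul] at this
                exact ((Complex.re_le_norm _).trans this).trans (by linarith)
              · rw [zero_add]
                apply re_charLog_tail_le hq _ hy _ (hσ₀.trans_le hp)
                · rw [Ne, inv_mul_eq_one]; exact fun h' => h h'.symm
                · refine le_trans ?_ hyT
                  gcongr
                  have h4 : |t χ - t χ'| ≤ |t χ| + |t χ'| := abs_sub _ _
                  linarith [ht χ hχ, ht χ' hχ']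
          _ = _ := by
              rw [Finset.sum_add_distrib, Finset.sum_ite_eq' S χ, if_pos hχ, Finset.sum_const, hScard]
              simp
      refine (Finset.sum_le_sum h3).trans (le_of_eq ?_)
      rw [Finset.sum_const, hScard, nsmul_eq_mul]
      push_cast; ring
    have h5 : ∑' n : ℕ, (if y < n then logZetaCoeff n / n * (n : ℝ) ^ (-σ₀) else 0) ≤ ℓ + 51 :=
      tsum_tail_le hσ₀ (fun T hT => sum_tail_log_of_le hy hσ₀ hσ₀' T hT)
    rw [h1]
    have hs2'' : Summable (fun n => (∑ χ ∈ S, ∑ χ' ∈ S, LSeries.term (tailCoeff y (charLogCoeff (χ⁻¹ * χ')))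
          ⟨1 + (σ χ + σ χ' - σ₀), t χ - t χ'⟩ n).re) := by
      have := Complex.reCLM.summable hs2'
      simpa using this
    have hs1'' : Summable (fun n => (∑ χ ∈ S,
        LSeries.term (tailCoeff y (logCoeff (charTwist Λf χ))) ⟨1 + σ χ, t χ⟩ n).re) := by
      have := Complex.reCLM.summable hs1'
      simpa using this
    have h6 := Summable.tsum_le_tsum (fun n => re_sum_term_le hκ hf S σ t y σ₀ hr0 n) hs1''
      (((hsA.mul_left r).add (hs2''.mul_left (1 / r))).mul_left (κ / 2))
    refine h6.trans ?_
    rw [tsum_mul_left, (hsA.mul_left r).tsum_add (hs2''.mul_left (1 / r)), tsum_mul_left, tsum_mul_left,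
      ← Complex.re_tsum (by simpa using hs2')]
    gcongr
  have htotal' : ∑ χ ∈ S, R χ ≤ ∑ χ ∈ S, (κ / r * (ℓ + C1)) := by
    refine htotal.trans (le_of_eq ?_)
    rw [Finset.sum_const, hScard, nsmul_eq_mul]
    push_cast
    rw [← hr2, hC1, ← hr2]
    field_simp
    ring
  have hSne : S.Nonempty := Finset.card_pos.1 (by omega)
  obtain ⟨χ, hχ, hle⟩ := Finset.exists_le_of_sum_le hSne htotal'
  have h7 := norm_LSeries_le_tail hκ (hf.twist_inv χ) (y := y) (by linarith) (hσ₀.trans_le (hσ χ hχ)) (t χ)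
  have h8 := hbig χ hχ
  have h9 : ‖LSeries (charTwist f χ) ⟨1 + σ χ, t χ⟩‖ ≤ M := by
    refine h7.trans ?_
    rw [hM, Real.rpow_def_of_pos (show 0 < 1 / (σ₀ * Real.log y) by positivity), ← hℓ]
    calc Real.exp (κ * eulerConst) * Real.log y ^ κ * Real.exp (R χ)
        ≤ Real.exp (κ * |eulerConst|) * Real.log y ^ κ * Real.exp (κ / r * (ℓ + C1)) := by
          gcongr
          exact le_abs_self _
      _ = _ := by
          rw [Real.exp_add, show κ / r * (ℓ + C1) = κ / r * C1 + ℓ * (κ / r) by ring, Real.exp_add]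
          ring
  linarith

lemma integrable_cexp_mul_exp_abs {c : ℝ} (hc : 0 < c) (w : ℝ) :
    IntegrableOn (fun v : ℝ => cexp (↑(-2 * Real.pi * v * w) * I) • (Real.exp (-c * |v|) : ℂ)) (Set.Ioi 0) ∧
    IntegrableOn (fun v : ℝ => cexp (↑(-2 * Real.pi * v * w) * I) • (Real.exp (-c * |v|) : ℂ)) (Set.Iic 0) ∧
    ∫ v in Set.Ioi 0, cexp (↑(-2 * Real.pi * v * w) * I) • (Real.exp (-c * |v|) : ℂ) =
      1 / (c + 2 * Real.pi * w * I) ∧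
    ∫ v in Set.Iic 0, cexp (↑(-2 * Real.pi * v * w) * I) • (Real.exp (-c * |v|) : ℂ) =
      1 / (c - 2 * Real.pi * w * I) := by
  set a : ℂ := -(c + 2 * Real.pi * w * I) with ha
  set b : ℂ := c - 2 * Real.pi * w * I with hb
  have har : a.re < 0 := by simp [ha, hc]
  have hbr : 0 < b.re := by simp [hb, hc]
  have h1 : Set.EqOn (fun v : ℝ => cexp (↑(-2 * Real.pi * v * w) * I) • (Real.exp (-c * |v|) : ℂ))
      (fun v : ℝ => cexp (a * v)) (Set.Ioi 0) := by
    intro v hv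
    simp only [smul_eq_mul]
    rw [abs_of_pos hv, Complex.ofReal_exp, ← Complex.exp_add]
    congr 1
    rw [ha]; push_cast; ring
  have h2 : Set.EqOn (fun v : ℝ => cexp (↑(-2 * Real.pi * v * w) * I) • (Real.exp (-c * |v|) : ℂ))
      (fun v : ℝ => cexp (b * v)) (Set.Iic 0) := by
    intro v hv
    simp only [smul_eq_mul]
    rw [abs_of_nonpos hv, Complex.ofReal_exp, ← Complex.exp_add]
    congr 1
    rw [hb]; push_cast; ring
  refine ⟨(integrableOn_congr_fun h1 measurableSet_Ioi).2 (integrableOn_exp_mul_complex_Ioi har 0),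
    (integrableOn_congr_fun h2 measurableSet_Iic).2 (integrableOn_exp_mul_complex_Iic hbr 0), ?_, ?_⟩
  · rw [setIntegral_congr_fun measurableSet_Ioi h1, integral_exp_mul_complex_Ioi har, ha]
    rw [Complex.ofReal_zero, mul_zero, Complex.exp_zero, neg_div_neg_eq]
  · rw [setIntegral_congr_fun measurableSet_Iic h2, integral_exp_mul_complex_Iic hbr]
    simp

lemma integrable_inv_sq_add_sq {c : ℝ} (hc : 0 < c) : Integrable (fun t : ℝ => 1 / (c ^ 2 + t ^ 2)) := by
  have h := (integrable_inv_one_add_sq.comp_div hc.ne').const_mul (1 / c ^ 2)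
  refine h.congr (Filter.Eventually.of_forall fun t => ?_)
  simp only
  have : c ^ 2 + t ^ 2 ≠ 0 := by positivity
  field_simp

lemma integral_univ_inv_sq_add_sq {c : ℝ} (hc : 0 < c) : ∫ t : ℝ, 1 / (c ^ 2 + t ^ 2) = Real.pi / c := by
  have h : (fun t : ℝ => 1 / (c ^ 2 + t ^ 2)) = fun t : ℝ => 1 / c ^ 2 * (1 + (t / c) ^ 2)⁻¹ := by
    ext t
    have : c ^ 2 + t ^ 2 ≠ 0 := by positivity
    field_simp
  rw [h, integral_const_mul, Measure.integral_comp_div (fun t : ℝ => (1 + t ^ 2)⁻¹) c,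
    integral_univ_inv_one_add_sq, abs_of_pos hc, smul_eq_mul]
  field_simp

theorem integral_cexp_div_sq_add_sq {c : ℝ} (hc : 0 < c) (x : ℝ) :
    ∫ t : ℝ, cexp (↑(t * x) * I) * ((1 / (c ^ 2 + t ^ 2) : ℝ) : ℂ) =
      ((Real.pi / c * Real.exp (-c * |x|) : ℝ) : ℂ) := by
  set g : ℝ → ℂ := fun v => (Real.exp (-c * |v|) : ℂ) with hg
  have hF : FourierTransform.fourier g =
      fun w : ℝ => ((2 * c * (1 / (c ^ 2 + (2 * Real.pi * w) ^ 2)) : ℝ) : ℂ) := by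
    ext w
    obtain ⟨i1, i2, e1, e2⟩ := integrable_cexp_mul_exp_abs hc w
    rw [Real.fourier_real_eq_integral_exp_smul, ← setIntegral_univ, ← Set.Iic_union_Ioi (a := (0 : ℝ)),
      setIntegral_union (Set.Iic_disjoint_Ioi le_rfl) measurableSet_Ioi i2 i1, e1, e2]
    have h1 : (c : ℂ) + 2 * Real.pi * w * I ≠ 0 := by
      intro h; have := congrArg Complex.re h; simp at this; linarith
    have h2 : (c : ℂ) - 2 * Real.pi * w * I ≠ 0 := by
      intro h; have := congrArg Complex.re h; simp at this; linarith
    have h3 : (c : ℂ) ^ 2 + (2 * Real.pi * w) ^ 2 ≠ 0 := by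
      have : ((c ^ 2 + (2 * Real.pi * w) ^ 2 : ℝ) : ℂ) ≠ 0 := by
        rw [Complex.ofReal_ne_zero]; positivity
      push_cast at this; exact this
    push_cast
    have h4 : (c : ℂ) ^ 2 + (2 * Real.pi * w) ^ 2 = (c - 2 * Real.pi * w * I) * (c + 2 * Real.pi * w * I) := by
      have := Complex.I_sq
      linear_combination (2 * Real.pi * w : ℂ) ^ 2 * this
    rw [h4]
    field_simp
    ring
  have hgint : Integrable g := by
    obtain ⟨i1, i2, -, -⟩ := integrable_cexp_mul_exp_abs hc 0
    have h : IntegrableOn (fun v : ℝ => cexp (↑(-2 * Real.pi * v * 0) * I) • (Real.exp (-c * |v|) : ℂ))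
        (Set.Iic 0 ∪ Set.Ioi 0) := i2.union i1
    rw [Set.Iic_union_Ioi, integrableOn_univ] at h
    simpa [hg] using h
  have hFint : Integrable (FourierTransform.fourier g) := by
    rw [hF]
    have h := (((integrable_inv_sq_add_sq hc).comp_mul_left' (show (2 * Real.pi) ≠ 0 by positivity)).const_mul
      (2 * c)).ofReal (𝕜 := ℂ)
    exact h
  have hcont : ContinuousAt g x := by
    apply Continuous.continuousAt
    fun_prop
  have h := hgint.fourierInv_fourier_eq hFint hcont
  rw [Real.fourierInv_eq', hF] at h
  have h5 := Measure.integral_comp_mul_left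
    (fun t : ℝ => cexp (↑(t * x) * I) * ((1 / (c ^ 2 + t ^ 2) : ℝ) : ℂ)) (2 * Real.pi)
  have h6 : ∫ v : ℝ, cexp (↑(2 * Real.pi * inner ℝ v x) * I) •
      ((2 * c * (1 / (c ^ 2 + (2 * Real.pi * v) ^ 2)) : ℝ) : ℂ) =
      2 * c * ∫ v : ℝ, cexp (↑((2 * Real.pi * v) * x) * I) * ((1 / (c ^ 2 + (2 * Real.pi * v) ^ 2) : ℝ) : ℂ) := by
    rw [← integral_const_mul]
    congr 1
    ext v
    rw [smul_eq_mul]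
    simp only [RCLike.inner_apply, conj_trivial, Complex.ofReal_mul]
    push_cast
    ring_nf
  rw [h6, h5] at h
  rw [abs_of_pos (by positivity), Complex.real_smul] at h
  have hpi : (Real.pi : ℂ) ≠ 0 := by exact_mod_cast Real.pi_ne_zero
  have hcc : (c : ℂ) ≠ 0 := by exact_mod_cast hc.ne'
  rw [hg] at h
  generalize (∫ t : ℝ, cexp (↑(t * x) * I) * ((1 / (c ^ 2 + t ^ 2) : ℝ) : ℂ)) = W at h ⊢
  push_cast at h ⊢
  rw [← h]
  field_simp

/-- The integral of `u ^ (-1 - 2 * c)` over `[v, v + 1]`. -/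
def planchWeight (c : ℝ) (v : ℕ) : ℝ := ((v : ℝ) ^ (-(2 * c)) - ((v + 1 : ℕ) : ℝ) ^ (-(2 * c))) / (2 * c)

lemma planchWeight_nonneg {c : ℝ} (hc : 0 < c) {v : ℕ} (hv : 1 ≤ v) : 0 ≤ planchWeight c v := by
  unfold planchWeight
  have hv' : (0 : ℝ) < v := by exact_mod_cast hv
  apply div_nonneg _ (by linarith)
  rw [sub_nonneg]
  apply Real.rpow_le_rpow_of_nonpos hv' (by push_cast; linarith) (by linarith)

lemma planchWeight_eq {c : ℝ} (hc : 0 < c) {v : ℕ} (hv : 1 ≤ v) :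
    planchWeight c v = ∫ u in (v : ℝ)..((v + 1 : ℕ) : ℝ), u ^ (-1 - 2 * c) := by
  have hv' : (0 : ℝ) < v := by exact_mod_cast hv
  rw [integral_rpow]
  · unfold planchWeight
    rw [show -1 - 2 * c + 1 = -(2 * c) by ring]
    rw [div_neg, ← neg_div]
    ring
  · right
    refine ⟨by linarith, ?_⟩
    rw [Set.uIcc_of_le (by push_cast; linarith)]
    intro h
    linarith [h.1]

lemma planchWeight_le {c : ℝ} (hc : 0 < c) {v : ℕ} (hv : 1 ≤ v) :
    planchWeight c v ≤ (v : ℝ) ^ (-1 - 2 * c) := by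
  have hv' : (0 : ℝ) < v := by exact_mod_cast hv
  rw [planchWeight_eq hc hv]
  have hle : (v : ℝ) ≤ ((v + 1 : ℕ) : ℝ) := by push_cast; linarith
  calc _ ≤ ∫ u in (v : ℝ)..((v + 1 : ℕ) : ℝ), (v : ℝ) ^ (-1 - 2 * c) := by
        apply intervalIntegral.integral_mono_on hle _ intervalIntegrable_const
        · intro u hu
          exact Real.rpow_le_rpow_of_nonpos hv' hu.1 (by linarith)
        · apply intervalIntegral.intervalIntegrable_rpow
          right
          rw [Set.uIcc_of_le hle]
          intro h
          linarith [h.1]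
    _ = _ := by rw [intervalIntegral.integral_const]; push_cast; simp

lemma le_planchWeight {c : ℝ} (hc : 0 < c) {v : ℕ} (hv : 1 ≤ v) :
    ((v : ℝ) + 1) ^ (-1 - 2 * c) ≤ planchWeight c v := by
  have hv' : (0 : ℝ) < v := by exact_mod_cast hv
  rw [planchWeight_eq hc hv]
  have hle : (v : ℝ) ≤ ((v + 1 : ℕ) : ℝ) := by push_cast; linarith
  calc _ = ∫ u in (v : ℝ)..((v + 1 : ℕ) : ℝ), ((v : ℝ) + 1) ^ (-1 - 2 * c) := by
        rw [intervalIntegral.integral_const]; push_cast; simp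
    _ ≤ _ := by
        apply intervalIntegral.integral_mono_on hle intervalIntegrable_const
        · apply intervalIntegral.intervalIntegrable_rpow
          right
          rw [Set.uIcc_of_le hle]
          intro h
          linarith [h.1]
        · intro u hu
          have := hu.2
          push_cast at this
          exact Real.rpow_le_rpow_of_nonpos (by linarith [hu.1]) this (by linarith)

lemma hasSum_planchWeight {c : ℝ} (hc : 0 < c) {k : ℕ} (hk : 1 ≤ k) :
    HasSum (fun v : ℕ => if k ≤ v then planchWeight c v else 0) ((k : ℝ) ^ (-(2 * c)) / (2 * c)) := by
  rw [hasSum_iff_tendsto_nat_of_nonneg]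
  swap
  · intro v
    split_ifs with h
    · exact planchWeight_nonneg hc (by omega)
    · exact le_rfl
  have h1 : ∀ M, k ≤ M → ∑ v ∈ Finset.range M, (if k ≤ v then planchWeight c v else 0) =
      ((k : ℝ) ^ (-(2 * c)) - (M : ℝ) ^ (-(2 * c))) / (2 * c) := by
    intro M hM
    induction M, hM using Nat.le_induction with
    | base =>
      rw [sub_self, zero_div]
      apply Finset.sum_eq_zero
      intro v hv
      rw [Finset.mem_range] at hv
      rw [if_neg (by omega)]
    | succ M hM ih =>
      rw [Finset.sum_range_succ, ih, if_pos hM]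
      unfold planchWeight
      ring
  have h2 : Filter.Tendsto (fun M : ℕ => ((k : ℝ) ^ (-(2 * c)) - (M : ℝ) ^ (-(2 * c))) / (2 * c))
      Filter.atTop (nhds (((k : ℝ) ^ (-(2 * c)) - 0) / (2 * c))) := by
    apply Filter.Tendsto.div_const
    apply Filter.Tendsto.const_sub
    exact (tendsto_rpow_neg_atTop (by linarith : 0 < 2 * c)).comp tendsto_natCast_atTop_atTop
  rw [sub_zero] at h2
  refine h2.congr' ?_
  filter_upwards [Filter.eventually_ge_atTop k] with M hM
  rw [h1 M hM]

lemma continuous_div_cpow (c : ℝ) {n : ℕ} (hn : n ≠ 0) (b : ℂ) :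
    Continuous (fun t : ℝ => b / (n : ℂ) ^ (⟨c, t⟩ : ℂ)) := by
  have hn0 : (n : ℂ) ≠ 0 := by exact_mod_cast hn
  have h : Continuous (fun t : ℝ => (⟨c, t⟩ : ℂ)) := by
    have : (fun t : ℝ => (⟨c, t⟩ : ℂ)) = fun t : ℝ => (c : ℂ) + t * I := by
      ext t; apply Complex.ext <;> simp
    rw [this]; fun_prop
  apply Continuous.div continuous_const
  · exact h.const_cpow (Or.inl hn0)
  · intro t
    simp [Complex.cpow_eq_zero_iff, hn0]

lemma integral_dirichlet_pair {c : ℝ} (hc : 0 < c) {n m : ℕ} (hn : n ≠ 0) (hm : m ≠ 0) (a b : ℂ) :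
    Integrable (fun t : ℝ => (a / (n : ℂ) ^ (⟨c, t⟩ : ℂ)) * (starRingEnd ℂ) (b / (m : ℂ) ^ (⟨c, t⟩ : ℂ)) *
      ((1 / (c ^ 2 + t ^ 2) : ℝ) : ℂ)) ∧
    ∫ t : ℝ, (a / (n : ℂ) ^ (⟨c, t⟩ : ℂ)) * (starRingEnd ℂ) (b / (m : ℂ) ^ (⟨c, t⟩ : ℂ)) *
      ((1 / (c ^ 2 + t ^ 2) : ℝ) : ℂ) =
      2 * Real.pi * (a * (starRingEnd ℂ) b * ((((max n m : ℕ) : ℝ) ^ (-(2 * c)) / (2 * c) : ℝ) : ℂ)) := by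
  have hn0 : (0 : ℝ) < n := by exact_mod_cast Nat.pos_of_ne_zero hn
  have hm0 : (0 : ℝ) < m := by exact_mod_cast Nat.pos_of_ne_zero hm
  constructor
  · have hcont : Continuous (fun t : ℝ => (a / (n : ℂ) ^ (⟨c, t⟩ : ℂ)) *
        (starRingEnd ℂ) (b / (m : ℂ) ^ (⟨c, t⟩ : ℂ))) :=
      (continuous_div_cpow c hn a).mul (Complex.continuous_conj.comp (continuous_div_cpow c hm b))
    refine (integrable_inv_sq_add_sq hc).ofReal (𝕜 := ℂ) |>.bdd_mul
      (c := ‖a‖ / (n : ℝ) ^ c * (‖b‖ / (m : ℝ) ^ c)) hcont.aestronglyMeasurable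
      (Filter.Eventually.of_forall fun t => ?_)
    rw [norm_mul, RCLike.norm_conj, norm_div, norm_div, Complex.norm_natCast_cpow_of_pos
      (Nat.pos_of_ne_zero hn), Complex.norm_natCast_cpow_of_pos (Nat.pos_of_ne_zero hm)]
  have key : ∀ t : ℝ, (a / (n : ℂ) ^ (⟨c, t⟩ : ℂ)) * (starRingEnd ℂ) (b / (m : ℂ) ^ (⟨c, t⟩ : ℂ)) *
      ((1 / (c ^ 2 + t ^ 2) : ℝ) : ℂ) = (a * (starRingEnd ℂ) b * (Real.exp (-c * (Real.log n + Real.log m)) : ℂ)) *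
        (cexp (↑(t * (Real.log m - Real.log n)) * I) * ((1 / (c ^ 2 + t ^ 2) : ℝ) : ℂ)) := by
    intro t
    have e : ∀ k : ℕ, k ≠ 0 → (k : ℂ) ^ (⟨c, t⟩ : ℂ) = cexp (Real.log k * (c + t * I)) := by
      intro k hk
      rw [Complex.cpow_def_of_ne_zero (by exact_mod_cast hk), Complex.natCast_log]
      congr 2
      apply Complex.ext <;> simp
    rw [map_div₀, e n hn, e m hm, ← Complex.exp_conj]
    simp only [map_mul, map_add, Complex.conj_ofReal, Complex.conj_I]
    rw [div_eq_mul_inv, div_eq_mul_inv, ← Complex.exp_neg, ← Complex.exp_neg, Complex.ofReal_exp]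
    have : cexp (-(Real.log n * (c + t * I))) * cexp (-(Real.log m * (c + t * -I))) =
      cexp ((-c * (Real.log n + Real.log m) : ℝ) : ℂ) * cexp (↑(t * (Real.log m - Real.log n)) * I) := by
      rw [← Complex.exp_add, ← Complex.exp_add]
      congr 1
      push_cast
      ring
    linear_combination (a * (starRingEnd ℂ) b * ((1 / (c ^ 2 + t ^ 2) : ℝ) : ℂ)) * this
  simp_rw [key]
  rw [integral_const_mul, integral_cexp_div_sq_add_sq hc]
  have h2 : Real.exp (-c * (Real.log n + Real.log m)) * (Real.pi / c * Real.exp (-c * |Real.log m - Real.log n|)) =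
      2 * Real.pi * (((max n m : ℕ) : ℝ) ^ (-(2 * c)) / (2 * c)) := by
    have h3 : Real.log ((max n m : ℕ) : ℝ) * 2 = Real.log n + Real.log m + |Real.log m - Real.log n| := by
      rcases le_total n m with h | h
      · have : Real.log n ≤ Real.log m := Real.log_le_log hn0 (by exact_mod_cast h)
        rw [max_eq_right h, abs_of_nonneg (by linarith)]; ring
      · have : Real.log m ≤ Real.log n := Real.log_le_log hm0 (by exact_mod_cast h)
        rw [max_eq_left h, abs_of_nonpos (by linarith)]; ring
    have hk : (0 : ℝ) < ((max n m : ℕ) : ℝ) := by exact_mod_cast lt_max_of_lt_left (Nat.pos_of_ne_zero hn)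
    rw [Real.rpow_def_of_pos hk, show Real.log ((max n m : ℕ) : ℝ) * -(2 * c) =
      -c * (Real.log ((max n m : ℕ) : ℝ) * 2) by ring, h3]
    generalize Real.log n + Real.log m = L
    rw [mul_add, Real.exp_add]
    field_simp
  have h4 : ((Real.exp (-c * (Real.log n + Real.log m)) *
      (Real.pi / c * Real.exp (-c * |Real.log m - Real.log n|)) : ℝ) : ℂ) =
      ((2 * Real.pi * (((max n m : ℕ) : ℝ) ^ (-(2 * c)) / (2 * c)) : ℝ) : ℂ) := by rw [h2]
  push_cast at h4 ⊢
  linear_combination (a * (starRingEnd ℂ) b) * h4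

/-- Plancherel's identity for finite Dirichlet polynomials. -/
theorem hasSum_plancherel {c : ℝ} (hc : 0 < c) (b : ℕ → ℂ) (N : ℕ) :
    HasSum (fun v : ℕ => ‖∑ n ∈ Finset.Icc 1 (min v N), b n‖ ^ 2 * planchWeight c v)
      (1 / (2 * Real.pi) * ∫ t : ℝ, ‖∑ n ∈ Finset.Icc 1 N, b n / (n : ℂ) ^ (⟨c, t⟩ : ℂ)‖ ^ 2 *
        (1 / (c ^ 2 + t ^ 2))) := by
  rw [← Complex.hasSum_ofReal]
  have hI : ((1 / (2 * Real.pi) * ∫ t : ℝ, ‖∑ n ∈ Finset.Icc 1 N, b n / (n : ℂ) ^ (⟨c, t⟩ : ℂ)‖ ^ 2 *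
        (1 / (c ^ 2 + t ^ 2)) : ℝ) : ℂ) = ∑ n ∈ Finset.Icc 1 N, ∑ m ∈ Finset.Icc 1 N,
      b n * (starRingEnd ℂ) (b m) * ((((max n m : ℕ) : ℝ) ^ (-(2 * c)) / (2 * c) : ℝ) : ℂ) := by
    have e1 : ∀ t : ℝ, ((‖∑ n ∈ Finset.Icc 1 N, b n / (n : ℂ) ^ (⟨c, t⟩ : ℂ)‖ ^ 2 *
        (1 / (c ^ 2 + t ^ 2)) : ℝ) : ℂ) = ∑ n ∈ Finset.Icc 1 N, ∑ m ∈ Finset.Icc 1 N,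
        (b n / (n : ℂ) ^ (⟨c, t⟩ : ℂ)) * (starRingEnd ℂ) (b m / (m : ℂ) ^ (⟨c, t⟩ : ℂ)) *
          ((1 / (c ^ 2 + t ^ 2) : ℝ) : ℂ) := by
      intro t
      rw [Complex.ofReal_mul, ← Complex.normSq_eq_norm_sq, ← Complex.mul_conj, map_sum,
        Finset.sum_mul_sum, Finset.sum_mul]
      simp_rw [Finset.sum_mul]
    have hne : ∀ n ∈ Finset.Icc 1 N, n ≠ 0 := fun n hn => by rw [Finset.mem_Icc] at hn; omega
    rw [Complex.ofReal_mul, ← integral_complex_ofReal]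
    simp_rw [e1]
    rw [integral_finsetSum _ (fun n hn => integrable_finsetSum _ fun m hm =>
      (integral_dirichlet_pair hc (hne n hn) (hne m hm) _ _).1), Finset.mul_sum]
    apply Finset.sum_congr rfl
    intro n hn
    rw [integral_finsetSum _ (fun m hm => (integral_dirichlet_pair hc (hne n hn) (hne m hm) _ _).1), Finset.mul_sum]
    apply Finset.sum_congr rfl
    intro m hm
    rw [(integral_dirichlet_pair hc (hne n hn) (hne m hm) _ _).2]
    have hpi : (Real.pi : ℂ) ≠ 0 := by exact_mod_cast Real.pi_ne_zero
    push_cast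
    field_simp
  rw [hI]
  have hS : ∀ v : ℕ, ((‖∑ n ∈ Finset.Icc 1 (min v N), b n‖ ^ 2 * planchWeight c v : ℝ) : ℂ) =
      ∑ n ∈ Finset.Icc 1 N, ∑ m ∈ Finset.Icc 1 N,
        b n * (starRingEnd ℂ) (b m) * ((if max n m ≤ v then planchWeight c v else 0 : ℝ) : ℂ) := by
    intro v
    have e2 : ∑ n ∈ Finset.Icc 1 (min v N), b n = ∑ n ∈ Finset.Icc 1 N, if n ≤ v then b n else 0 := by
      rw [← Finset.sum_filter]
      apply Finset.sum_congr _ (fun _ _ => rfl)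
      ext n
      simp only [Finset.mem_Icc, Finset.mem_filter, le_min_iff]
      tauto
    rw [Complex.ofReal_mul, ← Complex.normSq_eq_norm_sq, ← Complex.mul_conj, e2, map_sum,
      Finset.sum_mul_sum, Finset.sum_mul]
    apply Finset.sum_congr rfl
    intro n _
    rw [Finset.sum_mul]
    apply Finset.sum_congr rfl
    intro m _
    by_cases h1 : n ≤ v <;> by_cases h2 : m ≤ v <;> simp [h1, h2]
  simp_rw [hS]
  apply hasSum_sum
  intro n hn
  apply hasSum_sum
  intro m hm
  apply HasSum.mul_left
  rw [Complex.hasSum_ofReal]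
  exact hasSum_planchWeight hc (by rw [Finset.mem_Icc] at hn; exact hn.1.trans (le_max_left _ _))

lemma continuous_dirichletPoly (c : ℝ) (b : ℕ → ℂ) (N : ℕ) :
    Continuous (fun t : ℝ => ∑ n ∈ Finset.Icc 1 N, b n / (n : ℂ) ^ (⟨c, t⟩ : ℂ)) := by
  apply continuous_finsetSum
  intro n hn
  exact continuous_div_cpow c (by rw [Finset.mem_Icc] at hn; omega) _

lemma norm_dirichletPoly_le (c t : ℝ) (b : ℕ → ℂ) (N : ℕ) :
    ‖∑ n ∈ Finset.Icc 1 N, b n / (n : ℂ) ^ (⟨c, t⟩ : ℂ)‖ ≤ ∑ n ∈ Finset.Icc 1 N, ‖LSeries.term b c n‖ := by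
  apply norm_sum_le_of_le
  intro n hn
  have hn0 : n ≠ 0 := by rw [Finset.mem_Icc] at hn; omega
  rw [LSeries.term_of_ne_zero hn0, norm_div, norm_div,
    Complex.norm_natCast_cpow_of_pos (Nat.pos_of_ne_zero hn0),
    Complex.norm_natCast_cpow_of_pos (Nat.pos_of_ne_zero hn0), Complex.ofReal_re]

lemma integrable_dirichletPoly {c : ℝ} (hc : 0 < c) (b : ℕ → ℂ) (N : ℕ) :
    Integrable (fun t : ℝ => ‖∑ n ∈ Finset.Icc 1 N, b n / (n : ℂ) ^ (⟨c, t⟩ : ℂ)‖ ^ 2 * (1 / (c ^ 2 + t ^ 2))) := by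
  refine (integrable_inv_sq_add_sq hc).bdd_mul (c := (∑ n ∈ Finset.Icc 1 N, ‖LSeries.term b c n‖) ^ 2)
    ((continuous_dirichletPoly c b N).norm.pow 2).aestronglyMeasurable
    (Filter.Eventually.of_forall fun t => ?_)
  rw [norm_pow, norm_norm]
  gcongr
  exact norm_dirichletPoly_le c t b N

theorem sum_plancherel_le {c : ℝ} (hc : 0 < c) {b : ℕ → ℂ} (hb : LSeriesSummable b (c : ℂ)) (V : ℕ) :
    ∑ v ∈ Finset.range (V + 1), ‖∑ n ∈ Finset.Icc 1 v, b n‖ ^ 2 * planchWeight c v ≤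
      1 / (2 * Real.pi) * ∫ t : ℝ, ‖LSeries b ⟨c, t⟩‖ ^ 2 * (1 / (c ^ 2 + t ^ 2)) := by
  have hbt : ∀ t : ℝ, LSeriesSummable b ⟨c, t⟩ := fun t => hb.of_re_le_re (by simp)
  set A : ℝ := ∑' n, ‖LSeries.term b c n‖ with hA
  have hlim : Filter.Tendsto (fun N : ℕ => ∫ t : ℝ, ‖∑ n ∈ Finset.Icc 1 N, b n / (n : ℂ) ^ (⟨c, t⟩ : ℂ)‖ ^ 2 *
        (1 / (c ^ 2 + t ^ 2))) Filter.atTop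
        (nhds (∫ t : ℝ, ‖LSeries b ⟨c, t⟩‖ ^ 2 * (1 / (c ^ 2 + t ^ 2)))) := by
    apply tendsto_integral_of_dominated_convergence (fun t => A ^ 2 * (1 / (c ^ 2 + t ^ 2)))
    · intro N
      exact (integrable_dirichletPoly hc b N).aestronglyMeasurable
    · exact (integrable_inv_sq_add_sq hc).const_mul _
    · intro N
      refine Filter.Eventually.of_forall fun t => ?_
      rw [Real.norm_of_nonneg (by positivity)]
      gcongr
      exact (norm_dirichletPoly_le c t b N).trans (hb.norm.sum_le_tsum _ (fun _ _ => norm_nonneg _))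
    · refine Filter.Eventually.of_forall fun t => ?_
      apply Filter.Tendsto.mul_const
      apply Filter.Tendsto.pow
      apply Filter.Tendsto.norm
      have h1 := ((hbt t).hasSum.tendsto_sum_nat).comp (Filter.tendsto_add_atTop_nat 1)
      refine h1.congr fun N => ?_
      simp only [Function.comp]
      rw [Finset.range_eq_Ico, Finset.sum_eq_sum_Ico_succ_bot (Nat.succ_pos N), LSeries.term_zero, zero_add]
      apply Finset.sum_congr (by ext n; simp only [Finset.mem_Ico, Finset.mem_Icc]; omega)
      intro n hn
      rw [LSeries.term_of_ne_zero (by rw [Finset.mem_Icc] at hn; omega)]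
  have h2 := hlim.const_mul (1 / (2 * Real.pi))
  refine ge_of_tendsto h2 ?_
  filter_upwards [Filter.eventually_ge_atTop V] with N hN
  have h3 := hasSum_plancherel hc b N
  have h4 := sum_le_hasSum (Finset.range (V + 1)) (fun v _ => ?_) h3
  · refine le_trans (le_of_eq ?_) h4
    apply Finset.sum_congr rfl
    intro v hv
    rw [Finset.mem_range] at hv
    rw [min_eq_left (by omega)]
  · rcases Nat.eq_zero_or_pos v with rfl | hv
    · simp
    · have := planchWeight_nonneg hc hv
      positivity

/-- Mean square of the partial sums of a product of Dirichlet series. -/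
theorem sum_plancherel_mul_le {c M G T : ℝ} (hc : 1 < c) {p g : ℕ → ℂ} {D : ℕ}
    (hp : ∀ n, D < n → p n = 0) (hg : LSeriesSummable g (c : ℂ))
    (hT : c ≤ T) (hM : ∀ t : ℝ, |t| ≤ T → ‖LSeries g ⟨c, t⟩‖ ≤ M)
    (hG : ∀ t : ℝ, ‖∑ n ∈ Finset.Icc 1 D, p n / (n : ℂ) ^ (⟨c, t⟩ : ℂ)‖ * ‖LSeries g ⟨c, t⟩‖ ≤ G) (V : ℕ) :
    ∑ v ∈ Finset.range (V + 1), ‖∑ n ∈ Finset.Icc 1 v, LSeries.convolution p g n‖ ^ 2 * planchWeight c v ≤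
      M ^ 2 * ∑' v : ℕ, ‖∑ n ∈ Finset.Icc 1 (min v D), p n‖ ^ 2 * planchWeight c v + G ^ 2 / T := by
  have hc0 : 0 < c := by linarith
  have hT0 : 0 < T := by linarith
  have hps : ∀ s : ℂ, HasSum (LSeries.term p s) (∑ n ∈ Finset.Icc 1 D, p n / (n : ℂ) ^ s) := by
    intro s
    have h1 : HasSum (LSeries.term p s) (∑ n ∈ Finset.Icc 1 D, LSeries.term p s n) := by
      apply hasSum_sum_of_ne_finset_zero
      intro n hn
      rcases Nat.eq_zero_or_pos n with rfl | hn0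
      · simp
      · rw [LSeries.term_of_ne_zero hn0.ne', hp n (by rw [Finset.mem_Icc] at hn; omega), zero_div]
    convert! h1 using 1
    apply Finset.sum_congr rfl
    intro n hn
    rw [LSeries.term_of_ne_zero (by rw [Finset.mem_Icc] at hn; omega)]
  have hconv : LSeriesSummable (LSeries.convolution p g) (c : ℂ) :=
    LSeriesSummable.convolution (hps _).summable hg
  have hL : ∀ t : ℝ, LSeries (LSeries.convolution p g) ⟨c, t⟩ =
      (∑ n ∈ Finset.Icc 1 D, p n / (n : ℂ) ^ (⟨c, t⟩ : ℂ)) * LSeries g ⟨c, t⟩ := by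
    intro t
    rw [LSeries_convolution' (hps _).summable (hg.of_re_le_re (by simp)), LSeries, (hps _).tsum_eq]
  refine (sum_plancherel_le hc0 hconv V).trans ?_
  rw [(hasSum_plancherel hc0 p D).tsum_eq]
  have hpi := Real.pi_pos
  calc 1 / (2 * Real.pi) * ∫ t : ℝ, ‖LSeries (LSeries.convolution p g) ⟨c, t⟩‖ ^ 2 * (1 / (c ^ 2 + t ^ 2))
      ≤ 1 / (2 * Real.pi) * ∫ t : ℝ, (M ^ 2 * (‖∑ n ∈ Finset.Icc 1 D, p n / (n : ℂ) ^ (⟨c, t⟩ : ℂ)‖ ^ 2 *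
          (1 / (c ^ 2 + t ^ 2))) + (2 * G ^ 2) * (1 / (T ^ 2 + t ^ 2))) := by
        apply mul_le_mul_of_nonneg_left _ (by positivity)
        apply integral_mono_of_nonneg
        · exact Filter.Eventually.of_forall fun t => by simp only [Pi.zero_apply]; positivity
        · exact ((integrable_dirichletPoly hc0 p D).const_mul _).add
            ((integrable_inv_sq_add_sq hT0).const_mul _)
        · refine Filter.Eventually.of_forall fun t => ?_
          simp only
          rw [hL, norm_mul, mul_pow]
          by_cases ht : |t| ≤ T
          · have h1 := hM t ht
            calc _ ≤ ‖∑ n ∈ Finset.Icc 1 D, p n / (n : ℂ) ^ (⟨c, t⟩ : ℂ)‖ ^ 2 * M ^ 2 * (1 / (c ^ 2 + t ^ 2)) := by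
                  gcongr
              _ = M ^ 2 * (‖∑ n ∈ Finset.Icc 1 D, p n / (n : ℂ) ^ (⟨c, t⟩ : ℂ)‖ ^ 2 * (1 / (c ^ 2 + t ^ 2))) := by ring
              _ ≤ _ := le_add_of_nonneg_right (by positivity)
          · have h1 := hG t
            have h2 : 1 / (c ^ 2 + t ^ 2) ≤ 2 * (1 / (T ^ 2 + t ^ 2)) := by
              have : T ^ 2 ≤ t ^ 2 := by rw [← sq_abs t]; gcongr; exact (not_le.1 ht).le
              rw [mul_one_div, div_le_div_iff₀ (by positivity) (by positivity)]
              nlinarith [sq_nonneg c]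
            have h3 : ‖∑ n ∈ Finset.Icc 1 D, p n / (n : ℂ) ^ (⟨c, t⟩ : ℂ)‖ ^ 2 * ‖LSeries g ⟨c, t⟩‖ ^ 2 ≤ G ^ 2 := by
              rw [← mul_pow]; gcongr
            calc _ ≤ G ^ 2 * (2 * (1 / (T ^ 2 + t ^ 2))) := by gcongr
              _ = 2 * G ^ 2 * (1 / (T ^ 2 + t ^ 2)) := by ring
              _ ≤ _ := le_add_of_nonneg_left (by positivity)
    _ = _ := by
        rw [integral_add ((integrable_dirichletPoly hc0 p D).const_mul _)
            ((integrable_inv_sq_add_sq hT0).const_mul _), integral_const_mul, integral_const_mul,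
          integral_univ_inv_sq_add_sq hT0]
        field_simp

lemma tsum_sq_planchWeight_le {α B : ℝ} (hα : 0 < α) (hα1 : α ≤ 1) {ι : Type*} (S : Finset ι)
    (p : ι → ℕ → ℂ) (D : ℕ) (hB : ∀ v : ℕ, ∑ i ∈ S, ‖∑ n ∈ Finset.Icc 1 (min v D), p i n‖ ^ 2 ≤ B * (v : ℝ) ^ 2) :
    ∑ i ∈ S, ∑' v : ℕ, ‖∑ n ∈ Finset.Icc 1 (min v D), p i n‖ ^ 2 * planchWeight (1 + α) v ≤ 16 * B / α := by
  have hB0 : 0 ≤ B := by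
    have := hB 1
    refine le_trans (Finset.sum_nonneg fun i _ => by positivity) (this.trans (by simp))
  have h1 : ∀ i ∈ S, Summable (fun v : ℕ => ‖∑ n ∈ Finset.Icc 1 (min v D), p i n‖ ^ 2 * planchWeight (1 + α) v) :=
    fun i _ => (hasSum_plancherel (by linarith) (p i) D).summable
  rw [← Summable.tsum_finsetSum h1]
  have h2 := (hasSum_planchWeight hα le_rfl).mul_left (32 * B)
  have h3 : ∀ v : ℕ, ∑ i ∈ S, ‖∑ n ∈ Finset.Icc 1 (min v D), p i n‖ ^ 2 * planchWeight (1 + α) v ≤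
      32 * B * (if 1 ≤ v then planchWeight α v else 0) := by
    intro v
    rcases Nat.eq_zero_or_pos v with rfl | hv
    · simp
    rw [if_pos (by omega), ← Finset.sum_mul]
    have hv1 : (1 : ℝ) ≤ v := by exact_mod_cast hv
    have hv0 : (0 : ℝ) < v := by linarith
    calc _ ≤ (B * (v : ℝ) ^ 2) * (v : ℝ) ^ (-1 - 2 * (1 + α)) := by
          gcongr
          · exact planchWeight_nonneg (by linarith) hv
          · exact hB v
          · exact planchWeight_le (by linarith) hv
      _ = B * (v : ℝ) ^ (-1 - 2 * α) := by
          rw [mul_assoc, ← Real.rpow_natCast, ← Real.rpow_add hv0]; congr 2; push_cast; ring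
      _ ≤ B * (32 * planchWeight α v) := by
          gcongr
          have h5 := le_planchWeight hα hv
          have h6 : ((v : ℝ) + 1) ^ (1 + 2 * α) ≤ 32 * (v : ℝ) ^ (1 + 2 * α) := by
            calc ((v : ℝ) + 1) ^ (1 + 2 * α) ≤ (2 * v) ^ (1 + 2 * α) := by gcongr; linarith
              _ = 2 ^ (1 + 2 * α) * (v : ℝ) ^ (1 + 2 * α) := Real.mul_rpow (by norm_num) hv0.le
              _ ≤ 2 ^ (5 : ℝ) * (v : ℝ) ^ (1 + 2 * α) := by gcongr <;> linarith
              _ = _ := by norm_num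
          have h7 : (v : ℝ) ^ (-1 - 2 * α) = 1 / (v : ℝ) ^ (1 + 2 * α) := by
            rw [one_div, ← Real.rpow_neg hv0.le]; congr 1; ring
          have h8 : ((v : ℝ) + 1) ^ (-1 - 2 * α) = 1 / ((v : ℝ) + 1) ^ (1 + 2 * α) := by
            rw [one_div, ← Real.rpow_neg (by linarith)]; congr 1; ring
          rw [h8] at h5
          rw [h7]
          refine le_trans ?_ (mul_le_mul_of_nonneg_left h5 (by norm_num))
          rw [mul_one_div, div_le_div_iff₀ (by positivity) (by positivity)]
          linarith
      _ = _ := by ring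
  have h4 := h2.summable
  refine (Summable.tsum_le_tsum h3 (summable_sum h1) h4).trans (le_of_eq ?_)
  rw [h2.tsum_eq]
  simp
  field_simp
  ring

/-- The vector of the values `χ⁻¹(n)`, `χ ∈ 𝒢`. -/
def charVec {q : ℕ} (𝒢 : Finset (DirichletCharacter ℂ q)) (n : ℕ) :
    EuclideanSpace ℂ {χ : DirichletCharacter ℂ q // χ ∈ 𝒢} := WithLp.toLp 2 (fun χ => χ.1⁻¹ (n : ZMod q))

lemma norm_sum_charVec_sq {q : ℕ} (𝒢 : Finset (DirichletCharacter ℂ q)) (a : ℕ → ℂ) (I : Finset ℕ) :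
    ‖∑ n ∈ I, a n • charVec 𝒢 n‖ ^ 2 = ∑ χ ∈ 𝒢, ‖∑ n ∈ I, charTwist a χ n‖ ^ 2 := by
  rw [EuclideanSpace.norm_sq_eq, ← Finset.sum_coe_sort 𝒢]
  apply Finset.sum_congr rfl
  intro χ _
  congr 2
  simp [charVec, charTwist]

lemma norm_sum_charVec_mul_le {q : ℕ} (𝒢 : Finset (DirichletCharacter ℂ q)) (a : ℕ → ℂ) (I : Finset ℕ) (d : ℕ) :
    ‖∑ n ∈ I, a n • charVec 𝒢 (d * n)‖ ≤ ‖∑ n ∈ I, a n • charVec 𝒢 n‖ := by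
  rw [EuclideanSpace.norm_eq, EuclideanSpace.norm_eq]
  apply Real.sqrt_le_sqrt
  apply Finset.sum_le_sum
  intro χ _
  have h : (∑ n ∈ I, a n • charVec 𝒢 (d * n)) χ = χ.1⁻¹ (d : ZMod q) * (∑ n ∈ I, a n • charVec 𝒢 n) χ := by
    simp only [charVec, WithLp.ofLp_sum, Finset.sum_apply, PiLp.smul_apply, smul_eq_mul, Finset.mul_sum]
    apply Finset.sum_congr rfl
    intro n _
    push_cast
    rw [map_mul]
    ring
  rw [h, norm_mul]
  have := DirichletCharacter.norm_le_one χ.1⁻¹ (d : ZMod q)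
  gcongr
  exact mul_le_of_le_one_left (norm_nonneg _) this

theorem norm_sum_charVec_le {q : ℕ} (hq : 1 ≤ q) (𝒢 : Finset (DirichletCharacter ℂ q)) (a : ℕ → ℂ) (I : Finset ℕ)
    {B : ℝ} (hB0 : 0 ≤ B)
    (hB : ∀ b : ℕ, Nat.Coprime b q → ∑ n ∈ I.filter (fun n : ℕ => n ≡ b [MOD q]), ‖a n‖ ≤ B) :
    ‖∑ n ∈ I, a n • charVec 𝒢 n‖ ≤ q.totient * B := by
  have : NeZero q := ⟨by omega⟩
  apply le_of_sq_le_sq _ (by positivity)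
  rw [norm_sum_charVec_sq]
  set I' := I.filter (fun n : ℕ => Nat.Coprime n q) with hI'
  have h1 : ∑ χ ∈ 𝒢, ‖∑ n ∈ I, charTwist a χ n‖ ^ 2 ≤
      ∑ χ : DirichletCharacter ℂ q, ‖∑ n ∈ I', charTwist a χ n‖ ^ 2 := by
    refine (Finset.sum_le_univ_sum_of_nonneg (fun χ => by positivity)).trans (le_of_eq ?_)
    apply Finset.sum_congr rfl
    intro χ _
    congr 2
    rw [hI', Finset.sum_filter]
    apply Finset.sum_congr rfl
    intro n _
    split_ifs with h
    · rfl
    · unfold charTwist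
      rw [MulChar.map_nonunit _ (by rwa [ZMod.isUnit_iff_coprime]), mul_zero]
  have h2 : ((∑ χ : DirichletCharacter ℂ q, ‖∑ n ∈ I', charTwist a χ n‖ ^ 2 : ℝ) : ℂ) =
      ∑ n ∈ I', ∑ m ∈ I', a n * (starRingEnd ℂ) (a m) * (if n ≡ m [MOD q] then (q.totient : ℂ) else 0) := by
    push_cast
    have h3 : ∀ χ : DirichletCharacter ℂ q, ((‖∑ n ∈ I', charTwist a χ n‖ : ℝ) : ℂ) ^ 2 =
        ∑ n ∈ I', ∑ m ∈ I', a n * (starRingEnd ℂ) (a m) * (χ (n : ZMod q)⁻¹ * χ (m : ZMod q)) := by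
      intro χ
      rw [← Complex.ofReal_pow, ← Complex.normSq_eq_norm_sq, ← Complex.mul_conj, map_sum, Finset.sum_mul_sum]
      apply Finset.sum_congr rfl
      intro n hn
      apply Finset.sum_congr rfl
      intro m _
      unfold charTwist
      rw [map_mul, starRingEnd_apply (χ⁻¹ (m : ZMod q)), MulChar.star_apply', inv_inv]
      have hu : IsUnit (n : ZMod q) := by
        rw [ZMod.isUnit_iff_coprime]; exact (Finset.mem_filter.1 hn).2
      have hinv : χ⁻¹ (n : ZMod q) = χ (n : ZMod q)⁻¹ := by
        obtain ⟨u, hu⟩ := hu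
        rw [← hu, MulChar.inv_apply, Ring.inverse_unit, ZMod.inv_coe_unit]
      rw [hinv]
      ring
    simp_rw [h3]
    rw [Finset.sum_comm]
    apply Finset.sum_congr rfl
    intro n hn
    rw [Finset.sum_comm]
    apply Finset.sum_congr rfl
    intro m _
    have hu : IsUnit (n : ZMod q) := by
      rw [ZMod.isUnit_iff_coprime]; exact (Finset.mem_filter.1 hn).2
    rw [← Finset.mul_sum, DirichletCharacter.sum_char_inv_mul_char_eq ℂ hu]
    simp only [ZMod.natCast_eq_natCast_iff]
  have h4 : ∑ χ : DirichletCharacter ℂ q, ‖∑ n ∈ I', charTwist a χ n‖ ^ 2 ≤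
      ∑ n ∈ I', ∑ m ∈ I', ‖a n‖ * ‖a m‖ * (if n ≡ m [MOD q] then (q.totient : ℝ) else 0) := by
    have h5 : ∑ χ : DirichletCharacter ℂ q, ‖∑ n ∈ I', charTwist a χ n‖ ^ 2 =
        ‖((∑ χ : DirichletCharacter ℂ q, ‖∑ n ∈ I', charTwist a χ n‖ ^ 2 : ℝ) : ℂ)‖ := by
      rw [Complex.norm_real, Real.norm_of_nonneg (Finset.sum_nonneg fun χ _ => by positivity)]
    rw [h5, h2]
    refine norm_sum_le_of_le _ fun n _ => norm_sum_le_of_le _ fun m _ => ?_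
    rw [norm_mul, norm_mul, RCLike.norm_conj]
    split_ifs <;> simp
  have h6 : ∑ n ∈ I', ‖a n‖ ≤ q.totient * B := by
    have h7 : ∀ n ∈ I', n % q ∈ (Finset.range q).filter (fun b => Nat.Coprime q b) := by
      intro n hn
      rw [Finset.mem_filter, Finset.mem_range]
      refine ⟨Nat.mod_lt _ (by omega), ?_⟩
      have := (Finset.mem_filter.1 hn).2
      rw [Nat.coprime_iff_gcd_eq_one] at *
      rwa [Nat.gcd_comm, ← Nat.gcd_rec, Nat.gcd_comm]
    rw [← Finset.sum_fiberwise_of_maps_to h7]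
    refine (Finset.sum_le_card_nsmul _ _ B fun b hb => ?_).trans (le_of_eq ?_)
    · rw [Finset.mem_filter, Finset.mem_range] at hb
      refine le_trans ?_ (hB b hb.2.symm)
      apply Finset.sum_le_sum_of_subset_of_nonneg _ (fun _ _ _ => norm_nonneg _)
      intro n hn
      rw [Finset.mem_filter] at hn ⊢
      refine ⟨(Finset.mem_filter.1 hn.1).1, ?_⟩
      rw [Nat.ModEq, hn.2, Nat.mod_eq_of_lt hb.1]
    · rw [nsmul_eq_mul]; rfl
  calc _ ≤ _ := h1
    _ ≤ _ := h4
    _ = ∑ n ∈ I', ‖a n‖ * (q.totient * ∑ m ∈ I'.filter (fun m : ℕ => n ≡ m [MOD q]), ‖a m‖) := by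
        apply Finset.sum_congr rfl
        intro n _
        rw [Finset.sum_filter (fun m : ℕ => n ≡ m [MOD q]), Finset.mul_sum, Finset.mul_sum]
        apply Finset.sum_congr rfl
        intro m _
        split_ifs <;> ring
    _ ≤ ∑ n ∈ I', ‖a n‖ * (q.totient * B) := by
        apply Finset.sum_le_sum
        intro n hn
        apply mul_le_mul_of_nonneg_left _ (norm_nonneg _)
        apply mul_le_mul_of_nonneg_left _ (Nat.cast_nonneg _)
        refine le_trans ?_ (hB n (Finset.mem_filter.1 hn).2)
        apply Finset.sum_le_sum_of_subset_of_nonneg _ (fun _ _ _ => norm_nonneg _)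
        intro m hm
        rw [Finset.mem_filter] at hm ⊢
        exact ⟨(Finset.mem_filter.1 hm.1).1, hm.2.symm⟩
    _ = (∑ n ∈ I', ‖a n‖) * (q.totient * B) := by rw [Finset.sum_mul]
    _ ≤ (q.totient * B) * (q.totient * B) := by gcongr
    _ = _ := by ring

lemma norm_sum_vonMangoldt_charVec_le {q : ℕ} (hq : 1 ≤ q) (𝒢 : Finset (DirichletCharacter ℂ q)) {a : ℕ → ℂ}
    {κ : ℝ} (hκ : 0 ≤ κ) (ha : ∀ n, ‖a n‖ ≤ κ * Λ n) {A B : ℕ} (hAB : A ≤ B) {z : ℝ} (hz : 2 ≤ z)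
    (hB : (B : ℝ) ≤ z ^ 28) (hH : (q : ℝ) * z ^ 7 ≤ B - A) :
    ‖∑ n ∈ Finset.Ioc A B, a n • charVec 𝒢 n‖ ≤ 200 * κ * (B - A) := by
  have hφ : (0 : ℝ) < q.totient := by exact_mod_cast Nat.totient_pos.2 (by omega)
  have hAB' : (0 : ℝ) ≤ B - A := by rw [sub_nonneg]; exact_mod_cast hAB
  refine (norm_sum_charVec_le hq 𝒢 a _ (B := κ * (200 * ((B - A) / q.totient))) (by positivity)
    fun b _ => ?_).trans (le_of_eq ?_)
  · calc _ ≤ ∑ n ∈ (Finset.Ioc A B).filter (fun n : ℕ => n ≡ b [MOD q]), κ * Λ n :=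
          Finset.sum_le_sum fun n _ => ha n
      _ ≤ _ := by
          rw [← Finset.mul_sum]
          exact mul_le_mul_of_nonneg_left (sum_vonMangoldt_ap_le hq hAB hz hB hH) hκ
  · field_simp

theorem norm_sum_divMaj_charVec_le {κ : ℝ} (hκ : 0 < κ) : ∃ C z₀ : ℝ, 0 < C ∧ 3 ≤ z₀ ∧
    ∀ f : ℕ → ℂ, (∀ n, n ≠ 0 → ‖f n‖ ≤ divMaj κ n) → ∀ z, z₀ ≤ z → ∀ q A B : ℕ, 1 ≤ q → A ≤ B → (B : ℝ) ≤ z ^ 28 →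
      (q : ℝ) * z ^ 7 ≤ B - A → ∀ 𝒢 : Finset (DirichletCharacter ℂ q),
      ‖∑ n ∈ Finset.Ioc A B, f n • charVec 𝒢 n‖ ≤ C * (B - A) * Real.log z ^ (κ - 1) := by
  obtain ⟨C, z₀, hC, hz₀, h⟩ := shiu hκ
  refine ⟨C, z₀, hC, hz₀, fun f hf z hz q A B hq hAB hB hH 𝒢 => ?_⟩
  have hφ : (0 : ℝ) < q.totient := by exact_mod_cast Nat.totient_pos.2 (by omega)
  have hAB' : (0 : ℝ) ≤ B - A := by rw [sub_nonneg]; exact_mod_cast hAB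
  have hlz : 0 ≤ Real.log z := Real.log_nonneg (by linarith)
  refine (norm_sum_charVec_le hq 𝒢 f _ (B := C * ((B - A) / q.totient) * Real.log z ^ (κ - 1)) (by positivity)
    fun b hb => ?_).trans (le_of_eq ?_)
  · refine le_trans (Finset.sum_le_sum fun n hn => ?_) (h z hz q b A B hq hb hAB hB hH)
    have : n ≠ 0 := by
      have := (Finset.mem_Ioc.1 (Finset.mem_filter.1 hn).1).1
      omega
    exact hf n this
  · field_simp

lemma sum_convolution_smul {E : Type*} [AddCommGroup E] [Module ℂ E] (a b : ℕ → ℂ) (w : ℕ → E) (N : ℕ) :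
    ∑ n ∈ Finset.Icc 1 N, LSeries.convolution a b n • w n =
      ∑ d ∈ Finset.Icc 1 N, a d • ∑ m ∈ Finset.Icc 1 (N / d), b m • w (d * m) := by
  simp_rw [LSeries.convolution_apply_eq, Finset.sum_smul, Finset.smul_sum, smul_smul]
  rw [Finset.sum_sigma', Finset.sum_sigma']
  refine Finset.sum_nbij' (fun x => ⟨x.2, x.1 / x.2⟩) (fun x => ⟨x.1 * x.2, x.1⟩) ?_ ?_ ?_ ?_ ?_
  · rintro ⟨n, d⟩ h
    simp only [Finset.mem_sigma, Finset.mem_Icc, Nat.mem_divisors] at h ⊢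
    obtain ⟨⟨h1, h2⟩, h3, h4⟩ := h
    have hd := Nat.pos_of_dvd_of_pos h3 (by omega)
    have := Nat.le_of_dvd (by omega) h3
    exact ⟨⟨hd, by omega⟩, Nat.div_pos this hd, Nat.div_le_div_right h2⟩
  · rintro ⟨d, m⟩ h
    simp only [Finset.mem_sigma, Finset.mem_Icc, Nat.mem_divisors] at h ⊢
    obtain ⟨⟨h1, h2⟩, h3, h4⟩ := h
    have hpos : 0 < d * m := Nat.mul_pos (by omega) (by omega)
    refine ⟨⟨hpos, ?_⟩, dvd_mul_right _ _, hpos.ne'⟩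
    rw [mul_comm]
    exact (Nat.le_div_iff_mul_le (by omega)).1 h4
  · rintro ⟨n, d⟩ h
    simp only [Finset.mem_sigma, Finset.mem_Icc, Nat.mem_divisors] at h
    simp [Nat.mul_div_cancel' h.2.1]
  · rintro ⟨d, m⟩ h
    simp only [Finset.mem_sigma, Finset.mem_Icc] at h
    simp [Nat.mul_div_cancel_left m (show 0 < d by omega)]
  · rintro ⟨n, d⟩ h
    simp only [Finset.mem_sigma, Finset.mem_Icc, Nat.mem_divisors] at h
    simp [Nat.mul_div_cancel' h.2.1]

lemma charTwist_convolution {q : ℕ} (a b : ℕ → ℂ) (χ : DirichletCharacter ℂ q) (n : ℕ) :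
    charTwist (LSeries.convolution a b) χ n = LSeries.convolution (charTwist a χ) (charTwist b χ) n := by
  rw [charTwist, LSeries.convolution_apply_eq, LSeries.convolution_apply_eq, Finset.sum_mul]
  apply Finset.sum_congr rfl
  intro d hd
  have h : d * (n / d) = n := Nat.mul_div_cancel' (Nat.dvd_of_mem_divisors hd)
  have h2 : χ⁻¹ (n : ZMod q) = χ⁻¹ (d : ZMod q) * χ⁻¹ ((n / d : ℕ) : ZMod q) := by
    rw [← map_mul, ← Nat.cast_mul, h]
  unfold charTwist
  rw [h2]
  ring

/-- The coefficients `a n` for `y < n ≤ D`, and zero elsewhere. -/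
def midCoeff (y D : ℕ) (a : ℕ → ℂ) (n : ℕ) : ℂ := if y < n ∧ n ≤ D then a n else 0

lemma norm_midCoeff_le (y D : ℕ) (a : ℕ → ℂ) (n : ℕ) : ‖midCoeff y D a n‖ ≤ ‖a n‖ := by
  unfold midCoeff
  split_ifs <;> simp

theorem IsHalaszClass.norm_LSeries_le {κ : ℝ} (hκ : 0 ≤ κ) {f Λf : ℕ → ℂ} (hf : IsHalaszClass κ f Λf)
    {σ : ℝ} (hσ : 0 < σ) (hσ1 : σ ≤ 1) (t : ℝ) :
    ‖LSeries f ⟨1 + σ, t⟩‖ ≤ Real.exp (52 * κ) * (1 / σ) ^ κ := by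
  rw [hf.LSeries_eq_exp hκ (by simpa using hσ), Complex.norm_exp]
  have h1 : ‖LSeries (logCoeff Λf) ⟨1 + σ, t⟩‖ ≤ κ * (Real.log (1 / σ) + 52) := by
    refine (tsum_of_norm_bounded ((summable_logZetaCoeff hσ).mul_left κ).hasSum
      (norm_term_le_of_norm_le hf.norm_logCoeff_le σ rfl)).trans ?_
    rw [tsum_mul_left]
    exact mul_le_mul_of_nonneg_left (logZetaCoeff_tail_two_le hσ hσ1) hκ
  rw [Real.rpow_def_of_pos (by positivity), ← Real.exp_add]
  apply Real.exp_le_exp.2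
  calc _ ≤ _ := Complex.re_le_norm _
    _ ≤ _ := h1
    _ = _ := by ring

lemma norm_sum_charVec_prefix_le {q y N : ℕ} (hq : 1 ≤ q) {κ : ℝ} (hκ : 0 ≤ κ) {a : ℕ → ℂ}
    (ha : ∀ n, ‖a n‖ ≤ κ * Λ n) (hy : 2 ^ 14 ≤ y) (hqy : q ^ 2 ≤ y) (𝒢 : Finset (DirichletCharacter ℂ q))
    (hN : y ≤ N) : ‖∑ n ∈ Finset.Icc 1 N, a n • charVec 𝒢 n‖ ≤ 200 * κ * N := by
  have hN1 : (2 : ℝ) ^ 14 ≤ N := by exact_mod_cast hy.trans hN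
  have hN0 : (0 : ℝ) < N := by linarith [show (0 : ℝ) < 2 ^ 14 by norm_num]
  set z : ℝ := (N : ℝ) ^ (1 / 14 : ℝ) with hz
  have hz0 : 0 ≤ z := by positivity
  have hz14 : z ^ 14 = N := by
    rw [hz, ← Real.rpow_natCast, ← Real.rpow_mul hN0.le]; norm_num
  have hz2 : 2 ≤ z := by
    apply le_of_pow_le_pow_left₀ (n := 14) (by norm_num) hz0
    rwa [hz14]
  have hqz : (q : ℝ) ≤ z ^ 7 := by
    apply le_of_pow_le_pow_left₀ (n := 2) (by norm_num) (by positivity)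
    rw [← pow_mul, hz14]
    exact_mod_cast hqy.trans hN
  have h := norm_sum_vonMangoldt_charVec_le hq 𝒢 hκ ha (Nat.zero_le N) (z := z) hz2 (by
    calc (N : ℝ) = N * 1 := by ring
      _ ≤ N * N := by gcongr; linarith [show (1 : ℝ) < 2 ^ 14 by norm_num]
      _ = z ^ 28 := by rw [← hz14]; ring) (by
    calc (q : ℝ) * z ^ 7 ≤ z ^ 7 * z ^ 7 := by gcongr
      _ = _ := by rw [← pow_add, hz14]; simp)
  have hI : Finset.Ioc 0 N = Finset.Icc 1 N := rfl
  rw [hI] at h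
  simpa using h

/-- The vector-valued Plancherel bound for the middle part of the convolution `Λf ⍟ f`. -/
theorem sum_norm_mid_sq_le {κ : ℝ} (hκ : 0 ≤ κ) {f Λf : ℕ → ℂ} (hf : IsHalaszClass κ f Λf)
    {q y D : ℕ} (hq : 1 ≤ q) (hy : 2 ^ 14 ≤ y) (hqy : q ^ 2 ≤ y) (hD : 1 ≤ D) {α M T : ℝ} (hα : 0 < α) (hα1 : α ≤ 1)
    (hT : 2 ≤ T) (𝒢 : Finset (DirichletCharacter ℂ q))
    (hM : ∀ χ ∈ 𝒢, ∀ t : ℝ, |t| ≤ T → ‖LSeries (charTwist f χ) ⟨1 + α, t⟩‖ ≤ M) (V : ℕ) :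
    ∑ v ∈ Finset.range (V + 1), ‖∑ n ∈ Finset.Icc 1 v, LSeries.convolution (midCoeff y D Λf) f n • charVec 𝒢 n‖ ^ 2
        * planchWeight (1 + α) v ≤
      M ^ 2 * (16 * (200 * κ) ^ 2 / α) +
        q * (κ * (Real.log D + 7) * (Real.exp (52 * κ) * (1 / α) ^ κ)) ^ 2 / T := by
  have : NeZero q := ⟨by omega⟩
  set p := midCoeff y D Λf with hp
  set G := κ * (Real.log D + 7) * (Real.exp (52 * κ) * (1 / α) ^ κ) with hG
  have hpD : ∀ n, D < n → p n = 0 := by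
    intro n hn
    rw [hp, midCoeff, if_neg (by omega)]
  have hpb : ∀ n, ‖p n‖ ≤ κ * Λ n := fun n => (norm_midCoeff_le y D Λf n).trans (hf.bound' n)
  have hchi : ∀ χ ∈ 𝒢, ∑ v ∈ Finset.range (V + 1),
      ‖∑ n ∈ Finset.Icc 1 v, charTwist (LSeries.convolution p f) χ n‖ ^ 2 * planchWeight (1 + α) v ≤
      M ^ 2 * ∑' v : ℕ, ‖∑ n ∈ Finset.Icc 1 (min v D), charTwist p χ n‖ ^ 2 * planchWeight (1 + α) v + G ^ 2 / T := by
    intro χ hχ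
    simp_rw [charTwist_convolution]
    apply sum_plancherel_mul_le (by linarith)
    · intro n hn
      rw [charTwist, hpD n hn, zero_mul]
    · exact (hf.twist_inv χ).LSeriesSummable (by simpa using hα)
    · linarith
    · exact hM χ hχ
    · intro t
      have h1 := (hf.twist_inv χ).norm_LSeries_le hκ hα hα1 t
      have h2 : ‖∑ n ∈ Finset.Icc 1 D, charTwist p χ n / (n : ℂ) ^ (⟨1 + α, t⟩ : ℂ)‖ ≤ κ * (Real.log D + 7) := by
        calc _ ≤ ∑ n ∈ Finset.Icc 1 D, κ * (Λ n / n) := by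
              apply norm_sum_le_of_le
              intro n hn
              have hn1 : 1 ≤ n := (Finset.mem_Icc.1 hn).1
              have hn1' : (1 : ℝ) ≤ n := by exact_mod_cast hn1
              rw [norm_div, Complex.norm_natCast_cpow_of_pos hn1, charTwist, norm_mul, ← mul_div_assoc]
              have h3 := DirichletCharacter.norm_le_one χ⁻¹ (n : ZMod q)
              have h4 : (n : ℝ) ≤ (n : ℝ) ^ (1 + α) := by
                conv_lhs => rw [← Real.rpow_one (n : ℝ)]
                exact Real.rpow_le_rpow_of_exponent_le hn1' (by linarith)
              have h5 := hpb n
              have h6 : 0 ≤ κ * Λ n := (norm_nonneg _).trans h5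
              apply div_le_div₀ h6 _ (by linarith) h4
              calc _ ≤ ‖p n‖ * 1 := by gcongr
                _ ≤ _ := by linarith
          _ = κ * ∑ n ∈ Finset.Icc 1 D, Λ n / n := by rw [Finset.mul_sum]
          _ ≤ _ := by
              have h3 := (abs_le.1 (abs_mertens (x := D) (by exact_mod_cast hD))).2
              rw [Nat.floor_natCast] at h3
              gcongr
              linarith
      have h7 : 0 ≤ κ * (Real.log D + 7) := (norm_nonneg _).trans h2
      exact mul_le_mul h2 h1 (norm_nonneg _) h7
  have hB : ∀ v : ℕ, ∑ χ ∈ 𝒢, ‖∑ n ∈ Finset.Icc 1 (min v D), charTwist p χ n‖ ^ 2 ≤ (200 * κ) ^ 2 * (v : ℝ) ^ 2 := by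
    intro v
    rw [← norm_sum_charVec_sq, ← mul_pow]
    apply pow_le_pow_left₀ (norm_nonneg _)
    rcases le_or_gt (min v D) y with h | h
    · rw [Finset.sum_eq_zero]
      · rw [norm_zero]; positivity
      · intro n hn
        rw [Finset.mem_Icc] at hn
        rw [hp, midCoeff, if_neg (by omega), zero_smul]
    · exact norm_sum_charVec_prefix_le hq hκ hpb hy hqy 𝒢 h.le |>.trans (by
        have : ((min v D : ℕ) : ℝ) ≤ v := by exact_mod_cast min_le_left _ _
        gcongr)
  have hsum := tsum_sq_planchWeight_le hα hα1 𝒢 (fun χ => charTwist p χ) D hB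
  have hcard : (𝒢.card : ℝ) ≤ q := by
    have h1 : 𝒢.card ≤ Fintype.card (DirichletCharacter ℂ q) := Finset.card_le_univ _
    rw [← Nat.card_eq_fintype_card, DirichletCharacter.card_eq_totient_of_hasEnoughRootsOfUnity] at h1
    exact_mod_cast h1.trans (Nat.totient_le q)
  have hT0 : 0 < T := by linarith
  calc _ = ∑ χ ∈ 𝒢, ∑ v ∈ Finset.range (V + 1),
      ‖∑ n ∈ Finset.Icc 1 v, charTwist (LSeries.convolution p f) χ n‖ ^ 2 * planchWeight (1 + α) v := by
        rw [Finset.sum_comm]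
        apply Finset.sum_congr rfl
        intro v _
        rw [norm_sum_charVec_sq, Finset.sum_mul]
    _ ≤ _ := Finset.sum_le_sum hchi
    _ = M ^ 2 * (∑ χ ∈ 𝒢, ∑' v : ℕ, ‖∑ n ∈ Finset.Icc 1 (min v D), charTwist p χ n‖ ^ 2 * planchWeight (1 + α) v)
        + 𝒢.card * (G ^ 2 / T) := by
        rw [Finset.sum_add_distrib, Finset.mul_sum, Finset.sum_const, nsmul_eq_mul]
    _ ≤ _ := by
        rw [mul_div_assoc (q : ℝ)]
        gcongr

lemma inv_le_log_sub {v : ℕ} (hv : 3 ≤ v) : 1 / (v : ℝ) ≤ Real.log v - Real.log (v - 1 : ℝ) := by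
  have h1 : (3 : ℝ) ≤ v := by exact_mod_cast hv
  rw [← Real.log_div (by linarith) (by linarith)]
  refine le_trans (le_of_eq ?_) (Real.one_sub_inv_le_log_of_pos (by apply div_pos <;> linarith))
  rw [inv_div]
  field_simp
  ring

lemma sum_inv_mul_log_sq_le {V : ℕ} (hV : 3 ≤ V) (W : ℕ) :
    ∑ v ∈ Finset.Ico V W, 1 / ((v : ℝ) * Real.log v ^ 2) ≤ 2 / Real.log V := by
  have hlog : ∀ v : ℕ, 3 ≤ v → 0 < Real.log (v - 1 : ℝ) ∧ Real.log (v - 1 : ℝ) < Real.log v := by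
    intro v hv
    have h1 : (3 : ℝ) ≤ v := by exact_mod_cast hv
    exact ⟨Real.log_pos (by linarith), Real.log_lt_log (by linarith) (by linarith)⟩
  have key : ∀ W, V ≤ W → ∑ v ∈ Finset.Ico V W, 1 / ((v : ℝ) * Real.log v ^ 2) ≤
      1 / Real.log (V - 1 : ℝ) - 1 / Real.log (W - 1 : ℝ) := by
    intro W hW
    induction W, hW using Nat.le_induction with
    | base => simp
    | succ W hW ih =>
      rw [Finset.sum_Ico_succ_top hW]
      obtain ⟨h1, h2⟩ := hlog W (by omega)
      have h3 := inv_le_log_sub (v := W) (by omega)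
      have h0 : (0 : ℝ) < W := by exact_mod_cast (by omega : 0 < W)
      have h4 : 1 / ((W : ℝ) * Real.log W ^ 2) ≤ 1 / Real.log (W - 1 : ℝ) - 1 / Real.log W := by
        have h5 : 1 / Real.log (W - 1 : ℝ) - 1 / Real.log W =
            (Real.log W - Real.log (W - 1 : ℝ)) / (Real.log (W - 1 : ℝ) * Real.log W) := by
          have := h1.ne'
          have := (h1.trans h2).ne'
          field_simp
        rw [h5, ← div_div]
        have : Real.log (W - 1 : ℝ) * Real.log W ≤ Real.log W ^ 2 := by
          rw [sq]; gcongr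
        have h6 : 0 < Real.log (W - 1 : ℝ) * Real.log W := mul_pos h1 (h1.trans h2)
        apply div_le_div₀ _ h3 h6 this
        linarith
      push_cast
      rw [add_sub_cancel_right]
      linarith
  obtain ⟨h1, h2⟩ := hlog V hV
  have h3 : 1 / Real.log (V - 1 : ℝ) ≤ 2 / Real.log V := by
    rw [div_le_div_iff₀ h1 (h1.trans h2), one_mul]
    have hV' : (3 : ℝ) ≤ V := by exact_mod_cast hV
    calc Real.log V ≤ Real.log ((V - 1 : ℝ) ^ 2) := Real.log_le_log (by linarith) (by nlinarith)
      _ = _ := by rw [Real.log_pow]; norm_num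
  rcases le_or_gt V W with h | h
  · have h4 := key W h
    have h5 : 0 < 1 / Real.log (W - 1 : ℝ) := one_div_pos.2 (hlog W (by omega)).1
    linarith
  · rw [Finset.Ico_eq_empty (by omega), Finset.sum_empty]
    have := h1.trans h2
    positivity

lemma sum_inv_mul_log_le {V : ℕ} (hV : 3 ≤ V) {W : ℕ} (hVW : V ≤ W) :
    ∑ v ∈ Finset.Ico V W, 1 / ((v : ℝ) * Real.log v) ≤ Real.log (Real.log W / Real.log V) + 1 := by
  have hlog : ∀ v : ℕ, 3 ≤ v → 0 < Real.log (v - 1 : ℝ) ∧ Real.log (v - 1 : ℝ) < Real.log v := by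
    intro v hv
    have h1 : (3 : ℝ) ≤ v := by exact_mod_cast hv
    exact ⟨Real.log_pos (by linarith), Real.log_lt_log (by linarith) (by linarith)⟩
  have key : ∑ v ∈ Finset.Ico V W, 1 / ((v : ℝ) * Real.log v) ≤
      Real.log (Real.log (W - 1 : ℝ)) - Real.log (Real.log (V - 1 : ℝ)) := by
    induction W, hVW using Nat.le_induction with
    | base => simp
    | succ W hW ih =>
      rw [Finset.sum_Ico_succ_top hW]
      obtain ⟨h1, h2⟩ := hlog W (by omega)
      have h3 := inv_le_log_sub (v := W) (by omega)
      have h0 : (0 : ℝ) < W := by exact_mod_cast (by omega : 0 < W)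
      have h4 : 1 / ((W : ℝ) * Real.log W) ≤ Real.log (Real.log W) - Real.log (Real.log (W - 1 : ℝ)) := by
        have hw := h1.trans h2
        rw [← Real.log_div hw.ne' h1.ne']
        refine le_trans ?_ (Real.one_sub_inv_le_log_of_pos (by positivity))
        rw [inv_div, one_sub_div hw.ne', ← div_div]
        gcongr
      push_cast
      rw [add_sub_cancel_right]
      linarith
  obtain ⟨h1, h2⟩ := hlog V hV
  obtain ⟨h3, h4⟩ := hlog W (by omega)
  have hV' : (3 : ℝ) ≤ V := by exact_mod_cast hV
  have h5 : Real.log V ≤ 2 * Real.log (V - 1 : ℝ) := by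
    calc Real.log V ≤ Real.log ((V - 1 : ℝ) ^ 2) := Real.log_le_log (by linarith) (by nlinarith)
      _ = _ := by rw [Real.log_pow]; norm_num
  have h6 : Real.log (Real.log V) ≤ Real.log 2 + Real.log (Real.log (V - 1 : ℝ)) := by
    rw [← Real.log_mul (by norm_num) h1.ne']
    exact Real.log_le_log (h1.trans h2) h5
  have h7 := Real.log_le_log h3 h4.le
  rw [Real.log_div (h3.trans h4).ne' (h1.trans h2).ne']
  have := Real.log_two_lt_d9
  linarith

lemma sum_Ico_le_of_sq_blocks {a : ℕ → ℝ} (ha : ∀ v, 0 ≤ a v) {B : ℝ} {N : ℕ} {V : ℕ} (hV : 3 ≤ V)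
    (hB : ∀ U, V ≤ U → U ≤ N → ∑ v ∈ Finset.Ico U (U ^ 2), a v ≤ B) {W : ℕ} (hVW : V ≤ W) (hW : W ≤ N) :
    ∑ v ∈ Finset.Ico V W, a v ≤ B * (1 + 2 * Real.log (Real.log W / Real.log V)) := by
  have hB0 : 0 ≤ B := le_trans (Finset.sum_nonneg fun v _ => ha v) (hB W hVW hW)
  obtain ⟨k, hk⟩ : ∃ k, k = W - V := ⟨_, rfl⟩
  induction k using Nat.strong_induction_on generalizing V with
  | _ k ih =>
    have h0 : 0 < Real.log V := Real.log_pos (by exact_mod_cast (by omega : 1 < V))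
    rcases le_or_gt W (V ^ 2) with h | h
    · have h1 : 0 ≤ Real.log (Real.log W / Real.log V) := by
        apply Real.log_nonneg
        rw [le_div_iff₀ h0, one_mul]
        exact Real.log_le_log (by exact_mod_cast (by omega : 0 < V)) (by exact_mod_cast hVW)
      calc _ ≤ ∑ v ∈ Finset.Ico V (V ^ 2), a v :=
            Finset.sum_le_sum_of_subset_of_nonneg (Finset.Ico_subset_Ico_right h) (fun v _ _ => ha v)
        _ ≤ B := hB V le_rfl (hVW.trans hW)
        _ ≤ _ := by nlinarith
    · have hV2 : V + 3 ≤ V ^ 2 := by nlinarith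
      have h1 := ih (W - V ^ 2) (by omega) (V := V ^ 2) (by omega) (fun U hU => hB U (by omega)) h.le rfl
      rw [← Finset.sum_Ico_consecutive _ (show V ≤ V ^ 2 by omega) h.le]
      have h2 := hB V le_rfl (hVW.trans hW)
      have hW0 : 0 < Real.log W := Real.log_pos (by exact_mod_cast (by omega : 1 < W))
      have h3 : Real.log (Real.log W / Real.log ((V ^ 2 : ℕ) : ℝ)) =
          Real.log (Real.log W / Real.log V) - Real.log 2 := by
        rw [← Real.log_div (by positivity) (by norm_num)]
        congr 1
        push_cast
        rw [Real.log_pow]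
        push_cast
        field_simp
      rw [h3] at h1
      have := Real.log_two_gt_d9
      nlinarith

lemma planchWeight_lower {V v : ℕ} (hV : 3 ≤ V) (h1 : V ≤ v) (h2 : v ≤ V ^ 2) :
    1 / (2000 * (v : ℝ) ^ 3) ≤ planchWeight (1 + 1 / Real.log V) v := by
  have hV1 : (1 : ℝ) < V := by exact_mod_cast (by omega : 1 < V)
  have hl : 0 < Real.log V := Real.log_pos hV1
  set α := 1 / Real.log V with hα
  have hα0 : 0 < α := by positivity
  have hα1 : α ≤ 1 := by
    rw [hα, div_le_one hl, Real.le_log_iff_exp_le (by linarith)]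
    have := Real.exp_one_lt_d9
    have : (3 : ℝ) ≤ V := by exact_mod_cast hV
    linarith
  have hv : (1 : ℝ) ≤ v := by exact_mod_cast (by omega : 1 ≤ v)
  refine le_trans ?_ (le_planchWeight (c := 1 + α) (by linarith) (by omega))
  have h3 : -1 - 2 * (1 + α) = -(3 + 2 * α) := by ring
  rw [h3, Real.rpow_neg (by positivity), ← one_div]
  apply one_div_le_one_div_of_le (by positivity)
  have h4 : (v : ℝ) ^ (2 * α) ≤ Real.exp 4 := by
    rw [Real.rpow_def_of_pos (by linarith)]
    apply Real.exp_le_exp.2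
    have : Real.log v ≤ 2 * Real.log V := by
      calc Real.log v ≤ Real.log ((V : ℝ) ^ 2) := Real.log_le_log (by linarith) (by exact_mod_cast h2)
        _ = _ := by rw [Real.log_pow]; norm_num
    calc Real.log v * (2 * α) ≤ (2 * Real.log V) * (2 * α) := by gcongr
      _ = 4 := by rw [hα]; field_simp; norm_num
  have h5 : Real.exp 4 ≤ 60 := by
    have : Real.exp 4 = Real.exp 1 ^ 4 := by rw [← Real.exp_nat_mul]; norm_num
    rw [this]
    calc _ ≤ (2.7182818286 : ℝ) ^ 4 := by gcongr; exact Real.exp_one_lt_d9.le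
      _ ≤ 60 := by norm_num
  calc ((v : ℝ) + 1) ^ (3 + 2 * α) ≤ (2 * v) ^ (3 + 2 * α) := by gcongr; linarith
    _ = 2 ^ (3 + 2 * α) * ((v : ℝ) ^ (3 : ℝ) * (v : ℝ) ^ (2 * α)) := by
        rw [Real.mul_rpow (by norm_num) (by linarith), Real.rpow_add (show (0 : ℝ) < v by linarith) 3 (2 * α)]
    _ ≤ 2 ^ (5 : ℝ) * ((v : ℝ) ^ (3 : ℝ) * 60) := by
        gcongr
        · norm_num
        · linarith
        · linarith
    _ = 1920 * (v : ℝ) ^ 3 := by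
        rw [show (5 : ℝ) = ((5 : ℕ) : ℝ) by norm_num, show (3 : ℝ) = ((3 : ℕ) : ℝ) by norm_num,
          Real.rpow_natCast, Real.rpow_natCast]
        ring
    _ ≤ _ := by gcongr; norm_num

theorem sum_block_le {t : ℕ → ℝ} {V : ℕ} (hV : 3 ≤ V) {S : ℝ}
    (hS : ∑ v ∈ Finset.range (V ^ 2 + 1), t v ^ 2 * planchWeight (1 + 1 / Real.log V) v ≤ S * Real.log V)
    (h0 : t 0 = 0) :
    ∑ v ∈ Finset.Ico V (V ^ 2), t v / ((v : ℝ) ^ 2 * Real.log v) ≤ 100 * √S := by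
  have hV1 : (1 : ℝ) < V := by exact_mod_cast (by omega : 1 < V)
  have hl : 0 < Real.log V := Real.log_pos hV1
  have hc : 0 < 1 + 1 / Real.log V := by positivity
  have h1 : ∑ v ∈ Finset.Ico V (V ^ 2), t v ^ 2 / (v : ℝ) ^ 3 ≤ 2000 * (S * Real.log V) := by
    calc _ ≤ ∑ v ∈ Finset.Ico V (V ^ 2), 2000 * (t v ^ 2 * planchWeight (1 + 1 / Real.log V) v) := by
          apply Finset.sum_le_sum
          intro v hv
          rw [Finset.mem_Ico] at hv
          have h2 := planchWeight_lower hV hv.1 hv.2.le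
          have hv0 : (0 : ℝ) < v := by exact_mod_cast (by omega : 0 < v)
          calc t v ^ 2 / (v : ℝ) ^ 3 = 2000 * (t v ^ 2 * (1 / (2000 * (v : ℝ) ^ 3))) := by field_simp
            _ ≤ _ := by gcongr
      _ = 2000 * ∑ v ∈ Finset.Ico V (V ^ 2), (t v ^ 2 * planchWeight (1 + 1 / Real.log V) v) := by
          rw [Finset.mul_sum]
      _ ≤ _ := by
          gcongr
          refine le_trans (Finset.sum_le_sum_of_subset_of_nonneg ?_ ?_) hS
          · intro v hv
            rw [Finset.mem_Ico] at hv
            rw [Finset.mem_range]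
            omega
          · intro v _ _
            rcases Nat.eq_zero_or_pos v with rfl | hv
            · rw [h0]; simp
            · have := planchWeight_nonneg hc hv
              positivity
  have h2 := sum_inv_mul_log_sq_le hV (V ^ 2)
  have hS0 : 0 ≤ S := by
    have : 0 ≤ 2000 * (S * Real.log V) := le_trans (Finset.sum_nonneg fun v _ => by positivity) h1
    by_contra hneg
    have := mul_neg_of_neg_of_pos (not_le.1 hneg) hl
    linarith
  apply le_of_sq_le_sq _ (by positivity)
  have hcs := Finset.sum_mul_sq_le_sq_mul_sq (Finset.Ico V (V ^ 2)) (fun v : ℕ => t v / (√(v : ℝ) * v))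
    (fun v : ℕ => 1 / (√(v : ℝ) * Real.log v))
  have e1 : ∑ v ∈ Finset.Ico V (V ^ 2), t v / ((v : ℝ) ^ 2 * Real.log v) =
      ∑ v ∈ Finset.Ico V (V ^ 2), t v / (√(v : ℝ) * v) * (1 / (√(v : ℝ) * Real.log v)) := by
    apply Finset.sum_congr rfl
    intro v _
    rw [div_mul_div_comm, mul_one]
    congr 1
    calc (v : ℝ) ^ 2 * Real.log v = v * (v * Real.log v) := by ring
      _ = (√(v : ℝ) * √(v : ℝ)) * (v * Real.log v) := by rw [Real.mul_self_sqrt (Nat.cast_nonneg v)]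
      _ = _ := by ring
  have e2 : ∀ v : ℕ, (t v / (√(v : ℝ) * v)) ^ 2 = t v ^ 2 / (v : ℝ) ^ 3 := by
    intro v
    rw [div_pow, mul_pow, Real.sq_sqrt (Nat.cast_nonneg v)]
    ring
  have e3 : ∀ v : ℕ, (1 / (√(v : ℝ) * Real.log v)) ^ 2 = 1 / ((v : ℝ) * Real.log v ^ 2) := by
    intro v
    rw [div_pow, mul_pow, Real.sq_sqrt (Nat.cast_nonneg v), one_pow]
  rw [← e1] at hcs
  simp_rw [e2, e3] at hcs
  refine hcs.trans ?_
  calc _ ≤ (2000 * (S * Real.log V)) * (2 / Real.log V) := by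
        apply mul_le_mul h1 h2 (Finset.sum_nonneg fun v _ => by positivity) (by positivity)
    _ = 4000 * S := by field_simp; ring
    _ ≤ _ := by rw [mul_pow, Real.sq_sqrt hS0]; linarith

/-- The partial sum of the vectors `f(n) χ⁻¹(n)`. -/
def famSum {q : ℕ} (𝒢 : Finset (DirichletCharacter ℂ q)) (f : ℕ → ℂ) (N : ℕ) :
    EuclideanSpace ℂ {χ : DirichletCharacter ℂ q // χ ∈ 𝒢} := ∑ n ∈ Finset.Icc 1 N, f n • charVec 𝒢 n

theorem sum_norm_mid_le {κ : ℝ} (hκ : 0 ≤ κ) : ∃ C : ℝ, 0 ≤ C ∧ ∀ f Λf : ℕ → ℂ, IsHalaszClass κ f Λf →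
    ∀ q y D : ℕ, 1 ≤ q → 2 ^ 14 ≤ y → q ^ 2 ≤ y → 1 ≤ D → ∀ L T M : ℝ, 1 ≤ L → Real.log D ≤ 2 * L → 2 ≤ T →
      q * L ^ (2 * κ + 2) ≤ T → 1 ≤ M → ∀ 𝒢 : Finset (DirichletCharacter ℂ q),
      (∀ χ ∈ 𝒢, ∀ α t : ℝ, 1 / (2 * L) ≤ α → |t| ≤ T → ‖LSeries (charTwist f χ) ⟨1 + α, t⟩‖ ≤ M) →
      ∀ V W : ℕ, 3 ≤ V → V ≤ W → Real.log W ≤ 2 * L →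
      ∑ v ∈ Finset.Ico V W, ‖famSum 𝒢 (LSeries.convolution (midCoeff y D Λf) f) v‖ / ((v : ℝ) ^ 2 * Real.log v) ≤
        C * M * (1 + 2 * Real.log (Real.log W / Real.log V)) := by
  set K : ℝ := 16 * (200 * κ) ^ 2 + (κ * 9 * (Real.exp (52 * κ) * 2 ^ κ)) ^ 2 with hK
  have hK0 : 0 ≤ K := by positivity
  refine ⟨100 * √K, by positivity, ?_⟩
  intro f Λf hf q y D hq hy hqy hD L T M hL hDL hT hqT hM 𝒢 hF V W hV hVW hW
  apply sum_Ico_le_of_sq_blocks (fun v => by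
    have := Real.log_natCast_nonneg v
    positivity) hV _ hVW le_rfl
  intro U hVU hUW
  have hU3 : (3 : ℝ) ≤ U := by exact_mod_cast hV.trans hVU
  have hlU : 1 ≤ Real.log U := by
    rw [Real.le_log_iff_exp_le (by linarith)]
    have := Real.exp_one_lt_d9
    linarith
  have hlU2 : Real.log U ≤ 2 * L := by
    refine le_trans (Real.log_le_log (by linarith) (by exact_mod_cast hUW)) hW
  have hα0 : 0 < 1 / Real.log U := by positivity
  have hα1 : 1 / Real.log U ≤ 1 := by rw [div_le_one (by linarith)]; exact hlU
  have hα2 : 1 / (2 * L) ≤ 1 / Real.log U := one_div_le_one_div_of_le (by linarith) hlU2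
  have h1 := sum_norm_mid_sq_le hκ hf hq hy hqy hD hα0 hα1 hT 𝒢 (M := M)
    (fun χ hχ t ht => hF χ hχ _ t hα2 ht) (U ^ 2)
  have hlD := Real.log_natCast_nonneg D
  have h2 : q * (κ * (Real.log D + 7) * (Real.exp (52 * κ) * (1 / (1 / Real.log U)) ^ κ)) ^ 2 / T ≤
      (κ * 9 * (Real.exp (52 * κ) * 2 ^ κ)) ^ 2 := by
    rw [one_div_one_div, div_le_iff₀ (by linarith)]
    calc (q : ℝ) * (κ * (Real.log D + 7) * (Real.exp (52 * κ) * Real.log U ^ κ)) ^ 2 ≤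
        q * (κ * (9 * L) * (Real.exp (52 * κ) * (2 * L) ^ κ)) ^ 2 := by
          have : Real.log D + 7 ≤ 9 * L := by linarith
          have : Real.log U ^ κ ≤ (2 * L) ^ κ := Real.rpow_le_rpow (by linarith) hlU2 hκ
          gcongr
      _ = (κ * 9 * (Real.exp (52 * κ) * 2 ^ κ)) ^ 2 * (q * L ^ (2 * κ + 2)) := by
          rw [Real.mul_rpow (by norm_num) (by linarith), Real.rpow_add (by linarith) (2 * κ) 2, mul_comm 2 κ,
            Real.rpow_mul (by linarith)]
          norm_cast
          ring
      _ ≤ _ := by gcongr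
  have h3 : M ^ 2 * (16 * (200 * κ) ^ 2 / (1 / Real.log U)) +
      q * (κ * (Real.log D + 7) * (Real.exp (52 * κ) * (1 / (1 / Real.log U)) ^ κ)) ^ 2 / T ≤
      (M ^ 2 * K) * Real.log U := by
    refine (add_le_add le_rfl h2).trans ?_
    rw [div_div_eq_mul_div, div_one, hK]
    have hM2 : 1 ≤ M ^ 2 * Real.log U := by nlinarith
    have h4 : 0 ≤ (κ * 9 * (Real.exp (52 * κ) * 2 ^ κ)) ^ 2 := by positivity
    nlinarith
  have h5 := sum_block_le (hV.trans hVU) (h1.trans h3) (by simp)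
  refine h5.trans (le_of_eq ?_)
  rw [Real.sqrt_mul (by positivity), Real.sqrt_sq (by linarith)]
  ring

lemma log_smul_famSum {q : ℕ} (𝒢 : Finset (DirichletCharacter ℂ q)) (f : ℕ → ℂ) {N : ℕ} (hN : 1 ≤ N) :
    ((Real.log N : ℝ) : ℂ) • famSum 𝒢 f N =
      ∑ n ∈ Finset.Ico 1 N, ((Real.log (n + 1 : ℕ) - Real.log n : ℝ) : ℂ) • famSum 𝒢 f n +
        famSum 𝒢 (fun n => f n * (Real.log n : ℂ)) N := by
  induction N, hN using Nat.le_induction with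
  | base => simp [famSum]
  | succ N hN ih =>
    have h1 : ∀ g : ℕ → ℂ, famSum 𝒢 g (N + 1) = famSum 𝒢 g N + g (N + 1) • charVec 𝒢 (N + 1) := by
      intro g
      unfold famSum
      rw [Finset.sum_Icc_succ_top (by omega)]
    rw [h1 f, h1 (fun n => f n * (Real.log n : ℂ)), Finset.sum_Ico_succ_top hN]
    have h2 : famSum 𝒢 (fun n => f n * (Real.log n : ℂ)) N = ((Real.log N : ℝ) : ℂ) • famSum 𝒢 f N -
      ∑ n ∈ Finset.Ico 1 N, ((Real.log (n + 1 : ℕ) - Real.log n : ℝ) : ℂ) • famSum 𝒢 f n := by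
      rw [ih]; abel
    rw [h2]
    push_cast
    module

lemma convolution_swap (a b : ℕ → ℂ) : LSeries.convolution a b = LSeries.convolution b a := by
  ext n
  rw [LSeries.convolution_apply_eq, LSeries.convolution_apply_eq, ← Nat.sum_div_divisors]
  apply Finset.sum_congr rfl
  intro d hd
  have := Nat.mem_divisors.1 hd
  rw [Nat.div_div_self this.1 this.2, mul_comm]

lemma convolution_midCoeff_add {a b c : ℕ} (hab : a ≤ b) (hbc : b ≤ c) (g f : ℕ → ℂ) (n : ℕ) :
    LSeries.convolution (midCoeff a c g) f n =
      LSeries.convolution (midCoeff a b g) f n + LSeries.convolution (midCoeff b c g) f n := by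
  simp_rw [LSeries.convolution_apply_eq, ← Finset.sum_add_distrib, ← add_mul]
  apply Finset.sum_congr rfl
  intro d _
  congr 1
  unfold midCoeff
  by_cases h1 : a < d <;> by_cases h2 : d ≤ b <;> by_cases h3 : d ≤ c <;>
    simp [h1, h2, h3] <;> omega

lemma famSum_convolution_midCoeff_add {q : ℕ} (𝒢 : Finset (DirichletCharacter ℂ q)) {a b c : ℕ} (hab : a ≤ b)
    (hbc : b ≤ c) (g f : ℕ → ℂ) (N : ℕ) :
    famSum 𝒢 (LSeries.convolution (midCoeff a c g) f) N =
      famSum 𝒢 (LSeries.convolution (midCoeff a b g) f) N + famSum 𝒢 (LSeries.convolution (midCoeff b c g) f) N := by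
  unfold famSum
  rw [← Finset.sum_add_distrib]
  apply Finset.sum_congr rfl
  intro n _
  rw [← add_smul, convolution_midCoeff_add hab hbc]

lemma norm_famSum_convolution_midCoeff_le {q : ℕ} (𝒢 : Finset (DirichletCharacter ℂ q)) {κ : ℝ} {f Λf : ℕ → ℂ}
    (hf : IsHalaszClass κ f Λf) (a b N : ℕ) :
    ‖famSum 𝒢 (LSeries.convolution (midCoeff a b Λf) f) N‖ ≤
      κ * ∑ d ∈ Finset.Ioc a b, Λ d * ‖famSum 𝒢 f (N / d)‖ := by
  unfold famSum
  rw [sum_convolution_smul, Finset.mul_sum]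
  calc _ ≤ ∑ d ∈ Finset.Icc 1 N, ‖midCoeff a b Λf d‖ * ‖famSum 𝒢 f (N / d)‖ := by
        apply norm_sum_le_of_le
        intro d _
        rw [norm_smul]
        gcongr
        exact norm_sum_charVec_mul_le 𝒢 f _ d
    _ = ∑ d ∈ (Finset.Icc 1 N).filter (fun d : ℕ => a < d ∧ d ≤ b), ‖Λf d‖ * ‖famSum 𝒢 f (N / d)‖ := by
        rw [Finset.sum_filter]
        apply Finset.sum_congr rfl
        intro d _
        unfold midCoeff
        split_ifs <;> simp
    _ ≤ ∑ d ∈ Finset.Ioc a b, ‖Λf d‖ * ‖famSum 𝒢 f (N / d)‖ := by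
        apply Finset.sum_le_sum_of_subset_of_nonneg
        · intro d hd
          rw [Finset.mem_filter] at hd
          rw [Finset.mem_Ioc]
          exact hd.2
        · intros; positivity
    _ ≤ _ := by
        apply Finset.sum_le_sum
        intro d _
        rw [← mul_assoc]
        exact mul_le_mul_of_nonneg_right (hf.bound' d) (norm_nonneg _)

theorem log_mul_norm_famSum_le {q : ℕ} (𝒢 : Finset (DirichletCharacter ℂ q)) {κ : ℝ} {f Λf : ℕ → ℂ}
    (hf : IsHalaszClass κ f Λf) {y D N : ℕ} (hyD : y ≤ D) (hN : 1 ≤ N) (hND : N ≤ D) :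
    Real.log N * ‖famSum 𝒢 f N‖ ≤ ∑ n ∈ Finset.Ico 1 N, ‖famSum 𝒢 f n‖ / n +
      κ * ∑ d ∈ Finset.Ioc 0 y, Λ d * ‖famSum 𝒢 f (N / d)‖ +
      ‖famSum 𝒢 (LSeries.convolution (midCoeff y D Λf) f) N‖ := by
  have h1 := log_smul_famSum 𝒢 f hN
  have h2 : famSum 𝒢 (fun n => f n * (Real.log n : ℂ)) N =
      famSum 𝒢 (LSeries.convolution (midCoeff 0 D Λf) f) N := by
    unfold famSum
    apply Finset.sum_congr rfl
    intro n hn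
    rw [Finset.mem_Icc] at hn
    congr 1
    change f n * (Real.log n : ℂ) = _
    rw [hf.conv n hn.1, LSeries.convolution_apply_eq]
    apply Finset.sum_congr rfl
    intro d hd
    have := Nat.pos_of_mem_divisors hd
    have := Nat.divisor_le hd
    rw [midCoeff, if_pos (by omega)]
  rw [h2, famSum_convolution_midCoeff_add 𝒢 (Nat.zero_le y) hyD] at h1
  calc Real.log N * ‖famSum 𝒢 f N‖ = ‖((Real.log N : ℝ) : ℂ) • famSum 𝒢 f N‖ := by
        rw [norm_smul, Complex.norm_real, Real.norm_of_nonneg (Real.log_natCast_nonneg N)]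
    _ ≤ _ := by
        rw [h1, ← add_assoc]
        refine (norm_add_le _ _).trans (add_le_add_left ((norm_add_le _ _).trans (add_le_add ?_ ?_)) _)
        · apply norm_sum_le_of_le
          intro n hn
          rw [Finset.mem_Ico] at hn
          have hn0 : (0 : ℝ) < n := by exact_mod_cast hn.1
          rw [norm_smul, Complex.norm_real, div_eq_inv_mul]
          gcongr
          push_cast
          rw [Real.norm_of_nonneg (by rw [sub_nonneg]; exact Real.log_le_log hn0 (by linarith)),
            ← Real.log_div (by positivity) hn0.ne']
          refine (Real.log_le_sub_one_of_pos (by positivity)).trans (le_of_eq ?_)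
          field_simp
          ring
        · exact norm_famSum_convolution_midCoeff_le 𝒢 hf 0 y N

theorem norm_famSum_mid_le {q : ℕ} (hq : 1 ≤ q) (𝒢 : Finset (DirichletCharacter ℂ q)) {κ : ℝ} (hκ : 0 ≤ κ)
    {f Λf : ℕ → ℂ} (hf : IsHalaszClass κ f Λf) {y D N z : ℕ} (hy : 2 ^ 14 ≤ y) (hqy : q ^ 2 ≤ y) (hz : 1 ≤ z)
    (hyz : y ≤ N / z) (hND : N ≤ D) :
    ‖famSum 𝒢 (LSeries.convolution (midCoeff y D Λf) f) N‖ ≤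
      κ * ∑ d ∈ Finset.Ioc y (N / z), Λ d * ‖famSum 𝒢 f (N / d)‖ +
        200 * κ * N * ∑ m ∈ Finset.Icc 1 z, ‖f m‖ / m := by
  have hd : N / z ≤ D := (Nat.div_le_self _ _).trans hND
  rw [famSum_convolution_midCoeff_add 𝒢 hyz hd]
  refine (norm_add_le _ _).trans (add_le_add (norm_famSum_convolution_midCoeff_le 𝒢 hf _ _ N) ?_)
  unfold famSum
  rw [convolution_swap, sum_convolution_smul]
  set p := midCoeff (N / z) D Λf with hp
  have hz0 : ∀ m, z < m → ∑ d ∈ Finset.Icc 1 (N / m), p d • charVec 𝒢 (m * d) = 0 := by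
    intro m hm
    apply Finset.sum_eq_zero
    intro d hd
    rw [Finset.mem_Icc] at hd
    have : N / m ≤ N / z := Nat.div_le_div_left hm.le (by omega)
    rw [hp, midCoeff, if_neg (by omega), zero_smul]
  have hb : ∀ m ∈ Finset.Icc 1 N, ‖f m • ∑ d ∈ Finset.Icc 1 (N / m), p d • charVec 𝒢 (m * d)‖ ≤
      if m ≤ z then 200 * κ * N * (‖f m‖ / m) else 0 := by
    intro m hm
    split_ifs with h
    · rw [norm_smul]
      have hm0 : (0 : ℝ) < m := by exact_mod_cast (Finset.mem_Icc.1 hm).1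
      have h1 : ‖∑ d ∈ Finset.Icc 1 (N / m), p d • charVec 𝒢 (m * d)‖ ≤ 200 * κ * (N / m) := by
        refine (norm_sum_charVec_mul_le 𝒢 p _ m).trans ?_
        refine (norm_sum_charVec_prefix_le hq hκ (fun n => (norm_midCoeff_le _ _ Λf n).trans (hf.bound' n)) hy hqy 𝒢
          (hyz.trans (Nat.div_le_div_left h (Finset.mem_Icc.1 hm).1))).trans ?_
        gcongr
        exact Nat.cast_div_le
      calc _ ≤ ‖f m‖ * (200 * κ * (N / m)) := by gcongr
        _ = _ := by ring
    · rw [hz0 m (by omega), smul_zero, norm_zero]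
  refine (norm_sum_le_of_le _ hb).trans ?_
  rw [← Finset.sum_filter, Finset.mul_sum]
  apply Finset.sum_le_sum_of_subset_of_nonneg
  · intro m hm
    rw [Finset.mem_filter, Finset.mem_Icc] at hm
    rw [Finset.mem_Icc]
    omega
  · intros; positivity

lemma famSum_sub {q : ℕ} (𝒢 : Finset (DirichletCharacter ℂ q)) (f : ℕ → ℂ) {A B : ℕ} (hAB : A ≤ B) :
    famSum 𝒢 f B = famSum 𝒢 f A + ∑ n ∈ Finset.Ioc A B, f n • charVec 𝒢 n := by
  unfold famSum
  have h : ∀ N, Finset.Icc 1 N = Finset.Ioc 0 N := fun N => rfl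
  rw [h, h, Finset.sum_Ioc_consecutive _ (Nat.zero_le A) hAB]

theorem norm_famSum_le_add {κ : ℝ} (hκ : 0 < κ) : ∃ C u₀ : ℝ, 0 < C ∧ 1 ≤ u₀ ∧
    ∀ f Λf : ℕ → ℂ, IsHalaszClass κ f Λf → ∀ q : ℕ, 1 ≤ q → ∀ 𝒢 : Finset (DirichletCharacter ℂ q),
      ∀ (δ ℓ : ℝ) (u v : ℕ), 0 < δ → δ ≤ 1 → u₀ ≤ u → 4 * (q : ℝ) ^ 2 ≤ δ ^ 2 * u → Real.log u ≤ ℓ →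
      u - ⌊δ * u⌋₊ ≤ v → v ≤ u → ‖famSum 𝒢 f u‖ ≤ ‖famSum 𝒢 f v‖ + C * δ * u * ℓ ^ κ := by
  obtain ⟨C, z₀, hC, hz₀, h⟩ := norm_sum_divMaj_charVec_le hκ
  refine ⟨C, z₀ ^ 28, hC, one_le_pow₀ (by linarith), ?_⟩
  intro f Λf hf q hq 𝒢 δ ℓ u v hδ hδ1 hu hqu hℓ hv hvu
  have hu1 : (1 : ℝ) ≤ u := (one_le_pow₀ (by linarith)).trans hu
  have hq1 : (1 : ℝ) ≤ q := by exact_mod_cast hq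
  set k := ⌊δ * u⌋₊ with hk
  have hku : k ≤ u := by
    have : (k : ℝ) ≤ u := (Nat.floor_le (by positivity)).trans (by nlinarith)
    exact_mod_cast this
  set z : ℝ := (u : ℝ) ^ (1 / 28 : ℝ) with hz
  have hz0 : 0 ≤ z := by positivity
  have hz28 : z ^ 28 = u := by
    rw [hz, ← Real.rpow_natCast, ← Real.rpow_mul (by linarith)]; norm_num
  have hzz : z₀ ≤ z := by
    apply le_of_pow_le_pow_left₀ (n := 28) (by norm_num) hz0
    rwa [hz28]
  have hz1 : 1 ≤ z := by linarith
  have hδu : 2 * q * z ^ 14 ≤ δ * u := by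
    have h1 : 2 * q ≤ δ * z ^ 14 := by
      apply le_of_sq_le_sq _ (by positivity)
      calc (2 * (q : ℝ)) ^ 2 = 4 * (q : ℝ) ^ 2 := by ring
        _ ≤ _ := hqu
        _ = _ := by rw [← hz28]; ring
    calc 2 * q * z ^ 14 ≤ (δ * z ^ 14) * z ^ 14 := by gcongr
      _ = _ := by rw [← hz28]; ring
  have hk2 : δ * u / 2 ≤ k := by
    have h1 := (Nat.lt_floor_add_one (δ * u)).le
    have h2 : 2 * 1 * 1 ≤ 2 * q * z ^ 14 := by
      gcongr
      exact one_le_pow₀ hz1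
    rw [← hk] at h1
    linarith
  have hkδ : (k : ℝ) ≤ δ * u := Nat.floor_le (by positivity)
  set a : ℕ → ℂ := fun n => if v < n then f n else 0 with ha
  have h1 := h a (fun n hn => by
      rw [ha]
      dsimp only
      split_ifs
      · exact hf.norm_le_divMaj hκ hn
      · rw [norm_zero]; exact (divMaj_pos hκ n).le) z hzz q (u - k) u hq (Nat.sub_le _ _) hz28.ge (by
    rw [Nat.cast_sub hku]
    calc (q : ℝ) * z ^ 7 ≤ q * z ^ 14 := by gcongr; norm_num
      _ ≤ (k : ℝ) := by linarith
      _ = _ := by ring) 𝒢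
  have h2 : ∑ n ∈ Finset.Ioc (u - k) u, a n • charVec 𝒢 n = ∑ n ∈ Finset.Ioc v u, f n • charVec 𝒢 n := by
    symm
    rw [← Finset.sum_subset (Finset.Ioc_subset_Ioc_left hv)]
    · apply Finset.sum_congr rfl
      intro n hn
      rw [ha]
      simp [(Finset.mem_Ioc.1 hn).1]
    · intro n hn hn2
      rw [Finset.mem_Ioc] at hn hn2
      rw [ha]
      dsimp only
      rw [if_neg (by omega), zero_smul]
  rw [h2] at h1
  have hlz : 1 ≤ Real.log z := by
    rw [Real.le_log_iff_exp_le (by linarith)]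
    have := Real.exp_one_lt_d9
    linarith
  have hlz2 : Real.log z ^ (κ - 1) ≤ ℓ ^ κ := by
    have h3 : Real.log z ≤ ℓ := by
      refine le_trans (Real.log_le_log (by linarith) ?_) hℓ
      rw [← hz28]
      exact le_self_pow₀ hz1 (by norm_num)
    calc _ ≤ Real.log z ^ κ := Real.rpow_le_rpow_of_exponent_le hlz (by linarith)
      _ ≤ _ := by gcongr
  rw [famSum_sub 𝒢 f hvu]
  refine (norm_add_le _ _).trans (add_le_add le_rfl (h1.trans ?_))
  rw [Nat.cast_sub hku]
  calc C * (u - (u - k)) * Real.log z ^ (κ - 1) = C * k * Real.log z ^ (κ - 1) := by ring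
    _ ≤ C * (δ * u) * ℓ ^ κ := by gcongr
    _ = _ := by ring

/-- Chebyshev-type bound in the short interval `((1 - δ)x, x]`. -/
lemma sum_vonMangoldt_short_le {δ x : ℝ} (hδ : 0 < δ) (hδ1 : δ ≤ 1) {B : ℕ} (hB : B = ⌊x⌋₊) (hB2 : 2 ^ 28 ≤ B)
    (hBδ : 1 ≤ δ ^ 4 * B) {I : Finset ℕ} (hI : ∀ d ∈ I, (1 - δ) * x < d ∧ (d : ℝ) ≤ x) :
    ∑ d ∈ I, Λ d ≤ 400 * (δ * x) := by
  have hBR : (2 : ℝ) ^ 28 ≤ B := by exact_mod_cast hB2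
  have hx0 : 0 ≤ x := by
    by_contra hneg
    rw [hB, Nat.floor_of_nonpos (by linarith)] at hBR
    norm_num at hBR
  have hBx : (B : ℝ) ≤ x := by rw [hB]; exact Nat.floor_le hx0
  set A := ⌊(1 - δ) * x⌋₊ with hA
  have hA0 : 0 ≤ (1 - δ) * x := mul_nonneg (by linarith) hx0
  have hAx : (A : ℝ) ≤ (1 - δ) * x := Nat.floor_le hA0
  have hAx2 : (1 - δ) * x < A + 1 := Nat.lt_floor_add_one _
  have hBx2 : x < B + 1 := by rw [hB]; exact Nat.lt_floor_add_one _
  have hB0 : (0 : ℝ) < B := by linarith [show (0 : ℝ) < 2 ^ 28 by norm_num]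
  set z : ℝ := (B : ℝ) ^ (1 / 28 : ℝ) with hz
  have hz0 : 0 ≤ z := by positivity
  have hz28 : z ^ 28 = B := by
    rw [hz, ← Real.rpow_natCast, ← Real.rpow_mul hB0.le]; norm_num
  have hz2 : 2 ≤ z := by
    apply le_of_pow_le_pow_left₀ (n := 28) (by norm_num) hz0
    rwa [hz28]
  have h1 : 1 ≤ δ * z ^ 7 := by
    apply le_of_pow_le_pow_left₀ (n := 4) (by norm_num) (by positivity)
    calc (1 : ℝ) ^ 4 = 1 := by norm_num
      _ ≤ _ := hBδ
      _ = _ := by rw [← hz28]; ring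
  have hz7 : 2 ≤ z ^ 7 := hz2.trans (le_self_pow₀ (by linarith) (by norm_num))
  have h2 : (z ^ 7) ^ 3 ≤ δ * x := by
    calc (z ^ 7) ^ 3 = 1 * (z ^ 7) ^ 3 := by ring
      _ ≤ (δ * z ^ 7) * (z ^ 7) ^ 3 := by gcongr
      _ = δ * B := by rw [← hz28]; ring
      _ ≤ _ := by gcongr
  have h3 : z ^ 7 + 1 ≤ (z ^ 7) ^ 3 := by nlinarith [sq_nonneg (z ^ 7 - 2)]
  have hAB : A ≤ B := by
    rw [hA, hB]
    apply Nat.floor_le_floor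
    nlinarith
  have h4 := sum_vonMangoldt_ap_le (q := 1) (a := 0) le_rfl hAB hz2 hz28.ge (by
    push_cast
    linarith)
  calc ∑ d ∈ I, Λ d ≤ ∑ d ∈ (Finset.Ioc A B).filter (fun n : ℕ => n ≡ 0 [MOD 1]), Λ d := by
        apply Finset.sum_le_sum_of_subset_of_nonneg
        · intro d hd
          obtain ⟨hd1, hd2⟩ := hI d hd
          rw [Finset.mem_filter, Finset.mem_Ioc]
          refine ⟨⟨?_, ?_⟩, Nat.modEq_one⟩
          · exact (Nat.floor_lt hA0).2 hd1
          · rw [hB]; exact Nat.le_floor hd2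
        · intros; exact ArithmeticFunction.vonMangoldt_nonneg
    _ ≤ _ := h4
    _ = 200 * (B - A) := by simp
    _ ≤ _ := by linarith

set_option maxHeartbeats 1000000 in
theorem sum_vonMangoldt_mul_norm_famSum_le {κ : ℝ} (hκ : 0 < κ) : ∃ C u₀ : ℝ, 0 < C ∧ 1 ≤ u₀ ∧
    ∀ f Λf : ℕ → ℂ, IsHalaszClass κ f Λf → ∀ q : ℕ, 1 ≤ q → ∀ 𝒢 : Finset (DirichletCharacter ℂ q),
      ∀ (δ ℓ : ℝ) (y z w N : ℕ), 0 < δ → δ ≤ 1 / 2 → u₀ ≤ z → 4 * (q : ℝ) ^ 2 ≤ δ ^ 2 * z → 1 ≤ ℓ →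
      Real.log N ≤ ℓ → δ * ℓ ^ (κ + 1) ≤ 1 → 2 ^ 28 ≤ y → 1 ≤ δ ^ 4 * y → y ≤ N / z → 1 ≤ w → 2 * w ≤ z →
      ∑ d ∈ Finset.Ioc y (N / z), Λ d * ‖famSum 𝒢 f (N / d)‖ ≤
        800 * N * ∑ v ∈ Finset.Icc w N, ‖famSum 𝒢 f v‖ / (v : ℝ) ^ 2 + C * N := by
  obtain ⟨C, u₀, hC, hu₀, h⟩ := norm_famSum_le_add hκ
  refine ⟨8 * C, u₀, by positivity, hu₀, ?_⟩
  intro f Λf hf q hq 𝒢 δ ℓ y z w N hδ hδ2 hz hqz hℓ1 hℓ hδℓ hy hyδ hyN hw hwz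
  have hz1 : 1 ≤ z := by omega
  have hNy : 2 ^ 28 ≤ N := hy.trans (hyN.trans (Nat.div_le_self _ _))
  have hN0 : (0 : ℝ) < N := by exact_mod_cast (by omega : 0 < N)
  have hq1 : (1 : ℝ) ≤ q := by exact_mod_cast hq
  set P : ℕ → ℕ → Prop := fun d v => N / d - ⌊δ * (N / d : ℕ)⌋₊ < v ∧ v ≤ N / d with hP
  have hd : ∀ d ∈ Finset.Ioc y (N / z), z ≤ N / d ∧ 0 < d := by
    intro d hd
    rw [Finset.mem_Ioc] at hd
    have hd0 : 0 < d := by omega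
    refine ⟨?_, hd0⟩
    rw [Nat.le_div_iff_mul_le hd0, mul_comm]
    exact (Nat.le_div_iff_mul_le (by omega)).1 hd.2
  have hpt : ∀ d ∈ Finset.Ioc y (N / z), Λ d * ‖famSum 𝒢 f (N / d)‖ ≤
      Λ d * (∑ v ∈ Finset.Icc w N, if P d v then 2 / (δ * v) * ‖famSum 𝒢 f v‖ else 0) +
        C * δ * ℓ ^ κ * N * (Λ d / d) := by
    intro d hdm
    obtain ⟨hzu, hd0⟩ := hd d hdm
    have hd0' : (0 : ℝ) < d := by exact_mod_cast hd0
    set u := N / d with hu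
    set k := ⌊δ * (u : ℝ)⌋₊ with hk
    have huR : (u : ℝ) ≤ N / d := Nat.cast_div_le
    have hzuR : (z : ℝ) ≤ u := by exact_mod_cast hzu
    have hu0 : (0 : ℝ) < u := by linarith
    have hquu : 4 * (q : ℝ) ^ 2 ≤ δ ^ 2 * u := hqz.trans (by gcongr)
    have hkδ : (k : ℝ) ≤ δ * u := Nat.floor_le (by positivity)
    have hδu : 2 ≤ δ * u := by
      have : δ ^ 2 * u ≤ 1 / 2 * (δ * u) := by
        rw [sq, mul_assoc]
        gcongr
      nlinarith
    have hk2 : δ * u / 2 ≤ k := by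
      have h1 := (Nat.lt_floor_add_one (δ * u)).le
      rw [← hk] at h1
      linarith
    have hku : 2 * k ≤ u := by
      have : (2 * k : ℝ) ≤ u := by nlinarith
      exact_mod_cast this
    have hk0 : (0 : ℝ) < k := by linarith
    have huN : u ≤ N := Nat.div_le_self _ _
    have hE : ∀ v ∈ Finset.Ioc (u - k) u, ‖famSum 𝒢 f u‖ ≤ ‖famSum 𝒢 f v‖ + C * δ * u * ℓ ^ κ := by
      intro v hv
      rw [Finset.mem_Ioc] at hv
      refine h f Λf hf q hq 𝒢 δ ℓ u v hδ (by linarith) (hz.trans hzuR) hquu ?_ hv.1.le hv.2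
      exact (Real.log_le_log hu0 (by exact_mod_cast huN)).trans hℓ
    have hav : k * ‖famSum 𝒢 f u‖ ≤ ∑ v ∈ Finset.Ioc (u - k) u, ‖famSum 𝒢 f v‖ + k * (C * δ * u * ℓ ^ κ) := by
      have h1 := Finset.card_nsmul_le_sum (Finset.Ioc (u - k) u) _ _ hE
      rw [Finset.sum_add_distrib, Finset.sum_const, Nat.card_Ioc, nsmul_eq_mul, nsmul_eq_mul,
        Nat.sub_sub_self (by omega)] at h1
      exact h1
    have hav2 : ‖famSum 𝒢 f u‖ ≤ (∑ v ∈ Finset.Icc w N, if P d v then 2 / (δ * v) * ‖famSum 𝒢 f v‖ else 0) +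
        C * δ * u * ℓ ^ κ := by
      have h1 : ‖famSum 𝒢 f u‖ ≤ (∑ v ∈ Finset.Ioc (u - k) u, ‖famSum 𝒢 f v‖) / k + C * δ * u * ℓ ^ κ := by
        rw [div_add' _ _ _ hk0.ne', le_div_iff₀ hk0]
        linarith
      refine h1.trans (add_le_add ?_ le_rfl)
      rw [Finset.sum_div, ← Finset.sum_filter]
      calc ∑ v ∈ Finset.Ioc (u - k) u, ‖famSum 𝒢 f v‖ / k
          ≤ ∑ v ∈ Finset.Ioc (u - k) u, 2 / (δ * v) * ‖famSum 𝒢 f v‖ := by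
            apply Finset.sum_le_sum
            intro v hv
            rw [Finset.mem_Ioc] at hv
            have hv0 : (0 : ℝ) < v := by exact_mod_cast (by omega : 0 < v)
            have hvu : (v : ℝ) ≤ u := by exact_mod_cast hv.2
            rw [div_eq_inv_mul, ← one_div]
            gcongr ?_ * _
            rw [div_le_div_iff₀ hk0 (by positivity)]
            have : δ * v ≤ δ * u := by gcongr
            linarith
        _ ≤ _ := by
            apply Finset.sum_le_sum_of_subset_of_nonneg
            · intro v hv
              rw [Finset.mem_Ioc] at hv
              rw [Finset.mem_filter, Finset.mem_Icc]
              exact ⟨⟨by omega, by omega⟩, hv⟩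
            · intros; positivity
    have hΛ : 0 ≤ Λ d := ArithmeticFunction.vonMangoldt_nonneg
    calc Λ d * ‖famSum 𝒢 f u‖ ≤ Λ d * ((∑ v ∈ Finset.Icc w N, if P d v then 2 / (δ * v) * ‖famSum 𝒢 f v‖ else 0) +
        C * δ * (N / d) * ℓ ^ κ) := by
          gcongr
          refine hav2.trans ?_
          gcongr
      _ = _ := by ring
  refine (Finset.sum_le_sum hpt).trans ?_
  rw [Finset.sum_add_distrib]
  apply add_le_add
  · simp_rw [Finset.mul_sum]
    rw [Finset.sum_comm]
    apply Finset.sum_le_sum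
    intro v hv
    rw [Finset.mem_Icc] at hv
    have hv0 : (0 : ℝ) < v := by exact_mod_cast (by omega : 0 < v)
    have h1 : ∑ d ∈ Finset.Ioc y (N / z), Λ d * (if P d v then 2 / (δ * v) * ‖famSum 𝒢 f v‖ else 0) =
        (∑ d ∈ (Finset.Ioc y (N / z)).filter (fun d : ℕ => P d v), Λ d) * (2 / (δ * v) * ‖famSum 𝒢 f v‖) := by
      rw [Finset.sum_mul, Finset.sum_filter]
      apply Finset.sum_congr rfl
      intro d _
      split_ifs <;> simp
    rw [h1]
    have h2 : ∑ d ∈ (Finset.Ioc y (N / z)).filter (fun d : ℕ => P d v), Λ d ≤ 400 * (δ * (N / v)) := by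
      rcases ((Finset.Ioc y (N / z)).filter (fun d : ℕ => P d v)).eq_empty_or_nonempty with he | ⟨d₁, hd₁⟩
      · rw [he, Finset.sum_empty]; positivity
      · have hB : y ≤ N / v := by
          rw [Finset.mem_filter] at hd₁
          obtain ⟨h3, h4⟩ := hd₁
          have := (Nat.le_div_iff_mul_le (hd d₁ h3).2).1 h4.2
          have h5 : d₁ ≤ N / v := by
            rw [Nat.le_div_iff_mul_le (by omega)]; linarith
          have := (Finset.mem_Ioc.1 h3).1
          omega
        have hBR : (y : ℝ) ≤ (N / v : ℕ) := by exact_mod_cast hB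
        apply sum_vonMangoldt_short_le hδ (by linarith) (B := N / v) (Nat.floor_div_eq_div (K := ℝ) N v).symm (hy.trans hB)
        · exact hyδ.trans (by gcongr)
        · intro d hdm
          rw [Finset.mem_filter] at hdm
          obtain ⟨h3, h4⟩ := hdm
          obtain ⟨hzu, hd0⟩ := hd d h3
          have hd0' : (0 : ℝ) < d := by exact_mod_cast hd0
          have hkδ : (⌊δ * (N / d : ℕ)⌋₊ : ℝ) ≤ δ * (N / d : ℕ) := Nat.floor_le (by positivity)
          have huR : ((N / d : ℕ) : ℝ) ≤ N / d := Nat.cast_div_le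
          have huR2 : (N : ℝ) / d < (N / d : ℕ) + 1 := by
            rw [← Nat.floor_div_eq_div (K := ℝ)]; exact Nat.lt_floor_add_one _
          have h5 : ((N / d : ℕ) : ℝ) + 1 ≤ v + ⌊δ * (N / d : ℕ)⌋₊ := by
            have := h4.1
            exact_mod_cast (by omega : N / d + 1 ≤ v + ⌊δ * (N / d : ℕ)⌋₊)
          constructor
          · rw [← mul_div_assoc, div_lt_iff₀ hv0]
            have h6 : (1 - δ) * (N / d) < v := by
              have : δ * (N / d : ℕ) ≤ δ * (N / d) := by gcongr
              linarith
            rw [← mul_div_assoc, div_lt_iff₀ hd0'] at h6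
            linarith
          · rw [le_div_iff₀ hv0]
            have := (Nat.le_div_iff_mul_le hd0).1 h4.2
            have h7 : (v : ℝ) * d ≤ N := by exact_mod_cast this
            linarith
    calc _ ≤ 400 * (δ * (N / v)) * (2 / (δ * v) * ‖famSum 𝒢 f v‖) := by gcongr
      _ = _ := by field_simp; ring
  · rw [← Finset.mul_sum]
    have h1 : ∑ d ∈ Finset.Ioc y (N / z), Λ d / d ≤ ℓ + 7 := by
      have h3 := (abs_le.1 (abs_mertens (x := N) (by exact_mod_cast (by omega : 1 ≤ N)))).2
      rw [Nat.floor_natCast] at h3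
      calc _ ≤ ∑ d ∈ Finset.Icc 1 N, Λ d / d := by
            apply Finset.sum_le_sum_of_subset_of_nonneg
            · intro d hd
              rw [Finset.mem_Ioc] at hd
              have := Nat.div_le_self N z
              rw [Finset.mem_Icc]
              omega
            · intro d _ _
              have : 0 ≤ Λ d := ArithmeticFunction.vonMangoldt_nonneg
              positivity
        _ ≤ _ := by linarith
    calc C * δ * ℓ ^ κ * N * ∑ d ∈ Finset.Ioc y (N / z), Λ d / d ≤ C * δ * ℓ ^ κ * N * (8 * ℓ) := by
          gcongr
          linarith
      _ = 8 * C * N * (δ * ℓ ^ (κ + 1)) := by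
          rw [Real.rpow_add_one (by linarith)]; ring
      _ ≤ 8 * C * N * 1 := by gcongr
      _ = _ := by ring

lemma card_character_le {q : ℕ} (hq : 1 ≤ q) (𝒢 : Finset (DirichletCharacter ℂ q)) : (𝒢.card : ℝ) ≤ q := by
  have : NeZero q := ⟨by omega⟩
  have h1 : 𝒢.card ≤ Fintype.card (DirichletCharacter ℂ q) := Finset.card_le_univ _
  rw [← Nat.card_eq_fintype_card, DirichletCharacter.card_eq_totient_of_hasEnoughRootsOfUnity] at h1
  exact_mod_cast h1.trans (Nat.totient_le q)

lemma norm_charVec_le {q : ℕ} (hq : 1 ≤ q) (𝒢 : Finset (DirichletCharacter ℂ q)) (n : ℕ) : ‖charVec 𝒢 n‖ ≤ q := by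
  have hq1 : (1 : ℝ) ≤ q := by exact_mod_cast hq
  apply le_of_sq_le_sq _ (by positivity)
  have h1 := norm_sum_charVec_sq 𝒢 (fun _ => 1) {n}
  simp only [Finset.sum_singleton, one_smul, charTwist, one_mul] at h1
  rw [h1]
  calc ∑ χ ∈ 𝒢, ‖χ⁻¹ (n : ZMod q)‖ ^ 2 ≤ ∑ χ ∈ 𝒢, (1 : ℝ) := by
        apply Finset.sum_le_sum
        intro χ _
        exact pow_le_one₀ (norm_nonneg _) (DirichletCharacter.norm_le_one χ⁻¹ _)
    _ = 𝒢.card := by simp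
    _ ≤ q := card_character_le hq 𝒢
    _ ≤ _ := by nlinarith

theorem norm_famSum_le_crude {κ : ℝ} (hκ : 0 < κ) : ∃ C : ℝ, 0 < C ∧ ∀ f Λf : ℕ → ℂ, IsHalaszClass κ f Λf →
    ∀ q : ℕ, 1 ≤ q → ∀ (𝒢 : Finset (DirichletCharacter ℂ q)) (n : ℕ), ‖famSum 𝒢 f n‖ ≤ C * q * n * √n := by
  obtain ⟨C, hC, h⟩ := exists_divMaj_le_rpow hκ (show (0 : ℝ) < 1 / 2 by norm_num)
  refine ⟨C, by linarith, fun f Λf hf q hq 𝒢 n => ?_⟩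
  unfold famSum
  calc _ ≤ ∑ m ∈ Finset.Icc 1 n, C * √n * q := by
        apply norm_sum_le_of_le
        intro m hm
        rw [Finset.mem_Icc] at hm
        rw [norm_smul]
        have h1 := hf.norm_le_divMaj hκ (n := m) (by omega)
        have h2 := h m (by omega)
        rw [← Real.sqrt_eq_rpow] at h2
        have h3 : √(m : ℝ) ≤ √n := Real.sqrt_le_sqrt (by exact_mod_cast hm.2)
        have h4 := norm_charVec_le hq 𝒢 m
        have h5 : ‖f m‖ ≤ C * √n := by
          refine (h1.trans h2).trans ?_
          gcongr
        gcongr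
    _ = _ := by
        rw [Finset.sum_const, Nat.card_Icc, nsmul_eq_mul, Nat.add_sub_cancel]
        ring

theorem sum_low_le {κ : ℝ} (hκ : 0 < κ) : ∃ C : ℝ, 0 < C ∧ ∀ f Λf : ℕ → ℂ, IsHalaszClass κ f Λf →
    ∀ q : ℕ, 1 ≤ q → ∀ (𝒢 : Finset (DirichletCharacter ℂ q)) (y Z N : ℕ) (P : ℝ), 0 ≤ P → 1 ≤ y → 2 ≤ Z →
      (∀ n, Z ≤ n → n ≤ N → ‖famSum 𝒢 f n‖ ≤ P * (n / Real.log n)) →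
      ∀ v, Z ^ 2 ≤ v → v ≤ N → 4 * y ^ 2 ≤ v → (C * q) ^ 4 ≤ (v : ℝ) →
      ∑ n ∈ Finset.Ico 1 v, ‖famSum 𝒢 f n‖ / n + κ * ∑ d ∈ Finset.Ioc 0 y, Λ d * ‖famSum 𝒢 f (v / d)‖ ≤
        v + P * (2 + 2 * κ * (Real.log y + 7)) * (v / Real.log v) := by
  obtain ⟨C, hC, hcr⟩ := norm_famSum_le_crude hκ
  refine ⟨C, hC, ?_⟩
  intro f Λf hf q hq 𝒢 y Z N P hP hy hZ hN v hZv hvN hyv hCv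
  have hv4 : 4 ≤ v := by nlinarith
  have hv0 : (0 : ℝ) < v := by exact_mod_cast (by omega : 0 < v)
  have hlv : 0 < Real.log v := Real.log_pos (by exact_mod_cast (by omega : 1 < v))
  set t : ℝ := √(√v) with ht
  have ht0 : 0 ≤ t := Real.sqrt_nonneg _
  have ht2 : t ^ 2 = √v := Real.sq_sqrt (Real.sqrt_nonneg _)
  have ht4 : t ^ 4 = v := by
    rw [show t ^ 4 = (t ^ 2) ^ 2 by ring, ht2, Real.sq_sqrt hv0.le]
  have hCt : C * q ≤ t := by
    apply le_of_pow_le_pow_left₀ (n := 4) (by norm_num) ht0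
    rwa [ht4]
  have hbig : ∀ u : ℕ, v ≤ u ^ 2 → u ≤ v → ‖famSum 𝒢 f u‖ ≤ 2 * P / Real.log v * u := by
    intro u hu huv
    have hZu : Z ≤ u := by
      by_contra hneg
      have : u ^ 2 < Z ^ 2 := Nat.pow_lt_pow_left (not_le.1 hneg) (by norm_num)
      omega
    have hu0 : (0 : ℝ) < u := by exact_mod_cast (by omega : 0 < u)
    have hlu : Real.log v ≤ 2 * Real.log u := by
      calc Real.log v ≤ Real.log ((u : ℝ) ^ 2) := Real.log_le_log hv0 (by exact_mod_cast hu)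
        _ = _ := by rw [Real.log_pow]; norm_num
    refine (hN u hZu (huv.trans hvN)).trans ?_
    calc P * (u / Real.log u) ≤ P * (u / (Real.log v / 2)) := by gcongr; linarith
      _ = _ := by field_simp
  have h1 : ∑ n ∈ Finset.Ico 1 v, ‖famSum 𝒢 f n‖ / n ≤ v + 2 * P / Real.log v * v := by
    have hpt : ∀ n ∈ Finset.Ico 1 v, ‖famSum 𝒢 f n‖ / n ≤ (if n ^ 2 ≤ v then t * t else 0) + 2 * P / Real.log v := by
      intro n hn
      rw [Finset.mem_Ico] at hn
      have hn0 : (0 : ℝ) < n := by exact_mod_cast hn.1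
      rw [div_le_iff₀ hn0]
      split_ifs with h
      · have h2 : √(n : ℝ) ≤ t := by
          apply Real.sqrt_le_sqrt
          apply Real.le_sqrt_of_sq_le
          exact_mod_cast h
        calc _ ≤ _ := hcr f Λf hf q hq 𝒢 n
          _ ≤ t * n * t := by gcongr
          _ = t * t * n + 0 := by ring
          _ ≤ t * t * n + 2 * P / Real.log v * n := by gcongr; positivity
          _ = _ := by ring
      · rw [zero_add]
        exact hbig n (by omega) hn.2.le
    refine (Finset.sum_le_sum hpt).trans ?_
    rw [Finset.sum_add_distrib, ← Finset.sum_filter, Finset.sum_const, Finset.sum_const, nsmul_eq_mul, nsmul_eq_mul,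
      Nat.card_Ico]
    apply add_le_add
    · have hc : (((Finset.Ico 1 v).filter (fun n : ℕ => n ^ 2 ≤ v)).card : ℝ) ≤ t * t := by
        have h2 : ((Finset.Ico 1 v).filter (fun n : ℕ => n ^ 2 ≤ v)).card ≤ (Finset.Icc 1 (Nat.sqrt v)).card := by
          apply Finset.card_le_card
          intro n hn
          rw [Finset.mem_filter, Finset.mem_Ico] at hn
          rw [Finset.mem_Icc]
          exact ⟨hn.1.1, Nat.le_sqrt'.2 hn.2⟩
        rw [Nat.card_Icc, Nat.add_sub_cancel] at h2
        have h3 : (Nat.sqrt v : ℝ) ≤ t * t := by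
          rw [← sq, ht2]
          exact Real.nat_sqrt_le_real_sqrt
        exact le_trans (by exact_mod_cast h2) h3
      calc _ ≤ (t * t) * (t * t) := by gcongr
        _ = v := by rw [← ht4]; ring
    · rw [mul_comm]
      gcongr
      exact_mod_cast Nat.sub_le v 1
  have h2 : ∑ d ∈ Finset.Ioc 0 y, Λ d * ‖famSum 𝒢 f (v / d)‖ ≤ 2 * P / Real.log v * v * (Real.log y + 7) := by
    have hpt : ∀ d ∈ Finset.Ioc 0 y, Λ d * ‖famSum 𝒢 f (v / d)‖ ≤ 2 * P / Real.log v * v * (Λ d / d) := by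
      intro d hd
      rw [Finset.mem_Ioc] at hd
      have hu : v ≤ (v / d) ^ 2 := by
        have h3 : v < d * (v / d) + d := by
          have := Nat.div_add_mod v d
          have := Nat.mod_lt v hd.1
          omega
        have h4 : v ≤ 2 * y * (v / d) := by
          have h5 : d ≤ d * (v / d) := by
            apply Nat.le_mul_of_pos_right
            exact Nat.div_pos (by nlinarith) hd.1
          have h6 : d * (v / d) ≤ y * (v / d) := Nat.mul_le_mul_right _ hd.2
          nlinarith
        have h7 : v * (4 * y ^ 2) ≤ (v / d) ^ 2 * (4 * y ^ 2) := by
          calc v * (4 * y ^ 2) ≤ v * v := Nat.mul_le_mul_left _ hyv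
            _ ≤ (2 * y * (v / d)) * (2 * y * (v / d)) := Nat.mul_le_mul h4 h4
            _ = _ := by ring
        exact Nat.le_of_mul_le_mul_right h7 (by positivity)
      have h3 := hbig (v / d) hu (Nat.div_le_self _ _)
      have hΛ : 0 ≤ Λ d := ArithmeticFunction.vonMangoldt_nonneg
      calc _ ≤ Λ d * (2 * P / Real.log v * (v / d)) := by
            gcongr
            refine h3.trans ?_
            gcongr
            exact Nat.cast_div_le
        _ = _ := by ring
    refine (Finset.sum_le_sum hpt).trans ?_
    rw [← Finset.mul_sum]
    have h3 := (abs_le.1 (abs_mertens (x := y) (by exact_mod_cast hy))).2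
    rw [Nat.floor_natCast] at h3
    gcongr
    have h4 : Finset.Icc 1 y = Finset.Ioc 0 y := rfl
    rw [← h4]
    linarith
  calc _ ≤ (v + 2 * P / Real.log v * v) + κ * (2 * P / Real.log v * v * (Real.log y + 7)) := by gcongr
    _ = _ := by ring

lemma bootstrap_le {g : ℕ → ℝ} (hg : ∀ n, 0 ≤ g n) {Z N₀ N₁ : ℕ} {S B : ℝ}
    (hS : ∀ n, Z ≤ n → n < N₀ → n ≤ N₁ → g n ≤ S)
    (hB : ∀ P, 0 ≤ P → (∀ n, Z ≤ n → n ≤ N₁ → g n ≤ P) → ∀ n, N₀ ≤ n → n ≤ N₁ → g n ≤ P / 2 + B)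
    {n : ℕ} (hn : Z ≤ n) (hn1 : n ≤ N₁) : g n ≤ max S (2 * B) := by
  obtain ⟨m, hm, hmax⟩ := Finset.exists_max_image (Finset.Icc Z N₁) g ⟨n, Finset.mem_Icc.2 ⟨hn, hn1⟩⟩
  have h1 := hmax n (Finset.mem_Icc.2 ⟨hn, hn1⟩)
  rw [Finset.mem_Icc] at hm
  refine h1.trans ?_
  rcases lt_or_ge m N₀ with h | h
  · exact (hS m hm.1 h hm.2).trans (le_max_left _ _)
  · have h2 := hB (g m) (hg m) (fun n hn hn1 => hmax n (Finset.mem_Icc.2 ⟨hn, hn1⟩)) m h hm.2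
    exact le_trans (by linarith) (le_max_right _ _)

theorem sum_norm_div_le {κ : ℝ} (hκ : 0 < κ) : ∃ C : ℝ, 1 ≤ C ∧ ∀ f Λf : ℕ → ℂ, IsHalaszClass κ f Λf →
    ∀ z : ℕ, 2 ≤ z → ∑ m ∈ Finset.Icc 1 z, ‖f m‖ / m ≤ C * Real.log z ^ κ := by
  obtain ⟨C, hC, h⟩ := rankin_bound hκ (c₀ := 0)
  refine ⟨C, hC, fun f Λf hf z hz => ?_⟩
  refine le_trans ?_ (h z (by exact_mod_cast hz) 0 le_rfl (by norm_num) (by simp) (Finset.Icc 1 z) ?_)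
  · apply Finset.sum_le_sum
    intro m hm
    rw [Finset.mem_Icc] at hm
    rw [zero_sub, Real.rpow_neg_one, div_eq_mul_inv]
    gcongr
    exact hf.norm_le_divMaj hκ (by omega)
  · intro b hb
    rw [Finset.mem_Icc] at hb
    refine ⟨by omega, fun p _ hpb => ?_⟩
    exact_mod_cast (Nat.le_of_dvd (by omega) hpb).trans hb.2

set_option maxHeartbeats 1600000 in
theorem bootstrap_step {κ : ℝ} (hκ : 0 < κ) : ∃ C₁ : ℝ, 1 ≤ C₁ ∧ ∀ f Λf : ℕ → ℂ, IsHalaszClass κ f Λf →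
    ∀ q : ℕ, 1 ≤ q → ∀ (𝒢 : Finset (DirichletCharacter ℂ q)) (δ ℓ L T M : ℝ) (y Z D N₀ : ℕ),
      0 < δ → δ ≤ 1 / 2 → C₁ ≤ Z → 4 * (q : ℝ) ^ 2 ≤ δ ^ 2 * Z → 3 ≤ Z → 1 ≤ ℓ → Real.log D ≤ ℓ →
      δ * ℓ ^ (κ + 1) ≤ 1 → 2 ^ 28 ≤ y → 1 ≤ δ ^ 4 * y → q ^ 2 ≤ y → 1 ≤ L → Real.log (D + 1 : ℕ) ≤ 2 * L → 2 ≤ T →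
      q * L ^ (2 * κ + 2) ≤ T → 1 ≤ M →
      (∀ χ ∈ 𝒢, ∀ α t : ℝ, 1 / (2 * L) ≤ α → |t| ≤ T → ‖LSeries (charTwist f χ) ⟨1 + α, t⟩‖ ≤ M) →
      2 * y ≤ Z → (C₁ * q) ^ 2 ≤ Z → 2 * y * Z ^ 2 ≤ N₀ →
      4 * (2 + 2 * κ * (Real.log y + 7)) ≤ Real.log N₀ →
      3200 * κ * (2 + 2 * κ * (Real.log y + 7)) ≤ Real.log Z →
      ∀ P, 0 ≤ P → (∀ n, Z ≤ n → n ≤ D → ‖famSum 𝒢 f n‖ * Real.log n / n ≤ P) →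
      ∀ n, N₀ ≤ n → n ≤ D → ‖famSum 𝒢 f n‖ * Real.log n / n ≤
        P / 2 + C₁ * (M * (1 + Real.log (Real.log (D + 1 : ℕ) / Real.log (Z ^ 2 : ℕ))) + Real.log (2 * Z ^ 2 : ℕ) ^ κ) := by
  obtain ⟨Cl, hCl, hlow⟩ := sum_low_le hκ
  obtain ⟨Cd, u₀, hCd, hu₀, hdiag⟩ := sum_vonMangoldt_mul_norm_famSum_le hκ
  obtain ⟨Cm, hCm, hmid⟩ := sum_norm_mid_le hκ.le
  obtain ⟨Cr, hCr, hran⟩ := sum_norm_div_le hκ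
  refine ⟨Cl + u₀ + (1 + 800 * κ * (1 + 2 * Cm) + κ * Cd) + 200 * κ * Cr + 1600 * κ, ?_, ?_⟩
  · have : 0 ≤ 800 * κ * (1 + 2 * Cm) + κ * Cd + 200 * κ * Cr + 1600 * κ := by positivity
    linarith
  intro f Λf hf q hq 𝒢 δ ℓ L T M y Z D N₀ hδ hδ2 hCZ hqZ hZ3 hℓ hDℓ hδℓ hy hδy hqy hL hDL hT hqT hM hF hyZ hCqZ hN₀
    hWN hWZ P hP hg N hN hND
  have hCmD : 0 ≤ 800 * κ * (1 + 2 * Cm) + κ * Cd + 200 * κ * Cr + 1600 * κ := by positivity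
  set C₁ := Cl + u₀ + (1 + 800 * κ * (1 + 2 * Cm) + κ * Cd) + 200 * κ * Cr + 1600 * κ with hC₁
  have hZ1 : 1 ≤ Z ^ 2 := by nlinarith
  have hZ9 : 9 ≤ Z ^ 2 := by nlinarith
  have hy0 : 0 < y := by omega
  have hwN : Z ^ 2 ≤ N := (Nat.le_mul_of_pos_left _ (by omega)).trans (hN₀.trans hN)
  have hly : 0 ≤ Real.log y := Real.log_natCast_nonneg y
  set W := 2 + 2 * κ * (Real.log y + 7) with hW
  have hW0 : 0 ≤ W := by positivity
  have hNpos : (0 : ℝ) < N := by exact_mod_cast (by omega : 0 < N)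
  have hlZ : 0 < Real.log Z := Real.log_pos (by exact_mod_cast (by omega : 1 < Z))
  have hlw : Real.log (Z ^ 2 : ℕ) = 2 * Real.log Z := by push_cast; rw [Real.log_pow]; norm_num
  -- bound at each v
  have key : ∀ v, Z ^ 2 ≤ v → v ≤ D → Real.log v * ‖famSum 𝒢 f v‖ ≤ v + P * W * (v / Real.log v) +
      ‖famSum 𝒢 (LSeries.convolution (midCoeff y D Λf) f) v‖ := by
    intro v hv hvD
    have h1 := log_mul_norm_famSum_le 𝒢 hf (y := y) (D := D) (N := v)
      ((by omega : y ≤ Z).trans ((Nat.le_self_pow two_ne_zero Z).trans (hv.trans hvD))) (by omega) hvD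
    have h2 := hlow f Λf hf q hq 𝒢 y Z D P hP (by omega) (by omega) (fun n hn hnD => by
      have h3 := hg n hn hnD
      have hn0 : (0 : ℝ) < n := by exact_mod_cast (by omega : 0 < n)
      have hln : 0 < Real.log n := Real.log_pos (by exact_mod_cast (by omega : 1 < n))
      rw [div_le_iff₀ hn0] at h3
      rw [← mul_div_assoc, le_div_iff₀ hln]
      exact h3) v hv hvD (le_trans (by
        calc 4 * y ^ 2 = (2 * y) ^ 2 := by ring
          _ ≤ Z ^ 2 := Nat.pow_le_pow_left hyZ 2) hv) (by
        have h4 : (Cl * q) ^ 2 ≤ Z := le_trans (by gcongr; linarith) hCqZ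
        calc (Cl * q : ℝ) ^ 4 = ((Cl * q) ^ 2) ^ 2 := by ring
          _ ≤ (Z : ℝ) ^ 2 := by gcongr
          _ ≤ v := by exact_mod_cast hv)
    linarith
  set w := Z ^ 2 with hw
  set G := Real.log (Real.log (D + 1 : ℕ) / Real.log (w : ℕ)) with hG
  have hlwpos : 0 < Real.log (w : ℕ) := by rw [hlw]; positivity
  have hG0 : 0 ≤ G := by
    apply Real.log_nonneg
    rw [one_le_div hlwpos]
    apply Real.log_le_log (by positivity)
    exact_mod_cast (by omega : w ≤ D + 1)
  have hGN : Real.log (Real.log (N + 1 : ℕ) / Real.log (w : ℕ)) ≤ G := by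
    have h1 : Real.log (w : ℕ) ≤ Real.log (N + 1 : ℕ) := by
      apply Real.log_le_log (by positivity)
      exact_mod_cast (by omega : w ≤ N + 1)
    have h2 := hlwpos.trans_le h1
    apply Real.log_le_log (by positivity)
    gcongr
  have hLN : Real.log (N + 1 : ℕ) ≤ 2 * L := by
    refine le_trans (Real.log_le_log (by positivity) ?_) hDL
    exact_mod_cast (by omega : N + 1 ≤ D + 1)
  have hDL' : Real.log D ≤ 2 * L := by
    refine le_trans (Real.log_le_log (by exact_mod_cast (by omega : 0 < D)) ?_) hDL
    exact_mod_cast (by omega : D ≤ D + 1)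
  have hsum : ∑ v ∈ Finset.Icc w N, ‖famSum 𝒢 f v‖ / (v : ℝ) ^ 2 ≤
      (G + 1) + P * W * (2 / Real.log w) + Cm * M * (1 + 2 * G) := by
    have e : Finset.Icc w N = Finset.Ico w (N + 1) := by ext; simp
    rw [e]
    have t1 := sum_inv_mul_log_le (V := w) (W := N + 1) (by omega) (by omega)
    have t2 := sum_inv_mul_log_sq_le (V := w) (by omega) (N + 1)
    have t3 := hmid f Λf hf q y D hq (by omega) hqy (by omega) L T M hL hDL' hT hqT hM 𝒢 hF w (N + 1) (by omega)
      (by omega) hLN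
    calc ∑ v ∈ Finset.Ico w (N + 1), ‖famSum 𝒢 f v‖ / (v : ℝ) ^ 2
        ≤ ∑ v ∈ Finset.Ico w (N + 1), (1 / ((v : ℝ) * Real.log v) + P * W * (1 / ((v : ℝ) * Real.log v ^ 2)) +
          ‖famSum 𝒢 (LSeries.convolution (midCoeff y D Λf) f) v‖ / ((v : ℝ) ^ 2 * Real.log v)) := by
          apply Finset.sum_le_sum
          intro v hv
          rw [Finset.mem_Ico] at hv
          have hv0 : (0 : ℝ) < v := by exact_mod_cast (by omega : 0 < v)
          have hlv : 0 < Real.log v := Real.log_pos (by exact_mod_cast (by omega : 1 < v))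
          have := key v hv.1 (by omega)
          calc ‖famSum 𝒢 f v‖ / (v : ℝ) ^ 2 = (Real.log v * ‖famSum 𝒢 f v‖) / ((v : ℝ) ^ 2 * Real.log v) := by
                field_simp
            _ ≤ (v + P * W * (v / Real.log v) +
      ‖famSum 𝒢 (LSeries.convolution (midCoeff y D Λf) f) v‖) / ((v : ℝ) ^ 2 * Real.log v) := by gcongr
            _ = _ := by field_simp
      _ ≤ _ := by
          rw [Finset.sum_add_distrib, Finset.sum_add_distrib, ← Finset.mul_sum]
          have h5 : Cm * M * (1 + 2 * Real.log (Real.log (N + 1 : ℕ) / Real.log (w : ℕ))) ≤ Cm * M * (1 + 2 * G) := by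
            gcongr
          have h6 := mul_le_mul_of_nonneg_left t2 (mul_nonneg hP hW0)
          linarith
  have hkN := key N hwN hND
  have hyzN : y ≤ N / (2 * w) := by
    rw [Nat.le_div_iff_mul_le (by omega)]
    calc y * (2 * w) = 2 * y * w := by ring
      _ ≤ N := hN₀.trans hN
  have hm := norm_famSum_mid_le hq 𝒢 hκ.le hf (D := D) (z := 2 * w) (N := N) (by omega) hqy (by omega) hyzN hND
  have hZw : (Z : ℝ) ≤ ((2 * w : ℕ) : ℝ) := by
    exact_mod_cast (Nat.le_self_pow two_ne_zero Z).trans (by omega : w ≤ 2 * w)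
  have hd := hdiag f Λf hf q hq 𝒢 δ ℓ y (2 * w) w N hδ hδ2 (by linarith)
    (hqZ.trans (by gcongr)) hℓ
    ((Real.log_le_log hNpos (by exact_mod_cast hND)).trans hDℓ) hδℓ hy hδy hyzN (by omega) le_rfl
  have hr := hran f Λf hf (2 * w) (by omega)
  set Lz := Real.log (2 * w : ℕ) ^ κ with hLz
  have hLz0 : 0 ≤ Lz := Real.rpow_nonneg (Real.log_natCast_nonneg _) _
  set Sg := ∑ v ∈ Finset.Icc w N, ‖famSum 𝒢 f v‖ / (v : ℝ) ^ 2
  have hmain : Real.log N * ‖famSum 𝒢 f N‖ ≤ N * (1 + P * W / Real.log N +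
      κ * (800 * ((G + 1) + P * W * (2 / Real.log w) + Cm * M * (1 + 2 * G)) + Cd) + 200 * κ * (Cr * Lz)) := by
    have h1 : κ * ∑ d ∈ Finset.Ioc y (N / (2 * w)), Λ d * ‖famSum 𝒢 f (N / d)‖ ≤
        κ * (800 * N * ((G + 1) + P * W * (2 / Real.log w) + Cm * M * (1 + 2 * G)) + Cd * N) := by
      refine mul_le_mul_of_nonneg_left (hd.trans (add_le_add ?_ le_rfl)) hκ.le
      exact mul_le_mul_of_nonneg_left hsum (by positivity)
    have h2 : 200 * κ * N * ∑ m ∈ Finset.Icc 1 (2 * w), ‖f m‖ / m ≤ 200 * κ * N * (Cr * Lz) := by gcongr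
    calc _ ≤ _ := hkN
      _ ≤ _ := by
        refine (add_le_add le_rfl (hm.trans (add_le_add h1 h2))).trans (le_of_eq ?_)
        ring
  have hlN : Real.log N₀ ≤ Real.log N := Real.log_le_log (by
    exact_mod_cast lt_of_lt_of_le (by positivity) hN₀) (by exact_mod_cast hN)
  have hlN0 : 0 < Real.log N := Real.log_pos (by exact_mod_cast (by omega : 1 < N))
  have c1 : P * W / Real.log N ≤ P / 4 := by
    rw [div_le_iff₀ hlN0]
    linarith [mul_le_mul_of_nonneg_left (hWN.trans hlN) hP]
  have c2 : κ * (800 * (P * W * (2 / Real.log w))) ≤ P / 4 := by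
    have : κ * (800 * (P * W * (2 / Real.log w))) = (P * (1600 * κ * W)) / Real.log w := by ring
    rw [this, div_le_iff₀ hlwpos, hlw]
    linarith [mul_le_mul_of_nonneg_left hWZ hP]
  have c3 : ‖famSum 𝒢 f N‖ * Real.log N / N ≤ (1 + P * W / Real.log N +
      κ * (800 * ((G + 1) + P * W * (2 / Real.log w) + Cm * M * (1 + 2 * G)) + Cd) + 200 * κ * (Cr * Lz)) := by
    rw [div_le_iff₀ hNpos]
    linarith
  refine c3.trans ?_
  have hMG : 1 + G ≤ M * (1 + G) := le_mul_of_one_le_left (by positivity) hM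
  have d1 : Cm * M * (1 + 2 * G) ≤ 2 * Cm * (M * (1 + G)) := by
    have : Cm * M * (1 + 2 * G) ≤ Cm * M * (2 + 2 * G) := by gcongr; norm_num
    linarith
  have d2 : 1 + κ * (800 * ((G + 1) + Cm * M * (1 + 2 * G)) + Cd) ≤
      (1 + 800 * κ * (1 + 2 * Cm) + κ * Cd) * (M * (1 + G)) := by
    have d3 : κ * (800 * ((G + 1) + Cm * M * (1 + 2 * G)) + Cd) ≤
      κ * (800 * (M * (1 + G) + 2 * Cm * (M * (1 + G))) + Cd * (M * (1 + G))) := by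
      gcongr
      · linarith
      · exact le_mul_of_one_le_right hCd.le (by linarith)
    linarith
  have d4 : (1 + 800 * κ * (1 + 2 * Cm) + κ * Cd) * (M * (1 + G)) + 200 * κ * Cr * Lz ≤ C₁ * (M * (1 + G) + Lz) := by
    have e1 : 0 ≤ 800 * κ * (1 + 2 * Cm) + κ * Cd := by positivity
    have e2 : 0 ≤ 200 * κ * Cr := by positivity
    have e3 : 1 + 800 * κ * (1 + 2 * Cm) + κ * Cd ≤ C₁ := by linarith
    have e4 : 200 * κ * Cr ≤ C₁ := by linarith
    have e5 : 0 ≤ M * (1 + G) := by linarith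
    calc _ ≤ C₁ * (M * (1 + G)) + C₁ * Lz := by gcongr
      _ = _ := by ring
  linarith

theorem famSum_shiu {κ : ℝ} (hκ : 0 < κ) : ∃ C z₀ : ℝ, 0 < C ∧ 3 ≤ z₀ ∧ ∀ f Λf : ℕ → ℂ, IsHalaszClass κ f Λf →
    ∀ q : ℕ, 1 ≤ q → ∀ (𝒢 : Finset (DirichletCharacter ℂ q)) (n : ℕ), z₀ ^ 28 ≤ n → (q : ℝ) ^ 4 ≤ (n : ℝ) ^ 3 →
      ‖famSum 𝒢 f n‖ * Real.log n / n ≤ C * Real.log n ^ κ := by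
  obtain ⟨C, z₀, hC, hz₀, h⟩ := norm_sum_divMaj_charVec_le hκ
  refine ⟨28 * C, z₀, by positivity, hz₀, ?_⟩
  intro f Λf hf q hq 𝒢 n hn hqn
  have h1z : (1 : ℝ) < z₀ ^ 28 := one_lt_pow₀ (by linarith) (by norm_num)
  have hn0 : (0 : ℝ) < n := by linarith
  set z : ℝ := (n : ℝ) ^ ((1 : ℝ) / 28) with hz
  have hz0 : 0 ≤ z := by positivity
  have hz28 : z ^ 28 = n := by
    rw [hz, ← Real.rpow_natCast, ← Real.rpow_mul hn0.le]
    norm_num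
  have hzz : z₀ ≤ z := le_of_pow_le_pow_left₀ (n := 28) (by norm_num) hz0 (hn.trans hz28.ge)
  have hq21 : (q : ℝ) ≤ z ^ 21 := by
    apply le_of_pow_le_pow_left₀ (n := 4) (by norm_num) (by positivity)
    calc (q : ℝ) ^ 4 ≤ (n : ℝ) ^ 3 := hqn
      _ = (z ^ 21) ^ 4 := by rw [← hz28]; ring
  have h1 := h f (fun n hn => hf.norm_le_divMaj hκ hn) z hzz q 0 n hq (Nat.zero_le _) hz28.ge (by
    calc (q : ℝ) * z ^ 7 ≤ z ^ 21 * z ^ 7 := by gcongr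
      _ = (n : ℝ) - (0 : ℕ) := by rw [← hz28]; push_cast; ring) 𝒢
  have hlz : Real.log z = Real.log n / 28 := by rw [hz, Real.log_rpow hn0]; ring
  have hln : 0 < Real.log n := Real.log_pos (by linarith)
  have hlz0 : 0 < Real.log z := by rw [hlz]; positivity
  have e : famSum 𝒢 f n = ∑ m ∈ Finset.Ioc 0 n, f m • charVec 𝒢 m := by
    unfold famSum
    rfl
  rw [← e] at h1
  rw [div_le_iff₀ hn0]
  calc ‖famSum 𝒢 f n‖ * Real.log n ≤ (C * (n - (0 : ℕ)) * Real.log z ^ (κ - 1)) * Real.log n := by gcongr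
    _ = 28 * C * n * (Real.log z ^ (κ - 1) * Real.log z) := by rw [hlz]; push_cast; ring
    _ = 28 * C * n * Real.log z ^ κ := by
        rw [← Real.rpow_add_one hlz0.ne']
        congr 2
        ring
    _ ≤ 28 * C * n * Real.log n ^ κ := by
        have : Real.log z ≤ Real.log n := by
          rw [hlz]
          linarith
        gcongr
    _ = _ := by ring

lemma exists_natCeil_pow {Q : ℝ} (hQ : Real.exp 1 ≤ Q) (a : ℕ) :
    Q ^ a ≤ (⌈Q ^ a⌉₊ : ℝ) ∧ (⌈Q ^ a⌉₊ : ℝ) ≤ 2 * Q ^ a ∧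
      a * Real.log Q ≤ Real.log ⌈Q ^ a⌉₊ ∧ Real.log ⌈Q ^ a⌉₊ ≤ (a + 1) * Real.log Q := by
  have he := Real.add_one_le_exp (1 : ℝ)
  have h1 : 1 ≤ Q ^ a := one_le_pow₀ (by linarith)
  have hl : 1 ≤ Real.log Q := by
    rw [Real.le_log_iff_exp_le (by linarith)]; exact hQ
  have a1 : Q ^ a ≤ (⌈Q ^ a⌉₊ : ℝ) := Nat.le_ceil _
  have a2 : (⌈Q ^ a⌉₊ : ℝ) ≤ 2 * Q ^ a := by
    have := Nat.ceil_lt_add_one (a := Q ^ a) (by positivity)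
    linarith
  refine ⟨a1, a2, ?_, ?_⟩
  · rw [← Real.log_pow]
    exact Real.log_le_log (by linarith) a1
  · have h2 := Real.log_le_log (by linarith) a2
    rw [Real.log_mul (by norm_num) (by positivity), Real.log_pow] at h2
    have := Real.log_two_lt_d9
    linarith

set_option maxHeartbeats 3000000 in
theorem exists_exceptional_famSum_le {κ : ℝ} (hκ : 0 < κ) (J : ℕ) : ∃ (C : ℝ) (K : ℕ), 16 ≤ C ∧ 8 ≤ K ∧
    ∀ f Λf : ℕ → ℂ, IsHalaszClass κ f Λf → ∀ q : ℕ, 1 ≤ q → ∀ ℒ : ℝ, C ≤ ℒ →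
      2 * ((K : ℝ) + 1) * Real.log (q * ℒ) ≤ ℒ → ∀ D : ℕ, Real.log (D + 1 : ℕ) ≤ 3 * ℒ →
      ∃ 𝒳 : Finset (DirichletCharacter ℂ q), 𝒳.card ≤ J ∧ ∀ n : ℕ, (q * ℒ) ^ K ≤ n → n ≤ D →
        ‖famSum (Finset.univ \ 𝒳) f n‖ * Real.log n / n ≤
          C * (Real.log (q * ℒ) ^ κ * (ℒ / Real.log (q * ℒ)) ^ (κ / √((J : ℝ) + 1))) *
            (1 + Real.log (ℒ / Real.log (q * ℒ))) := by
  obtain ⟨Cs, z₀, hCs, hz₀, hshiu⟩ := famSum_shiu hκ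
  obtain ⟨C₁, hC₁, hboot⟩ := bootstrap_step hκ
  obtain ⟨Ce, hCe, hexc⟩ := exists_exceptional hκ J
  set η := κ / √((J : ℝ) + 1) with hη
  have hη0 : 0 ≤ η := by positivity
  set e := ⌈κ⌉₊ with he
  have hκe : κ ≤ e := Nat.le_ceil _
  set E := 2 * e + 2 with hE
  set A := 8 * e + 8 with hA
  set cW : ℝ := 2 + 2 * κ * (A + 8) with hcW
  have hcW0 : 0 ≤ cW := by positivity
  set K := ⌈4 * cW + 3200 * κ * cW⌉₊ + A + 2 * E + 36 with hK
  have hKW : 4 * cW + 3200 * κ * cW ≤ K := by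
    have := Nat.le_ceil (4 * cW + 3200 * κ * cW)
    rw [hK]
    push_cast
    have : (0 : ℝ) ≤ A + 2 * E := by positivity
    linarith
  set CM := Ce * ((A : ℝ) + 1) ^ κ * 4 ^ η with hCM
  have hCM1 : 1 ≤ CM := by
    have h1 : (1 : ℝ) ≤ ((A : ℝ) + 1) ^ κ := Real.one_le_rpow (by linarith [Nat.cast_nonneg (α := ℝ) A]) hκ.le
    have h2 : (1 : ℝ) ≤ 4 ^ η := Real.one_le_rpow (by norm_num) hη0
    exact one_le_mul_of_one_le_of_one_le (one_le_mul_of_one_le_of_one_le hCe h1) h2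
  set B₁ := Cs * ((A : ℝ) + 2 * K + 4) ^ κ with hB₁
  set B₂ := 2 * (C₁ * (3 * CM + ((2 * K + 3 : ℝ)) ^ κ)) with hB₂
  have hB₁0 : 0 ≤ B₁ := by positivity
  have hB₂0 : 0 ≤ B₂ := by positivity
  refine ⟨16 + z₀ + C₁ + B₁ + B₂, K, by linarith, by omega, ?_⟩
  intro f Λf hf q hq ℒ hℒ hKℒ D hD
  have hq1 : (1 : ℝ) ≤ q := by exact_mod_cast hq
  have hℒ16 : 16 ≤ ℒ := by linarith
  set Q : ℝ := q * ℒ with hQ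
  have hQℒ : ℒ ≤ Q := le_mul_of_one_le_left (by linarith) hq1
  have hQq : (q : ℝ) ≤ Q := le_mul_of_one_le_right (by linarith) (by linarith)
  have hQ16 : 16 ≤ Q := hℒ16.trans hQℒ
  have hQ1 : 1 ≤ Q := by linarith
  have hexp1 : Real.exp 1 ≤ 3 := by have := Real.exp_one_lt_d9; linarith
  have hQe : Real.exp 1 ≤ Q := by linarith
  set Lg := Real.log Q with hLg
  have hLg1 : 1 ≤ Lg := by
    rw [hLg, Real.le_log_iff_exp_le (by linarith)]; exact hQe
  have hLg0 : 0 < Lg := by linarith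
  have hr16 : Lg ≤ ℒ := by
    have : Lg ≤ 2 * ((K : ℝ) + 1) * Lg := le_mul_of_one_le_left hLg0.le (by linarith [Nat.cast_nonneg (α := ℝ) K])
    linarith
  have hr1 : 1 ≤ ℒ / Lg := by rwa [one_le_div hLg0]
  set M0 := Lg ^ κ * (ℒ / Lg) ^ η with hM0
  have hM01 : 1 ≤ M0 := one_le_mul_of_one_le_of_one_le (Real.one_le_rpow hLg1 hκ.le) (Real.one_le_rpow hr1 hη0)
  have hLgM0 : Lg ^ κ ≤ M0 := le_mul_of_one_le_right (by positivity) (Real.one_le_rpow hr1 hη0)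
  set Lh := 1 + Real.log (ℒ / Lg) with hLh
  have hLh1 : 1 ≤ Lh := by have := Real.log_nonneg hr1; linarith
  obtain ⟨y1, y2, y3, y4⟩ := exists_natCeil_pow hQe A
  obtain ⟨z1, z2, z3, z4⟩ := exists_natCeil_pow hQe K
  rw [← hLg] at y3 y4 z3 z4
  set y := ⌈Q ^ A⌉₊ with hy
  set Z := ⌈Q ^ K⌉₊ with hZ
  have hpow : ∀ {a b : ℕ}, a ≤ b → Q ^ a ≤ Q ^ b := fun h => pow_le_pow_right₀ hQ1 h
  have hy28 : (2 : ℝ) ^ 28 ≤ y := by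
    calc (2 : ℝ) ^ 28 ≤ 16 ^ 8 := by norm_num
      _ ≤ Q ^ 8 := by gcongr
      _ ≤ Q ^ A := hpow (by omega)
      _ ≤ y := y1
  have hlyLg : Lg ≤ Real.log y :=
    (le_mul_of_one_le_left hLg0.le (by exact_mod_cast (by omega : 1 ≤ A))).trans y3
  have hly1 : 1 ≤ Real.log y := hLg1.trans hlyLg
  set L := 2 * ℒ with hL
  set T := q * L ^ (2 * κ + 2) with hT
  have hL1 : 1 ≤ L := by linarith
  have hTbig : 2 ≤ T := by
    have h1 : L ^ (1 : ℝ) ≤ L ^ (2 * κ + 2) := Real.rpow_le_rpow_of_exponent_le hL1 (by linarith)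
    rw [Real.rpow_one] at h1
    calc (2 : ℝ) ≤ 1 * L := by linarith
      _ ≤ T := by rw [hT]; gcongr
  have hTy : q * (2 + 2 * T) ≤ (y : ℝ) := by
    have h1 : L ^ (2 * κ + 2) ≤ Q ^ (4 * e + 4) := by
      calc L ^ (2 * κ + 2) ≤ L ^ ((2 * e + 2 : ℕ) : ℝ) := by
            apply Real.rpow_le_rpow_of_exponent_le hL1
            push_cast
            linarith
        _ = L ^ (2 * e + 2) := Real.rpow_natCast _ _
        _ ≤ (Q ^ 2) ^ (2 * e + 2) := by
            gcongr
            rw [sq]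
            exact mul_le_mul (by linarith) hQℒ (by linarith) (by linarith)
        _ = Q ^ (4 * e + 4) := by rw [← pow_mul]; congr 1; ring
    calc q * (2 + 2 * T) ≤ q * (4 * T) := by gcongr; linarith
      _ = 4 * q * q * L ^ (2 * κ + 2) := by rw [hT]; ring
      _ ≤ Q * Q * Q * Q ^ (4 * e + 4) := by
          gcongr
          linarith
      _ = Q ^ (4 * e + 7) := by ring
      _ ≤ Q ^ A := hpow (by omega)
      _ ≤ y := y1
  have hKA : (A : ℝ) + 1 ≤ 2 * ((K : ℝ) + 1) := by
    have : (A : ℝ) ≤ K := by exact_mod_cast (by omega : A ≤ K)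
    linarith [Nat.cast_nonneg (α := ℝ) K]
  have hlyℒ : Real.log y ≤ ℒ := by
    have : ((A : ℝ) + 1) * Lg ≤ 2 * ((K : ℝ) + 1) * Lg := by gcongr
    linarith
  obtain ⟨𝒳, h𝒳J, h𝒳⟩ := hexc f Λf hf q hq y (1 / (2 * L)) T (by linarith) (by positivity)
    (by apply one_div_le_one_div_of_le <;> linarith) hTy
  refine ⟨𝒳, h𝒳J, ?_⟩
  set 𝒢 := Finset.univ \ 𝒳 with h𝒢
  have hF : ∀ χ ∈ 𝒢, ∀ α t : ℝ, 1 / (2 * L) ≤ α → |t| ≤ T → ‖LSeries (charTwist f χ) ⟨1 + α, t⟩‖ ≤ CM * M0 := by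
    intro χ hχ α t hα ht
    have hχ' : χ ∉ 𝒳 := by simpa [h𝒢] using hχ
    refine (h𝒳 χ hχ' α t hα ht).trans ?_
    have h1 : 1 / (1 / (2 * L) * Real.log y) ≤ 4 * (ℒ / Lg) := by
      have : 1 / (1 / (2 * L) * Real.log y) = 4 * (ℒ / Real.log y) := by rw [hL]; field_simp; ring
      rw [this]
      gcongr
    calc Ce * Real.log y ^ κ * (1 / (1 / (2 * L) * Real.log y)) ^ η
        ≤ Ce * (((A : ℝ) + 1) * Lg) ^ κ * (4 * (ℒ / Lg)) ^ η := by gcongr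
      _ = CM * M0 := by
          rw [Real.mul_rpow (by positivity) (by positivity), Real.mul_rpow (by positivity) (by positivity)]
          ring
  have hZQ : ∀ {a : ℕ}, a ≤ K → Q ^ a ≤ Z := fun h => (hpow h).trans z1
  have hZQ1 : Q ≤ Z := by simpa using hZQ (a := 1) (by omega)
  have hZ16 : (16 : ℝ) ≤ Z := hQ16.trans hZQ1
  have hW : 2 + 2 * κ * (Real.log y + 7) ≤ cW * Lg := by
    have : Real.log y + 7 ≤ (A + 8) * Lg := by linarith
    calc 2 + 2 * κ * (Real.log y + 7) ≤ 2 * Lg + 2 * κ * ((A + 8) * Lg) := by gcongr; linarith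
      _ = _ := by rw [hcW]; ring
  have hy0 : (0 : ℝ) < y := by linarith
  have hN₀ : Real.log (2 * y * Z ^ 2 : ℕ) = Real.log 2 + Real.log y + 2 * Real.log Z := by
    push_cast
    rw [Real.log_mul (by positivity) (by positivity), Real.log_mul (by norm_num) hy0.ne', Real.log_pow]
    push_cast
    ring
  have hZ2 : Real.log (Z ^ 2 : ℕ) = 2 * Real.log Z := by
    push_cast
    rw [Real.log_pow]
    push_cast
    ring
  have h2Z2 : Real.log (2 * Z ^ 2 : ℕ) = Real.log 2 + 2 * Real.log Z := by
    push_cast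
    rw [Real.log_mul (by positivity) (by positivity), Real.log_pow]
    push_cast
    ring
  have hlog2 := Real.log_two_lt_d9
  have hlog2' := Real.log_two_gt_d9
  have hKLg : (4 * cW + 3200 * κ * cW) * Lg ≤ K * Lg := by gcongr
  have hQE : 0 < Q ^ E := by positivity
  have hδℓ : (Q ^ E)⁻¹ * (3 * ℒ) ^ (κ + 1) ≤ 1 := by
    rw [inv_mul_le_one₀ hQE]
    calc (3 * ℒ) ^ (κ + 1) ≤ (3 * ℒ) ^ ((e + 1 : ℕ) : ℝ) := by
          apply Real.rpow_le_rpow_of_exponent_le (by linarith)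
          push_cast
          linarith
      _ = (3 * ℒ) ^ (e + 1) := Real.rpow_natCast _ _
      _ ≤ (Q ^ 2) ^ (e + 1) := by
          gcongr
          rw [sq]
          exact mul_le_mul (by linarith) hQℒ (by linarith) (by linarith)
      _ = Q ^ E := by rw [← pow_mul]; congr 1
  have hδy : 1 ≤ ((Q ^ E)⁻¹) ^ 4 * (y : ℝ) := by
    rw [inv_pow, ← pow_mul, ← div_eq_inv_mul, one_le_div (by positivity)]
    exact (hpow (by omega)).trans y1
  have hδZ : 4 * (q : ℝ) ^ 2 ≤ ((Q ^ E)⁻¹) ^ 2 * Z := by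
    rw [inv_pow, ← pow_mul, ← div_eq_inv_mul, le_div_iff₀ (by positivity)]
    calc 4 * (q : ℝ) ^ 2 * Q ^ (E * 2) ≤ Q * Q ^ 2 * Q ^ (E * 2) := by gcongr; linarith
      _ = Q ^ (E * 2 + 3) := by ring
      _ ≤ (Z : ℝ) := hZQ (by omega)
  have hyZ : 2 * y ≤ Z := by
    have : 2 * (y : ℝ) ≤ Z := by
      calc 2 * (y : ℝ) ≤ 4 * Q ^ A := by linarith
        _ ≤ Q * Q ^ A := by gcongr; linarith
        _ = Q ^ (A + 1) := by ring
        _ ≤ (Z : ℝ) := hZQ (by omega)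
    exact_mod_cast this
  have hlD : Real.log D ≤ 3 * ℒ := by
    rcases Nat.eq_zero_or_pos D with h | h
    · rw [h]; simp; linarith
    · refine le_trans (Real.log_le_log (by exact_mod_cast h) ?_) hD
      exact_mod_cast (by omega : D ≤ D + 1)
  have hstep := hboot f Λf hf q hq 𝒢 (Q ^ E)⁻¹ (3 * ℒ) L T (CM * M0) y Z D (2 * y * Z ^ 2) (by positivity)
    (by
      rw [inv_le_comm₀ hQE (by norm_num)]
      have := hpow (a := 1) (b := E) (by omega)
      rw [pow_one] at this
      linarith) (by linarith) hδZ (by exact_mod_cast (by linarith : (3 : ℝ) ≤ Z)) (by linarith) hlD hδℓ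
    (by exact_mod_cast hy28) hδy (by
      have : (q : ℝ) ^ 2 ≤ y := by
        calc (q : ℝ) ^ 2 ≤ Q ^ 2 := by gcongr
          _ ≤ Q ^ A := hpow (by omega)
          _ ≤ y := y1
      exact_mod_cast this) hL1 (by linarith) hTbig le_rfl
    (one_le_mul_of_one_le_of_one_le hCM1 hM01) hF hyZ (by
      calc (C₁ * q : ℝ) ^ 2 ≤ Q ^ 2 := by
            gcongr
            rw [hQ, mul_comm]
            gcongr
            linarith
        _ ≤ (Z : ℝ) := hZQ (by omega)) le_rfl (by
      rw [hN₀]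
      have : 0 ≤ 3200 * κ * cW * Lg := by positivity
      have : 0 ≤ (K : ℝ) * Lg := by positivity
      linarith) (by
      have : 0 ≤ 4 * cW * Lg := by positivity
      have h3 : 3200 * κ * (2 + 2 * κ * (Real.log y + 7)) ≤ 3200 * κ * (cW * Lg) := by gcongr
      linarith)
  intro n hn hnD
  have hZn : Z ≤ n := Nat.ceil_le.2 hn
  have hfin := bootstrap_le (g := fun n => ‖famSum 𝒢 f n‖ * Real.log n / n) (Z := Z) (N₀ := 2 * y * Z ^ 2) (N₁ := D)
    (S := B₁ * M0 * Lh) (B := C₁ * (3 * CM + ((2 * K + 3 : ℝ)) ^ κ) * M0 * Lh)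
    (fun n => by
      have := Real.log_natCast_nonneg n
      positivity) (fun n hZn hnN _ => by
      have hZn' : (Z : ℝ) ≤ n := by exact_mod_cast hZn
      have hn0 : (0 : ℝ) < n := by linarith
      have h1 := hshiu f Λf hf q hq 𝒢 n (by
        calc (z₀ : ℝ) ^ 28 ≤ Q ^ 28 := by gcongr; linarith
          _ ≤ (Z : ℝ) := hZQ (by omega)
          _ ≤ (n : ℝ) := hZn') (by
        calc (q : ℝ) ^ 4 ≤ Q ^ 4 := by gcongr
          _ ≤ (Z : ℝ) := hZQ (by omega)
          _ ≤ (n : ℝ) := hZn'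
          _ ≤ (n : ℝ) ^ 3 := le_self_pow₀ (by linarith) (by norm_num))
      refine h1.trans ?_
      have h2 : Real.log n ≤ (A + 2 * K + 4) * Lg := by
        have h3 : Real.log n ≤ Real.log (2 * y * Z ^ 2 : ℕ) := Real.log_le_log hn0 (by exact_mod_cast hnN.le)
        rw [hN₀] at h3
        linarith
      calc Cs * Real.log n ^ κ ≤ Cs * ((A + 2 * K + 4) * Lg) ^ κ := by
            have := Real.log_natCast_nonneg n
            gcongr
        _ = B₁ * Lg ^ κ := by
            rw [Real.mul_rpow (by positivity) (by positivity)]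
            ring
        _ ≤ B₁ * M0 := by gcongr
        _ ≤ B₁ * M0 * Lh := le_mul_of_one_le_right (by positivity) hLh1) (fun P hP hg n hNn hnD => by
      refine (hstep P hP hg n hNn hnD).trans ?_
      have hZD : Z ≤ D := by
        refine le_trans ?_ (hNn.trans hnD)
        calc Z ≤ Z ^ 2 := Nat.le_self_pow two_ne_zero Z
          _ ≤ 2 * y * Z ^ 2 := Nat.le_mul_of_pos_left _ (by
            have : 0 < y := by exact_mod_cast hy0
            omega)
      have hD0 : 0 < Real.log (D + 1 : ℕ) := Real.log_pos (by
        have : (Z : ℝ) ≤ (D + 1 : ℕ) := by exact_mod_cast (by omega : Z ≤ D + 1)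
        linarith)
      have hlZLg : Lg ≤ Real.log (Z ^ 2 : ℕ) := by
        have h1 : Lg ≤ Real.log Z :=
          (le_mul_of_one_le_left hLg0.le (by exact_mod_cast (by omega : 1 ≤ K))).trans z3
        linarith
      have hG : Real.log (Real.log (D + 1 : ℕ) / Real.log (Z ^ 2 : ℕ)) ≤ 2 + Real.log (ℒ / Lg) := by
        have h0 := hLg0.trans_le hlZLg
        have h1 : Real.log (Real.log (D + 1 : ℕ) / Real.log (Z ^ 2 : ℕ)) ≤ Real.log (4 * (ℒ / Lg)) := by
          apply Real.log_le_log (by positivity)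
          rw [← mul_div_assoc]
          gcongr
          linarith
        have h2 : Real.log 4 = 2 * Real.log 2 := by
          rw [show (4 : ℝ) = 2 ^ 2 by norm_num, Real.log_pow]
          norm_num
        rw [Real.log_mul (by norm_num) (by positivity)] at h1
        linarith
      have hz : Real.log (2 * Z ^ 2 : ℕ) ^ κ ≤ (2 * K + 3 : ℝ) ^ κ * M0 := by
        calc Real.log (2 * Z ^ 2 : ℕ) ^ κ ≤ ((2 * K + 3 : ℝ) * Lg) ^ κ := by
              have := Real.log_natCast_nonneg (2 * Z ^ 2)
              gcongr
              rw [h2Z2]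
              linarith
          _ = (2 * K + 3 : ℝ) ^ κ * Lg ^ κ := Real.mul_rpow (by positivity) (by positivity)
          _ ≤ _ := by gcongr
      have h5 : CM * M0 * (1 + Real.log (Real.log (D + 1 : ℕ) / Real.log (Z ^ 2 : ℕ))) ≤ CM * M0 * (3 * Lh) := by
        gcongr
        linarith [Real.log_nonneg hr1]
      have h6 : (2 * K + 3 : ℝ) ^ κ * M0 ≤ (2 * K + 3 : ℝ) ^ κ * M0 * Lh := le_mul_of_one_le_right (by positivity) hLh1
      have h7 : C₁ * (CM * M0 * (1 + Real.log (Real.log (D + 1 : ℕ) / Real.log (Z ^ 2 : ℕ))) +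
          Real.log (2 * Z ^ 2 : ℕ) ^ κ) ≤ C₁ * (CM * M0 * (3 * Lh) + (2 * K + 3 : ℝ) ^ κ * M0 * Lh) := by
        gcongr
        exact hz.trans h6
      linarith) hZn hnD
  refine hfin.trans (max_le ?_ ?_)
  · gcongr
    linarith
  · calc 2 * (C₁ * (3 * CM + ((2 * K + 3 : ℝ)) ^ κ) * M0 * Lh) = B₂ * M0 * Lh := by rw [hB₂]; ring
      _ ≤ _ := by
        gcongr
        linarith

lemma tsum_norm_Sf_sq {q : ℕ} (f : ℕ → ℂ) (𝒳 : Finset (DirichletCharacter ℂ q)) (x : ℝ) :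
    ∑' χ : {χ : DirichletCharacter ℂ q // χ ∉ 𝒳}, ‖Sf f (χ : DirichletCharacter ℂ q) x‖ ^ 2 =
      ‖famSum (Finset.univ \ 𝒳) f ⌊x⌋₊‖ ^ 2 := by
  unfold famSum
  rw [norm_sum_charVec_sq, tsum_fintype,
    Finset.sum_subtype (Finset.univ \ 𝒳) (p := fun χ => χ ∉ 𝒳) (by simp)
      (fun χ => ‖∑ n ∈ Finset.Icc 1 ⌊x⌋₊, charTwist f χ n‖ ^ 2)]
  apply Finset.sum_congr rfl
  intro χ _
  congr 2
  unfold Sf charTwist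
  apply Finset.sum_congr rfl
  intro n _
  rw [← MulChar.star_apply']
  rfl

lemma one_add_log_le {r s : ℝ} (hr : 16 ≤ r) (hs : r / 2 ≤ s) : 1 + Real.log r ≤ 2 * Real.log s := by
  have h1 : Real.log (r / 2) ≤ Real.log s := Real.log_le_log (by linarith) hs
  have h2 : Real.log 8 ≤ Real.log (r / 2) := Real.log_le_log (by norm_num) (by linarith)
  have h3 : Real.log 8 = 3 * Real.log 2 := by
    rw [show (8 : ℝ) = 2 ^ 3 by norm_num, Real.log_pow]
    norm_num
  rw [Real.log_div (by linarith) (by norm_num)] at h1 h2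
  linarith [Real.log_two_gt_d9, Real.log_two_lt_d9]

lemma mul_rpow_div_le {κ η ℓ Lg ℒ : ℝ} (hη : 0 ≤ η) (hηκ : η ≤ κ) (hLg : 0 < Lg) (hℓ : 0 < ℓ) (hℒ0 : 0 < ℒ)
    (hℒ : ℒ ≤ 2 * ℓ) : Lg ^ κ * (ℒ / Lg) ^ η ≤ 2 ^ κ * (ℓ ^ κ * (Lg / ℓ) ^ (κ - η)) := by
  have e1 : ℓ ^ κ * (Lg / ℓ) ^ (κ - η) = Lg ^ κ * (ℓ / Lg) ^ η := by
    rw [Real.div_rpow hLg.le hℓ.le, Real.div_rpow hℓ.le hLg.le, Real.rpow_sub hLg, Real.rpow_sub hℓ]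
    field_simp
  rw [e1]
  calc Lg ^ κ * (ℒ / Lg) ^ η ≤ Lg ^ κ * (2 * (ℓ / Lg)) ^ η := by
        gcongr
        rw [← mul_div_assoc]
        gcongr
    _ = 2 ^ η * (Lg ^ κ * (ℓ / Lg) ^ η) := by
        rw [Real.mul_rpow (by norm_num) (by positivity)]
        ring
    _ ≤ _ := by
        gcongr
        norm_num

lemma sq_le_of_mul_log_div_le {κ S x n B C : ℝ} (hS : 0 ≤ S) (hx : 8 ≤ x) (hn : x / 2 ≤ n) (hnx : n ≤ x)
    (hB : 0 ≤ B) (hC : 0 ≤ C) (h : S * Real.log n / n ≤ C * (Real.log x ^ κ * B)) :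
    S ^ 2 ≤ (2 * C) ^ 2 * (x * Real.log x ^ (κ - 1)) ^ 2 * B ^ 2 := by
  have hn0 : 0 < n := by linarith
  have hlx : 2 * Real.log 2 ≤ Real.log x := by
    have : Real.log (2 ^ 2) ≤ Real.log x := Real.log_le_log (by norm_num) (by linarith)
    rw [Real.log_pow] at this
    exact_mod_cast this
  have hl2 := Real.log_two_gt_d9
  have hlx0 : 0 < Real.log x := by linarith
  have hln : Real.log x / 2 ≤ Real.log n := by
    have := Real.log_le_log (by linarith) hn
    rw [Real.log_div (by linarith) (by norm_num)] at this
    linarith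
  have h1 : S * Real.log n ≤ C * (Real.log x ^ κ * B) * x := by
    rw [div_le_iff₀ hn0] at h
    exact h.trans (by gcongr)
  have h2 : S * Real.log x ≤ 2 * (C * (Real.log x ^ κ * B) * x) := by
    have := mul_le_mul_of_nonneg_left hln hS
    linarith
  have h3 : S ≤ 2 * C * (x * Real.log x ^ (κ - 1)) * B := by
    rw [Real.rpow_sub_one hlx0.ne']
    rw [← le_div_iff₀ hlx0] at h2
    refine h2.trans (le_of_eq ?_)
    ring
  calc S ^ 2 ≤ (2 * C * (x * Real.log x ^ (κ - 1)) * B) ^ 2 := by gcongr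
    _ = _ := by ring

set_option maxHeartbeats 1000000 in
theorem pretentious_large_sieve (κ : ℝ) (hκ : 0 < κ) (J : ℕ) (hJ : 1 ≤ J) :
    ∃ C : ℝ, 0 < C ∧ ∀ f Λf : ℕ → ℂ, IsHalaszClass κ f Λf →
    ∀ X : ℝ, C ≤ X → ∀ q : ℕ, 1 ≤ q → (q : ℝ) ≤ X ^ ((1 : ℝ) / 4) →
    ∃ 𝒳 : Finset (DirichletCharacter ℂ q), 𝒳.card ≤ J ∧
      ∀ x : ℝ, Real.sqrt X ≤ x → x ≤ X ^ 2 →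
        (∑' χ : {χ : DirichletCharacter ℂ q // χ ∉ 𝒳}, ‖Sf f (χ : DirichletCharacter ℂ q) x‖ ^ 2) ≤
          C * (x * Real.log x ^ (κ - 1)) ^ 2 *
            ((Real.log ((q : ℝ) * Real.log X) / Real.log x)
                ^ (κ * (1 - 1 / Real.sqrt ((J : ℝ) + 1)))
              * Real.log (Real.log x / Real.log ((q : ℝ) * Real.log X))) ^ 2 := by
  obtain ⟨Cs, z₀, hCs, hz₀, hshiu⟩ := famSum_shiu hκ
  obtain ⟨C₀, K, hC₀, hK, hexc⟩ := exists_exceptional_famSum_le hκ J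
  set η := κ / √((J : ℝ) + 1) with hη
  have hη0 : 0 ≤ η := by positivity
  have hηκ : η ≤ κ := div_le_self hκ.le (Real.one_le_sqrt.2 (by linarith [Nat.cast_nonneg (α := ℝ) J]))
  have hθ : κ * (1 - 1 / Real.sqrt ((J : ℝ) + 1)) = κ - η := by rw [hη]; ring
  rw [hθ]
  set C₁ := C₀ * 2 ^ κ * 2 with hC₁
  set C₂ := 4 * Cs * (4 * ((K : ℝ) + 1)) ^ κ with hC₂
  set ℒ₀ := C₀ + 256 + 2 * z₀ ^ 28 with hℒ₀
  have hz28 : 0 < z₀ ^ 28 := by positivity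
  refine ⟨Real.exp ℒ₀ + (2 * C₁) ^ 2 + (2 * C₂) ^ 2, by positivity, ?_⟩
  intro f Λf hf X hX q hq hqX
  have hX1 : Real.exp ℒ₀ ≤ X := le_trans (by linarith [sq_nonneg (2 * C₁), sq_nonneg (2 * C₂)]) hX
  have hX0 : 0 < X := (Real.exp_pos _).trans_le hX1
  set ℒ := Real.log X with hℒ
  have hℒ1 : ℒ₀ ≤ ℒ := by rwa [hℒ, Real.le_log_iff_exp_le hX0]
  have hℒ256 : 256 ≤ ℒ := by linarith
  have hq1 : (1 : ℝ) ≤ q := by exact_mod_cast hq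
  have hXe : X = Real.exp ℒ := (Real.exp_log hX0).symm
  set Lg := Real.log (q * ℒ) with hLg
  have hℒQ : ℒ ≤ q * ℒ := le_mul_of_one_le_left (by linarith) hq1
  have hLg1 : 1 ≤ Lg := by
    rw [hLg, Real.le_log_iff_exp_le (by linarith)]
    linarith [Real.exp_one_lt_d9]
  have hLgle : Lg ≤ 3 / 8 * ℒ := by
    have h1 : Real.log q ≤ ℒ / 4 := by
      have := Real.log_le_log (by linarith) hqX
      rw [Real.log_rpow hX0] at this
      linarith
    have h2 : Real.log ℒ ≤ ℒ / 8 := by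
      have h3 : Real.log (√ℒ) ≤ √ℒ := Real.log_le_self (Real.sqrt_nonneg _)
      rw [Real.log_sqrt (by linarith)] at h3
      have h4 : 16 ≤ √ℒ := Real.le_sqrt_of_sq_le (by linarith)
      have h5 : √ℒ * √ℒ = ℒ := Real.mul_self_sqrt (by linarith)
      have h6 : 16 * √ℒ ≤ √ℒ * √ℒ := mul_le_mul_of_nonneg_right h4 (by positivity)
      linarith
    rw [hLg, Real.log_mul (by linarith) (by linarith)]
    linarith
  have hx : ∀ x, √X ≤ x → x ≤ X ^ 2 → 8 ≤ x ∧ x / 2 ≤ ⌊x⌋₊ ∧ (⌊x⌋₊ : ℝ) ≤ x ∧ ℒ / 2 ≤ Real.log x ∧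
      Real.log x ≤ 2 * ℒ ∧ ℒ / 2 - 1 ≤ Real.log ⌊x⌋₊ ∧ 0 < Real.log x ∧ ⌊x⌋₊ ≤ ⌊X ^ 2⌋₊ := by
    intro x hx1 hx2
    have hsX : √X = Real.exp (ℒ / 2) := by rw [hXe, Real.exp_half]
    have h1 : 8 ≤ x := by
      have := Real.add_one_le_exp (ℒ / 2)
      rw [← hsX] at this
      linarith
    have h2 : x / 2 ≤ ⌊x⌋₊ := by
      have := Nat.lt_floor_add_one x
      linarith
    have h3 : ℒ / 2 ≤ Real.log x := by
      rw [Real.le_log_iff_exp_le (by linarith), ← hsX]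
      exact hx1
    refine ⟨h1, h2, Nat.floor_le (by linarith), h3, ?_, ?_, by linarith, Nat.floor_mono hx2⟩
    · have := Real.log_le_log (by linarith) hx2
      rw [Real.log_pow] at this
      exact_mod_cast this
    · have := Real.log_le_log (by linarith) h2
      rw [Real.log_div (by linarith) (by norm_num)] at this
      linarith [Real.log_two_lt_d9]
  by_cases hcase : 2 * ((K : ℝ) + 1) * Lg ≤ ℒ
  · obtain ⟨𝒳, h𝒳, hbd⟩ := hexc f Λf hf q hq ℒ (by linarith) hcase ⌊X ^ 2⌋₊ (by
      have h1 : ((⌊X ^ 2⌋₊ + 1 : ℕ) : ℝ) ≤ X ^ 3 := by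
        push_cast
        have h2 : (⌊X ^ 2⌋₊ : ℝ) ≤ X ^ 2 := Nat.floor_le (by positivity)
        have h3 : 256 ≤ X := by
          have := Real.add_one_le_exp ℒ
          rw [← hXe] at this
          linarith
        have h4 : 256 * X ^ 2 ≤ X * X ^ 2 := by gcongr
        have h5 : 1 ≤ X ^ 2 := one_le_pow₀ (by linarith)
        calc (⌊X ^ 2⌋₊ : ℝ) + 1 ≤ X * X ^ 2 := by linarith
          _ = X ^ 3 := by ring
      have h2 := Real.log_le_log (by positivity) h1
      rw [Real.log_pow] at h2
      exact_mod_cast h2)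
    refine ⟨𝒳, h𝒳, fun x hx1 hx2 => ?_⟩
    obtain ⟨x8, xn, nx, hlx, hlx2, hln, hlx0, hnD⟩ := hx x hx1 hx2
    rw [tsum_norm_Sf_sq]
    have hr : 16 ≤ ℒ / Lg := by
      rw [le_div_iff₀ (by linarith)]
      have : (8 : ℝ) ≤ K := by exact_mod_cast hK
      have h2 : 16 * Lg ≤ 2 * ((K : ℝ) + 1) * Lg := by gcongr; linarith
      linarith
    have hrs : ℒ / Lg / 2 ≤ Real.log x / Lg := by
      rw [div_right_comm]
      gcongr
    have h1 := hbd ⌊x⌋₊ (by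
      have h2 : Real.log ((q * ℒ) ^ K) ≤ Real.log ⌊x⌋₊ := by
        rw [Real.log_pow]
        linarith
      exact (Real.log_le_log_iff (by positivity) (by linarith)).1 h2) hnD
    have h2 := one_add_log_le hr hrs
    have h3 := mul_rpow_div_le hη0 hηκ (by linarith : 0 < Lg) hlx0 (by linarith : 0 < ℒ) (by linarith)
    have hlog0 : 0 ≤ Real.log (Real.log x / Lg) := Real.log_nonneg (by linarith)
    have hR0 : 0 ≤ (Lg / Real.log x) ^ (κ - η) := by positivity
    have h4 : ‖famSum (Finset.univ \ 𝒳) f ⌊x⌋₊‖ * Real.log ⌊x⌋₊ / ⌊x⌋₊ ≤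
        C₁ * (Real.log x ^ κ * ((Lg / Real.log x) ^ (κ - η) * Real.log (Real.log x / Lg))) := by
      refine h1.trans ?_
      calc C₀ * (Lg ^ κ * (ℒ / Lg) ^ η) * (1 + Real.log (ℒ / Lg))
          ≤ C₀ * (2 ^ κ * (Real.log x ^ κ * (Lg / Real.log x) ^ (κ - η))) * (2 * Real.log (Real.log x / Lg)) := by
            have : 0 ≤ 1 + Real.log (ℒ / Lg) := by
              have := Real.log_nonneg (by linarith : 1 ≤ ℒ / Lg)
              linarith
            gcongr
        _ = _ := by rw [hC₁]; ring
    refine (sq_le_of_mul_log_div_le (norm_nonneg _) x8 xn nx (mul_nonneg hR0 hlog0) (by positivity) h4).trans ?_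
    gcongr
    linarith [Real.exp_pos ℒ₀, sq_nonneg (2 * C₂)]
  · refine ⟨∅, by simp, fun x hx1 hx2 => ?_⟩
    obtain ⟨x8, xn, nx, hlx, hlx2, hln, hlx0, hnD⟩ := hx x hx1 hx2
    rw [tsum_norm_Sf_sq]
    have hn0 : (0 : ℝ) < ⌊x⌋₊ := by linarith
    have h1 := hshiu f Λf hf q hq (Finset.univ \ (∅ : Finset (DirichletCharacter ℂ q))) ⌊x⌋₊ (by
      have h2 := Real.add_one_le_exp (ℒ / 2 - 1)
      rw [Real.le_log_iff_exp_le hn0] at hln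
      linarith) (by
      have h2 : (q : ℝ) ^ 4 ≤ X := by
        calc (q : ℝ) ^ 4 ≤ (X ^ ((1 : ℝ) / 4)) ^ 4 := by gcongr
          _ = X := by
            rw [← Real.rpow_natCast, ← Real.rpow_mul hX0.le]
            norm_num
      calc (q : ℝ) ^ 4 ≤ X := h2
        _ ≤ x ^ 2 := Real.sqrt_le_left (by linarith) |>.1 hx1
        _ ≤ (2 * (⌊x⌋₊ : ℝ)) ^ 2 := by gcongr; linarith
        _ = 4 * (⌊x⌋₊ : ℝ) ^ 2 := by ring
        _ ≤ ⌊x⌋₊ * (⌊x⌋₊ : ℝ) ^ 2 := by gcongr; linarith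
        _ = _ := by ring)
    have hlog0 : 1 / 4 ≤ Real.log (Real.log x / Lg) := by
      have h2 : 4 / 3 ≤ Real.log x / Lg := by
        rw [le_div_iff₀ (by linarith)]
        linarith
      have h3 := Real.one_sub_inv_le_log_of_pos (show (0 : ℝ) < 4 / 3 by norm_num)
      have h4 := Real.log_le_log (by norm_num) h2
      norm_num at h3
      linarith
    have hR : 1 ≤ (4 * ((K : ℝ) + 1)) ^ κ * (Lg / Real.log x) ^ (κ - η) := by
      have h2 : 1 ≤ 4 * ((K : ℝ) + 1) * (Lg / Real.log x) := by
        rw [← mul_div_assoc, one_le_div hlx0]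
        push Not at hcase
        linarith
      have h3 : (1 : ℝ) ≤ 4 * ((K : ℝ) + 1) := by linarith [Nat.cast_nonneg (α := ℝ) K]
      calc (1 : ℝ) ≤ (4 * ((K : ℝ) + 1) * (Lg / Real.log x)) ^ (κ - η) := Real.one_le_rpow h2 (by linarith)
        _ = (4 * ((K : ℝ) + 1)) ^ (κ - η) * (Lg / Real.log x) ^ (κ - η) :=
            Real.mul_rpow (by linarith) (by positivity)
        _ ≤ _ := by
            gcongr
            linarith
    have hR0 : 0 ≤ (Lg / Real.log x) ^ (κ - η) := by positivity
    have hnlog : Real.log ⌊x⌋₊ ≤ Real.log x := Real.log_le_log hn0 nx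
    have h4 : ‖famSum (Finset.univ \ (∅ : Finset (DirichletCharacter ℂ q))) f ⌊x⌋₊‖ * Real.log ⌊x⌋₊ / ⌊x⌋₊ ≤
        C₂ * (Real.log x ^ κ * ((Lg / Real.log x) ^ (κ - η) * Real.log (Real.log x / Lg))) := by
      refine h1.trans ?_
      calc Cs * Real.log ⌊x⌋₊ ^ κ ≤ Cs * Real.log x ^ κ * 1 * (4 * (1 / 4)) := by
            have := Real.log_natCast_nonneg ⌊x⌋₊
            norm_num
            gcongr
        _ ≤ Cs * Real.log x ^ κ * ((4 * ((K : ℝ) + 1)) ^ κ * (Lg / Real.log x) ^ (κ - η)) *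
            (4 * Real.log (Real.log x / Lg)) := by gcongr
        _ = _ := by rw [hC₂]; ring
    refine (sq_le_of_mul_log_div_le (norm_nonneg _) x8 xn nx (mul_nonneg hR0 (by linarith)) (by positivity) h4).trans ?_
    gcongr
    linarith [Real.exp_pos ℒ₀, sq_nonneg (2 * C₁)]
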